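/- (Hayden's Theorem, as embellished in the paper) Let H be a finite group and d ∈ H an element of order 3 such that X = C_H(d) is isomorphic to the centralizer in PSp₄(3) of a non-trivial 3-central element. Let P be a Sylow 3-subgroup of X and E an elementary abelian subgroup of P of order 27. If E does not normalize any non-trivial subgroup of H of order coprime to 3 and d is not H-conjugate to its inverse d⁻¹, then either H = C_H(d) or H is isomorphic to PSp₄(3). -/

import Mathlib

/-- `P` is a Sylow `p`-subgroup of the subgroup `K` of `G`: `P` is a `p`-subgroup
contained in `K` which is maximal among the `p`-subgroups of `G` contained in `K`. -/
def IsSylowIn {G : Type*} [Group G] (p : ℕ) (P K : Subgroup G) : Prop :=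
  P ≤ K ∧ IsPGroup p P ∧ ∀ R : Subgroup G, R ≤ K → IsPGroup p R → P ≤ R → R = P

/-- the symplectic group `Sp₄(3)` of `4 × 4` symplectic matrices over `ℤ/3ℤ`. -/
abbrev Sp4F3 : Type := Matrix.symplecticGroup (Fin 2) (ZMod 3)

/-- the projective symplectic group `PSp₄(3)`, the quotient of `Sp₄(3)` by its centre. -/
abbrev PSp4F3 : Type := Sp4F3 ⧸ Subgroup.center Sp4F3

/-- an element of a group is `3`-central if it has order `3` and lies in the centre of
some Sylow `3`-subgroup. -/
def IsThreeCentral {H : Type*} [Group H] (z : H) : Prop :=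
  orderOf z = 3 ∧ ∃ T : Sylow 3 H, z ∈ (T : Subgroup H) ∧ ∀ t ∈ (T : Subgroup H), z * t = t * z

set_option linter.unusedSectionVars false
set_option linter.deprecated false
set_option linter.constructorNameAsVariable false
set_option linter.unusedVariables false
set_option linter.unusedSimpArgs false

/-! ## General finite group lemmas -/
section General
variable {G : Type*} [Group G]

/-- `g` normalizes `A` (elementwise). -/
def Nz (A : Subgroup G) (g : G) : Prop := ∀ a, g * a * g⁻¹ ∈ A ↔ a ∈ A
theorem Nz.conj {A : Subgroup G} {g : G} (h : Nz A g) {a : G} (ha : a ∈ A) : g * a * g⁻¹ ∈ A :=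
  (h a).2 ha
theorem Nz.of_finite [Finite G] {A : Subgroup G} {g : G} (h : ∀ a ∈ A, g * a * g⁻¹ ∈ A) :
    Nz A g := by
  intro a
  refine ⟨fun ha => ?_, h a⟩
  have hn : ∀ n : ℕ, ∀ a ∈ A, g ^ n * a * (g ^ n)⁻¹ ∈ A := by
    intro n
    induction n with
    | zero => intro a ha; simpa using ha
    | succ k ih =>
      intro a ha
      have := h _ (ih a ha)
      rw [pow_succ']
      simpa [mul_assoc] using this
  have hf : orderOf g ≠ 0 := (orderOf_pos g).ne'
  have := hn (orderOf g - 1) _ ha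
  have e : g ^ (orderOf g - 1) = g⁻¹ := by
    rw [eq_inv_iff_mul_eq_one, ← pow_succ, Nat.sub_add_cancel (orderOf_pos g), pow_orderOf_eq_one]
  rw [e] at this
  simpa [mul_assoc] using this
theorem Nz.one (A : Subgroup G) : Nz A 1 := by intro a; simp
theorem Nz.mul {A : Subgroup G} {g h : G} (hg : Nz A g) (hh : Nz A h) : Nz A (g * h) := by
  intro a
  rw [← hh a, ← hg (h * a * h⁻¹)]
  simp [mul_assoc]
theorem Nz.inv {A : Subgroup G} {g : G} (hg : Nz A g) : Nz A g⁻¹ := by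
  intro a
  rw [← hg (g⁻¹ * a * g⁻¹⁻¹)]
  simp [mul_assoc]
theorem Nz.of_mem {A : Subgroup G} {g : G} (hg : g ∈ A) : Nz A g := by
  intro a
  constructor
  · intro h
    have := A.mul_mem (A.mul_mem (A.inv_mem hg) h) hg
    simpa [mul_assoc] using this
  · intro h
    exact A.mul_mem (A.mul_mem hg h) (A.inv_mem hg)

/-- The normalizer as a subgroup. -/
def NN (A : Subgroup G) : Subgroup G where
  carrier := {g | Nz A g}
  mul_mem' := fun h k => h.mul k
  one_mem' := Nz.one A
  inv_mem' := fun h => h.inv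

@[simp] theorem mem_NN {A : Subgroup G} {g : G} : g ∈ NN A ↔ Nz A g := Iff.rfl
theorem NN_eq (A : Subgroup G) : NN A = Subgroup.normalizer (A : Set G) := by
  ext g
  rw [mem_NN, Subgroup.mem_normalizer_iff]
  exact forall_congr' fun a => Iff.comm

/-- The centralizer of one element. -/
def CC (x : G) : Subgroup G where
  carrier := {g | g * x = x * g}
  mul_mem' := by
    intro a b ha hb
    simp only [Set.mem_setOf_eq] at *
    rw [mul_assoc, hb, ← mul_assoc, ha, mul_assoc]
  one_mem' := by simp
  inv_mem' := by
    intro a ha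
    simp only [Set.mem_setOf_eq] at *
    rw [inv_mul_eq_iff_eq_mul, ← mul_assoc, ha, mul_assoc, mul_inv_cancel, mul_one]

@[simp] theorem mem_CC {x g : G} : g ∈ CC x ↔ g * x = x * g := Iff.rfl
theorem mem_CC' {x g : G} : g ∈ CC x ↔ g * x * g⁻¹ = x := by
  rw [mem_CC, mul_inv_eq_iff_eq_mul]
theorem CC_eq (x : G) : CC x = Subgroup.centralizer {x} := by
  ext g
  rw [mem_CC, Subgroup.mem_centralizer_iff]
  simp [eq_comm]

/-- conjugate subgroup `g A g⁻¹` -/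
def CJ (g : G) (A : Subgroup G) : Subgroup G := A.map (MulAut.conj g).toMonoidHom
theorem mem_CJ {g : G} {A : Subgroup G} {x : G} : x ∈ CJ g A ↔ g⁻¹ * x * g ∈ A := by
  constructor
  · rintro ⟨a, ha, rfl⟩
    simpa [mul_assoc] using ha
  · intro h
    exact ⟨_, h, by simp [mul_assoc]⟩
theorem conj_mem_CJ {g : G} {A : Subgroup G} {x : G} (h : x ∈ A) : g * x * g⁻¹ ∈ CJ g A := by
  rw [mem_CJ]; simpa [mul_assoc] using h
theorem card_CJ (g : G) (A : Subgroup G) : Nat.card (CJ g A) = Nat.card A :=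
  Nat.card_congr (A.equivMapOfInjective _ (MulAut.conj g).injective).symm.toEquiv
theorem IsPGroup_CJ {p : ℕ} {A : Subgroup G} (h : IsPGroup p A) (g : G) : IsPGroup p (CJ g A) :=
  h.map _
theorem pgroup_mem {p : ℕ} {A : Subgroup G} (h : IsPGroup p A) {x : G} (hx : x ∈ A) :
    ∃ k : ℕ, x ^ p ^ k = 1 := by
  obtain ⟨k, hk⟩ := h ⟨x, hx⟩
  exact ⟨k, by simpa [Subtype.ext_iff] using hk⟩
theorem pgroup_of {p : ℕ} {A : Subgroup G} (h : ∀ x ∈ A, ∃ k : ℕ, x ^ p ^ k = 1) : IsPGroup p A := by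
  rintro ⟨x, hx⟩
  obtain ⟨k, hk⟩ := h x hx
  exact ⟨k, by simpa [Subtype.ext_iff] using hk⟩
variable [Finite G] {p : ℕ} [hp : Fact p.Prime]
theorem IsSylowIn.toSylow {A H : Subgroup G} (h : IsSylowIn p A H) :
    ∃ S : Sylow p H, (S : Subgroup H) = A.subgroupOf H := by
  refine ⟨⟨A.subgroupOf H, h.2.1.comap_of_injective _ H.subtype_injective, ?_⟩, rfl⟩
  intro Q hQ hle
  have h1 : Q.map H.subtype = A := by
    apply h.2.2 _ (Subgroup.map_subtype_le Q) (hQ.map _)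
    have := Subgroup.map_mono (f := H.subtype) hle
    rwa [Subgroup.subgroupOf_map_subtype, inf_eq_left.2 h.1] at this
  rw [← h1]
  exact (Subgroup.comap_map_eq_self_of_injective H.subtype_injective Q).symm
theorem exists_sylowIn {B H : Subgroup G} (hB : IsPGroup p B) (hBH : B ≤ H) :
    ∃ A, IsSylowIn p A H ∧ B ≤ A := by
  have h1 : IsPGroup p (B.subgroupOf H) := hB.comap_of_injective _ H.subtype_injective
  obtain ⟨S, hS⟩ := h1.exists_le_sylow
  refine ⟨(S : Subgroup H).map H.subtype, ⟨Subgroup.map_subtype_le _, S.2.map _, ?_⟩, ?_⟩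
  · intro R hR hRp hle
    have h2 : R.subgroupOf H = S := by
      apply S.3 (hRp.comap_of_injective _ H.subtype_injective)
      intro x hx
      exact hle ⟨x, hx, rfl⟩
    rw [← h2, Subgroup.subgroupOf_map_subtype, inf_eq_left.2 hR]
  · intro b hb
    exact ⟨⟨b, hBH hb⟩, hS hb, rfl⟩
theorem IsSylowIn.conj {A H : Subgroup G} (h : IsSylowIn p A H) {B : Subgroup G}
    (hB : IsPGroup p B) (hBH : B ≤ H) : ∃ g ∈ H, ∀ b ∈ B, g * b * g⁻¹ ∈ A := by
  obtain ⟨S, hS⟩ := h.toSylow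
  have h1 : IsPGroup p (B.subgroupOf H) := hB.comap_of_injective _ H.subtype_injective
  obtain ⟨Q, hQ⟩ := h1.exists_le_sylow
  obtain ⟨g, hg⟩ := MulAction.exists_smul_eq H Q S
  refine ⟨g, g.2, fun b hb => ?_⟩
  have h2 : (⟨b, hBH hb⟩ : H) ∈ (Q : Subgroup H) := hQ hb
  have h3 : g * ⟨b, hBH hb⟩ * g⁻¹ ∈ (S : Subgroup H) := by
    rw [← hg, Sylow.coe_subgroup_smul, Sylow.smul_def] at *
    exact ⟨_, h2, rfl⟩
  rw [hS] at h3
  exact h3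
theorem pgroup_zpowers {x : G} {k : ℕ} (hx : x ^ p ^ k = 1) : IsPGroup p (Subgroup.zpowers x) := by
  apply pgroup_of
  rintro y ⟨n, rfl⟩
  exact ⟨k, by
    show (x ^ n) ^ p ^ k = 1
    rw [← zpow_natCast, ← zpow_mul, mul_comm, zpow_mul, zpow_natCast, hx, one_zpow]⟩
theorem IsSylowIn.conj_elt {A H : Subgroup G} (h : IsSylowIn p A H) {x : G} (hx : x ∈ H) {k : ℕ}
    (hk : x ^ p ^ k = 1) : ∃ g ∈ H, g * x * g⁻¹ ∈ A := by
  obtain ⟨g, hg, h1⟩ := h.conj (pgroup_zpowers hk) (by simpa using hx)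
  exact ⟨g, hg, h1 x (Subgroup.mem_zpowers x)⟩
theorem IsSylowIn.card {A H : Subgroup G} (h : IsSylowIn p A H) :
    ∃ m, Nat.card H = Nat.card A * m ∧ ¬ p ∣ m := by
  obtain ⟨S, hS⟩ := h.toSylow
  refine ⟨(S : Subgroup H).index, ?_, S.not_dvd_index⟩
  have e : Nat.card (S : Subgroup H) = Nat.card A := by
    rw [hS]; exact Nat.card_congr (Subgroup.subgroupOfEquivOfLe h.1).toEquiv
  rw [← e, Subgroup.card_mul_index]
theorem isSylowIn_of_card {A H : Subgroup G} (hA : IsPGroup p A) (hAH : A ≤ H) {m : ℕ}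
    (hc : Nat.card H = Nat.card A * m) (hm : ¬ p ∣ m) : IsSylowIn p A H := by
  refine ⟨hAH, hA, fun R hR hRp hle => ?_⟩
  symm
  apply Subgroup.eq_of_le_of_card_ge hle
  obtain ⟨k, hk⟩ := hRp.exists_card_eq
  obtain ⟨l, hl⟩ := hA.exists_card_eq
  have h1 : Nat.card R ∣ Nat.card A * m := hc ▸ Subgroup.card_dvd_of_le hR
  have h2 : Nat.Coprime (Nat.card R) m := by
    rw [hk]; exact Nat.Coprime.pow_left _ ((Nat.Prime.coprime_iff_not_dvd hp.out).2 hm)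
  exact Nat.le_of_dvd Nat.card_pos (h2.dvd_of_dvd_mul_right h1)

/-- a `p`-subgroup containing all `p`-elements of its normalizer is Sylow. -/
theorem isSylowIn_of_nz {A H : Subgroup G} (hA : IsPGroup p A) (hAH : A ≤ H)
    (h : ∀ g ∈ H, Nz A g → (∃ k : ℕ, g ^ p ^ k = 1) → g ∈ A) : IsSylowIn p A H := by
  refine ⟨hAH, hA, fun R hR hRp hle => ?_⟩
  by_contra hne
  have hlt : A.subgroupOf R < ⊤ := by
    refine lt_of_le_of_ne le_top fun h => hne (le_antisymm ?_ hle)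
    exact Subgroup.subgroupOf_eq_top.1 h
  have := hRp.isNilpotent
  have hnc := Group.normalizerCondition_of_isNilpotent (G := R) _ hlt
  obtain ⟨x, hx1, hx2⟩ := SetLike.exists_of_lt hnc
  apply hx2
  rw [Subgroup.mem_normalizer_iff] at hx1
  apply h x (hR x.2) _ (pgroup_mem hRp x.2)
  apply Nz.of_finite
  intro a ha
  exact (hx1 ⟨a, hle ha⟩).1 ha
theorem IsSylowIn.mem_of_nz {A H : Subgroup G} (h : IsSylowIn p A H) {g : G} (hg : g ∈ H)
    (hn : Nz A g) {k : ℕ} (hk : g ^ p ^ k = 1) : g ∈ A := by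
  have h1 : IsPGroup p (A ⊔ Subgroup.zpowers g : Subgroup G) := by
    apply IsPGroup.to_sup_of_normal_left' h.2.1 (pgroup_zpowers hk)
    rw [Subgroup.zpowers_le, ← NN_eq]
    exact hn
  have := h.2.2 _ (sup_le h.1 (by simpa using hg)) h1 le_sup_left
  rw [← this]
  exact Subgroup.mem_sup_right (Subgroup.mem_zpowers g)
theorem IsSylowIn.mono {A H K : Subgroup G} (h : IsSylowIn p A H) (hK : K ≤ H) (hA : A ≤ K) :
    IsSylowIn p A K :=
  ⟨hA, h.2.1, fun R hR => h.2.2 R (hR.trans hK)⟩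

/-- Fusion: if `A` is abelian and weakly closed (in `p`-subgroups of `H`), then `N_H(A)` controls
fusion in `A`. -/
theorem fusion {A H : Subgroup G} (hAH : A ≤ H) (hA : IsPGroup p A)
    (hab : ∀ a ∈ A, ∀ b ∈ A, a * b = b * a)
    (hw : ∀ h ∈ H, ∀ S ≤ H, IsPGroup p S → A ≤ S → (∀ a ∈ A, h * a * h⁻¹ ∈ S) →
      ∀ a ∈ A, h * a * h⁻¹ ∈ A)
    {e h : G} (he : e ∈ A) (hh : h ∈ H) (heh : h * e * h⁻¹ ∈ A) :
    ∃ n ∈ H, Nz A n ∧ n * e * n⁻¹ = h * e * h⁻¹ := by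
  set f := h * e * h⁻¹ with hf
  obtain ⟨S, hS, hAS⟩ := exists_sylowIn (H := H ⊓ CC f) hA
    (le_inf hAH (fun a ha => hab a ha f heh))
  obtain ⟨k, hk, h1⟩ := hS.conj (IsPGroup_CJ hA h) (by
    intro x hx
    rw [mem_CJ] at hx
    refine ⟨?_, ?_⟩
    · have := H.mul_mem (H.mul_mem hh (hAH hx)) (H.inv_mem hh)
      simpa [mul_assoc] using this
    · show x * f = f * x
      have := hab _ hx _ he
      have h2 := congrArg (fun y => h * y * h⁻¹) this
      simpa [hf, mul_assoc] using h2)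
  refine ⟨k * h, H.mul_mem hk.1 hh, Nz.of_finite ?_, ?_⟩
  · apply hw _ (H.mul_mem hk.1 hh) S (hS.1.trans inf_le_left) hS.2.1 hAS
    intro a ha
    have := h1 _ (conj_mem_CJ (g := h) ha)
    simpa [mul_assoc] using this
  · have : k * f * k⁻¹ = f := mem_CC'.1 hk.2
    rw [← this, hf]; simp [mul_assoc]
theorem IsSylowIn.fusion {A H : Subgroup G} (hS : IsSylowIn p A H)
    (hab : ∀ a ∈ A, ∀ b ∈ A, a * b = b * a)
    {e h : G} (he : e ∈ A) (hh : h ∈ H) (heh : h * e * h⁻¹ ∈ A) :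
    ∃ n ∈ H, Nz A n ∧ n * e * n⁻¹ = h * e * h⁻¹ := by
  apply _root_.fusion hS.1 hS.2.1 hab _ he hh heh
  intro h _ S hSH hSp hAS h1
  rwa [hS.2.2 S hSH hSp hAS] at h1

theorem burnside {A H : Subgroup G} (hS : IsSylowIn p A H)
    (hn : ∀ g ∈ H, Nz A g → ∀ a ∈ A, g * a = a * g) :
    ∃ Y : Subgroup G, Y ≤ H ∧ ¬ p ∣ Nat.card Y ∧ (∀ h ∈ H, Nz Y h) ∧
      (∀ h ∈ H, ∃ y ∈ Y, ∃ a ∈ A, h = y * a) ∧ Nat.card H = Nat.card Y * Nat.card A ∧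
      (∀ h ∈ H, ¬ p ∣ orderOf h → h ∈ Y) := by
  obtain ⟨S, hSA⟩ := hS.toSylow
  have hP : Subgroup.normalizer (S : Set H) ≤ Subgroup.centralizer ((S : Subgroup H) : Set H) := by
    intro g hg
    replace hg := (Subgroup.mem_normalizer_iff (H := (S : Subgroup H))).1 hg
    rw [Subgroup.mem_centralizer_iff]
    intro a ha
    have ha' : (a : G) ∈ A := by
      have : a ∈ (S : Subgroup H) := ha
      rwa [hSA] at this
    have := hn g g.2 (Nz.of_finite (fun a ha => by
      have h1 : (⟨a, hS.1 ha⟩ : H) ∈ (S : Subgroup H) := by rw [hSA]; exact ha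
      have h2 := (hg _).1 h1
      have h3 : g * ⟨a, hS.1 ha⟩ * g⁻¹ ∈ (S : Subgroup H) := h2
      rw [hSA] at h3
      exact h3)) a ha'
    exact Subtype.ext this.symm
  set K := (MonoidHom.transferSylow S hP).ker with hK
  have hc := MonoidHom.ker_transferSylow_isComplement' S hP
  have hnd := MonoidHom.not_dvd_card_ker_transferSylow S hP
  have hcard : Nat.card (K.map H.subtype) = Nat.card K :=
    Nat.card_congr (K.equivMapOfInjective _ H.subtype_injective).symm.toEquiv
  have e : Nat.card (S : Subgroup H) = Nat.card A := by
    rw [hSA]; exact Nat.card_congr (Subgroup.subgroupOfEquivOfLe hS.1).toEquiv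
  refine ⟨K.map H.subtype, Subgroup.map_subtype_le _, ?_, ?_, ?_, ?_, ?_⟩
  · rw [hcard]; exact hnd
  · intro h hh
    apply Nz.of_finite
    rintro _ ⟨k, hk, rfl⟩
    have : K.Normal := MonoidHom.normal_ker _
    exact ⟨_, this.conj_mem k hk ⟨h, hh⟩, rfl⟩
  · intro h hh
    obtain ⟨⟨y, a⟩, hya⟩ := (Subgroup.IsComplement.existsUnique hc ⟨h, hh⟩).exists
    have ha0 : (a : H) ∈ (S : Subgroup H) := a.2
    have ha : (a : H) ∈ A.subgroupOf H := hSA ▸ ha0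
    exact ⟨_, ⟨y, y.2, rfl⟩, (a : H), ha, by
      have := congrArg (Subtype.val) hya
      exact this.symm⟩
  · rw [hcard, ← e, hc.card_mul]
  · intro h hh ho
    refine ⟨⟨h, hh⟩, ?_, rfl⟩
    show MonoidHom.transferSylow S hP ⟨h, hh⟩ = 1
    set u := MonoidHom.transferSylow S hP ⟨h, hh⟩ with hu
    have h1 : orderOf u ∣ orderOf h := by
      rw [← Subgroup.orderOf_mk h hh]
      exact orderOf_map_dvd _ _
    obtain ⟨k, hk⟩ := S.2 u
    have h2 : orderOf u ∣ p ^ k := orderOf_dvd_of_pow_eq_one hk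
    have h3 : Nat.Coprime (orderOf h) (p ^ k) :=
      Nat.Coprime.pow_right _ (((Nat.Prime.coprime_iff_not_dvd hp.out).2 ho).symm)
    exact orderOf_eq_one_iff.1 (Nat.eq_one_of_dvd_coprimes h3 h1 h2)
end General

section General2
open scoped commutatorElement
variable {G : Type*} [Group G]

/-- conjugation by a normalizing element, as an automorphism. -/
def Nz.aut {A : Subgroup G} {g : G} (h : Nz A g) : MulAut A where
  toFun a := ⟨g * a * g⁻¹, (h a).2 a.2⟩
  invFun a := ⟨g⁻¹ * a * g, by have := (h.inv a).2 a.2; simpa using this⟩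
  left_inv a := by ext; simp [mul_assoc]
  right_inv a := by ext; simp [mul_assoc]
  map_mul' a b := by ext; simp [mul_assoc]

@[simp] theorem Nz.aut_coe {A : Subgroup G} {g : G} (h : Nz A g) (a : A) :
    ((h.aut a : A) : G) = g * a * g⁻¹ := rfl
theorem exists_fixed_mod {Q : Type*} [Group Q] [Finite Q] (p : ℕ) [hp : Fact p.Prime] (N : Subgroup Q)
    (hN : ¬ p ∣ Nat.card N) (σ : MulAut Q) (hσ : ∀ x, (σ : Q → Q)^[p] x = x)
    (hinv : ∀ n ∈ N, σ n ∈ N) (u : Q) (hu : u⁻¹ * σ u ∈ N) : ∃ n ∈ N, σ (u * n) = u * n := by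
  classical
  let f : N → N := fun n => ⟨u⁻¹ * σ (u * n), by
    rw [map_mul, ← mul_assoc]; exact N.mul_mem hu (hinv _ n.2)⟩
  have hf1 : ∀ n : N, u * (f n : Q) = σ (u * n) := fun n => by simp [f]
  have hfi : ∀ k : ℕ, ∀ n : N, u * ((f^[k] n : N) : Q) = (σ : Q → Q)^[k] (u * n) := by
    intro k
    induction k with
    | zero => intro n; rfl
    | succ k ih =>
      intro n
      rw [Function.iterate_succ_apply, Function.iterate_succ_apply, ih, hf1]
  have hfp : f^[p] = id := by
    funext n
    have := hfi p n
    rw [hσ] at this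
    exact Subtype.ext (mul_left_cancel this)
  have hinj : Function.Injective f := by
    intro a b h
    have h1 := congrArg (fun n : N => u * (n : Q)) h
    simp only [hf1] at h1
    exact Subtype.ext (mul_left_cancel (σ.injective h1))
  have := Fintype.ofFinite N
  let π : Equiv.Perm N := Equiv.ofBijective f (Finite.injective_iff_bijective.1 hinj)
  have hπ : π ^ p ^ 1 = 1 := by
    rw [pow_one]
    ext n
    have : ((π ^ p) n) = f^[p] n := by
      rw [Equiv.Perm.coe_pow]; rfl
    rw [this, hfp]; rfl
  obtain ⟨n, hn⟩ := Equiv.Perm.exists_fixed_point_of_prime (n := 1)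
    (by rwa [← Nat.card_eq_fintype_card]) hπ
  refine ⟨n, n.2, ?_⟩
  rw [← hf1]
  exact congrArg (fun n : N => u * (n : Q)) hn
theorem sup_commutator_top {Q : Type*} [Group Q] [Finite Q] {q : ℕ} [Fact q.Prime] (hQ : IsPGroup q Q)
    (H : Subgroup Q) (h : H ⊔ commutator Q = ⊤) : H = ⊤ := by
  by_contra hne
  obtain ⟨M, hM, hHM⟩ := (eq_top_or_exists_le_coatom H).resolve_left hne
  have hnil := hQ.isNilpotent
  have : M.Normal := Subgroup.NormalizerCondition.normal_of_coatom _ Group.normalizerCondition_of_isNilpotent hM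
  have hq : IsPGroup q (Q ⧸ M) := hQ.to_quotient M
  have hnt : Nontrivial (Q ⧸ M) := by
    rw [QuotientGroup.nontrivial_iff]
    exact hM.1
  have hc := hq.center_nontrivial
  have hlt : M < (Subgroup.center (Q ⧸ M)).comap (QuotientGroup.mk' M) := by
    refine lt_of_le_of_ne ?_ ?_
    · intro x hx
      rw [Subgroup.mem_comap, QuotientGroup.mk'_apply, (QuotientGroup.eq_one_iff x).2 hx]
      exact Subgroup.one_mem _
    · intro he
      obtain ⟨⟨z, hz⟩, hz1⟩ := exists_ne (1 : Subgroup.center (Q ⧸ M))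
      obtain ⟨x, rfl⟩ := QuotientGroup.mk'_surjective M z
      have : x ∈ M := by rw [he]; exact hz
      apply hz1
      exact Subtype.ext ((QuotientGroup.eq_one_iff x).2 this)
  have ht := hM.2 _ hlt
  apply hM.1
  rw [← top_le_iff, ← h]
  refine sup_le hHM ?_
  rw [commutator_def, Subgroup.commutator_le]
  intro x _ y _
  have hx : x ∈ (Subgroup.center (Q ⧸ M)).comap (QuotientGroup.mk' M) := ht ▸ Subgroup.mem_top x
  rw [Subgroup.mem_comap, Subgroup.mem_center_iff] at hx
  have := hx (QuotientGroup.mk' M y)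
  rw [← QuotientGroup.eq_one_iff, ← QuotientGroup.mk'_apply, map_commutatorElement,
    commutatorElement_eq_one_iff_mul_comm, this]
theorem qgen {Q : Type*} [Group Q] [Finite Q] {q : ℕ} [Fact q.Prime] (hQ : IsPGroup q Q) (hq3 : q ≠ 3)
    (σ τ : MulAut Q) (hστ : ∀ x, σ (τ x) = τ (σ x)) (hσ : ∀ x, σ (σ (σ x)) = x)
    (hτ : ∀ x, τ (τ (τ x)) = x) (H : Subgroup Q)
    (h1 : ∀ x, σ x = x → x ∈ H) (h2 : ∀ x, τ x = x → x ∈ H)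
    (h3 : ∀ x, σ (τ x) = x → x ∈ H) (h4 : ∀ x, σ (τ (τ x)) = x → x ∈ H) : H = ⊤ := by
  apply sup_commutator_top hQ
  set N := H ⊔ commutator Q with hN
  have hcN : commutator Q ≤ N := le_sup_right
  have hcop : ∀ K : Subgroup Q, ¬ 3 ∣ Nat.card K := by
    intro K hd
    obtain ⟨k, hk⟩ := (hQ.to_subgroup K).exists_card_eq
    rw [hk] at hd
    have := Nat.prime_three.dvd_of_dvd_pow hd
    exact hq3 ((Nat.prime_dvd_prime_iff_eq Nat.prime_three Fact.out).1 this).symm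
  have hnorm : N.Normal := by
    constructor
    intro n hn g
    have : g * n * g⁻¹ = ⁅g, n⁆ * n := by simp [commutatorElement_def]
    rw [this]
    exact N.mul_mem (hcN (Subgroup.commutator_mem_commutator (Subgroup.mem_top _)
      (Subgroup.mem_top _))) hn
  have comm : ∀ x y : Q, (QuotientGroup.mk' N x) * (QuotientGroup.mk' N y) =
      (QuotientGroup.mk' N y) * (QuotientGroup.mk' N x) := by
    intro x y
    rw [← commutatorElement_eq_one_iff_mul_comm, ← map_commutatorElement, QuotientGroup.mk'_apply,
      QuotientGroup.eq_one_iff]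
    exact hcN (Subgroup.commutator_mem_commutator (Subgroup.mem_top _) (Subgroup.mem_top _))
  let _ : CommGroup (Q ⧸ N) := { (inferInstance : Group (Q ⧸ N)) with
    mul_comm := by
      intro a b
      obtain ⟨x, rfl⟩ := QuotientGroup.mk'_surjective N a
      obtain ⟨y, rfl⟩ := QuotientGroup.mk'_surjective N b
      exact comm x y }
  have key : ∀ ρ : MulAut Q, (∀ x, ρ (ρ (ρ x)) = x) → (∀ x, ρ x = x → x ∈ H) → ∀ x : Q,
      (x : Q ⧸ N) * (ρ x : Q) * (ρ (ρ x) : Q) = 1 := by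
    intro ρ hρ hH x
    have hu : (x * ρ x * ρ (ρ x))⁻¹ * ρ (x * ρ x * ρ (ρ x)) ∈ commutator Q := by
      rw [map_mul, map_mul, hρ]
      have : (x * ρ x * ρ (ρ x))⁻¹ * (ρ x * ρ (ρ x) * x) = ⁅(ρ x * ρ (ρ x))⁻¹, x⁻¹⁆ := by
        simp [commutatorElement_def, mul_assoc]
      rw [this]
      exact Subgroup.commutator_mem_commutator (Subgroup.mem_top _) (Subgroup.mem_top _)
    obtain ⟨n, hn, hfix⟩ := exists_fixed_mod 3 (commutator Q) (hcop _) ρ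
      (fun x => hρ x) (fun n hn => by
        have : (commutator Q).map ρ.toMonoidHom = commutator Q :=
          (Subgroup.characteristic_iff_map_eq.1 inferInstance) ρ
        rw [← this]; exact ⟨n, hn, rfl⟩) _ hu
    have hmem : x * ρ x * ρ (ρ x) ∈ N := by
      have := N.mul_mem (le_sup_left (a := H) (b := commutator Q) (hH _ hfix))
        (N.inv_mem (hcN hn))
      simpa using this
    have := (QuotientGroup.eq_one_iff _).2 hmem
    simpa using this
  have c1 := key σ hσ h1
  have c2 := key τ hτ h2
  have c3 := key (σ * τ) (fun x => by simp [← hστ, hσ, hτ]) h3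
  have c4 := key (σ * (τ * τ)) (fun x => by simp [← hστ, hσ, hτ]) h4
  rw [← top_le_iff]
  intro x _
  rw [← QuotientGroup.eq_one_iff]
  have d1 := c1 x
  have d2 := c2 x
  have d3 := c3 x
  have d4 := c4 x
  have d5 := c1 (x * τ x * τ (τ x))
  simp only [MulAut.mul_apply, map_mul, QuotientGroup.mk_mul, ← hστ, hτ] at d1 d2 d3 d4 d5
  have h3x : (x : Q ⧸ N) ^ 3 = 1 := by
    have e : (x : Q ⧸ N) ^ 3 = ((x : Q ⧸ N) * (σ x : Q) * (σ (σ x) : Q)) *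
      ((x : Q ⧸ N) * (τ x : Q) * (τ (τ x) : Q)) *
      ((x : Q ⧸ N) * (σ (τ x) : Q) * (σ (σ (τ (τ x))) : Q)) *
      ((x : Q ⧸ N) * (σ (τ (τ x)) : Q) * (σ (σ (τ x)) : Q)) *
      ((x : Q ⧸ N) * (τ x : Q) * (τ (τ x) : Q) *
        ((σ x : Q) * (σ (τ x) : Q) * (σ (τ (τ x)) : Q)) *
        ((σ (σ x) : Q) * (σ (σ (τ x)) : Q) * (σ (σ (τ (τ x))) : Q)))⁻¹ := by
      have aux : ∀ a b c d e f g h i : Q ⧸ N, a ^ 3 = (a * d * g) * (a * b * c) * (a * e * i) *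
        (a * f * h) * ((a * b * c) * (d * e * f) * (g * h * i))⁻¹ := by
        intro a b c d e f g h i
        rw [eq_mul_inv_iff_mul_eq]
        simp only [pow_three]
        ac_rfl
      exact aux _ _ _ _ _ _ _ _ _
    rw [e, d5, d1, d2, d3, d4]; simp
  have hp : IsPGroup q (Q ⧸ N) := hQ.to_quotient N
  obtain ⟨k, hk⟩ := hp (x : Q ⧸ N)
  have a1 := orderOf_dvd_of_pow_eq_one hk
  have a2 := orderOf_dvd_of_pow_eq_one h3x
  have : Nat.Coprime (q ^ k) 3 := Nat.Coprime.pow_left _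
    ((Nat.coprime_primes Fact.out Nat.prime_three).2 hq3)
  exact orderOf_eq_one_iff.1 (Nat.eq_one_of_dvd_coprimes this a1 a2)
theorem CJ_mul (g h : G) (A : Subgroup G) : CJ (g * h) A = CJ g (CJ h A) := by
  ext x; simp only [mem_CJ]; simp [mul_assoc]
theorem CJ_one (A : Subgroup G) : CJ 1 A = A := by
  ext x; simp [mem_CJ]
theorem CJ_mono {A B : Subgroup G} (h : A ≤ B) (g : G) : CJ g A ≤ CJ g B := Subgroup.map_mono h
theorem Nz.CJ_eq {A : Subgroup G} {g : G} (h : Nz A g) : CJ g A = A := by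
  ext x
  rw [mem_CJ]
  have := h.inv x
  simpa using this
theorem Nz.of_CJ_eq {A : Subgroup G} {g : G} (h : CJ g A = A) : Nz A g := by
  intro a
  constructor
  · intro ha
    rw [← h, mem_CJ] at ha
    simpa [mul_assoc] using ha
  · intro ha
    rw [← h]; exact conj_mem_CJ ha
theorem IsSylowIn.CJ {p : ℕ} {A H : Subgroup G} (h : IsSylowIn p A H) {g : G} (hg : Nz H g) :
    IsSylowIn p (CJ g A) H := by
  refine ⟨?_, IsPGroup_CJ h.2.1 g, ?_⟩
  · have := CJ_mono h.1 g
    rwa [hg.CJ_eq] at this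
  · intro R hR hRp hle
    have h1 := h.2.2 (_root_.CJ g⁻¹ R) (by
      have := CJ_mono hR g⁻¹
      rwa [hg.inv.CJ_eq] at this) (IsPGroup_CJ hRp _) (by
      have := CJ_mono hle g⁻¹
      rwa [← CJ_mul, inv_mul_cancel, CJ_one] at this)
    rw [← h1, ← CJ_mul, mul_inv_cancel, CJ_one]
variable [Finite G]

/-- A `p`-group normalizing a `p'`-group `Y` normalizes some Sylow `q`-subgroup of `Y`. -/
theorem exists_inv_sylow {p q : ℕ} [hp : Fact p.Prime] [hq : Fact q.Prime] {R Y : Subgroup G}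
    (hR : IsPGroup p R) (hY : ¬ p ∣ Nat.card Y) (hRY : ∀ r ∈ R, Nz Y r) :
    ∃ S, IsSylowIn q S Y ∧ ∀ r ∈ R, Nz S r := by
  let X := {S : Subgroup G // IsSylowIn q S Y}
  letI act : MulAction (NN Y) X :=
    { smul := fun g S => ⟨CJ g S.1, S.2.CJ g.2⟩
      one_smul := fun S => Subtype.ext (CJ_one _)
      mul_smul := fun g h S => Subtype.ext (CJ_mul _ _ _) }
  have hYN : Y ≤ NN Y := fun y hy => Nz.of_mem hy
  have hfin : Finite X := inferInstance
  obtain ⟨S₀, hS₀, -⟩ := exists_sylowIn (p := q) (IsPGroup.of_bot (p := q) (G := G)) (bot_le (a := Y))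
  have hcard : ¬ p ∣ Nat.card X := by
    letI : MulAction Y X := MulAction.compHom X (Subgroup.inclusion hYN)
    have htr : MulAction.IsPretransitive Y X := by
      constructor
      intro A B
      obtain ⟨g, hg, h⟩ := B.2.conj A.2.2.1 A.2.1
      refine ⟨⟨g, hg⟩, Subtype.ext ?_⟩
      have hle : CJ g A.1 ≤ B.1 := by
        rintro _ ⟨a, ha, rfl⟩; exact h a ha
      exact ((A.2.CJ (Nz.of_mem hg)).2.2 B.1 B.2.1 B.2.2.1 hle).symm
    rw [← MulAction.index_stabilizer_of_transitive Y (⟨S₀, hS₀⟩ : X)]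
    intro hd
    exact hY (hd.trans (Subgroup.index_dvd_card _))
  letI : MulAction R X := MulAction.compHom X (Subgroup.inclusion (show R ≤ NN Y from hRY))
  obtain ⟨S, hS⟩ := hR.nonempty_fixed_point_of_prime_not_dvd_card X hcard
  exact ⟨S.1, S.2, fun r hr => Nz.of_CJ_eq (congrArg Subtype.val (hS ⟨r, hr⟩))⟩
theorem pgroup_two {p : ℕ} [hp : Fact p.Prime] {σ τ : G} (h : σ * τ = τ * σ) (hσ : σ ^ p = 1)
    (hτ : τ ^ p = 1) : IsPGroup p (Subgroup.zpowers σ ⊔ Subgroup.zpowers τ : Subgroup G) := by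
  apply IsPGroup.to_sup_of_normal_left' (pgroup_zpowers (k := 1) (by simpa using hσ))
    (pgroup_zpowers (k := 1) (by simpa using hτ))
  rw [Subgroup.zpowers_le, ← NN_eq]
  apply Nz.of_finite
  rintro _ ⟨n, rfl⟩
  have : Commute τ (σ ^ n) := Commute.zpow_right h.symm n
  simp only
  rw [this.eq, mul_assoc, mul_inv_cancel, mul_one]
  exact ⟨n, rfl⟩
theorem generation {Y W : Subgroup G} (hY : ¬ 3 ∣ Nat.card Y) {σ τ : G} (hστ : σ * τ = τ * σ)
    (hσ : σ ^ 3 = 1) (hτ : τ ^ 3 = 1) (nσ : Nz Y σ) (nτ : Nz Y τ)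
    (h1 : ∀ y ∈ Y, σ * y * σ⁻¹ = y → y ∈ W) (h2 : ∀ y ∈ Y, τ * y * τ⁻¹ = y → y ∈ W)
    (h3 : ∀ y ∈ Y, (σ * τ) * y * (σ * τ)⁻¹ = y → y ∈ W)
    (h4 : ∀ y ∈ Y, (σ * τ * τ) * y * (σ * τ * τ)⁻¹ = y → y ∈ W) : Y ≤ W := by
  have : Fact (Nat.Prime 3) := ⟨Nat.prime_three⟩
  have hR := pgroup_two (p := 3) hστ hσ hτ
  have hRY : ∀ r ∈ Subgroup.zpowers σ ⊔ Subgroup.zpowers τ, Nz Y r := by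
    have : Subgroup.zpowers σ ⊔ Subgroup.zpowers τ ≤ NN Y :=
      sup_le (by simpa using nσ) (by simpa using nτ)
    exact this
  have hS : ∀ q : ℕ, q.Prime → ∃ S, IsSylowIn q S Y ∧ S ≤ Y ⊓ W := by
    intro q hq
    have : Fact q.Prime := ⟨hq⟩
    obtain ⟨S, hS, hinv⟩ := exists_inv_sylow (q := q) hR hY hRY
    refine ⟨S, hS, le_inf hS.1 ?_⟩
    by_cases hq3 : q = 3
    · subst hq3
      obtain ⟨k, hk⟩ := hS.2.1.exists_card_eq
      have : k = 0 := by
        by_contra h0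
        exact hY ((hk ▸ dvd_pow_self 3 h0).trans (Subgroup.card_dvd_of_le hS.1))
      rw [this, pow_zero] at hk
      rw [Subgroup.card_eq_one.1 hk]; exact bot_le
    have iσ : Nz S σ := hinv σ (Subgroup.mem_sup_left (Subgroup.mem_zpowers σ))
    have iτ : Nz S τ := hinv τ (Subgroup.mem_sup_right (Subgroup.mem_zpowers τ))
    have := qgen hS.2.1 hq3 iσ.aut iτ.aut
      (fun x => Subtype.ext (by
        show σ * (τ * x * τ⁻¹) * σ⁻¹ = τ * (σ * x * σ⁻¹) * τ⁻¹
        calc _ = (σ * τ) * x * (σ * τ)⁻¹ := by simp [mul_assoc]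
          _ = _ := by rw [hστ]; simp [mul_assoc]))
      (fun x => Subtype.ext (by
        show σ * (σ * (σ * x * σ⁻¹) * σ⁻¹) * σ⁻¹ = x
        calc _ = σ ^ 3 * x * (σ ^ 3)⁻¹ := by simp [pow_three, mul_assoc]
          _ = _ := by rw [hσ]; simp))
      (fun x => Subtype.ext (by
        show τ * (τ * (τ * x * τ⁻¹) * τ⁻¹) * τ⁻¹ = x
        calc _ = τ ^ 3 * x * (τ ^ 3)⁻¹ := by simp [pow_three, mul_assoc]
          _ = _ := by rw [hτ]; simp)) (W.subgroupOf S)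
      (fun x hx => h1 x (hS.1 x.2) (congrArg Subtype.val hx))
      (fun x hx => h2 x (hS.1 x.2) (congrArg Subtype.val hx))
      (fun x hx => h3 x (hS.1 x.2) (by
        have : σ * (τ * x * τ⁻¹) * σ⁻¹ = x := congrArg Subtype.val hx
        simpa [mul_assoc] using this))
      (fun x hx => h4 x (hS.1 x.2) (by
        have : σ * (τ * (τ * x * τ⁻¹) * τ⁻¹) * σ⁻¹ = x := congrArg Subtype.val hx
        simpa [mul_assoc] using this))
    exact Subgroup.subgroupOf_eq_top.1 this
  have hdvd := Subgroup.card_dvd_of_le (inf_le_left : Y ⊓ W ≤ Y)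
  obtain ⟨m, hm⟩ := hdvd
  have hm1 : m = 1 := by
    by_contra h1
    obtain ⟨q, hq, hqm⟩ := Nat.exists_prime_and_dvd h1
    have : Fact q.Prime := ⟨hq⟩
    obtain ⟨S, hS, hle⟩ := hS q hq
    obtain ⟨k, hk, hqk⟩ := hS.card
    obtain ⟨j, hj⟩ := Subgroup.card_dvd_of_le hle
    apply hqk
    have : Nat.card S * k = Nat.card S * (j * m) := by rw [← hk, hm, hj, mul_assoc]
    rw [Nat.eq_of_mul_eq_mul_left Nat.card_pos this]
    exact hqm.mul_left j
  have := Subgroup.eq_of_le_of_card_ge (inf_le_left : Y ⊓ W ≤ Y) (by rw [hm, hm1, mul_one])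
  exact inf_eq_left.1 this
end General2

section General3
variable {G : Type*} [Group G]

def cls (H : Subgroup G) (x : G) : Set G := {y | ∃ h ∈ H, y = h * x * h⁻¹}
theorem self_mem_cls (H : Subgroup G) (x : G) : x ∈ cls H x := ⟨1, H.one_mem, by simp⟩
theorem cls_conj {H : Subgroup G} {x y h : G} (hh : h ∈ H) (hy : y ∈ cls H x) :
    h * y * h⁻¹ ∈ cls H x := by
  obtain ⟨k, hk, rfl⟩ := hy
  exact ⟨h * k, H.mul_mem hh hk, by simp [mul_assoc]⟩
theorem cls_symm {H : Subgroup G} {x y : G} (hy : y ∈ cls H x) : x ∈ cls H y := by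
  obtain ⟨k, hk, rfl⟩ := hy
  exact ⟨k⁻¹, H.inv_mem hk, by simp [mul_assoc]⟩
theorem cls_trans {H : Subgroup G} {x y z : G} (hy : y ∈ cls H x) (hz : z ∈ cls H y) :
    z ∈ cls H x := by
  obtain ⟨k, hk, rfl⟩ := hz
  exact cls_conj hk hy
theorem cls_subset {H : Subgroup G} {x : G} (hx : x ∈ H) {y : G} (hy : y ∈ cls H x) : y ∈ H := by
  obtain ⟨k, hk, rfl⟩ := hy
  exact H.mul_mem (H.mul_mem hk hx) (H.inv_mem hk)
theorem cls_mono {H K : Subgroup G} (h : H ≤ K) {x y : G} (hy : y ∈ cls H x) : y ∈ cls K x := by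
  obtain ⟨k, hk, rfl⟩ := hy
  exact ⟨k, h hk, rfl⟩
variable [Finite G]
theorem card_cls (H : Subgroup G) (x : G) :
    (cls H x).ncard * Nat.card (H ⊓ CC x : Subgroup G) = Nat.card H := by
  let act : MulAction H G := MulAction.compHom G (MulAut.conj.comp H.subtype)
  have hs : ∀ (h : H) (y : G), h • y = h * y * h⁻¹ := fun h y => rfl
  have h1 : MulAction.orbit H x = cls H x := by
    ext y
    constructor
    · rintro ⟨h, rfl⟩
      exact ⟨h, h.2, rfl⟩
    · rintro ⟨h, hh, rfl⟩
      exact ⟨⟨h, hh⟩, rfl⟩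
  have h2 : MulAction.stabilizer H x = (H ⊓ CC x).subgroupOf H := by
    ext h
    rw [MulAction.mem_stabilizer_iff, hs, Subgroup.mem_subgroupOf, Subgroup.mem_inf, mem_CC']
    simp
  have h3 := MulAction.index_stabilizer H x
  rw [h1] at h3
  rw [← h3, h2, ← Nat.card_congr (Subgroup.subgroupOfEquivOfLe (inf_le_left : H ⊓ CC x ≤ H)).toEquiv,
    Subgroup.index_mul_card]
variable {p : ℕ} [hp : Fact p.Prime]
open scoped IsMulCommutative in
theorem transfer_hom {A H : Subgroup G} (hS : IsSylowIn p A H)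
    (hab : ∀ a ∈ A, ∀ b ∈ A, a * b = b * a) {m : ℕ} (hm : Nat.card H = Nat.card A * m) :
    ∃ φ : H →* G, (∀ h, φ h ∈ A) ∧ ∀ e (he : e ∈ A),
      (∀ n ∈ H, Nz A n → n * e * n⁻¹ = e) → φ ⟨e, hS.1 he⟩ = e ^ m := by
  have : IsMulCommutative (A.subgroupOf H) :=
    ⟨⟨fun a b => Subtype.ext (Subtype.ext (hab _ a.2 _ b.2))⟩⟩
  have hidx : (A.subgroupOf H).index = m := by
    have := Subgroup.card_mul_index (A.subgroupOf H)
    rw [Nat.card_congr (Subgroup.subgroupOfEquivOfLe hS.1).toEquiv, hm] at this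
    exact Nat.eq_of_mul_eq_mul_left Nat.card_pos this
  let φ := MonoidHom.transfer (MonoidHom.id (A.subgroupOf H))
  refine ⟨(H.subtype.comp (A.subgroupOf H).subtype).comp φ, fun h => (φ h).2, fun e he hn => ?_⟩
  have key := MonoidHom.transfer_eq_pow (MonoidHom.id (A.subgroupOf H)) (⟨e, hS.1 he⟩ : H) (by
    intro k g hg
    have h1 : (g⁻¹ : H) * e ^ k * (g⁻¹ : H)⁻¹ ∈ A := by
      have : ((g⁻¹ * (⟨e, hS.1 he⟩ : H) ^ k * g : H) : G) ∈ A := hg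
      simpa using this
    obtain ⟨n, hnH, hnz, h2⟩ := hS.fusion hab (A.pow_mem he k) (H.inv_mem g.2) h1
    have h3 : n * e ^ k * n⁻¹ = e ^ k := by
      rw [← conj_pow, hn n hnH hnz]
    apply Subtype.ext
    rw [h3] at h2
    simpa using h2.symm)
  show (((φ ⟨e, hS.1 he⟩ : A.subgroupOf H) : H) : G) = e ^ m
  have h4 : φ ⟨e, hS.1 he⟩ = _ := key
  rw [h4]
  simp [hidx]

/-- Thompson transfer lemma (via sign). -/
theorem thompson {T Z : Subgroup G} (hZT : Z ≤ T) {k : ℕ} (hk : Odd k)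
    (hc : Nat.card T = Nat.card Z * (2 * k)) {r : G} (hr : r ∈ T) (hr2 : r * r = 1)
    (hno : ∀ g ∈ T, g * r * g⁻¹ ∉ Z) :
    ∃ T2 : Subgroup G, T2 ≤ T ∧ r ∉ T2 ∧ Nat.card T = 2 * Nat.card T2 ∧ (∀ g ∈ T, Nz T2 g) ∧
      ∀ g ∈ T, g * g ∈ T2 := by
  classical
  obtain ⟨s, hsr⟩ : ∃ s : T →* ℤˣ, s ⟨r, hr⟩ = -1 := by
    let Q := T ⧸ (Z.subgroupOf T)
    have : Fintype Q := Fintype.ofFinite _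
    let ρ : T →* Equiv.Perm Q := MulAction.toPermHom T Q
    refine ⟨Equiv.Perm.sign.comp ρ, ?_⟩
    show Equiv.Perm.sign (ρ ⟨r, hr⟩) = -1
    rw [Equiv.Perm.sign_of_pow_two_eq_one]
    · have hfix : Function.fixedPoints (ρ ⟨r, hr⟩) = ∅ := by
        rw [Set.eq_empty_iff_forall_notMem]
        intro q hq
        obtain ⟨g, rfl⟩ := QuotientGroup.mk_surjective q
        have h1 : ((⟨r, hr⟩ * g : T) : Q) = (g : Q) := hq
        have h2 := QuotientGroup.eq.1 h1.symm
        have h3 : (g : G)⁻¹ * (r * g) ∈ Z := h2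
        apply hno (g : G)⁻¹ (T.inv_mem g.2)
        simpa [mul_assoc] using h3
      have hcQ : Fintype.card Q = 2 * k := by
        rw [← Nat.card_eq_fintype_card]
        have := Subgroup.card_mul_index (Z.subgroupOf T)
        rw [Nat.card_congr (Subgroup.subgroupOfEquivOfLe hZT).toEquiv, hc] at this
        exact Nat.eq_of_mul_eq_mul_left Nat.card_pos this
      have h0 : Fintype.card (Function.fixedPoints (ρ ⟨r, hr⟩)) = 0 := by
        rw [Fintype.card_eq_zero_iff, hfix]; infer_instance
      rw [h0, hcQ]
      simp [hk.neg_one_pow]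
    · rw [← map_pow, pow_two]
      have : (⟨r, hr⟩ * ⟨r, hr⟩ : T) = 1 := Subtype.ext hr2
      rw [this, map_one]
  have hcard : Nat.card s.ker * 2 = Nat.card T := by
    have hsurj : Function.Surjective s := by
      intro u
      rcases Int.units_eq_one_or u with h | h
      · exact ⟨1, by rw [map_one, h]⟩
      · exact ⟨_, by rw [hsr, h]⟩
    have := Subgroup.card_mul_index s.ker
    rw [Subgroup.index_ker, MonoidHom.range_eq_top.2 hsurj] at this
    rw [← this]; simp
  refine ⟨s.ker.map T.subtype, Subgroup.map_subtype_le _, ?_, ?_, ?_, ?_⟩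
  · rintro ⟨x, hx, h⟩
    have : x = ⟨r, hr⟩ := Subtype.ext h
    rw [this] at hx
    have hx' : s ⟨r, hr⟩ = 1 := hx
    rw [hsr] at hx'
    exact absurd hx' (by decide)
  · rw [← hcard, Nat.card_congr (s.ker.equivMapOfInjective _ T.subtype_injective).symm.toEquiv,
      mul_comm]
  · intro g hg
    apply Nz.of_finite
    rintro _ ⟨x, hx, rfl⟩
    exact ⟨⟨g, hg⟩ * x * ⟨g, hg⟩⁻¹, (MonoidHom.normal_ker s).conj_mem x hx _, rfl⟩
  · intro g hg
    exact ⟨⟨g, hg⟩ * ⟨g, hg⟩, by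
      show s _ = 1
      rw [map_mul]; exact Int.units_mul_self _, rfl⟩
end General3

section General4
open scoped Pointwise
variable {G : Type*} [Group G] [Finite G]
theorem compl_of_pquot {p : ℕ} [hp : Fact p.Prime] {A J N : Subgroup G} (hA : IsSylowIn p A J)
    (hNJ : N ≤ J) (hN : ∀ g ∈ J, Nz N g) (hq : ∀ g ∈ J, ∃ k : ℕ, g ^ p ^ k ∈ N) {g : G} (hg : g ∈ J) :
    ∃ n ∈ N, ∃ s ∈ A, g = n * s := by
  obtain ⟨S, hS⟩ := hA.toSylow
  have hn : (N.subgroupOf J).Normal := by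
    constructor
    intro n hn g
    exact (hN g g.2).conj hn
  have hsurj := QuotientGroup.mk'_surjective (N.subgroupOf J)
  have hpg : IsPGroup p (J ⧸ N.subgroupOf J) := by
    intro u
    obtain ⟨g, rfl⟩ := hsurj u
    obtain ⟨k, hk⟩ := hq g g.2
    refine ⟨k, ?_⟩
    rw [← map_pow, QuotientGroup.mk'_apply, QuotientGroup.eq_one_iff]
    exact hk
  have htop : ((S.mapSurjective hsurj : Sylow p _) : Subgroup (J ⧸ N.subgroupOf J)) = ⊤ :=
    ((S.mapSurjective hsurj).3 (hpg.to_subgroup ⊤) le_top).symm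
  rw [Sylow.coe_mapSurjective] at htop
  have hm : QuotientGroup.mk' (N.subgroupOf J) ⟨g, hg⟩ ∈ (S : Subgroup J).map (QuotientGroup.mk' _) := by
    rw [htop]; trivial
  obtain ⟨s, hs, hsg⟩ := hm
  have hs' : (s : G) ∈ A := by
    have : s ∈ (S : Subgroup J) := hs
    rwa [hS] at this
  have h1 : s⁻¹ * ⟨g, hg⟩ ∈ N.subgroupOf J := QuotientGroup.eq.1 hsg
  have h2 : (s : G)⁻¹ * g ∈ N := h1
  refine ⟨s * (s⁻¹ * g) * (s : G)⁻¹, (hN s s.2).conj h2, s, hs', by simp⟩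
theorem coprime_inter {p : ℕ} [hp : Fact p.Prime] {A N : Subgroup G} (hA : IsPGroup p A)
    (hN : ¬ p ∣ Nat.card N) {x : G} (hx : x ∈ A) (hx2 : x ∈ N) : x = 1 := by
  obtain ⟨k, hk⟩ := pgroup_mem hA hx
  have h1 : orderOf x ∣ p ^ k := orderOf_dvd_of_pow_eq_one hk
  have h2 : orderOf x ∣ Nat.card N := Subgroup.orderOf_dvd_natCard N hx2
  have : Nat.Coprime (p ^ k) (Nat.card N) :=
    Nat.Coprime.pow_left _ ((Nat.Prime.coprime_iff_not_dvd hp.out).2 hN)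
  exact orderOf_eq_one_iff.1 (Nat.eq_one_of_dvd_coprimes this h1 h2)

/-- the `3'`-part of an abelian subgroup. -/
theorem exists_p'_part {p : ℕ} [hp : Fact p.Prime] (B : Subgroup G)
    (hab : ∀ a ∈ B, ∀ b ∈ B, a * b = b * a) : ∃ C ≤ B, ¬ p ∣ Nat.card C ∧
      (∀ g, Nz B g → Nz C g) ∧ (∀ b ∈ B, ∃ k : ℕ, b ^ p ^ k ∈ C) := by
  obtain ⟨k, n, hn, hc⟩ := Nat.exists_eq_pow_mul_and_not_dvd (n := Nat.card B) Nat.card_pos.ne' p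
    hp.out.one_lt.ne'
  let C : Subgroup G :=
    { carrier := {b | b ∈ B ∧ b ^ n = 1}
      mul_mem' := by
        rintro a b ⟨ha, ha1⟩ ⟨hb, hb1⟩
        refine ⟨B.mul_mem ha hb, ?_⟩
        rw [Commute.mul_pow (hab a ha b hb), ha1, hb1, one_mul]
      one_mem' := ⟨B.one_mem, one_pow n⟩
      inv_mem' := by
        rintro a ⟨ha, ha1⟩
        exact ⟨B.inv_mem ha, by rw [inv_pow, ha1, inv_one]⟩ }
  refine ⟨C, fun b hb => hb.1, ?_, ?_, ?_⟩
  · intro hd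
    obtain ⟨x, hx⟩ := exists_prime_orderOf_dvd_card' (G := C) p hd
    apply hn
    rw [← hx]
    apply orderOf_dvd_of_pow_eq_one
    exact Subtype.ext x.2.2
  · intro g hg
    apply Nz.of_finite
    rintro a ⟨ha, ha1⟩
    exact ⟨hg.conj ha, by rw [conj_pow, ha1]; simp⟩
  · intro b hb
    refine ⟨k, B.pow_mem hb _, ?_⟩
    rw [← pow_mul, ← hc]
    exact orderOf_dvd_iff_pow_eq_one.1 (Subgroup.orderOf_dvd_natCard B hb)
theorem sylow_abelian {p : ℕ} [hp : Fact p.Prime] {E L R : Subgroup G} (hE : IsSylowIn p E L)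
    (hab : ∀ a ∈ E, ∀ b ∈ E, a * b = b * a) (hR : IsPGroup p R) (hRL : R ≤ L) :
    ∀ a ∈ R, ∀ b ∈ R, a * b = b * a := by
  obtain ⟨g, -, h⟩ := hE.conj hR hRL
  intro a ha b hb
  have := hab _ (h a ha) _ (h b hb)
  have h2 : g * (a * b) * g⁻¹ = g * (b * a) * g⁻¹ := by
    calc g * (a * b) * g⁻¹ = g * a * g⁻¹ * (g * b * g⁻¹) := by simp [mul_assoc]
      _ = _ := by rw [this]; simp [mul_assoc]
  exact mul_left_cancel (mul_right_cancel h2)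
theorem tri {E L : Subgroup G} (hE : IsSylowIn 3 E L)
    (hab : ∀ a ∈ E, ∀ b ∈ E, a * b = b * a) {x y a : G} (hxL : x ∈ L) (hyL : y ∈ L)
    (hx : x ^ 3 = 1) (hy : y ^ 3 = 1) (ha : a ∈ E) (ha3 : a ^ 3 = 1) (hxy : x = a * y)
    (hC : ∀ g ∈ L, g * a = a * g → (∃ k : ℕ, g ^ 3 ^ k = 1) → g ∈ E) :
    ∃ r₁ ∈ E, ∃ r₂ ∈ E, r₁ = a * r₂ ∧ r₁ ∈ cls L x ∧ r₂ ∈ cls L y ∧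
      ∃ B ≤ L, ¬ 3 ∣ Nat.card B ∧ r₁ * x⁻¹ ∈ B ∧ r₂ * y⁻¹ ∈ B ∧ Nz B a ∧
        (∀ b ∈ B, b * (a * r₁) = (a * r₁) * b) ∧ (∀ b ∈ B, b * a = a * b → b = 1) := by
  have : Fact (Nat.Prime 3) := ⟨Nat.prime_three⟩
  have hxi : x⁻¹ = x * x := by
    rw [inv_eq_iff_mul_eq_one, ← hx, pow_three]
  have hyi : y⁻¹ = y * y := by
    rw [inv_eq_iff_mul_eq_one, ← hy, pow_three]
  have hayx : a = x * y⁻¹ := by rw [hxy]; simp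
  have hrel : x * y⁻¹ * (x * y⁻¹ * (x * y⁻¹)) = 1 := by
    rw [← pow_three, ← hayx, ha3]
  set α := x * y with hα
  set β := y * x with hβ
  have h1 : α * β = x * y⁻¹ * x := by rw [hyi]; simp [hα, hβ, mul_assoc]
  have h2 : β * α = y * x⁻¹ * y := by rw [hxi]; simp [hα, hβ, mul_assoc]
  have hcomm : α * β = β * α := by
    rw [h1, h2]
    have : (x * y⁻¹ * x) * (y⁻¹ * x * y⁻¹) = 1 := by
      rw [← hrel]; simp [mul_assoc]
    rw [mul_eq_one_iff_eq_inv] at this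
    rw [this]; simp [mul_assoc]
  have h3 : x⁻¹ * α * x = β := by simp [hα, hβ, mul_assoc]
  have h4 : x⁻¹ * β * x = (α * β)⁻¹ := by
    rw [h1]
    have : y * x * x = y * x⁻¹ := by rw [hxi, mul_assoc]
    calc x⁻¹ * β * x = x⁻¹ * (y * x * x) := by simp [hβ, mul_assoc]
      _ = _ := by rw [this]; simp [mul_assoc]
  set B := Subgroup.closure {α, β} with hB
  have hαB : α ∈ B := Subgroup.subset_closure (by simp)
  have hβB : β ∈ B := Subgroup.subset_closure (by simp)
  have hBab : ∀ a ∈ B, ∀ b ∈ B, a * b = b * a := by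
    have : IsMulCommutative B := Subgroup.isMulCommutative_closure (by
      rintro u (rfl | rfl) v (rfl | rfl)
      · rfl
      · exact hcomm
      · exact hcomm.symm
      · rfl)
    intro a ha b hb
    exact congrArg Subtype.val (this.is_comm.comm ⟨a, ha⟩ ⟨b, hb⟩)
  have nx' : Nz B x⁻¹ := by
    apply Nz.of_finite
    intro b hb
    have : B ≤ CJ x B := by
      rw [hB, Subgroup.closure_le]
      rintro u (rfl | rfl)
      · rw [SetLike.mem_coe, mem_CJ, h3]; exact hβB
      · rw [SetLike.mem_coe, mem_CJ, h4]; exact B.inv_mem (B.mul_mem hαB hβB)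
    have := mem_CJ.1 (this hb)
    simpa using this
  have nx : Nz B x := by simpa using nx'.inv
  have hnorm : ∀ b ∈ B, b * (x⁻¹ * b * x) * (x⁻¹ * (x⁻¹ * b * x) * x) = 1 := by
    have cj : ∀ b ∈ B, x⁻¹ * b * x ∈ B := fun b hb => by simpa using nx'.conj hb
    intro b hb
    induction hb using Subgroup.closure_induction with
    | mem u hu =>
      rcases hu with rfl | rfl
      · rw [h3, h4]; simp
      · rw [h4]
        have : x⁻¹ * (α * β)⁻¹ * x = ((x⁻¹ * α * x) * (x⁻¹ * β * x))⁻¹ := by simp [mul_assoc]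
        rw [this, h3, h4]
        simp [hcomm, mul_assoc]
    | one => simp
    | mul u v hu hv ihu ihv =>
      have e : u * v * (x⁻¹ * (u * v) * x) * (x⁻¹ * (x⁻¹ * (u * v) * x) * x) =
        u * (v * (x⁻¹ * u * x)) * ((x⁻¹ * v * x) * (x⁻¹ * (x⁻¹ * u * x) * x)) *
          (x⁻¹ * (x⁻¹ * v * x) * x) := by simp [mul_assoc]
      rw [e, hBab v hv _ (cj u hu), hBab _ (cj v hv) _ (cj _ (cj u hu))]
      calc _ = u * (x⁻¹ * u * x) * (v * (x⁻¹ * (x⁻¹ * u * x) * x)) * ((x⁻¹ * v * x) *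
          (x⁻¹ * (x⁻¹ * v * x) * x)) := by simp only [mul_assoc]
        _ = (u * (x⁻¹ * u * x) * (x⁻¹ * (x⁻¹ * u * x) * x)) * (v * (x⁻¹ * v * x) *
          (x⁻¹ * (x⁻¹ * v * x) * x)) := by
            rw [hBab v hv _ (cj _ (cj u hu))]; simp only [mul_assoc]
        _ = 1 := by rw [ihu, ihv, one_mul]
    | inv u hu ih =>
      have := congrArg (·⁻¹) ih
      simp only [inv_one] at this
      rw [← this]
      have e1 := hBab _ (B.mul_mem hu (cj u hu)) _ (cj _ (cj u hu))
      rw [e1, hBab u hu _ (cj u hu)]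
      simp [mul_assoc]
  obtain ⟨C, hCB, hC3, hCn, hCq⟩ := exists_p'_part (p := 3) B hBab
  have hBL : B ≤ L := by
    rw [hB, Subgroup.closure_le]
    rintro u (rfl | rfl)
    · exact L.mul_mem hxL hyL
    · exact L.mul_mem hyL hxL
  have nCx : Nz C x := hCn x nx
  set J := B ⊔ Subgroup.zpowers x with hJ
  have hJL : J ≤ L := sup_le hBL (by simpa using hxL)
  have hxJ : x ∈ J := Subgroup.mem_sup_right (Subgroup.mem_zpowers x)
  have hBJ : B ≤ J := le_sup_left
  have hyJ : y ∈ J := by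
    have : y = x⁻¹ * α := by simp [hα]
    rw [this]; exact J.mul_mem (J.inv_mem hxJ) (hBJ hαB)
  have haJ : a ∈ J := by rw [hayx]; exact J.mul_mem hxJ (J.inv_mem hyJ)
  have hJdec : ∀ g ∈ J, ∃ b ∈ B, ∃ n : ℤ, g = b * x ^ n := by
    intro g hg
    have hz : Subgroup.zpowers x ≤ Subgroup.normalizer (B : Set G) := by
      rw [← NN_eq, Subgroup.zpowers_le]; exact nx
    have : g ∈ (B : Set G) * (Subgroup.zpowers x : Set G) := by
      rw [← Subgroup.coe_mul_of_right_le_normalizer_left _ _ hz]; exact hg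
    obtain ⟨b, hb, _, ⟨n, rfl⟩, rfl⟩ := this
    exact ⟨b, hb, n, rfl⟩
  have nCB : ∀ b ∈ B, Nz C b := by
    intro b hb
    apply Nz.of_finite
    intro c hc
    rw [hBab b hb c (hCB hc)]; simpa using hc
  have nCJ : ∀ g ∈ J, Nz C g := by
    have : J ≤ NN C := sup_le nCB (by rw [Subgroup.zpowers_le]; exact nCx)
    exact this
  have nBJ : ∀ g ∈ J, Nz B g := by
    have : J ≤ NN B := sup_le (fun b hb => Nz.of_mem hb) (by rw [Subgroup.zpowers_le]; exact nx)
    exact this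
  have hq : ∀ g ∈ J, ∃ k : ℕ, g ^ 3 ^ k ∈ C := by
    intro g hg
    obtain ⟨b, hb, n, rfl⟩ := hJdec g hg
    have h3B : (b * x ^ n) ^ 3 ∈ B := by
      set w := x ^ n with hw
      have hw3 : w * w * w = 1 := by
        have : w ^ 3 = 1 := by
          rw [hw, ← zpow_natCast, ← zpow_mul, mul_comm, zpow_mul, zpow_natCast, hx, one_zpow]
        rw [← this, pow_three, mul_assoc]
      have nw : Nz B w := nBJ w (J.zpow_mem hxJ n)
      have e : (b * w) ^ 3 = b * (w * b * w⁻¹) * (w * (w * b * w⁻¹) * w⁻¹) * (w * w * w) := by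
        simp [pow_three, mul_assoc]
      rw [e, hw3, mul_one]
      exact B.mul_mem (B.mul_mem hb (nw.conj hb)) (nw.conj (nw.conj hb))
    obtain ⟨k, hk⟩ := hCq _ h3B
    exact ⟨k + 1, by rwa [pow_succ', pow_mul]⟩
  have pza : IsPGroup 3 (Subgroup.zpowers a) := pgroup_zpowers (k := 1) (by simpa using ha3)
  obtain ⟨R, hR, haR⟩ := exists_sylowIn pza (by simpa using haJ : Subgroup.zpowers a ≤ J)
  rw [Subgroup.zpowers_le] at haR
  have hRab := sylow_abelian hE hab hR.2.1 (hR.1.trans hJL)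
  have hRE : R ≤ E := fun g hg => hC g (hJL (hR.1 hg)) (hRab g hg a haR) (pgroup_mem hR.2.1 hg)
  have hdec : ∀ g ∈ J, ∃ n ∈ C, ∃ s ∈ R, g = n * s := fun g hg =>
    compl_of_pquot hR (hCB.trans hBJ) nCJ hq hg
  have hmod : ∀ h ∈ J, ∀ g ∈ J, h * g * h⁻¹ * g⁻¹ ∈ C := by
    intro h hh g hg
    obtain ⟨n, hn, s, hs, rfl⟩ := hdec h hh
    obtain ⟨m, hm, u, hu, rfl⟩ := hdec g hg
    have e : n * s * (m * u) * (n * s)⁻¹ * (m * u)⁻¹ =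
        n * (s * m * s⁻¹) * ((s * u) * s⁻¹ * n⁻¹ * u⁻¹) * m⁻¹ := by simp [mul_assoc]
    rw [e, hRab s hs u hu]
    have e2 : u * s * s⁻¹ * n⁻¹ * u⁻¹ = u * n⁻¹ * u⁻¹ := by simp [mul_assoc]
    rw [e2]
    exact C.mul_mem (C.mul_mem (C.mul_mem hn ((nCJ s (hR.1 hs)).conj hm))
      ((nCJ u (hR.1 hu)).conj (C.inv_mem hn))) (C.inv_mem hm)
  obtain ⟨h, hh, hr1⟩ := hR.conj_elt hxJ (k := 1) (by simpa using hx)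
  obtain ⟨k, hk, hr2⟩ := hR.conj_elt hyJ (k := 1) (by simpa using hy)
  have m1 := hmod h hh x hxJ
  have m2 := hmod k hk y hyJ
  set r₁ := h * x * h⁻¹ with hr1d
  set r₂ := k * y * k⁻¹ with hr2d
  refine ⟨r₁, hRE hr1, r₂, hRE hr2, ?_, ⟨h, hJL hh, rfl⟩, ⟨k, hJL hk, rfl⟩, C, hCB.trans hBL, hC3, m1,
    m2, nCJ a haJ, ?_, ?_⟩
  · have h5 : r₁ * r₂⁻¹ * a⁻¹ ∈ C := by
      have e : r₁ * r₂⁻¹ * a⁻¹ = (r₁ * x⁻¹) * (a * (r₂ * y⁻¹)⁻¹ * a⁻¹) := by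
        rw [hayx]; simp [mul_assoc]
      rw [e]
      exact C.mul_mem m1 ((nCJ a haJ).conj (C.inv_mem m2))
    have h6 := coprime_inter hR.2.1 hC3 (R.mul_mem (R.mul_mem hr1 (R.inv_mem hr2)) (R.inv_mem haR)) h5
    rw [mul_inv_eq_one, mul_inv_eq_iff_eq_mul] at h6
    exact h6
  · intro b hb
    have h7 : a * r₁ ∈ B := by
      have e : a * r₁ = x * (α⁻¹ * (x * (r₁ * x⁻¹) * x⁻¹)) * x⁻¹ * (x * (x * x)) := by
        have : y⁻¹ = α⁻¹ * x := by simp [hα]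
        rw [hayx, this]; simp [mul_assoc]
      rw [e, ← pow_three, hx, mul_one]
      exact nx.conj (B.mul_mem (B.inv_mem hαB) (nx.conj (hCB m1)))
    exact hBab b (hCB hb) _ h7
  · intro b hb hba
    have hbB := hCB hb
    have hax : a = (x * α⁻¹ * x⁻¹) * (x * x) := by
      have : y⁻¹ = α⁻¹ * x := by simp [hα]
      rw [hayx, this]; simp [mul_assoc]
    have hu : x * α⁻¹ * x⁻¹ ∈ B := nx.conj (B.inv_mem hαB)
    have h8 : b * x⁻¹ = x⁻¹ * b := by
      rw [hax] at hba
      generalize x * α⁻¹ * x⁻¹ = u at hba hu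
      rw [← mul_assoc, hBab b hbB _ hu, mul_assoc, mul_assoc] at hba
      rw [hxi]; exact mul_left_cancel hba
    have h9 : x⁻¹ * b * x = b := by rw [← h8]; simp
    have h10 := hnorm b hbB
    rw [h9, h9] at h10
    have h11 : b ^ 3 = 1 := by rw [pow_three, ← mul_assoc]; exact h10
    exact coprime_inter (pgroup_zpowers (p := 3) (k := 1) (by simpa using h11)) hC3
      (Subgroup.mem_zpowers b) hb
end General4

/-- A copy of the field with three elements, convenient for kernel computations. -/
inductive T3 : Type where
  | o : T3
  | i : T3
  | j : T3
namespace T3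

instance : DecidableEq T3 := fun x y => match x, y with
  | o, o => isTrue rfl
  | i, i => isTrue rfl
  | j, j => isTrue rfl
  | o, i => isFalse (by intro h; cases h)
  | o, j => isFalse (by intro h; cases h)
  | i, o => isFalse (by intro h; cases h)
  | i, j => isFalse (by intro h; cases h)
  | j, o => isFalse (by intro h; cases h)
  | j, i => isFalse (by intro h; cases h)

instance {Q : T3 → Prop} [DecidablePred Q] : Decidable (∀ x, Q x) :=
  decidable_of_iff (Q o ∧ Q i ∧ Q j) ⟨fun h x => by cases x <;> tauto, fun h => ⟨h _, h _, h _⟩⟩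

instance {Q : T3 → Prop} [DecidablePred Q] : Decidable (∃ x, Q x) :=
  decidable_of_iff (Q o ∨ Q i ∨ Q j)
    ⟨fun h => by rcases h with h | h | h <;> exact ⟨_, h⟩, fun ⟨x, h⟩ => by cases x <;> tauto⟩

instance : Fintype T3 := ⟨{o, i, j}, fun x => by cases x <;> decide⟩

instance : Add T3 := ⟨fun x y => match x, y with
  | o, y => y
  | x, o => x
  | i, i => j
  | i, j => o
  | j, i => o
  | j, j => i⟩

instance : Mul T3 := ⟨fun x y => match x, y with
  | o, _ => o
  | _, o => o
  | i, y => y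
  | x, i => x
  | j, j => i⟩

instance : Neg T3 := ⟨fun x => match x with
  | o => o
  | i => j
  | j => i⟩

instance : Sub T3 := ⟨fun x y => x + - y⟩
instance : Zero T3 := ⟨o⟩
instance : One T3 := ⟨i⟩

instance : CommRing T3 where
  add_assoc := by decide
  zero_add := by decide
  add_zero := by decide
  add_comm := by decide
  left_distrib := by decide
  right_distrib := by decide
  zero_mul := by decide
  mul_zero := by decide
  mul_assoc := by decide
  one_mul := by decide
  mul_one := by decide
  neg_add_cancel := by decide
  mul_comm := by decide
  sub_eq_add_neg := by decide
  nsmul := nsmulRec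
  zsmul := zsmulRec
theorem card : Nat.card T3 = 3 := by
  rw [Nat.card_eq_fintype_card]; rfl

@[simp] theorem fcard : Fintype.card T3 = 3 := rfl
end T3

/-- The model `3^{1+2} : SL₂(3)`. -/
@[ext] structure X0 where
  p : T3
  q : T3
  z : T3
  a : T3
  b : T3
  c : T3
  e : T3
  h : a * e - b * c = 1
namespace X0

instance : DecidableEq X0 := fun x y =>
  decidable_of_iff (x.p = y.p ∧ x.q = y.q ∧ x.z = y.z ∧ x.a = y.a ∧ x.b = y.b ∧ x.c = y.c ∧ x.e = y.e)
    (by rw [X0.ext_iff])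

instance : Mul X0 := ⟨fun x y =>
  { p := x.p + (x.a * y.p + x.b * y.q)
    q := x.q + (x.c * y.p + x.e * y.q)
    z := x.z + y.z + (x.p * (x.c * y.p + x.e * y.q) - x.q * (x.a * y.p + x.b * y.q))
    a := x.a * y.a + x.b * y.c
    b := x.a * y.b + x.b * y.e
    c := x.c * y.a + x.e * y.c
    e := x.c * y.b + x.e * y.e
    h := by
      have h1 := x.h
      have h2 := y.h
      linear_combination h1 * (y.a * y.e - y.b * y.c) + h2 }⟩

instance : One X0 := ⟨{ p := 0, q := 0, z := 0, a := 1, b := 0, c := 0, e := 1, h := by decide }⟩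

instance : Inv X0 := ⟨fun x =>
  { p := -(x.e * x.p - x.b * x.q)
    q := -(- x.c * x.p + x.a * x.q)
    z := -x.z
    a := x.e
    b := - x.b
    c := - x.c
    e := x.a
    h := by
      have h1 := x.h
      linear_combination h1 }⟩
theorem mul_def (x y : X0) : x * y =
  { p := x.p + (x.a * y.p + x.b * y.q)
    q := x.q + (x.c * y.p + x.e * y.q)
    z := x.z + y.z + (x.p * (x.c * y.p + x.e * y.q) - x.q * (x.a * y.p + x.b * y.q))
    a := x.a * y.a + x.b * y.c
    b := x.a * y.b + x.b * y.e
    c := x.c * y.a + x.e * y.c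
    e := x.c * y.b + x.e * y.e
    h := (x * y).h } := rfl
theorem inv_def (x : X0) : x⁻¹ =
  { p := -(x.e * x.p - x.b * x.q)
    q := -(- x.c * x.p + x.a * x.q)
    z := -x.z
    a := x.e
    b := - x.b
    c := - x.c
    e := x.a
    h := (x⁻¹).h } := rfl

instance : Group X0 := Group.ofLeftAxioms
  (by
    intro x y w
    have h1 := x.h
    ext <;> simp only [mul_def]
    all_goals try ring1
    linear_combination (y.p * (y.c * w.p + y.e * w.q) - y.q * (y.a * w.p + y.b * w.q)) * h1)
  (by
    intro x
    ext <;> show _ = _ <;> simp [mul_def, show (1 : X0).p = 0 from rfl, show (1 : X0).q = 0 from rfl, show (1 : X0).z = 0 from rfl, show (1 : X0).a = 1 from rfl, show (1 : X0).b = 0 from rfl, show (1 : X0).c = 0 from rfl, show (1 : X0).e = 1 from rfl])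
  (by
    intro x
    have h1 := x.h
    ext
    · show -(x.e * x.p - x.b * x.q) + (x.e * x.p + - x.b * x.q) = 0
      ring
    · show -(- x.c * x.p + x.a * x.q) + (- x.c * x.p + x.a * x.q) = 0
      ring
    · show -x.z + x.z + (-(x.e * x.p - x.b * x.q) * (- x.c * x.p + x.a * x.q) - -(- x.c * x.p + x.a * x.q) * (x.e * x.p + - x.b * x.q)) = 0
      ring
    · show x.e * x.a + - x.b * x.c = 1
      linear_combination h1
    · show x.e * x.b + - x.b * x.e = 0
      ring
    · show - x.c * x.a + x.a * x.c = 0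
      ring
    · show - x.c * x.b + x.a * x.e = 1
      linear_combination h1)

abbrev mk0 (p q z : T3) : X0 := ⟨p, q, z, 1, 0, 0, 1, by decide⟩
abbrev dd : X0 := mk0 0 0 1
abbrev b1 : X0 := mk0 1 0 0
abbrev yy : X0 := mk0 0 1 0
abbrev d3 : X0 := ⟨0, 0, 0, 1, 1, 0, 1, by decide⟩
abbrev ww : X0 := ⟨0, 0, 0, 0, 1, -1, 0, by decide⟩
abbrev tt : X0 := ⟨0, 0, 0, -1, 0, 0, -1, by decide⟩
theorem forall_iff {Q : X0 → Prop} : (∀ x, Q x) ↔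
    ∀ a b c e, ∀ h : a * e - b * c = 1, ∀ p q z, Q ⟨p, q, z, a, b, c, e, h⟩ :=
  ⟨fun h _ _ _ _ _ _ _ _ => h _, fun h x => h _ _ _ _ x.h _ _ _⟩

instance {Q : X0 → Prop} [DecidablePred Q] : Decidable (∀ x, Q x) :=
  decidable_of_iff _ forall_iff.symm

def P0 : Subgroup X0 where
  carrier := {x | x.a = 1 ∧ x.e = 1 ∧ x.c = 0}
  mul_mem' := by
    rintro x y ⟨h1, h2, h3⟩ ⟨k1, k2, k3⟩
    refine ⟨?_, ?_, ?_⟩ <;> simp [mul_def, h1, h2, h3, k1, k2, k3]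
  one_mem' := by decide
  inv_mem' := by
    rintro x ⟨h1, h2, h3⟩
    refine ⟨h2, h1, ?_⟩
    show - x.c = 0
    rw [h3, neg_zero]

/-- its elementary abelian subgroup of order 27 -/
def E0 : Subgroup X0 where
  carrier := {x | x.a = 1 ∧ x.e = 1 ∧ x.c = 0 ∧ x.q = 0}
  mul_mem' := by
    rintro x y ⟨h1, h2, h3, h4⟩ ⟨k1, k2, k3, k4⟩
    refine ⟨?_, ?_, ?_, ?_⟩ <;> simp [mul_def, h1, h2, h3, h4, k1, k2, k3, k4]
  one_mem' := by decide
  inv_mem' := by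
    rintro x ⟨h1, h2, h3, h4⟩
    refine ⟨h2, h1, ?_, ?_⟩
    · show - x.c = 0
      rw [h3, neg_zero]
    · show -(- x.c * x.p + x.a * x.q) = 0
      rw [h3, h4]; simp
theorem mem_P0 {x : X0} : x ∈ P0 ↔ x.a = 1 ∧ x.e = 1 ∧ x.c = 0 := Iff.rfl
theorem mem_E0 {x : X0} : x ∈ E0 ↔ x.a = 1 ∧ x.e = 1 ∧ x.c = 0 ∧ x.q = 0 := Iff.rfl

instance (x : X0) : Decidable (x ∈ P0) := decidable_of_iff _ mem_P0.symm
instance (x : X0) : Decidable (x ∈ E0) := decidable_of_iff _ mem_E0.symm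

abbrev el (p z b : T3) : X0 := ⟨p, 0, z, 1, b, 0, 1, by simp⟩
theorem el_mem (p z b : T3) : el p z b ∈ E0 := ⟨rfl, rfl, rfl, rfl⟩
theorem mem_E0_el {x : X0} (h : x ∈ E0) : x = el x.p x.z x.b := by
  obtain ⟨h1, h2, h3, h4⟩ := h
  ext <;> simp_all
theorem el_inj {p z b p' z' b' : T3} (h : el p z b = el p' z' b') : p = p' ∧ z = z' ∧ b = b' := by
  simpa [X0.ext_iff] using h
theorem el_mul (p z b p' z' b' : T3) : el p z b * el p' z' b' = el (p + p') (z + z') (b + b') := by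
  ext <;> simp [mul_def, add_comm]
theorem E0_le : E0 ≤ P0 := fun _ h => ⟨h.1, h.2.1, h.2.2.1⟩

def equivE0 : E0 ≃ T3 × T3 × T3 where
  toFun x := (x.1.p, x.1.z, x.1.b)
  invFun v := ⟨el v.1 v.2.1 v.2.2, el_mem _ _ _⟩
  left_inv x := Subtype.ext (mem_E0_el x.2).symm
  right_inv _ := rfl

def equivP0 : P0 ≃ T3 × T3 × T3 × T3 where
  toFun x := (x.1.p, x.1.z, x.1.b, x.1.q)
  invFun v := ⟨⟨v.1, v.2.2.2, v.2.1, 1, v.2.2.1, 0, 1, by simp⟩, ⟨rfl, rfl, rfl⟩⟩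
  left_inv x := by
    obtain ⟨x, h1, h2, h3⟩ := x
    apply Subtype.ext
    ext <;> simp_all
  right_inv _ := rfl

def equivX0 : X0 ≃ {v : T3 × T3 × T3 × T3 // v.1 * v.2.2.2 - v.2.1 * v.2.2.1 = 1} ×
    T3 × T3 × T3 where
  toFun x := (⟨(x.a, x.b, x.c, x.e), x.h⟩, x.p, x.q, x.z)
  invFun v := ⟨v.2.1, v.2.2.1, v.2.2.2, v.1.1.1, v.1.1.2.1, v.1.1.2.2.1, v.1.1.2.2.2, v.1.2⟩
  left_inv _ := rfl
  right_inv _ := rfl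

instance : Finite X0 := Finite.of_equiv _ equivX0.symm
theorem card_E0 : Nat.card E0 = 27 := by
  rw [Nat.card_congr equivE0]; simp
theorem card_P0 : Nat.card P0 = 81 := by
  rw [Nat.card_congr equivP0]; simp
theorem card_X0 : Nat.card X0 = 648 := by
  rw [Nat.card_congr equivX0, Nat.card_prod, Nat.card_eq_fintype_card]
  have : Fintype.card {v : T3 × T3 × T3 × T3 // v.1 * v.2.2.2 - v.2.1 * v.2.2.1 = 1} = 24 := by
    decide +kernel
  rw [this]; simp
theorem E0_comm {x y : X0} (hx : x ∈ E0) (hy : y ∈ E0) : x * y = y * x := by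
  rw [mem_E0_el hx, mem_E0_el hy, el_mul, el_mul, add_comm x.p, add_comm x.z, add_comm x.b]
theorem E0_cube : ∀ x ∈ E0, x * x * x = 1 := by decide +kernel
theorem centr_E : ∀ x : X0, x * b1 = b1 * x → x * d3 = d3 * x → x ∈ E0 := by decide +kernel
theorem centr_dd : ∀ x : X0, x * dd = dd * x := by decide +kernel
theorem centr_P : ∀ x ∈ P0, x * b1 = b1 * x → x * d3 = d3 * x → x * yy = yy * x →
  x = 1 ∨ x = dd ∨ x = dd * dd := by decide +kernel
/-- centralizer in `E` of an element of `P` outside `E` -/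
theorem centr_out : ∀ x ∈ P0, x ∉ E0 → ∀ p z b, el p z b * x = x * el p z b → p = 0 ∧ b = 0 := by decide +kernel
theorem norm_E0 : ∀ x : X0, x * d3 * x⁻¹ ∈ E0 → x * b1 * x⁻¹ ∈ E0 → x.c = 0 := by decide +kernel
theorem norm_E0' : ∀ x : X0, x.c = 0 → ∀ p z b, x * el p z b * x⁻¹ ∈ E0 := by
  intro x hc p z b
  have h := x.h
  rw [hc, mul_zero, sub_zero] at h
  have h' : x.e * x.a = 1 := by rw [mul_comm]; exact h
  refine ⟨?_, ?_, ?_, ?_⟩ <;> simp [mul_def, inv_def, hc, h, h']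
  linear_combination (- x.q) * h'
end X0
open X0

structure Setup (G : Type*) [Group G] where
  α : X0 →* G
  inj : Function.Injective α
  cent : ∀ g, g * α dd = α dd * g → ∃ x, α x = g
  nonreal : ∀ g, g * α dd * g⁻¹ ≠ (α dd)⁻¹
  sig : ∀ Y : Subgroup G, ¬ 3 ∣ Nat.card Y → (∀ x ∈ E0, Nz Y (α x)) → Y = ⊥
namespace Setup
variable {G : Type*} [Group G] [Finite G] (S : Setup G)

def D : G := S.α dd
def E : Subgroup G := E0.map S.α
def P : Subgroup G := P0.map S.α
theorem mem_E {g : G} : g ∈ S.E ↔ ∃ x ∈ E0, S.α x = g := Subgroup.mem_map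
theorem mem_P {g : G} : g ∈ S.P ↔ ∃ x ∈ P0, S.α x = g := Subgroup.mem_map
theorem α_E {x : X0} : S.α x ∈ S.E ↔ x ∈ E0 := Subgroup.mem_map_iff_mem S.inj
theorem α_P {x : X0} : S.α x ∈ S.P ↔ x ∈ P0 := Subgroup.mem_map_iff_mem S.inj
theorem E_le_P : S.E ≤ S.P := Subgroup.map_mono E0_le
theorem cardE : Nat.card S.E = 27 := by
  rw [← card_E0]; exact (Nat.card_congr (Subgroup.equivMapOfInjective _ _ S.inj).toEquiv).symm
theorem cardP : Nat.card S.P = 81 := by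
  rw [← card_P0]; exact (Nat.card_congr (Subgroup.equivMapOfInjective _ _ S.inj).toEquiv).symm
theorem CC_D : CC S.D = S.α.range := by
  ext g
  constructor
  · intro h
    obtain ⟨x, hx⟩ := S.cent g h
    exact ⟨x, hx⟩
  · rintro ⟨x, rfl⟩
    show S.α x * S.α dd = S.α dd * S.α x
    rw [← map_mul, ← map_mul, centr_dd]
theorem cardX : Nat.card (CC S.D) = 648 := by
  rw [S.CC_D, ← card_X0]
  exact (Nat.card_congr (MonoidHom.ofInjective S.inj).toEquiv).symm
theorem pgE : IsPGroup 3 S.E := IsPGroup.of_card (n := 3) (by rw [S.cardE]; norm_num)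
theorem pgP : IsPGroup 3 S.P := IsPGroup.of_card (n := 4) (by rw [S.cardP]; norm_num)
theorem E_comm : ∀ a ∈ S.E, ∀ b ∈ S.E, a * b = b * a := by
  rintro _ ⟨x, hx, rfl⟩ _ ⟨y, hy, rfl⟩
  rw [← map_mul, ← map_mul, E0_comm hx hy]
theorem E_cube {a : G} (h : a ∈ S.E) : a ^ 3 = 1 := by
  obtain ⟨x, hx, rfl⟩ := S.mem_E.1 h
  rw [← map_pow, pow_three, ← mul_assoc, E0_cube x hx, map_one]
theorem D_mem : S.D ∈ S.E := S.α_E.2 (by decide)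

instance fact3 : Fact (Nat.Prime 3) := ⟨Nat.prime_three⟩
theorem cent_E {g : G} (h : ∀ a ∈ S.E, g * a = a * g) : g ∈ S.E := by
  obtain ⟨x, rfl⟩ := S.cent g (h _ S.D_mem)
  refine S.α_E.2 (centr_E x ?_ ?_)
  · exact S.inj (by simpa using h _ (S.α_E.2 (by decide : b1 ∈ E0)))
  · exact S.inj (by simpa using h _ (S.α_E.2 (by decide : d3 ∈ E0)))
theorem E_le_CC {e : G} (h : e ∈ S.E) : S.E ≤ CC e := fun a ha => S.E_comm a ha e h
theorem P_le_X : S.P ≤ CC S.D := by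
  rw [S.CC_D]; rintro _ ⟨x, -, rfl⟩; exact ⟨x, rfl⟩
theorem sylP_X : IsSylowIn 3 S.P (CC S.D) :=
  isSylowIn_of_card S.pgP S.P_le_X (m := 8) (by rw [S.cardX, S.cardP]) (by norm_num)
theorem sylP : IsSylowIn 3 S.P ⊤ := by
  apply isSylowIn_of_nz S.pgP le_top
  rintro g - hg ⟨k, hk⟩
  have hD : g * S.D * g⁻¹ ∈ S.P := hg.conj (S.E_le_P S.D_mem)
  obtain ⟨x, hx, hxg⟩ := S.mem_P.1 hD
  have hc : ∀ y ∈ P0, x * y = y * x := by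
    intro y hy
    apply S.inj
    rw [map_mul, map_mul, hxg]
    have h1 : g⁻¹ * S.α y * g ∈ S.P := by simpa using hg.inv.conj (S.α_P.2 hy)
    have h2 : g⁻¹ * S.α y * g * S.D = S.D * (g⁻¹ * S.α y * g) := S.P_le_X h1
    calc g * S.D * g⁻¹ * S.α y = g * (S.D * (g⁻¹ * S.α y * g)) * g⁻¹ := by simp [mul_assoc]
      _ = _ := by rw [← h2]; simp [mul_assoc]
  have h3 : x = dd := by
    rcases centr_P x hx (hc _ (by decide)) (hc _ (by decide)) (hc _ (by decide)) with h | h | h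
    · rw [h, map_one, eq_comm, conj_eq_one_iff] at hxg
      exact absurd (S.inj (hxg.trans (map_one S.α).symm)) (by decide)
    · exact h
    · exfalso
      apply S.nonreal g
      have : S.α dd * S.α (dd * dd) = 1 := by rw [← map_mul, ← map_one S.α]; congr 1
      rw [h] at hxg
      rw [eq_inv_iff_mul_eq_one]
      change S.α (dd * dd) = g * S.α dd * g⁻¹ at hxg
      rw [← hxg, ← map_mul, ← map_one S.α]; congr 1
  have h4 : g ∈ CC S.D := by rw [mem_CC', ← hxg, h3]; rfl
  exact S.sylP_X.mem_of_nz h4 hg hk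
end Setup
namespace X0
theorem C_el_R : ∀ z b : T3, b ≠ 0 → ∀ x : X0, x * el 0 z b = el 0 z b * x → x.c = 0 ∧ x.q = 0 := by
  decide +kernel
theorem C_el_A : ∀ z p : T3, p ≠ 0 → ∀ x : X0, x * el p z 0 = el p z 0 * x → x ∈ E0 := by
  decide +kernel
theorem el_conj : ∀ p z b : T3, b ≠ 0 →
    mk0 0 (-p * b) 0 * el 0 (z - b * p * p) b * (mk0 0 (-p * b) 0)⁻¹ = el p z b := by decide +kernel
theorem el_real : ∀ p z : T3, p ≠ 0 → ∃ k : T3,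
    (tt * mk0 0 k 0) * el p z 0 * (tt * mk0 0 k 0)⁻¹ = (el p z 0)⁻¹ := by decide +kernel
theorem conj_into_E : ∀ x : X0, x * x * x = 1 → x ∈ E0 ∨ ∃ j : T3,
    (ww * el 0 0 j) * x * (ww * el 0 0 j)⁻¹ ∈ E0 := by decide +kernel
theorem mem_Et : ∀ x : X0, x.c = 0 → x.q = 0 → x ∈ E0 ∨ tt * x ∈ E0 := by decide +kernel
theorem tt_el : ∀ p z b : T3, tt * el p z b * tt⁻¹ = el (-p) z b := by decide +kernel
theorem el_inv (p z b : T3) : (el p z b)⁻¹ = el (-p) (-z) (-b) := by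
  rw [inv_eq_iff_mul_eq_one, el_mul]; simp; rfl
end X0
theorem card_inf_relIndex {G : Type*} [Group G] (F E : Subgroup G) :
    Nat.card (F ⊓ E : Subgroup G) * E.relIndex F = Nat.card F := by
  have := Subgroup.relIndex_mul_relIndex ⊥ (F ⊓ E) F bot_le inf_le_left
  rwa [Subgroup.relIndex_bot_left, Subgroup.relIndex_bot_left, Subgroup.inf_relIndex_left] at this
theorem X0.unique27 {F : Subgroup X0} (hF : F ≤ P0) (hc : Nat.card F = 27)
    (hab : ∀ a ∈ F, ∀ b ∈ F, a * b = b * a) : F = E0 := by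
  have hfin : Finite X0 := Nat.finite_of_card_ne_zero (by rw [card_X0]; norm_num)
  by_cases hle : F ≤ E0
  · exact Subgroup.eq_of_le_of_card_ge hle (by rw [hc, card_E0])
  exfalso
  obtain ⟨x, hg, hxE⟩ := Set.not_subset.1 hle
  have hZ : F ⊓ E0 ≤ Subgroup.zpowers dd := by
    rintro e ⟨h1, he⟩
    have h2 := hab _ h1 _ hg
    rw [mem_E0_el he] at h2 ⊢
    obtain ⟨h3, h4⟩ := centr_out x (hF hg) hxE _ _ _ h2
    rw [h3, h4]
    generalize e.z = z
    have : ∀ z : T3, el 0 z 0 = 1 ∨ el 0 z 0 = dd ∨ el 0 z 0 = dd * dd := by decide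
    rcases this z with h | h | h <;> rw [h]
    · exact one_mem _
    · exact Subgroup.mem_zpowers _
    · exact mul_mem (Subgroup.mem_zpowers dd) (Subgroup.mem_zpowers dd)
  have h3 : Nat.card (F ⊓ E0 : Subgroup X0) ≤ 3 := by
    refine (Nat.le_of_dvd Nat.card_pos (Subgroup.card_dvd_of_le hZ)).trans ?_
    rw [Nat.card_zpowers]
    exact Nat.le_of_dvd (by norm_num) (orderOf_dvd_of_pow_eq_one (by decide +kernel))
  have h4 := card_inf_relIndex F E0
  have h5 : E0.relIndex P0 = 3 := by
    have := card_inf_relIndex P0 E0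
    rw [inf_eq_right.2 E0_le, card_E0, card_P0] at this
    omega
  have h6 : E0.relIndex F ≤ 3 := by
    rw [← h5]; exact Subgroup.relIndex_le_of_le_right hF (by rw [h5]; norm_num)
  rw [hc] at h4
  have := Nat.mul_le_mul h3 h6
  omega

/-- the images of `P0` and `E0` under an injective homomorphism -/
theorem X0.unique27_map {G : Type*} [Group G] {α : X0 →* G} (hα : Function.Injective α) {F : Subgroup G}
    (hF : F ≤ P0.map α) (hc : Nat.card F = 27)
    (hab : ∀ a ∈ F, ∀ b ∈ F, a * b = b * a) : F = E0.map α := by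
  have hm : (F.comap α).map α = F := Subgroup.map_comap_eq_self (hF.trans (Subgroup.map_le_range _ _))
  rw [← hm]
  congr 1
  apply X0.unique27
  · intro x hx
    exact (Subgroup.mem_map_iff_mem hα).1 (hF hx)
  · rw [← hc]
    nth_rewrite 2 [← hm]
    exact Nat.card_congr (Subgroup.equivMapOfInjective _ _ hα).toEquiv
  · intro a ha b hb
    apply hα
    rw [map_mul, map_mul]; exact hab _ ha _ hb
namespace Setup
variable {G : Type*} [Group G] [Finite G] (S : Setup G)
theorem unique27 {F : Subgroup G} (hF : F ≤ S.P) (hc : Nat.card F = 27)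
    (hab : ∀ a ∈ F, ∀ b ∈ F, a * b = b * a) : F = S.E := X0.unique27_map S.inj hF hc hab
theorem CJ_ab {F : Subgroup G} (hab : ∀ a ∈ F, ∀ b ∈ F, a * b = b * a) (g : G) :
    ∀ a ∈ CJ g F, ∀ b ∈ CJ g F, a * b = b * a := by
  intro a ha b hb
  rw [mem_CJ] at ha hb
  have := hab _ ha _ hb
  have h2 : g⁻¹ * (a * b) * g = g⁻¹ * (b * a) * g := by
    calc g⁻¹ * (a * b) * g = g⁻¹ * a * g * (g⁻¹ * b * g) := by simp [mul_assoc]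
      _ = _ := by rw [this]; simp [mul_assoc]
  exact mul_left_cancel (mul_right_cancel h2)
theorem weak {h : G} {Q : Subgroup G} (hQ : IsPGroup 3 Q) (hE : S.E ≤ Q)
    (hh : ∀ a ∈ S.E, h * a * h⁻¹ ∈ Q) : Nz S.E h := by
  obtain ⟨g, -, hg⟩ := S.sylP.conj hQ le_top
  have h1 : CJ g S.E = S.E := by
    apply S.unique27 _ (by rw [card_CJ, S.cardE]) (CJ_ab S.E_comm g)
    intro x hx
    rw [mem_CJ] at hx
    simpa [mul_assoc] using hg _ (hE hx)
  have h2 : CJ (g * h) S.E = S.E := by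
    apply S.unique27 _ (by rw [card_CJ, S.cardE]) (CJ_ab S.E_comm _)
    intro x hx
    rw [mem_CJ] at hx
    simpa [mul_assoc] using hg _ (hh _ hx)
  have := (Nz.of_CJ_eq h1).inv.mul (Nz.of_CJ_eq h2)
  simpa using this
theorem fus {e h : G} (he : e ∈ S.E) (heh : h * e * h⁻¹ ∈ S.E) :
    ∃ n, Nz S.E n ∧ n * e * n⁻¹ = h * e * h⁻¹ := by
  obtain ⟨n, -, h1, h2⟩ := fusion (p := 3) (H := ⊤) le_top S.pgE S.E_comm
    (fun h _ Q _ hQ hE hh a ha => (S.weak hQ hE hh).conj ha) he (Subgroup.mem_top h) heh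
  exact ⟨n, h1, h2⟩

/-- not conjugate to `D` or `D⁻¹` -/
def ND (e : G) : Prop := ∀ g, g * e * g⁻¹ ≠ S.D ∧ g * e * g⁻¹ ≠ S.D⁻¹
theorem nonreal' (g : G) : g * S.D * g⁻¹ ≠ S.D⁻¹ := S.nonreal g
theorem ND_of_real {e x : G} (h : x * e * x⁻¹ = e⁻¹) : S.ND e := by
  have h' : x * e⁻¹ * x⁻¹ = e := by
    have := congrArg (·⁻¹) h
    simpa [mul_assoc] using this
  intro g
  constructor
  · intro hg
    apply S.nonreal' (g * x * g⁻¹)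
    rw [← hg]
    calc g * x * g⁻¹ * (g * e * g⁻¹) * (g * x * g⁻¹)⁻¹ = g * (x * e * x⁻¹) * g⁻¹ := by simp [mul_assoc]
      _ = _ := by rw [h]; simp [mul_assoc]
  · intro hg
    apply S.nonreal' (g * x * g⁻¹)
    have hg' : S.D = g * e⁻¹ * g⁻¹ := by
      have := congrArg (·⁻¹) hg
      simp only [inv_inv] at this
      rw [← this]; simp [mul_assoc]
    rw [hg']
    calc g * x * g⁻¹ * (g * e⁻¹ * g⁻¹) * (g * x * g⁻¹)⁻¹ = g * (x * e⁻¹ * x⁻¹) * g⁻¹ := by simp [mul_assoc]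
      _ = _ := by rw [h']; simp [mul_assoc]
theorem ND_A {p z : T3} (hp : p ≠ 0) : S.ND (S.α (el p z 0)) := by
  obtain ⟨k, hk⟩ := el_real p z hp
  apply S.ND_of_real (x := S.α (tt * mk0 0 k 0))
  rw [← map_mul, ← map_inv, ← map_mul, hk, map_inv]
theorem D_pow (z : T3) : S.α (el 0 z 0) = 1 ∨ S.α (el 0 z 0) = S.D ∨ S.α (el 0 z 0) = S.D⁻¹ := by
  have : ∀ z : T3, el 0 z 0 = 1 ∨ el 0 z 0 = dd ∨ el 0 z 0 = dd⁻¹ := by decide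
  rcases this z with h | h | h <;> rw [h]
  · left; exact map_one _
  · right; left; rfl
  · right; right; rw [map_inv]; rfl
theorem sylE {e : G} (he : e ∈ S.E) (h1 : e ≠ 1) (hn : S.ND e) : IsSylowIn 3 S.E (CC e) := by
  apply isSylowIn_of_nz S.pgE (S.E_le_CC he)
  intro g hg hgE hk
  by_contra hgn
  have hp : IsPGroup 3 (S.E ⊔ Subgroup.zpowers g : Subgroup G) := by
    apply IsPGroup.to_sup_of_normal_left' S.pgE
    · obtain ⟨k, hk⟩ := hk
      exact pgroup_zpowers hk
    · rw [← NN_eq, Subgroup.zpowers_le]; exact hgE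
  obtain ⟨h, -, hh⟩ := S.sylP.conj hp le_top
  have nh : Nz S.E h := by
    have h1 : CJ h S.E = S.E := by
      apply S.unique27 _ (by rw [card_CJ, S.cardE]) (CJ_ab S.E_comm h)
      intro x hx
      rw [mem_CJ] at hx
      simpa [mul_assoc] using hh _ (Subgroup.mem_sup_left hx)
    exact Nz.of_CJ_eq h1
  have h2 := hh g (Subgroup.mem_sup_right (Subgroup.mem_zpowers g))
  obtain ⟨x, hx, hxg⟩ := S.mem_P.1 h2
  have hxE : x ∉ E0 := by
    intro hx'
    apply hgn
    rw [← nh, ← hxg]; exact S.α_E.2 hx'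
  obtain ⟨y, hy, hye⟩ := S.mem_E.1 (nh.conj he)
  have hc : y * x = x * y := by
    apply S.inj
    rw [map_mul, map_mul, hxg, hye]
    have : g * e = e * g := hg
    calc h * e * h⁻¹ * (h * g * h⁻¹) = h * (e * g) * h⁻¹ := by simp [mul_assoc]
      _ = _ := by rw [← this]; simp [mul_assoc]
  rw [mem_E0_el hy] at hc hye
  obtain ⟨h3, h4⟩ := centr_out x hx hxE _ _ _ hc
  rw [h3, h4] at hye
  rcases S.D_pow y.z with h | h | h <;> rw [h] at hye
  · apply h1; rw [eq_comm, conj_eq_one_iff] at hye; exact hye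
  · exact (hn _).1 hye.symm
  · exact (hn _).2 hye.symm
theorem NC {H : Subgroup G} (hS : IsSylowIn 3 S.E H) (hn : ∀ g ∈ H, Nz S.E g → g ∈ S.E) : H ≤ S.E := by
  obtain ⟨Y, hYH, hY3, hYn, hYA, -, -⟩ := burnside hS (fun g hg hgn a ha => S.E_comm g (hn g hg hgn) a ha)
  have : Y = ⊥ := S.sig Y hY3 (fun x hx => hYn _ (hS.1 (S.α_E.2 hx)))
  intro h hh
  obtain ⟨y, hy, a, ha, rfl⟩ := hYA h hh
  rw [this, Subgroup.mem_bot] at hy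
  rw [hy, one_mul]; exact ha
theorem NE_X {g : G} (h : Nz S.E g) (hg : g * S.D = S.D * g) : ∃ x : X0, x.c = 0 ∧ S.α x = g := by
  obtain ⟨x, rfl⟩ := S.cent g hg
  refine ⟨x, norm_E0 x ?_ ?_, rfl⟩
  · rw [← S.α_E]; simpa using h.conj (S.α_E.2 (by decide : d3 ∈ E0))
  · rw [← S.α_E]; simpa using h.conj (S.α_E.2 (by decide : b1 ∈ E0))
theorem X_NE {x : X0} (h : x.c = 0) : Nz S.E (S.α x) := by
  apply Nz.of_finite
  rintro _ ⟨y, hy, rfl⟩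
  rw [← map_mul, ← map_inv, ← map_mul, S.α_E, mem_E0_el hy]
  exact norm_E0' x h _ _ _
end Setup
namespace X0

def U0 : Subgroup X0 where
  carrier := {x | x.c = 0 ∧ x.q = 0}
  mul_mem' := by
    rintro x y ⟨h1, h2⟩ ⟨k1, k2⟩
    refine ⟨?_, ?_⟩ <;> simp [mul_def, h1, h2, k1, k2]
  one_mem' := by decide
  inv_mem' := by
    rintro x ⟨h1, h2⟩
    refine ⟨?_, ?_⟩
    · show - x.c = 0
      rw [h1, neg_zero]
    · show -(- x.c * x.p + x.a * x.q) = 0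
      rw [h1, h2]; simp
theorem mem_U0 {x : X0} : x ∈ U0 ↔ x.c = 0 ∧ x.q = 0 := Iff.rfl
theorem card_U0 : Nat.card U0 ≤ 54 := by
  have aux : ∀ x : X0, x.c = 0 → x.a ≠ 0 ∧ x.e = x.a := by decide +kernel
  have h := Nat.card_le_card_of_injective (α := U0) (β := {a : T3 // a ≠ 0} × T3 × T3 × T3)
    (fun x => (⟨x.1.a, (aux _ x.2.1).1⟩, x.1.p, x.1.z, x.1.b)) (by
      rintro ⟨x, hx⟩ ⟨y, hy⟩ h
      simp only [Prod.mk.injEq, Subtype.mk.injEq] at h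
      obtain ⟨h1, h2, h3, h4⟩ := h
      apply Subtype.ext
      have e1 := (aux _ hx.1).2
      have e2 := (aux _ hy.1).2
      obtain ⟨k1, k2⟩ := mem_U0.1 hx
      obtain ⟨k3, k4⟩ := mem_U0.1 hy
      apply X0.ext <;> simp_all)
  refine h.trans ?_
  have : Fintype.card {a : T3 // a ≠ 0} = 2 := by decide
  rw [Nat.card_prod, Nat.card_eq_fintype_card, this]; simp
theorem U_conj {x : X0} (hx : x ∈ U0) (p z b : T3) :
    x * el p z b * x⁻¹ = el p z b ∨ x * el p z b * x⁻¹ = el (-p) z b := by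
  rcases mem_Et x hx.1 hx.2 with h | h
  · left
    rw [E0_comm h (el_mem _ _ _)]; simp
  · right
    have h2 := E0_comm h (el_mem p z b)
    have h3 : x * el p z b * x⁻¹ = tt⁻¹ * (tt * x * el p z b) * x⁻¹ := by simp [mul_assoc]
    rw [h3, h2, ← tt_el]
    have : tt⁻¹ = tt := by decide
    rw [this]; simp [mul_assoc]
end X0
theorem pow_inj3 {G : Type*} [Group G] {e f : G} {m : ℕ} (he : e ^ 3 = 1) (hf : f ^ 3 = 1)
    (hm : ¬ 3 ∣ m) (h : e ^ m = f ^ m) : e = f := by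
  obtain ⟨k, rfl | rfl⟩ : ∃ k, m = 3 * k + 1 ∨ m = 3 * k + 2 := ⟨m / 3, by omega⟩
  · simpa [pow_add, pow_mul, he, hf] using h
  · have h2 : e ^ 2 = f ^ 2 := by simpa [pow_add, pow_mul, he, hf] using h
    have h3 : e ^ 2 * e = f ^ 2 * f := by rw [← pow_succ, ← pow_succ, he, hf]
    rw [h2] at h3
    exact mul_left_cancel h3
namespace Setup
variable {G : Type*} [Group G] [Finite G] (S : Setup G)

def U : Subgroup G := U0.map S.α
theorem mem_U {g : G} : g ∈ S.U ↔ ∃ x ∈ U0, S.α x = g := Subgroup.mem_map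
theorem α_U {x : X0} : S.α x ∈ S.U ↔ x ∈ U0 := Subgroup.mem_map_iff_mem S.inj
theorem card_U : Nat.card S.U ≤ 54 := by
  refine le_trans (le_of_eq ?_) card_U0
  exact (Nat.card_congr (Subgroup.equivMapOfInjective _ _ S.inj).toEquiv).symm
theorem U_nz {g : G} (h : g ∈ S.U) : Nz S.E g := by
  obtain ⟨x, hx, rfl⟩ := S.mem_U.1 h
  exact S.X_NE hx.1
theorem U_act {g : G} (h : g ∈ S.U) (p z b : T3) : g * S.α (el p z b) * g⁻¹ = S.α (el p z b) ∨
    g * S.α (el p z b) * g⁻¹ = S.α (el (-p) z b) := by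
  obtain ⟨x, hx, rfl⟩ := S.mem_U.1 h
  rw [← map_mul, ← map_inv, ← map_mul]
  rcases U_conj hx p z b with h | h <;> rw [h] <;> tauto
theorem mini {z b : T3} (hb : b ≠ 0) (hND : S.ND (S.α (el 0 z b)))
    (hN : ∀ n, Nz S.E n → n * S.α (el 0 z b) = S.α (el 0 z b) * n → n * S.D = S.D * n) :
    CC (S.α (el 0 z b)) ≤ S.U := by
  set f := S.α (el 0 z b) with hf
  have hfE : f ∈ S.E := S.α_E.2 (el_mem _ _ _)
  have hf1 : f ≠ 1 := by
    intro h
    rw [hf, ← map_one S.α] at h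
    exact hb (congrArg X0.b (S.inj h))
  have hS := S.sylE hfE hf1 hND
  set L := CC f with hL
  have hEL : S.E ≤ L := hS.1
  -- centralizer of D in L
  have CLD : ∀ g ∈ L, g * S.D = S.D * g → g ∈ S.U := by
    intro g hg hgD
    obtain ⟨x, rfl⟩ := S.cent g hgD
    refine S.α_U.2 (C_el_R z b hb x (S.inj ?_))
    rw [map_mul, map_mul]; exact hg
  have NL : ∀ g ∈ L, Nz S.E g → g ∈ S.U := fun g hg hgE => CLD g hg (hN g hgE hg)
  have CLa : ∀ g ∈ L, ∀ p z : T3, p ≠ 0 → g * S.α (el p z 0) = S.α (el p z 0) * g → g ∈ S.E := by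
    intro g hg p z hp hga
    have hle : S.E ≤ L ⊓ CC (S.α (el p z 0)) := le_inf hEL (S.E_le_CC (S.α_E.2 (el_mem _ _ _)))
    refine S.NC (hS.mono inf_le_left hle) ?_ ⟨hg, hga⟩
    rintro h ⟨hhL, hha⟩ hhE
    obtain ⟨x, hx, rfl⟩ := S.mem_U.1 (NL h hhL hhE)
    refine S.α_E.2 (C_el_A z p hp x (S.inj ?_))
    rw [map_mul, map_mul]; exact hha
  have htL : S.α tt ∈ L := by
    show S.α tt * S.α (el 0 z b) = S.α (el 0 z b) * S.α tt
    rw [← map_mul, ← map_mul]; congr 1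
    have := tt_el 0 z b
    rw [neg_zero] at this
    rw [mul_inv_eq_iff_eq_mul] at this; exact this
  obtain ⟨m, hm, h3m⟩ := hS.card
  obtain ⟨φ, hφE, hφ⟩ := transfer_hom hS S.E_comm hm
  have aL : ∀ p z b, S.α (el p z b) ∈ L := fun p z b => hEL (S.α_E.2 (el_mem _ _ _))
  have φR : ∀ z b, φ ⟨S.α (el 0 z b), aL 0 z b⟩ = S.α (el 0 z b) ^ m := by
    intro z b
    apply hφ _ (S.α_E.2 (el_mem _ _ _))
    intro n hn hnE
    have := S.U_act (NL n hn hnE) 0 z b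
    simpa using this
  have φa : ∀ p, φ ⟨S.α (el p 0 0), aL p 0 0⟩ = 1 := by
    intro p
    have e1 : (⟨S.α tt, htL⟩ : L) * ⟨S.α (el p 0 0), aL p 0 0⟩ * (⟨S.α tt, htL⟩ : L)⁻¹ =
        (⟨S.α (el p 0 0), aL p 0 0⟩ : L)⁻¹ := by
      apply Subtype.ext
      show S.α tt * S.α (el p 0 0) * (S.α tt)⁻¹ = (S.α (el p 0 0))⁻¹
      rw [← map_mul, ← map_inv, ← map_mul, ← map_inv, tt_el, el_inv, neg_zero]
    have e2 := congrArg φ e1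
    rw [map_mul, map_mul, map_inv, map_inv, S.E_comm _ (hφE _) _ (hφE _), mul_inv_cancel_right,
      eq_inv_iff_mul_eq_one] at e2
    have e3 := S.E_cube (hφE ⟨S.α (el p 0 0), aL p 0 0⟩)
    rw [pow_succ, sq, e2, one_mul] at e3
    exact e3
  have hcard : Nat.card φ.ker * Nat.card φ.range = 27 * m := by
    rw [← S.cardE, ← hm, Subgroup.card_eq_card_quotient_mul_card_subgroup φ.ker, mul_comm,
      Nat.card_congr (QuotientGroup.quotientKerEquivRange φ).toEquiv]
  have hrange : 9 ≤ Nat.card φ.range := by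
    have := Nat.card_le_card_of_injective (α := T3 × T3) (β := φ.range)
      (fun v => ⟨φ ⟨S.α (el 0 v.1 v.2), aL _ _ _⟩, _, rfl⟩) (by
        rintro ⟨z, b⟩ ⟨z', b'⟩ h
        have h1 := congrArg Subtype.val h
        simp only [φR] at h1
        have h2 := pow_inj3 (S.E_cube (S.α_E.2 (el_mem _ _ _))) (S.E_cube (S.α_E.2 (el_mem _ _ _))) h3m h1
        have h3 := el_inj (S.inj h2)
        rw [h3.2.1, h3.2.2])
    simpa using this
  have hker : Nat.card φ.ker ≤ 3 * m := by
    have := Nat.mul_le_mul_left (Nat.card φ.ker) hrange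
    omega
  have hDL : S.D ∈ L := aL 0 1 0
  set W : Set G := {x | ∃ h : x ∈ L, φ ⟨x, h⟩ = φ ⟨S.D, hDL⟩} with hW
  have hWc : W.ncard ≤ 3 * m := by
    refine le_trans ?_ hker
    rw [← Nat.card_coe_set_eq]
    refine Nat.card_le_card_of_injective (fun x => ⟨⟨x.1, x.2.1⟩ * (⟨S.D, hDL⟩ : L)⁻¹, ?_⟩) ?_
    · rw [MonoidHom.mem_ker, map_mul, map_inv, mul_inv_eq_one]; exact x.2.2
    · rintro ⟨x, hx⟩ ⟨y, hy⟩ h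
      have := congrArg (fun v => (v.1 : L).1) h
      simp only [Subgroup.coe_mul] at this
      exact Subtype.ext (mul_right_cancel this)
  -- the two classes
  set Da := S.α (el 1 1 0) with hDa
  set K1 := cls L S.D with hK1
  set K2 := cls L Da with hK2
  have hDaL : Da ∈ L := aL _ _ _
  have K1L : K1 ⊆ L := fun x hx => cls_subset hDL hx
  have K2L : K2 ⊆ L := fun x hx => cls_subset hDaL hx
  have K1E : ∀ x ∈ K1, x ∈ S.E → x = S.D := by
    rintro x ⟨g, hg, rfl⟩ hxE
    obtain ⟨n, hn, hnE, he⟩ := hS.fusion S.E_comm S.D_mem hg hxE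
    rw [← he, mul_inv_eq_iff_eq_mul]
    exact hN n hnE hn
  have K2E : ∀ x ∈ K2, x ∈ S.E → x = S.α (el 1 1 0) ∨ x = S.α (el (-1) 1 0) := by
    rintro x ⟨g, hg, rfl⟩ hxE
    obtain ⟨n, hn, hnE, he⟩ := hS.fusion S.E_comm (S.α_E.2 (el_mem 1 1 0)) hg hxE
    rw [← he]
    exact S.U_act (NL n hn hnE) _ _ _
  have SE : ∀ x ∈ K1 ∪ K2, x ∈ S.E → ∃ s, x = S.α (el s 1 0) := by
    rintro x (hx | hx) hxE
    · exact ⟨0, K1E x hx hxE⟩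
    · rcases K2E x hx hxE with h | h
      · exact ⟨_, h⟩
      · exact ⟨_, h⟩
  have hdisj : Disjoint K1 K2 := by
    rw [Set.disjoint_left]
    intro x h1 h2
    obtain ⟨g, -, hg⟩ := cls_trans h2 (cls_symm h1)
    exact (S.ND_A (p := 1) (z := 1) (by decide) g).1 hg.symm
  have hφconj : ∀ x y : L, (∃ g : L, y = g * x * g⁻¹) → φ y = φ x := by
    rintro x y ⟨g, rfl⟩
    rw [map_mul, map_mul, S.E_comm _ (hφE _) _ (hφE _), map_inv, mul_inv_cancel_right]
  have hφmul : ∀ s (x : G) (hx : x ∈ L), φ ⟨S.α (el s 0 0) * x, L.mul_mem (aL s 0 0) hx⟩ = φ ⟨x, hx⟩ := by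
    intro s x hx
    have : (⟨S.α (el s 0 0) * x, L.mul_mem (aL s 0 0) hx⟩ : L) = ⟨S.α (el s 0 0), aL s 0 0⟩ * ⟨x, hx⟩ := rfl
    rw [this, map_mul, φa, one_mul]
  have Wmul : ∀ s, ∀ x ∈ W, S.α (el s 0 0) * x ∈ W := by
    rintro s x ⟨hx, h⟩
    exact ⟨L.mul_mem (aL s 0 0) hx, by rw [hφmul s x hx, h]⟩
  have hDW : S.D ∈ W := ⟨hDL, rfl⟩
  have hsD : ∀ s, S.α (el s 0 0) * S.D = S.α (el s 1 0) := by
    intro s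
    show S.α (el s 0 0) * S.α (el 0 1 0) = _
    rw [← map_mul, el_mul]; simp
  have hsW : ∀ s, S.α (el s 1 0) ∈ W := by
    intro s; rw [← hsD]; exact Wmul s _ hDW
  have clsW : ∀ x ∈ W, ∀ y ∈ cls L x, y ∈ W := by
    rintro x ⟨hx, h⟩ y ⟨g, hg, rfl⟩
    refine ⟨L.mul_mem (L.mul_mem hg hx) (L.inv_mem hg), ?_⟩
    rw [← h]
    exact hφconj _ _ ⟨⟨g, hg⟩, rfl⟩
  have SW : K1 ∪ K2 ⊆ W := by
    rintro x (hx | hx)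
    · exact clsW _ hDW _ hx
    · exact clsW _ (hsW 1) _ hx
  have SL : K1 ∪ K2 ⊆ L := Set.union_subset K1L K2L
  have Scube : ∀ x ∈ K1 ∪ K2, x ^ 3 = 1 := by
    rintro x (⟨g, -, rfl⟩ | ⟨g, -, rfl⟩)
    · rw [conj_pow, S.E_cube S.D_mem]; simp
    · rw [conj_pow, S.E_cube (S.α_E.2 (el_mem _ _ _))]; simp
  have Scls : ∀ x ∈ K1 ∪ K2, ∀ y ∈ cls L x, y ∈ K1 ∪ K2 := by
    rintro x (hx | hx) y hy
    · exact Or.inl (cls_trans hx hy)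
    · exact Or.inr (cls_trans hx hy)
  have key : ∀ x ∈ K1 ∪ K2, ∀ y ∈ K1 ∪ K2, ∀ s : T3, s ≠ 0 → x = S.α (el s 0 0) * y →
      x ∈ S.E ∧ y ∈ S.E := by
    intro x hx y hy s hs hxy
    obtain ⟨r1, hr1, r2, hr2, h12, hc1, hc2, B, hBL, hB3, hb1, hb2, hBa, hBc, hBf⟩ :=
      tri hS S.E_comm (SL hx) (SL hy) (Scube x hx) (Scube y hy) (S.α_E.2 (el_mem s 0 0))
        (S.E_cube (S.α_E.2 (el_mem s 0 0))) hxy (fun g hg hga _ => CLa g hg s 0 hs hga)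
    obtain ⟨s1, h1⟩ := SE r1 (Scls x hx r1 hc1) hr1
    have hB : ∀ b ∈ B, b = 1 := by
      intro b hb
      have hbc := hBc b hb
      rw [h1, ← map_mul, el_mul, zero_add, zero_add] at hbc
      have hbU : Nz S.E b := by
        by_cases h0 : s + s1 = 0
        · rw [h0] at hbc
          exact S.U_nz (CLD b (hBL hb) hbc)
        · exact Nz.of_mem (CLa b (hBL hb) _ _ h0 hbc)
      apply hBf b hb
      have h3 : b * S.α (el s 0 0) * b⁻¹ * (S.α (el s 0 0))⁻¹ ∈ S.E :=
        S.E.mul_mem (hbU.conj (S.α_E.2 (el_mem _ _ _))) (S.E.inv_mem (S.α_E.2 (el_mem _ _ _)))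
      have h4 : b * S.α (el s 0 0) * b⁻¹ * (S.α (el s 0 0))⁻¹ ∈ B := by
        have : b * S.α (el s 0 0) * b⁻¹ * (S.α (el s 0 0))⁻¹ =
          b * (S.α (el s 0 0) * b⁻¹ * (S.α (el s 0 0))⁻¹) := by simp [mul_assoc]
        rw [this]
        exact B.mul_mem hb (hBa.conj (B.inv_mem hb))
      have h5 := coprime_inter S.pgE hB3 h3 h4
      rw [mul_inv_eq_one, mul_inv_eq_iff_eq_mul] at h5
      exact h5
    have e1 := hB _ hb1
    have e2 := hB _ hb2
    rw [mul_inv_eq_one] at e1 e2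
    rw [← e1, ← e2]
    exact ⟨hr1, hr2⟩
  set Sn := (K1 ∪ K2) \ (S.E : Set G) with hSn
  have hcnt : Sn.ncard * 3 + 3 ≤ W.ncard := by
    rw [← Nat.card_coe_set_eq, ← Nat.card_coe_set_eq]
    have hc : Nat.card ((Sn × T3) ⊕ T3) = Nat.card Sn * 3 + 3 := by
      rw [Nat.card_sum, Nat.card_prod, T3.card]
    rw [← hc]
    refine Nat.card_le_card_of_injective (Sum.elim (fun v => ⟨S.α (el v.2 0 0) * v.1.1, ?_⟩)
      (fun s => ⟨S.α (el s 1 0), hsW s⟩)) ?_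
    · exact Wmul _ _ (SW v.1.2.1)
    · have aux : ∀ (s s' : T3) (x y : G), S.α (el s 0 0) * x = S.α (el s' 0 0) * y →
          x = S.α (el (s' - s) 0 0) * y := by
        intro s s' x y h
        have h1 : x = (S.α (el s 0 0))⁻¹ * (S.α (el s' 0 0) * y) := by rw [← h]; simp
        rw [h1, ← mul_assoc, ← map_inv, ← map_mul, el_inv, el_mul, sub_eq_add_neg, add_comm s']
        simp
      rintro (⟨⟨x, hx⟩, s⟩ | s) (⟨⟨y, hy⟩, s'⟩ | s') h <;>
        simp only [Sum.elim_inl, Sum.elim_inr, Subtype.mk.injEq] at h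
      · have h1 := aux _ _ _ _ h
        by_cases h0 : s' - s = 0
        · rw [h0] at h1
          have : el 0 0 0 = 1 := rfl
          rw [this, map_one, one_mul] at h1
          subst h1
          rw [sub_eq_zero] at h0
          rw [h0]
        · exact absurd (key x hx.1 y hy.1 _ h0 h1).1 hx.2
      · rw [← hsD] at h
        have h1 := aux _ _ _ _ h
        rw [hsD] at h1
        exact absurd (by rw [h1]; exact S.α_E.2 (el_mem _ _ _)) hx.2
      · rw [← hsD] at h
        have h1 := aux _ _ _ _ h.symm
        rw [hsD] at h1
        exact absurd (by rw [h1]; exact S.α_E.2 (el_mem _ _ _)) hy.2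
      · rw [(el_inj (S.inj h)).1]
  have hcS : (K1 ∪ K2).ncard = K1.ncard + K2.ncard := Set.ncard_union_eq hdisj
  have hSn3 : K1.ncard + K2.ncard ≤ Sn.ncard + 3 := by
    rw [← hcS]
    have h1 : K1 ∪ K2 ⊆ Sn ∪ Set.range (fun s => S.α (el s 1 0)) := by
      intro x hx
      by_cases hxE : x ∈ S.E
      · obtain ⟨s, rfl⟩ := SE x hx hxE
        exact Or.inr ⟨s, rfl⟩
      · exact Or.inl ⟨hx, hxE⟩
    refine (Set.ncard_le_ncard h1).trans ((Set.ncard_union_le _ _).trans ?_)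
    gcongr
    rw [← Set.image_univ]
    refine (Set.ncard_image_le).trans ?_
    rw [Set.ncard_univ, T3.card]
  have c1 : m ≤ 2 * K1.ncard := by
    have h1 : K1.ncard * Nat.card (L ⊓ CC S.D : Subgroup G) = 27 * m := by
      rw [← S.cardE, ← hm]; exact card_cls L S.D
    have h2 : Nat.card (L ⊓ CC S.D : Subgroup G) ≤ 54 := by
      refine le_trans (Nat.le_of_dvd Nat.card_pos (Subgroup.card_dvd_of_le ?_)) S.card_U
      rintro g ⟨hg, hgD⟩
      exact CLD g hg hgD
    have := Nat.mul_le_mul_left K1.ncard h2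
    omega
  have c2 : m ≤ K2.ncard := by
    have h1 : K2.ncard * Nat.card (L ⊓ CC Da : Subgroup G) = 27 * m := by
      rw [← S.cardE, ← hm]; exact card_cls L Da
    have h2 : Nat.card (L ⊓ CC Da : Subgroup G) ≤ 27 := by
      rw [← S.cardE]
      refine Nat.le_of_dvd Nat.card_pos (Subgroup.card_dvd_of_le ?_)
      rintro g ⟨hg, hgD⟩
      exact CLa g hg 1 1 (by decide) hgD
    have := Nat.mul_le_mul_left K2.ncard h2
    omega
  have c3 : K1.ncard ≤ 2 := by omega
  intro g hg
  apply CLD g hg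
  by_contra hgD
  set D' := g * S.D * g⁻¹ with hD'
  have hD'1 : D' ∈ K1 := ⟨g, hg, rfl⟩
  have hne : D' ≠ S.D := by
    intro h
    apply hgD
    rw [hD', mul_inv_eq_iff_eq_mul] at h; exact h
  set a := S.α (el 1 0 0) with ha
  have haD : a * S.D * a⁻¹ = S.D := by
    rw [mul_inv_eq_iff_eq_mul]; exact S.E_comm _ (S.α_E.2 (el_mem _ _ _)) _ S.D_mem
  have hD'' : a * D' * a⁻¹ ∈ K1 := cls_conj (aL _ _ _) hD'1
  have hne2 : a * D' * a⁻¹ ≠ S.D := by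
    intro h
    rw [← haD] at h
    exact hne (mul_left_cancel (mul_right_cancel h))
  have hne3 : a * D' * a⁻¹ ≠ D' := by
    intro h
    rw [mul_inv_eq_iff_eq_mul] at h
    exact hne (K1E _ hD'1 (CLa _ (K1L hD'1) 1 0 (by decide) h.symm))
  have : ({S.D, D', a * D' * a⁻¹} : Set G).ncard = 3 :=
    Set.ncard_eq_three.2 ⟨_, _, _, hne.symm, hne2.symm, hne3.symm, rfl⟩
  have h3 : ({S.D, D', a * D' * a⁻¹} : Set G) ⊆ K1 := by
    rintro x (rfl | rfl | rfl)
    · exact self_mem_cls _ _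
    · exact hD'1
    · exact hD''
  have := Set.ncard_le_ncard h3
  omega
end Setup
namespace X0

def R0 : Subgroup X0 where
  carrier := {x | x ∈ E0 ∧ x.p = 0}
  mul_mem' := by
    rintro x y ⟨h1, h2⟩ ⟨k1, k2⟩
    refine ⟨E0.mul_mem h1 k1, ?_⟩
    rw [mem_E0] at h1 k1
    simp [mul_def, h1, h2, k1, k2]
  one_mem' := by decide
  inv_mem' := by
    rintro x ⟨h1, h2⟩
    refine ⟨E0.inv_mem h1, ?_⟩
    rw [mem_E0] at h1
    show -(x.e * x.p - x.b * x.q) = 0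
    rw [h2, h1.2.2.2]; simp
theorem mem_R0 {x : X0} : x ∈ R0 ↔ x ∈ E0 ∧ x.p = 0 := Iff.rfl
instance (x : X0) : Decidable (x ∈ R0) := decidable_of_iff _ mem_R0.symm
theorem R0_le : R0 ≤ E0 := fun _ h => h.1
theorem el_R0 (z b : T3) : el 0 z b ∈ R0 := ⟨el_mem _ _ _, rfl⟩
theorem mem_R0_el {x : X0} (h : x ∈ R0) : x = el 0 x.z x.b := by
  have := mem_E0_el h.1
  rwa [h.2] at this
theorem R0_norm : ∀ x : X0, x * tt = tt * x → x * d3 * x⁻¹ ∈ R0 →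
    x ∈ R0 ∨ x * x * x = tt ∧ tt * x ∈ R0 := by decide +kernel
theorem R0_tt : ∀ x ∈ R0, x * tt = tt * x := by decide +kernel
theorem X0_pow : ∀ x : X0, x ≠ 1 → ∃ k : Fin 7, x ^ (k : ℕ) ≠ 1 ∧
    (x ^ (k : ℕ) * x ^ (k : ℕ) = 1 ∨ x ^ (k : ℕ) * x ^ (k : ℕ) * x ^ (k : ℕ) = 1) := by decide +kernel
theorem X0_inv : ∀ x : X0, x * x = 1 → x ≠ 1 → ∃ p q : T3,
    x = mk0 p q 0 * tt * (mk0 p q 0)⁻¹ := by decide +kernel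
theorem C_tt : ∀ x : X0, x * tt = tt * x → x.p = 0 ∧ x.q = 0 := by decide +kernel
end X0
namespace Setup
variable {G : Type*} [Group G] [Finite G] (S : Setup G)

def R : Subgroup G := R0.map S.α
theorem mem_R {g : G} : g ∈ S.R ↔ ∃ x ∈ R0, S.α x = g := Subgroup.mem_map
theorem α_R {x : X0} : S.α x ∈ S.R ↔ x ∈ R0 := Subgroup.mem_map_iff_mem S.inj
theorem R_le_E : S.R ≤ S.E := Subgroup.map_mono R0_le
theorem pgR : IsPGroup 3 S.R := S.pgE.to_le S.R_le_E
theorem R_comm : ∀ a ∈ S.R, ∀ b ∈ S.R, a * b = b * a :=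
  fun a ha b hb => S.E_comm a (S.R_le_E ha) b (S.R_le_E hb)

def t : G := S.α tt
theorem tt_sq : S.t * S.t = 1 := by
  rw [t, ← map_mul, ← map_one S.α]; congr 1
theorem t_ne : S.t ≠ 1 := by
  intro h
  rw [t, ← map_one S.α] at h
  exact absurd (S.inj h) (by decide)
theorem α_comm {x y : X0} : S.α x * S.α y = S.α y * S.α x ↔ x * y = y * x := by
  rw [← map_mul, ← map_mul, S.inj.eq_iff]
theorem α_conj (x y : X0) : S.α x * S.α y * (S.α x)⁻¹ = S.α (x * y * x⁻¹) := by
  rw [map_mul, map_mul, map_inv]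
theorem R_le_T : S.R ≤ CC S.t := by
  rintro _ ⟨x, hx, rfl⟩
  exact S.α_comm.2 (R0_tt x hx)
theorem t_3 {k : ℕ} (h : S.t ^ 3 ^ k = 1) : False := by
  have h1 : orderOf S.t ∣ 3 ^ k := orderOf_dvd_of_pow_eq_one h
  have h2 : orderOf S.t ∣ 2 := orderOf_dvd_of_pow_eq_one (by rw [sq]; exact S.tt_sq)
  have h3 : orderOf S.t ∣ 1 := by
    have := Nat.dvd_gcd h1 h2
    rwa [Nat.Coprime.gcd_eq_one (Nat.Coprime.pow_left _ (by norm_num))] at this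
  exact S.t_ne (orderOf_eq_one_iff.1 (Nat.dvd_one.1 h3))

/-- `R` is Sylow in `C(t)` once 3-elements normalizing it centralize `D`. -/
theorem sylR (h : ∀ g, g ∈ CC S.t → Nz S.R g → (∃ k : ℕ, g ^ 3 ^ k = 1) → g * S.D = S.D * g) :
    IsSylowIn 3 S.R (CC S.t) := by
  apply isSylowIn_of_nz S.pgR S.R_le_T
  intro g hg hn hk
  obtain ⟨x, rfl⟩ := S.cent g (h g hg hn hk)
  have h1 : x * d3 * x⁻¹ ∈ R0 := by
    rw [← S.α_R, ← S.α_conj]; exact hn.conj (S.α_R.2 (el_R0 0 1))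
  rcases R0_norm x (S.α_comm.1 hg) h1 with h2 | ⟨h2, -⟩
  · exact S.α_R.2 h2
  · exfalso
    obtain ⟨k, hk⟩ := hk
    apply S.t_3 (k := k)
    rw [t, ← h2, map_mul, map_mul, ← pow_two, ← pow_succ, ← pow_mul, mul_comm, pow_mul, hk, one_pow]
theorem C_inv {W : Subgroup G} (hT : CC S.t ≤ W) (hX : CC S.D ≤ W) {x : X0} (h2 : x * x = 1) (h1 : x ≠ 1) :
    CC (S.α x) ≤ W := by
  obtain ⟨p, q, rfl⟩ := X0_inv x h2 h1
  intro g hg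
  set y := mk0 p q 0 with hy
  have h3 : (S.α y)⁻¹ * g * S.α y ∈ CC S.t := by
    have hg' : g * (S.α y * S.α tt * (S.α y)⁻¹) = S.α y * S.α tt * (S.α y)⁻¹ * g := by
      rw [S.α_conj]; exact hg
    show (S.α y)⁻¹ * g * S.α y * S.α tt = S.α tt * ((S.α y)⁻¹ * g * S.α y)
    calc _ = (S.α y)⁻¹ * (g * (S.α y * S.α tt * (S.α y)⁻¹)) * S.α y := by simp [mul_assoc]
      _ = _ := by rw [hg']; simp [mul_assoc]
  have hyW : S.α y ∈ W := hX (by rw [S.CC_D]; exact ⟨y, rfl⟩)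
  have h4 := W.mul_mem (W.mul_mem hyW (hT h3)) (W.inv_mem hyW)
  simpa [mul_assoc] using h4
theorem C_conj {W : Subgroup G} {y g : G} (hy : y ∈ W) (h : CC (y * g * y⁻¹) ≤ W) : CC g ≤ W := by
  intro x hx
  have hx' : x * g = g * x := hx
  have h3 : y * x * y⁻¹ ∈ CC (y * g * y⁻¹) := by
    show y * x * y⁻¹ * (y * g * y⁻¹) = (y * g * y⁻¹) * (y * x * y⁻¹)
    calc _ = y * (x * g) * y⁻¹ := by simp [mul_assoc]
      _ = _ := by rw [hx']; simp [mul_assoc]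
  have h4 := W.mul_mem (W.mul_mem (W.inv_mem hy) (h h3)) hy
  simpa [mul_assoc] using h4
theorem X_mem (x : X0) : S.α x ∈ CC S.D := by rw [S.CC_D]; exact ⟨x, rfl⟩
theorem C_el {W : Subgroup G} (hX : CC S.D ≤ W)
    (hA : ∀ p z, p ≠ 0 → CC (S.α (el p z 0)) ≤ W)
    (hR : ∀ z b, b ≠ 0 → CC (S.α (el 0 z b)) ≤ W) {x : X0} (h3 : x * x * x = 1) (h1 : x ≠ 1) :
    CC (S.α x) ≤ W := by
  have hXW : ∀ x, S.α x ∈ W := fun x => hX (S.X_mem x)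
  have key : ∀ x ∈ E0, x ≠ 1 → CC (S.α x) ≤ W := by
    intro x hx h1
    have hx' := mem_E0_el hx
    by_cases hb : x.b = 0
    · by_cases hp : x.p = 0
      · rw [hb, hp] at hx'
        rcases S.D_pow x.z with h | h | h <;> rw [← hx'] at h
        · exact absurd (S.inj (h.trans (map_one S.α).symm)) h1
        · rw [h]; exact hX
        · rw [h]
          intro g hg
          apply hX
          have hg' : g * S.D⁻¹ = S.D⁻¹ * g := hg
          rw [mem_CC, ← eq_mul_inv_iff_mul_eq, mul_assoc, hg']; simp
      · rw [hb] at hx'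
        rw [hx']; exact hA _ _ hp
    · have h2 := el_conj x.p x.z x.b hb
      rw [← hx'] at h2
      have h4 := hR (x.z - x.b * x.p * x.p) _ hb
      generalize mk0 0 (-x.p * x.b) 0 = y at h2
      generalize el 0 (x.z - x.b * x.p * x.p) x.b = f at h2 h4
      refine C_conj (y := (S.α y)⁻¹) (W.inv_mem (hXW _)) ?_
      rw [← h2, ← S.α_conj]
      simpa [mul_assoc] using h4
  rcases conj_into_E x h3 with h | ⟨j, h⟩
  · exact key x h h1
  · refine C_conj (y := S.α (ww * el 0 0 j)) (hXW _) ?_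
    rw [S.α_conj]
    apply key _ h
    intro h; rw [conj_eq_one_iff] at h; exact h1 h
theorem inv_pair {u v g g' : G} (hug : u = g * S.t * g⁻¹) (hvg : v = g' * S.t * g'⁻¹)
    (h : u * S.D * u⁻¹ = v * S.D * v⁻¹) (hne : u ≠ v) :
    ∃ x : X0, x ≠ 1 ∧ (x * x = 1 ∨ x * x * x = 1) ∧ u * S.D * u⁻¹ ∈ CC (S.α x) := by
  have hu2 : u * u = 1 := by rw [hug, conj_mul, S.tt_sq]; simp
  have hv2 : v * v = 1 := by rw [hvg, conj_mul, S.tt_sq]; simp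
  have hui : u⁻¹ = u := inv_eq_of_mul_eq_one_left hu2
  have hvi : v⁻¹ = v := inv_eq_of_mul_eq_one_left hv2
  simp only [hui, hvi] at h
  have hw : u * v ∈ CC S.D := by
    rw [mem_CC', mul_inv_rev, hui, hvi]
    calc u * v * S.D * (v * u) = u * (v * S.D * v) * u := by simp [mul_assoc]
      _ = (u * u) * S.D * (u * u) := by rw [← h]; simp [mul_assoc]
      _ = _ := by rw [hu2]; simp
  have hw' : (u * v) * (u * S.D * u) = (u * S.D * u) * (u * v) := by
    calc (u * v) * (u * S.D * u) = u * (v * v) * S.D * v := by rw [h]; simp [mul_assoc]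
      _ = u * S.D * (u * u) * v := by rw [hv2, hu2]; simp
      _ = _ := by simp [mul_assoc]
  obtain ⟨x, hx⟩ := S.cent _ hw
  have hx1 : x ≠ 1 := by
    rintro rfl
    rw [map_one] at hx
    apply hne
    rw [← hvi]; exact eq_inv_of_mul_eq_one_left hx.symm
  obtain ⟨k, hk1, hk2⟩ := X0_pow x hx1
  refine ⟨_, hk1, hk2, ?_⟩
  rw [map_pow, hx, hui]
  exact (Commute.pow_left (show Commute (u * v) (u * S.D * u) from hw') k).symm

section k1
variable (hk : ∀ n, Nz S.E n → n * S.D = S.D * n)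
include hk
theorem k1_D {e g : G} (he : e ∈ S.E) (h : g * e * g⁻¹ = S.D) : e = S.D := by
  obtain ⟨n, hn, h1⟩ := S.fus he (by rw [h]; exact S.D_mem)
  rw [h, mul_inv_eq_iff_eq_mul] at h1
  have := hk n hn
  rw [← this] at h1
  exact mul_left_cancel h1
theorem k1_ND {z b : T3} (hb : b ≠ 0) : S.ND (S.α (el 0 z b)) := by
  intro g
  have hE := S.α_E.2 (el_mem 0 z b)
  constructor
  · intro h
    have := S.inj (S.k1_D hk hE h : _ = S.α (el 0 1 0))
    exact hb (el_inj this).2.2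
  · intro h
    have h' : g * (S.α (el 0 z b))⁻¹ * g⁻¹ = S.D := by
      rw [← inv_inj, ← h]; simp [mul_assoc]
    have := S.k1_D hk (S.E.inv_mem hE) h'
    rw [← map_inv, el_inv] at this
    have := (el_inj (S.inj (this : _ = S.α (el 0 1 0)))).2.2
    exact hb (neg_eq_zero.1 this)
theorem k1_f {z b : T3} (hb : b ≠ 0) : CC (S.α (el 0 z b)) ≤ CC S.D := by
  refine (S.mini hb (S.k1_ND hk hb) (fun n hn _ => hk n hn)).trans ?_
  rintro _ ⟨x, -, rfl⟩
  exact S.X_mem x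
theorem k1_NR {g : G} (hg : g ∈ CC S.t) (hn : Nz S.R g) : g * S.D = S.D * g := by
  have h1 : g * S.D * g⁻¹ ∈ S.E := S.R_le_E (hn.conj (S.α_R.2 (el_R0 1 0)))
  have h2 := S.k1_D hk (g := g⁻¹) h1 (by simp [mul_assoc])
  rwa [mul_inv_eq_iff_eq_mul] at h2
theorem k1_T : CC S.t ≤ CC S.D := by
  have hS := S.sylR (fun g hg hn _ => S.k1_NR hk hg hn)
  obtain ⟨Y, hYT, hY3, hYn, hYR, -, -⟩ := burnside hS (by
    intro g hg hn a ha
    obtain ⟨x, rfl⟩ := S.cent g (S.k1_NR hk hg hn)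
    have h1 : x * d3 * x⁻¹ ∈ R0 := by
      rw [← S.α_R, ← S.α_conj]; exact hn.conj (S.α_R.2 (el_R0 0 1))
    rcases R0_norm x (S.α_comm.1 hg) h1 with h2 | ⟨-, h2⟩
    · exact S.R_comm _ (S.α_R.2 h2) _ ha
    · obtain ⟨y, hy, rfl⟩ := S.mem_R.1 ha
      rw [S.α_comm]
      have h3 := E0_comm h2.1 hy.1
      have h4 := R0_tt y hy
      have : x = tt⁻¹ * (tt * x) := by simp
      calc x * y = tt⁻¹ * (tt * x * y) := by simp [mul_assoc]
        _ = tt⁻¹ * (y * tt) * x := by rw [h3]; simp [mul_assoc]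
        _ = _ := by rw [h4]; simp [mul_assoc])
  have hT : ∀ z b, S.α (el 0 z b) ∈ CC S.t := fun z b => S.R_le_T (S.α_R.2 (el_R0 z b))
  have hY : Y ≤ CC S.D := by
    have c : ∀ z b, b ≠ 0 → ∀ y ∈ Y, S.α (el 0 z b) * y * (S.α (el 0 z b))⁻¹ = y → y ∈ CC S.D := by
      intro z b hb y _ h
      apply S.k1_f hk (z := z) hb
      rw [mul_inv_eq_iff_eq_mul] at h
      exact h.symm
    have cube : ∀ z b, S.α (el 0 z b) ^ 3 = 1 := fun z b => S.E_cube (S.α_E.2 (el_mem _ _ _))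
    refine generation hY3 (σ := S.α (el 0 1 0)) (τ := S.α (el 0 0 1)) ?_ (cube _ _) (cube _ _)
      (hYn _ (hT _ _)) (hYn _ (hT _ _)) ?_ (c _ _ (by decide)) ?_ ?_
    · rw [S.α_comm]; decide
    · intro y _ h
      rw [mul_inv_eq_iff_eq_mul] at h
      exact h.symm
    · rw [← map_mul, el_mul]; exact c _ _ (by decide)
    · rw [← map_mul, ← map_mul, el_mul, el_mul]; exact c _ _ (by decide)
  intro g hg
  obtain ⟨y, hy, a, ha, rfl⟩ := hYR g hg
  obtain ⟨x, -, rfl⟩ := S.mem_R.1 ha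
  exact (CC S.D).mul_mem (hY hy) (S.X_mem x)
theorem k1_C {x : X0} (h1 : x ≠ 1) (h : x * x = 1 ∨ x * x * x = 1) : CC (S.α x) ≤ CC S.D := by
  rcases h with h | h
  · exact S.C_inv (S.k1_T hk) le_rfl h h1
  · refine S.C_el le_rfl ?_ (fun z b hb => S.k1_f hk hb) h h1
    intro p z hp
    have hE := S.α_E.2 (el_mem p z 0)
    have hle : CC (S.α (el p z 0)) ≤ S.E := by
      refine S.NC (S.sylE hE ?_ (S.ND_A hp)) ?_
      · intro h
        have := S.inj (h.trans (map_one S.α).symm)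
        exact hp (congrArg X0.p this)
      · intro g hg hn
        obtain ⟨x, rfl⟩ := S.cent g (hk g hn)
        exact S.α_E.2 (C_el_A z p hp x (S.α_comm.1 hg))
    exact hle.trans (S.E_le_P.trans S.P_le_X)
theorem k1_unique {g : G} (h : g * S.D * g⁻¹ ∈ CC S.D) : g * S.D * g⁻¹ = S.D := by
  obtain ⟨x, hx⟩ := S.cent _ h
  have h3 : x * x * x = 1 := by
    apply S.inj
    have := S.E_cube S.D_mem
    rw [map_one, map_mul, map_mul, hx, ← pow_two, ← pow_succ, conj_pow, this]; simp
  have key : ∀ y : X0, y * x * y⁻¹ ∈ E0 → S.α x = S.D := by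
    intro y hy
    have h4 := S.k1_D hk (e := S.α (y * x * y⁻¹)) (g := (S.α y * g)⁻¹) (S.α_E.2 hy) (by
      rw [← S.α_conj, hx]; simp [mul_assoc])
    have h5 : y * x * y⁻¹ = dd := S.inj h4
    rw [mul_inv_eq_iff_eq_mul, ← centr_dd] at h5
    rw [mul_left_cancel h5]; rfl
  rw [← hx]
  rcases conj_into_E x h3 with h | ⟨j, h⟩
  · exact key 1 (by simpa using h)
  · exact key _ h
theorem k1_finish : CC S.D = ⊤ := by
  have hct := card_cls ⊤ S.t
  have hcd := card_cls ⊤ S.D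
  rw [top_inf_eq, S.cardX] at hcd
  rw [top_inf_eq] at hct
  set N := (cls ⊤ S.D).ncard with hN
  have hT72 : Nat.card (CC S.t) ≤ 72 := by
    have := Nat.card_le_card_of_injective (α := CC S.t)
      (β := T3 × {v : T3 × T3 × T3 × T3 // v.1 * v.2.2.2 - v.2.1 * v.2.2.1 = 1})
      (fun g => (((S.cent g (S.k1_T hk g.2)).choose).z,
        ⟨((S.cent g (S.k1_T hk g.2)).choose.a, (S.cent g (S.k1_T hk g.2)).choose.b,
          (S.cent g (S.k1_T hk g.2)).choose.c, (S.cent g (S.k1_T hk g.2)).choose.e),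
          (S.cent g (S.k1_T hk g.2)).choose.h⟩)) (by
        rintro ⟨g, hg⟩ ⟨g', hg'⟩ h
        have s1 := (S.cent g (S.k1_T hk hg)).choose_spec
        have s2 := (S.cent g' (S.k1_T hk hg')).choose_spec
        simp only [Prod.mk.injEq, Subtype.mk.injEq] at h
        generalize (S.cent g (S.k1_T hk hg)).choose = x at *
        generalize (S.cent g' (S.k1_T hk hg')).choose = x' at *
        subst s1 s2
        have c1 := C_tt x (S.α_comm.1 hg)
        have c2 := C_tt x' (S.α_comm.1 hg')
        congr 2
        apply X0.ext <;> simp_all)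
    refine this.trans ?_
    rw [Nat.card_prod, T3.card, Nat.card_eq_fintype_card]
    decide +kernel
  have hfib : (cls ⊤ S.t).ncard ≤ 9 + (N - 1) := by
    have h1 : (cls ⊤ S.t ∩ CC S.D).ncard ≤ 9 := by
      have hsub : cls ⊤ S.t ∩ CC S.D ⊆ Set.range (fun v : T3 × T3 => S.α (mk0 v.1 v.2 0 * tt * (mk0 v.1 v.2 0)⁻¹)) := by
        rintro u ⟨⟨g, -, rfl⟩, hu⟩
        obtain ⟨x, hx⟩ := S.cent _ hu
        obtain ⟨p, q, h⟩ := X0_inv x (by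
          apply S.inj
          rw [map_mul, hx, map_one, conj_mul, S.tt_sq]; simp) (by
          rintro rfl
          rw [map_one, eq_comm, conj_eq_one_iff] at hx
          exact S.t_ne hx)
        exact ⟨(p, q), by rw [← hx, h]⟩
      refine (Set.ncard_le_ncard hsub).trans ?_
      rw [← Set.image_univ]
      refine (Set.ncard_image_le).trans ?_
      rw [Set.ncard_univ]; simp
    have h2 : (cls ⊤ S.t \ CC S.D).ncard ≤ (cls ⊤ S.D \ {S.D}).ncard := by
      apply Set.ncard_le_ncard_of_injOn (fun u => u * S.D * u⁻¹)
      · rintro u ⟨-, hu⟩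
        exact ⟨⟨u, Subgroup.mem_top u, rfl⟩, fun h => hu (mem_CC'.2 h)⟩
      · rintro u ⟨⟨g, -, hug⟩, hu⟩ v ⟨⟨g', -, hvg⟩, hv⟩ h
        by_contra hne
        obtain ⟨x, hx1, hx2, h5⟩ := S.inv_pair hug hvg h hne
        exact hu (mem_CC'.2 (S.k1_unique hk (g := u) (S.k1_C hk hx1 hx2 h5)))
    have h3 : (cls ⊤ S.D \ {S.D}).ncard = N - 1 := Set.ncard_diff_singleton_of_mem (self_mem_cls _ _)
    have h4 := Set.ncard_inter_add_ncard_diff_eq_ncard (cls ⊤ S.t) (CC S.D : Set G)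
    omega
  have hNpos : 0 < N := Nat.pos_of_ne_zero (by
    intro h; rw [h, zero_mul] at hcd
    exact (Nat.card_pos (α := (⊤ : Subgroup G))).ne hcd)
  have h8 : N * 648 ≤ (9 + (N - 1)) * 72 := by
    rw [hcd, ← hct]; exact Nat.mul_le_mul hfib hT72
  have hN1 : N = 1 := by omega
  apply Subgroup.eq_top_of_card_eq
  rw [S.cardX]
  rw [hN1, one_mul, Subgroup.card_top] at hcd
  exact hcd
end k1
end Setup
theorem card_fixed {G : Type*} [Group G] [Finite G] {p : ℕ} [Fact p.Prime] {A : Subgroup G} {g : G}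
    (hn : Nz A g) {k : ℕ} (hg : g ^ p ^ k = 1) : Nat.card A ≡ Nat.card (A ⊓ CC g : Subgroup G) [MOD p] := by
  classical
  let f : Function.End A := fun a => ⟨g * a * g⁻¹, hn.conj a.2⟩
  have hf : ∀ m (a : A), ((f ^ m) a : G) = g ^ m * a * (g ^ m)⁻¹ := by
    intro m
    induction m with
    | zero => intro a; simp; rfl
    | succ m ih =>
      intro a
      rw [pow_succ' f]
      show g * ((f ^ m) a : G) * g⁻¹ = _
      rw [ih, pow_succ']; simp [mul_assoc]
  have h1 : f ^ p ^ k = 1 := by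
    funext a
    apply Subtype.ext
    rw [hf, hg]; simp
    rfl
  have := Fintype.ofFinite A
  have h2 := Equiv.Perm.card_fixedPoints_modEq (p := p) (n := k) (f := f) h1
  rw [← Nat.card_eq_fintype_card, ← Nat.card_eq_fintype_card] at h2
  have h3 : Nat.card (Function.fixedPoints f) = Nat.card (A ⊓ CC g : Subgroup G) := by
    refine Nat.card_congr ⟨fun a => ⟨a.1.1, a.1.2, ?_⟩, fun a => ⟨⟨a.1, a.2.1⟩, ?_⟩, fun a => rfl, fun a => rfl⟩
    · have := congrArg Subtype.val a.2
      change g * a.1.1 * g⁻¹ = a.1.1 at this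
      rw [mul_inv_eq_iff_eq_mul] at this
      exact this.symm
    · apply Subtype.ext
      show g * a.1 * g⁻¹ = a.1
      rw [mul_inv_eq_iff_eq_mul]
      exact (mem_CC.1 a.2.2).symm
  rw [h3] at h2
  exact h2
namespace X0

def lam (a b c e : T3) : T3 := a * b * (1 - c * c) + c * (a + e)
theorem lam_mul : ∀ a b c e a' b' c' e' : T3, a * e - b * c = 1 → a' * e' - b' * c' = 1 →
    lam (a * a' + b * c') (a * b' + b * e') (c * a' + e * c') (c * b' + e * e') =
      lam a b c e + lam a' b' c' e' := by decide +kernel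

def twist (j : T3) : X0 →* X0 where
  toFun x := { x with z := x.z + j * lam x.a x.b x.c x.e }
  map_one' := by
    apply X0.ext <;> first | rfl | skip
    revert j; decide
  map_mul' := by
    intro x y
    apply X0.ext <;> first | rfl | skip
    have := lam_mul x.a x.b x.c x.e y.a y.b y.c y.e x.h y.h
    simp only [mul_def]
    rw [this]; ring
theorem twist_el (j : T3) (p z b : T3) : twist j (el p z b) = el p (z + j * b) b := by
  revert j p z b; decide
theorem twist_dd (j : T3) : twist j dd = dd := by revert j; decide
theorem twist_twist (j : T3) (x : X0) : twist j (twist (-j) x) = x := by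
  apply X0.ext <;> first | rfl | skip
  show x.z + -j * lam x.a x.b x.c x.e + j * lam x.a x.b x.c x.e = x.z
  ring

def ev (u v w : T3) : T3 → T3
  | .o => u
  | .i => v
  | .j => w
theorem ev_fun (ε : T3 → T3) (x : T3) : ε x = ev (ε 0) (ε 1) (ε (-1)) x := by cases x <;> rfl

abbrev cnd (u v w : T3) (p z b : T3) : Prop := (p = 0 ∧ z = 1 ∧ b = 0) ∨ (b ≠ 0 ∧
  ev u v w (b * z - p * p) = b)

def cnt (u v w : T3) : ℕ := (Finset.univ.filter (fun x : T3 × T3 × T3 => cnd u v w x.1 x.2.1 x.2.2)).card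
theorem cnt_val : ∀ u v w, cnt u v w = 1 ∧ u = 0 ∧ v = 0 ∧ w = 0 ∨ cnt u v w = 7 ∨ cnt u v w = 10 ∨
    ∃ j s : T3, s ≠ 0 ∧ ∀ p z b, cnd u v w p z b ↔ (p = 0 ∧ z = 1 ∧ b = 0) ∨ (b = s ∧ b * z - p * p = j) := by
  decide +kernel

def oo (j : T3) (k : Fin 4) : X0 := if k = 0 then el 0 1 0 else if k = 1 then el 0 (-j) (-1) else
  if k = 2 then el 1 (-j-1) (-1) else el (-1) (-j-1) (-1)
theorem oo_spec : ∀ j p z b : T3, (p = 0 ∧ z = 1 ∧ b = 0) ∨ (b = -1 ∧ b * z - p * p = j) →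
   ∃ k, el p z b = oo j k := by decide +kernel
theorem oo_spec' : ∀ j : T3, ∀ k k1 k2 k3 : Fin 4, k ≠ 0 → k1 ≠ k2 → k2 ≠ k3 → k1 ≠ k3 → k1 ≠ k → k2 ≠ k → k3 ≠ k →
  oo j k1 * oo j k2 * oo j k3 ≠ oo j k := by decide +kernel
theorem oo_prod : ∀ j : T3, oo j 1 * oo j 2 * oo j 3 = oo j 0 := by decide +kernel
theorem oo_inj : ∀ j : T3, ∀ k k' : Fin 4, oo j k = oo j k' → k = k' := by decide +kernel
theorem oo_mem : ∀ j : T3, ∀ k : Fin 4, ∃ p z b, oo j k = el p z b ∧ ((p = 0 ∧ z = 1 ∧ b = 0) ∨ (b = -1 ∧ b * z - p * p = j)) := by decide +kernel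
end X0
namespace Setup
variable {G : Type*} [Group G] [Finite G] (S : Setup G)
theorem order_kill {ℓ : ℕ} [hl : Fact ℓ.Prime] (h : ℓ ∣ Nat.card (NN S.E)) (hl2 : ℓ = 5 ∨ ℓ = 7) : False := by
  obtain ⟨⟨g, hg⟩, hgo⟩ := exists_prime_orderOf_dvd_card' ℓ h
  rw [Subgroup.orderOf_mk] at hgo
  have hgl : g ^ ℓ ^ 1 = 1 := by rw [pow_one, ← hgo]; exact pow_orderOf_eq_one g
  have h1 := card_fixed (mem_NN.1 hg) hgl
  have h2 : Nat.card (S.E ⊓ CC g : Subgroup G) ∣ 3 ^ 3 := by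
    have := Subgroup.card_dvd_of_le (inf_le_left : S.E ⊓ CC g ≤ S.E)
    rwa [S.cardE] at this
  rw [S.cardE] at h1
  obtain ⟨k, hk, hk2⟩ := (Nat.dvd_prime_pow Nat.prime_three).1 h2
  rw [hk2] at h1
  have hk3 : k = 3 := by
    interval_cases k <;> rcases hl2 with rfl | rfl <;> revert h1 <;> decide
  rw [hk3] at hk2
  have h4 : S.E ⊓ CC g = S.E := Subgroup.eq_of_le_of_card_ge inf_le_left (by rw [hk2, S.cardE]; norm_num)
  have h5 : g ∈ S.E := by
    apply S.cent_E
    intro a ha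
    rw [← h4] at ha
    exact (mem_CC.1 ha.2).symm
  have h6 := orderOf_dvd_of_pow_eq_one (S.E_cube h5)
  rw [hgo] at h6
  rcases hl2 with rfl | rfl <;> revert h6 <;> decide
theorem el_conj_Δ {p z b : T3} (hb : b ≠ 0) (Δ : Set G) (hΔ : ∀ x ∈ Δ, ∀ y : X0, y.c = 0 → S.α y * x * (S.α y)⁻¹ ∈ Δ) :
    S.α (el p z b) ∈ Δ ↔ S.α (el 0 (z - b * p * p) b) ∈ Δ := by
  have h := el_conj p z b hb
  constructor
  · intro h1
    have := hΔ _ h1 (mk0 0 (-p * b) 0)⁻¹ (by show -(0:T3) = 0; decide)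
    rw [← h, S.α_conj] at this
    simpa [mul_assoc] using this
  · intro h1
    have := hΔ _ h1 (mk0 0 (-p * b) 0) rfl
    rwa [S.α_conj, h] at this

/-- the shape of the second case -/
structure K4 (S : Setup G) : Prop where
  cls : ∀ n, Nz S.E n → n * S.D * n⁻¹ = S.D ∨ ∃ p, n * S.D * n⁻¹ = S.α (el p (p * p) 1)
  ex : ∃ n, Nz S.E n ∧ n * S.D * n⁻¹ = S.α d3

def twist (j : T3) : Setup G where
  α := S.α.comp (X0.twist j)
  inj := by
    intro x y h
    have := S.inj h
    rw [← twist_twist (-j) x, ← twist_twist (-j) y, neg_neg, this]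
  cent := by
    intro g hg
    rw [MonoidHom.comp_apply, twist_dd] at hg
    obtain ⟨x, rfl⟩ := S.cent g hg
    exact ⟨X0.twist (-j) x, congrArg S.α (twist_twist j x)⟩
  nonreal := by
    rw [MonoidHom.comp_apply, twist_dd]; exact S.nonreal
  sig := by
    intro Y hY h
    apply S.sig Y hY
    intro x hx
    have := h (X0.twist (-j) x) hx
    change Nz Y (S.α (X0.twist j (X0.twist (-j) x))) at this
    rwa [twist_twist] at this
theorem twist_E (j : T3) : (S.twist j).E = S.E := by
  ext g
  rw [mem_E, mem_E]
  constructor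
  · rintro ⟨x, hx, rfl⟩; exact ⟨X0.twist j x, hx, rfl⟩
  · rintro ⟨x, hx, rfl⟩
    exact ⟨X0.twist (-j) x, hx, congrArg S.α (twist_twist j x)⟩
theorem twist_D (j : T3) : (S.twist j).D = S.D := congrArg S.α (twist_dd j)
theorem dichotomy : (∀ n, Nz S.E n → n * S.D = S.D * n) ∨ ∃ S' : Setup G, S'.K4 ∧ S'.D = S.D := by
  classical
  by_cases hk : ∀ n, Nz S.E n → n * S.D = S.D * n
  · exact Or.inl hk
  right
  push Not at hk
  obtain ⟨n0, hn0, hn0D⟩ := hk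
  set Δ := cls (NN S.E) S.D with hΔ
  have hΔE : ∀ x ∈ Δ, x ∈ S.E := by
    rintro x ⟨n, hn, rfl⟩
    exact (mem_NN.1 hn).conj S.D_mem
  have hΔX : ∀ x ∈ Δ, ∀ y : X0, y.c = 0 → S.α y * x * (S.α y)⁻¹ ∈ Δ :=
    fun x hx y hy => cls_conj (mem_NN.2 (S.X_NE hy)) hx
  have hΔinv : ∀ x ∈ Δ, x⁻¹ ∉ Δ := by
    rintro x hx hx'
    have h1 := cls_trans hx' (show x⁻¹⁻¹ ∈ cls (NN S.E) x⁻¹ by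
      rw [inv_inv]
      obtain ⟨n, hn, h⟩ := cls_trans (cls_symm hx) hx'
      obtain ⟨n', hn', h'⟩ := hx
      refine ⟨n⁻¹, (NN S.E).inv_mem hn, ?_⟩
      rw [h]; simp [mul_assoc])
    obtain ⟨n, hn, h⟩ := cls_trans (cls_symm hx) hx'
    obtain ⟨m, hm, h'⟩ := hx
    apply S.nonreal' (m⁻¹ * n * m)
    calc m⁻¹ * n * m * S.D * (m⁻¹ * n * m)⁻¹ = m⁻¹ * (n * (m * S.D * m⁻¹) * n⁻¹) * m := by simp [mul_assoc]
      _ = m⁻¹ * x⁻¹ * m := by rw [← h', ← h]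
      _ = _ := by rw [h']; simp [mul_assoc]
  have hDΔ : S.D ∈ Δ := self_mem_cls _ _
  have hb0 : ∀ p z, S.α (el p z 0) ∈ Δ ↔ p = 0 ∧ z = 1 := by
    intro p z
    constructor
    · intro h
      by_cases hp : p = 0
      · subst hp
        refine ⟨rfl, ?_⟩
        have : ∀ z : T3, z = 1 ∨ z = -1 ∨ z = 0 := by decide
        rcases this z with rfl | rfl | rfl
        · rfl
        · exfalso
          refine hΔinv _ hDΔ ?_
          convert h using 1
          show (S.α (el 0 1 0))⁻¹ = _
          rw [← map_inv, el_inv]; rfl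
        · exfalso
          obtain ⟨n, -, h⟩ := h
          rw [show el 0 0 0 = 1 from rfl, map_one, eq_comm, conj_eq_one_iff] at h
          exact absurd (S.inj (h.trans (map_one S.α).symm)) (by decide)
      · exfalso
        obtain ⟨n, -, h⟩ := h
        apply (S.ND_A (z := z) hp n⁻¹).1
        rw [h]; simp [mul_assoc]
    · rintro ⟨rfl, rfl⟩; exact hDΔ
  set ε : T3 → T3 := fun x => if S.α (el 0 x 1) ∈ Δ then 1 else if S.α (el 0 (-x) (-1)) ∈ Δ then -1 else 0 with hε
  have hcond : ∀ p z b, S.α (el p z b) ∈ Δ ↔ cnd (ε 0) (ε 1) (ε (-1)) p z b := by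
    intro p z b
    rw [cnd, ← ev_fun]
    by_cases hb : b = 0
    · subst hb
      rw [hb0]; simp
    · rw [S.el_conj_Δ hb Δ hΔX]
      have h3 : ∀ b : T3, b = 0 ∨ b = 1 ∨ b = -1 := by decide
      have hinv : ∀ x, S.α (el 0 x 1) ∈ Δ → S.α (el 0 (-x) (-1)) ∉ Δ := by
        intro x hx
        have := hΔinv _ hx
        rwa [← map_inv, el_inv, neg_zero] at this
      have hne : (1 : T3) ≠ -1 := by decide
      have hne0 : (0 : T3) ≠ 1 := by decide
      have hne1 : (0 : T3) ≠ -1 := by decide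
      rcases h3 b with rfl | rfl | rfl
      · exact absurd rfl hb
      · simp only [hε, one_mul]
        by_cases h4 : S.α (el 0 (z - p * p) 1) ∈ Δ
        · simp [h4, hb]
        · by_cases h5 : S.α (el 0 (-(z - p * p)) (-1)) ∈ Δ
          · rw [if_neg h4, if_pos h5]
            simp [h4, hne.symm, hb]
          · rw [if_neg h4, if_neg h5]; simp [h4, hne0]
      · have e : z - -1 * p * p = - (-1 * z - p * p) := by ring
        simp only [hε, e]
        generalize -1 * z - p * p = x
        by_cases h4 : S.α (el 0 x 1) ∈ Δ
        · simp [h4, hinv x h4, hne]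
        · by_cases h5 : S.α (el 0 (-x) (-1)) ∈ Δ
          · rw [if_neg h4, if_pos h5]
            simp [h5, hne.symm, hb]
          · rw [if_neg h4, if_neg h5]; simp [h5, hne1]
  have hcard : Δ.ncard = cnt (ε 0) (ε 1) (ε (-1)) := by
    rw [cnt, ← Set.ncard_coe_finset]
    symm
    apply Set.ncard_congr (fun v _ => S.α (el v.1 v.2.1 v.2.2))
    · rintro ⟨p, z, b⟩ h
      rw [Finset.mem_coe, Finset.mem_filter] at h
      exact (hcond _ _ _).2 h.2
    · rintro ⟨p, z, b⟩ ⟨p', z', b'⟩ _ _ h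
      obtain ⟨h1, h2, h3⟩ := el_inj (S.inj h)
      simp only [] at h1 h2 h3
      rw [h1, h2, h3]
    · intro x hx
      obtain ⟨y, hy, rfl⟩ := S.mem_E.1 (hΔE x hx)
      rw [mem_E0_el hy] at hx ⊢
      refine ⟨(y.p, y.z, y.b), ?_, rfl⟩
      rw [Finset.mem_coe, Finset.mem_filter]
      exact ⟨Finset.mem_univ _, (hcond _ _ _).1 hx⟩
  have hdvd : Δ.ncard ∣ Nat.card (NN S.E) := ⟨_, (card_cls (NN S.E) S.D).symm⟩
  have hΔel : ∀ x ∈ Δ, ∃ p z b, x = S.α (el p z b) ∧ cnd (ε 0) (ε 1) (ε (-1)) p z b := by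
    intro x hx
    obtain ⟨y, hy, rfl⟩ := S.mem_E.1 (hΔE x hx)
    rw [mem_E0_el hy] at hx ⊢
    exact ⟨_, _, _, rfl, (hcond _ _ _).1 hx⟩
  have hn0Δ : n0 * S.D * n0⁻¹ ∈ Δ := ⟨n0, hn0, rfl⟩
  have hn0ne : n0 * S.D * n0⁻¹ ≠ S.D := by rwa [Ne, mul_inv_eq_iff_eq_mul]
  rcases cnt_val (ε 0) (ε 1) (ε (-1)) with ⟨h, -⟩ | h | h | ⟨j, s, hs, h⟩
  · exfalso
    rw [h, Set.ncard_eq_one] at hcard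
    obtain ⟨a, ha⟩ := hcard
    rw [ha] at hn0Δ hDΔ
    exact hn0ne (hn0Δ.trans hDΔ.symm)
  · exfalso
    rw [hcard, h] at hdvd
    have : Fact (Nat.Prime 7) := ⟨by norm_num⟩
    exact S.order_kill hdvd (Or.inr rfl)
  · exfalso
    rw [hcard, h] at hdvd
    have : Fact (Nat.Prime 5) := ⟨by norm_num⟩
    exact S.order_kill ((by norm_num : 5 ∣ 10).trans hdvd) (Or.inl rfl)
  · simp only [h] at hcond hΔel
    have : ∀ s : T3, s ≠ 0 → s = 1 ∨ s = -1 := by decide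
    rcases this s hs with rfl | rfl
    · refine ⟨S.twist j, ⟨?_, ?_⟩, ?_⟩
      · intro n hn
        rw [S.twist_E] at hn
        have hD := S.twist_D j
        rw [hD]
        obtain ⟨p, z, b, h1, h2⟩ := hΔel (n * S.D * n⁻¹) ⟨n, hn, rfl⟩
        rcases h2 with ⟨rfl, rfl, rfl⟩ | ⟨rfl, h3⟩
        · left; exact h1
        · right
          refine ⟨p, h1.trans ?_⟩
          show _ = S.α (X0.twist j _)
          rw [twist_el]
          congr 2
          rw [← h3]; ring
      · have h1 : S.α (el 0 j 1) ∈ Δ := (hcond _ _ _).2 (Or.inr ⟨rfl, by ring⟩)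
        obtain ⟨n, hn, h2⟩ := h1
        refine ⟨n, by rw [S.twist_E]; exact hn, ?_⟩
        rw [S.twist_D, ← h2]
        show _ = S.α (X0.twist j (el 0 0 1))
        rw [twist_el]; simp
      · exact S.twist_D j
    · exfalso
      have hoo : ∀ x ∈ Δ, ∃ k, x = S.α (oo j k) := by
        intro x hx
        obtain ⟨p, z, b, rfl, h2⟩ := hΔel x hx
        obtain ⟨k, hk⟩ := oo_spec j p z b h2
        exact ⟨k, by rw [hk]⟩
      have hoo' : ∀ k, S.α (oo j k) ∈ Δ := by
        intro k
        obtain ⟨p, z, b, h1, h2⟩ := oo_mem j k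
        rw [h1]; exact (hcond _ _ _).2 h2
      have hc : ∀ k, ∃ k', n0 * S.α (oo j k) * n0⁻¹ = S.α (oo j k') :=
        fun k => hoo _ (cls_conj hn0 (hoo' k))
      choose f hf using hc
      have hfi : ∀ k k', f k = f k' → k = k' := by
        intro k k' h
        have := (hf k).trans ((congrArg (fun k => S.α (oo j k)) h).trans (hf k').symm)
        exact oo_inj j k k' (S.inj (mul_left_cancel (mul_right_cancel this)))
      refine oo_spec' j (f 0) (f 1) (f 2) (f 3) ?_ (fun h => absurd (hfi _ _ h) (by decide))
        (fun h => absurd (hfi _ _ h) (by decide)) (fun h => absurd (hfi _ _ h) (by decide))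
        (fun h => absurd (hfi _ _ h) (by decide)) (fun h => absurd (hfi _ _ h) (by decide))
        (fun h => absurd (hfi _ _ h) (by decide)) ?_
      · intro h0
        have := hf 0
        rw [h0] at this
        exact hn0ne this
      · apply S.inj
        rw [map_mul, map_mul, ← hf, ← hf, ← hf, ← hf, ← oo_prod j, map_mul, map_mul]
        simp [mul_assoc]
end Setup
namespace X0
abbrev t2 : X0 := yy⁻¹ * tt * yy
theorem S3_act : ∀ p q : T3, p ≠ q → ∃ x : X0, x.c = 0 ∧
    x * el 1 1 1 * x⁻¹ = el p (p * p) 1 ∧ x * el (-1) 1 1 * x⁻¹ = el q (q * q) 1 := by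
  have : ∀ p q : T3, p ≠ q → ∃ k : T3, ∃ s : Fin 2, (tt ^ (s : ℕ) * mk0 0 k 0).c = 0 ∧
    (tt ^ (s : ℕ) * mk0 0 k 0) * el 1 1 1 * (tt ^ (s : ℕ) * mk0 0 k 0)⁻¹ = el p (p * p) 1 ∧
    (tt ^ (s : ℕ) * mk0 0 k 0) * el (-1) 1 1 * (tt ^ (s : ℕ) * mk0 0 k 0)⁻¹ = el q (q * q) 1 := by decide +kernel
  intro p q h
  obtain ⟨k, s, h⟩ := this p q h
  exact ⟨_, h⟩
theorem t2_inv : ∀ p z b : T3, t2 * el p z b * t2⁻¹ = (el p z b)⁻¹ → ∃ k : T3, p = k ∧ z = -k ∧ b = 0 := by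
  decide +kernel
theorem dl_conj : ∀ p : T3, ∃ k : T3, mk0 0 k 0 * el 0 0 1 * (mk0 0 k 0)⁻¹ = el p (p * p) 1 := by decide +kernel
end X0
theorem conj_conj' {G : Type*} [Group G] (a b x : G) : (a * b) * x * (a * b)⁻¹ = a * (b * x * b⁻¹) * a⁻¹ := by
  simp [mul_assoc]
theorem conj_mul' {G : Type*} [Group G] (a x y : G) : a * (x * y) * a⁻¹ = (a * x * a⁻¹) * (a * y * a⁻¹) := by
  simp [mul_assoc]
theorem conj_inv' {G : Type*} [Group G] (a x : G) : a * x⁻¹ * a⁻¹ = (a * x * a⁻¹)⁻¹ := by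
  simp [mul_assoc]
theorem dihedral {G : Type*} [Group G] {r τ : G} (hr : r * r = 1) (ht : τ * τ = 1) :
    τ * ((r * τ) * (r * τ) * (r * τ)) * τ⁻¹ = ((r * τ) * (r * τ) * (r * τ))⁻¹ ∧
    r * ((r * τ) * (r * τ) * (r * τ)) * r⁻¹ = ((r * τ) * (r * τ) * (r * τ))⁻¹ := by
  have r' : r⁻¹ = r := inv_eq_of_mul_eq_one_left hr
  have t' : τ⁻¹ = τ := inv_eq_of_mul_eq_one_left ht
  have e : ∀ y : G, r * (r * y) = y := fun x => by rw [← mul_assoc, hr, one_mul]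
  simp [mul_inv_rev, r', t', mul_assoc, ht, e]
namespace Setup
variable {G : Type*} [Group G] [Finite G] (S : Setup G)
theorem el_split (p z b : T3) : ∃ i j k : ℕ, S.α (el p z b) =
    (S.α (el 1 0 0)) ^ i * (S.α (el 0 1 0)) ^ j * (S.α (el 0 0 1)) ^ k := by
  have h : ∀ p z b : T3, ∃ i j k : Fin 3, el p z b = (el 1 0 0) ^ (i:ℕ) * (el 0 1 0) ^ (j:ℕ) * (el 0 0 1) ^ (k:ℕ) := by
    decide +kernel
  obtain ⟨i, j, k, h⟩ := h p z b
  exact ⟨i, j, k, by rw [h]; simp⟩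
theorem el_add (p z b p' z' b' : T3) : S.α (el p z b) * S.α (el p' z' b') = S.α (el (p + p') (z + z') (b + b')) := by
  rw [← map_mul, el_mul]
theorem el_inv' (p z b : T3) : (S.α (el p z b))⁻¹ = S.α (el (-p) (-z) (-b)) := by
  rw [← map_inv, el_inv]

/-- `r` induces the transposition (3 4) -/
structure RD (S : Setup G) (r : G) : Prop where
  sq : r * r = 1
  comm : r * S.t = S.t * r
  act : ∀ p z b, r * S.α (el p z b) * r⁻¹ = S.α (el p b z)
variable {S}
theorem act_of {g : G} (h4 : g * S.α (el 0 1 0) * g⁻¹ = S.α (el 0 0 1)) (h1 : g * S.α (el 1 1 1) * g⁻¹ = S.α (el 1 1 1))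
    (h2 : g * S.α (el (-1) 1 1) * g⁻¹ = S.α (el (-1) 1 1)) (p z b : T3) :
    g * S.α (el p z b) * g⁻¹ = S.α (el p b z) := by
  have hb1 : g * S.α (el 1 0 0) * g⁻¹ = S.α (el 1 0 0) := by
    have e : S.α (el 1 0 0) = S.α (el (-1) 1 1) * (S.α (el 1 1 1))⁻¹ := by
      rw [S.el_inv', S.el_add]; rfl
    rw [e, conj_mul', conj_inv', h1, h2]
  have h3 : g * S.α (el 0 0 1) * g⁻¹ = S.α (el 0 1 0) := by
    have e : S.α (el 0 0 1) = (S.α (el 0 1 0))⁻¹ * S.α (el 1 1 1) * (S.α (el 1 0 0))⁻¹ := by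
      rw [S.el_inv', S.el_inv', S.el_add, S.el_add]; rfl
    rw [e, conj_mul', conj_mul', conj_inv', conj_inv', h4, hb1, h1, S.el_inv', S.el_inv', S.el_add, S.el_add]; rfl
  obtain ⟨i, j, k, h⟩ := S.el_split p z b
  have h' : S.α (el p b z) = (S.α (el 1 0 0)) ^ i * (S.α (el 0 1 0)) ^ k * (S.α (el 0 0 1)) ^ j := by
    have e1 : ∀ n : ℕ, ∀ v : T3 × T3 × T3, S.α (el v.1 v.2.1 v.2.2) ^ n = S.α (el (n • v.1) (n • v.2.1) (n • v.2.2)) := by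
      intro n v
      induction n with
      | zero => rw [pow_zero, ← map_one S.α]; simp only [zero_smul]; rfl
      | succ n ih => rw [pow_succ, ih, S.el_add]; simp only [succ_nsmul]
    have e2 := e1 i (1, 0, 0)
    have e3 := e1 j (0, 1, 0)
    have e4 := e1 k (0, 0, 1)
    have e5 := e1 k (0, 1, 0)
    have e6 := e1 j (0, 0, 1)
    simp only [] at e2 e3 e4 e5 e6
    rw [e2, e3, e4, S.el_add, S.el_add] at h
    rw [e2, e5, e6, S.el_add, S.el_add]
    have h7 := el_inj (S.inj h)
    simp at h7
    obtain ⟨h7, h8, h9⟩ := h7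
    simp [h7, h8, h9]
  rw [h, h', conj_mul', conj_mul', ← conj_pow, ← conj_pow, ← conj_pow, h4, hb1, h3, mul_assoc, mul_assoc]
  congr 1
  have c : Commute (S.α (el 0 0 1)) (S.α (el 0 1 0)) := S.α_comm.2 (by decide)
  exact (c.pow_pow j k).eq
theorem fix_E {g : G} (h : ∀ p z b, g * S.α (el p z b) * g⁻¹ = S.α (el p z b)) : g ∈ S.E := by
  apply S.cent_E
  intro a ha
  obtain ⟨x, hx, rfl⟩ := S.mem_E.1 ha
  rw [mem_E0_el hx, ← mul_inv_eq_iff_eq_mul]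
  exact h _ _ _
theorem K4.cls' (K : S.K4) {n : G} (hn : Nz S.E n) (p : T3) : n * S.α (el p (p * p) 1) * n⁻¹ = S.D ∨
    ∃ q, n * S.α (el p (p * p) 1) * n⁻¹ = S.α (el q (q * q) 1) := by
  obtain ⟨m, hm, h⟩ := K.ex
  obtain ⟨k, hk⟩ := dl_conj p
  have h1 := K.cls (n * (S.α (mk0 0 k 0) * m)) (hn.mul ((S.X_NE rfl).mul hm))
  rw [conj_conj', conj_conj', h, S.α_conj, hk] at h1
  exact h1
theorem nz_of_act {g : G} {f : T3 → T3 → T3 → T3 × T3 × T3}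
    (h : ∀ p z b, g * S.α (el p z b) * g⁻¹ = S.α (el (f p z b).1 (f p z b).2.1 (f p z b).2.2)) : Nz S.E g := by
  apply Nz.of_finite
  intro a ha
  obtain ⟨x, hx, rfl⟩ := S.mem_E.1 ha
  rw [mem_E0_el hx, h]
  exact S.α_E.2 (el_mem _ _ _)
theorem RD.nz {r : G} (hr : S.RD r) : Nz S.E r := nz_of_act (f := fun p z b => (p, b, z)) hr.act
theorem t_act (p z b : T3) : S.t * S.α (el p z b) * S.t⁻¹ = S.α (el (-p) z b) := by
  rw [t, S.α_conj, tt_el]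
theorem K4.exists_r (K : S.K4) : ∃ r, S.RD r := by
  obtain ⟨n, hn, hnD⟩ := K.ex
  have hd3 : ∀ q : T3, S.D = S.α (el q (q * q) 1) → False := by
    intro q h
    have : (0 : T3) = 1 := (el_inj (S.inj (h : S.α (el 0 1 0) = _))).2.2
    exact absurd this (by decide)
  have pre : ∀ p : T3, p ≠ 0 → ∃ q, n⁻¹ * S.α (el p (p * p) 1) * n = S.α (el q (q * q) 1) := by
    intro p hp
    rcases K.cls' hn.inv p with h | h
    · exfalso
      rw [inv_inv] at h
      have h2 : S.α (el p (p * p) 1) = S.α (el 0 0 1) := by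
        rw [← show n * S.D * n⁻¹ = S.α (el 0 0 1) from hnD, ← h]; simp [mul_assoc]
      exact hp (el_inj (S.inj h2)).1
    · rwa [inv_inv] at h
  obtain ⟨p, hp⟩ := pre 1 (by decide)
  obtain ⟨q, hq⟩ := pre (-1) (by decide)
  obtain ⟨s, hs, hs1, hs2⟩ := S3_act p q (by
    rintro rfl
    have h1 := hp.trans hq.symm
    have h2 := S.inj (mul_left_cancel (mul_right_cancel h1))
    exact absurd h2 (by decide))
  set g := n * S.α s with hg
  have g1 : g * S.α (el 1 1 1) * g⁻¹ = S.α (el 1 1 1) := by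
    rw [hg, conj_conj', S.α_conj, hs1, ← hp]
    have : (1 : T3) * 1 = 1 := rfl
    rw [this]; simp [mul_assoc]
  have g2 : g * S.α (el (-1) 1 1) * g⁻¹ = S.α (el (-1) 1 1) := by
    rw [hg, conj_conj', S.α_conj, hs2, ← hq]
    have : (-1 : T3) * -1 = 1 := rfl
    rw [this]; simp [mul_assoc]
  have g4 : g * S.α (el 0 1 0) * g⁻¹ = S.α (el 0 0 1) := by
    have : s * el 0 1 0 * s⁻¹ = dd := by rw [mul_inv_eq_iff_eq_mul]; exact centr_dd s
    rw [hg, conj_conj', S.α_conj, this]; exact hnD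
  have gact := act_of g4 g1 g2
  -- involution
  have inv3 : ∀ v : G, (∀ p z b, (v * v) * S.α (el p z b) * (v * v)⁻¹ = S.α (el p z b)) →
      (v * v * v) * (v * v * v) = 1 := by
    intro v hv
    have := S.E_cube (fix_E hv)
    rw [← this]; simp only [pow_succ, pow_zero, one_mul, mul_assoc]
  set v0 := g * g * g with hv0
  have v0sq : v0 * v0 = 1 := inv3 g (by intro p z b; rw [conj_conj', gact, gact])
  have v0act : ∀ p z b, v0 * S.α (el p z b) * v0⁻¹ = S.α (el p b z) := by
    intro p z b; rw [hv0, conj_conj', conj_conj', gact, gact, gact]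
  set u := S.t * v0 with hu
  have uact : ∀ p z b, u * S.α (el p z b) * u⁻¹ = S.α (el (-p) b z) := by
    intro p z b; rw [hu, conj_conj', v0act, t_act]
  set v := u * u * u with hv
  have vsq : v * v = 1 := inv3 u (by intro p z b; rw [conj_conj', uact, uact, neg_neg])
  have vact : ∀ p z b, v * S.α (el p z b) * v⁻¹ = S.α (el (-p) b z) := by
    intro p z b; rw [hv, conj_conj', conj_conj', uact, uact, uact, neg_neg]
  have htt := S.tt_sq
  have hvt : S.t * v * S.t = v := by
    have h1 : (S.t * v * S.t) * v = 1 := by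
      rw [hv, hu]
      have e : ∀ x : G, S.t * (S.t * x) = x := fun x => by rw [← mul_assoc, htt, one_mul]
      have e' : ∀ x : G, v0 * (v0 * x) = x := fun x => by rw [← mul_assoc, v0sq, one_mul]
      simp only [mul_assoc, e, e', v0sq]
    have h2 := vsq
    rw [← h1] at h2
    exact (mul_right_cancel h2).symm
  have hvt' : v * S.t = S.t * v := by
    calc v * S.t = (S.t * S.t) * v * S.t := by rw [htt, one_mul]
      _ = S.t * (S.t * v * S.t) := by simp [mul_assoc]
      _ = _ := by rw [hvt]
  refine ⟨S.t * v, ?_, ?_, ?_⟩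
  · calc S.t * v * (S.t * v) = S.t * v * S.t * v := by simp [mul_assoc]
      _ = 1 := by rw [hvt, vsq]
  · rw [mul_assoc, hvt']
  · intro p z b
    rw [conj_conj', vact, t_act, neg_neg]
theorem RD.inv {r : G} (hr : S.RD r) : r⁻¹ = r := inv_eq_of_mul_eq_one_left hr.sq
theorem RD.act' {r : G} (hr : S.RD r) (p z b : T3) : r * S.α (el p z b) = S.α (el p b z) * r := by
  rw [← mul_inv_eq_iff_eq_mul]; exact hr.act p z b
theorem RD.braid {r : G} (hr : S.RD r) : (r * S.α t2) ^ 3 = 1 := by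
  have t2a : ∀ p z b : T3, ∃ p' z' b', S.α t2 * S.α (el p z b) * (S.α t2)⁻¹ = S.α (el p' z' b') ∧
      t2 * el p z b * t2⁻¹ = el p' z' b' := by
    intro p z b
    exact ⟨_, _, _, by rw [S.α_conj, ← mem_E0_el (norm_E0' t2 (by decide) p z b)],
      mem_E0_el (norm_E0' t2 (by decide) p z b)⟩
  have key : ∀ p z b p1 z1 b1 p2 z2 b2 p3 z3 b3, t2 * el p z b * t2⁻¹ = el p1 z1 b1 →
      t2 * el p1 b1 z1 * t2⁻¹ = el p2 z2 b2 → t2 * el p2 b2 z2 * t2⁻¹ = el p3 z3 b3 →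
      el p3 b3 z3 = el p z b := by
    intro p z b p1 z1 b1 p2 z2 b2 p3 z3 b3 h1 h2 h3
    have fin : ∀ p z b : T3,
      (let x1 := t2 * el p z b * t2⁻¹
       let x2 := t2 * el x1.p x1.b x1.z * t2⁻¹
       let x3 := t2 * el x2.p x2.b x2.z * t2⁻¹
       el x3.p x3.b x3.z = el p z b) := by decide +kernel
    have := fin p z b
    simp only [h1] at this
    simp only [h2] at this
    simp only [h3] at this
    exact this
  have hE : (r * S.α t2) * (r * S.α t2) * (r * S.α t2) ∈ S.E := by
    apply fix_E
    intro p z b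
    obtain ⟨p1, z1, b1, h1, h1'⟩ := t2a p z b
    obtain ⟨p2, z2, b2, h2, h2'⟩ := t2a p1 b1 z1
    obtain ⟨p3, z3, b3, h3, h3'⟩ := t2a p2 b2 z2
    have st : ∀ {p z b p1 z1 b1}, S.α t2 * S.α (el p z b) * (S.α t2)⁻¹ = S.α (el p1 z1 b1) →
        (r * S.α t2) * S.α (el p z b) * (r * S.α t2)⁻¹ = S.α (el p1 b1 z1) := by
      intro p z b p1 z1 b1 h
      rw [conj_conj', h, hr.act]
    have k1 := st h1
    have k2 := st h2
    have k3 := st h3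
    generalize r * S.α t2 = g at k1 k2 k3
    rw [conj_conj', conj_conj', k1, k2, k3, key _ _ _ _ _ _ _ _ _ _ _ _ h1' h2' h3']
  rw [show (r * S.α t2) ^ 3 = (r * S.α t2) * (r * S.α t2) * (r * S.α t2) by
    simp only [pow_succ, pow_zero, one_mul]]
  obtain ⟨x, hx, hxe⟩ := S.mem_E.1 hE
  have t2sq : S.α t2 * S.α t2 = 1 := by rw [← map_mul, ← map_one S.α]; congr 1
  have t2i : (S.α t2)⁻¹ = S.α t2 := inv_eq_of_mul_eq_one_left t2sq
  have e1 : S.α t2 * S.α x * (S.α t2)⁻¹ = (S.α x)⁻¹ := by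
    rw [hxe]; exact (dihedral hr.sq t2sq).1
  have e2 : r * S.α x * r⁻¹ = (S.α x)⁻¹ := by
    rw [hxe]; exact (dihedral hr.sq t2sq).2
  rw [mem_E0_el hx] at e1 e2
  rw [← hxe, mem_E0_el hx]
  rw [S.α_conj, ← map_inv] at e1
  obtain ⟨k, h1, h2, h3⟩ := t2_inv _ _ _ (S.inj e1)
  rw [h1, h2, h3] at e2 ⊢
  rw [hr.act, S.el_inv'] at e2
  have := el_inj (S.inj e2)
  have aux : ∀ k : T3, k = -k → k = 0 := by decide
  rw [aux k this.1, ← map_one S.α]; rfl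
end Setup

section comb
open Finset
variable {ι : Type*} [Fintype ι] [DecidableEq ι]
theorem tern {f : ι → ℤ} (h : ∑ i, f i * f i = 3) (i : ι) : f i = 0 ∨ f i = 1 ∨ f i = -1 := by
  have : f i * f i ≤ 3 := by
    rw [← h]; exact single_le_sum (f := fun i => f i * f i) (fun i _ => mul_self_nonneg _) (mem_univ i)
  have h2 : f i ≤ 1 := by nlinarith
  have h3 : -1 ≤ f i := by nlinarith
  omega
theorem norm3 (f : ι → ℤ) (h : ∑ i, f i * f i = 3) : ∃ a b c : ι, a ≠ b ∧ a ≠ c ∧ b ≠ c ∧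
    (f a = 1 ∨ f a = -1) ∧ (f b = 1 ∨ f b = -1) ∧ (f c = 1 ∨ f c = -1) ∧
    (∀ x : ι → ℚ, ∑ i, f i * x i = f a * x a + f b * x b + f c * x c) ∧
    (∀ x : ι → ℤ, ∑ i, f i * x i = f a * x a + f b * x b + f c * x c) ∧
    (∀ i, f i ≠ 0 → i = a ∨ i = b ∨ i = c) := by
  have h1 := tern h
  have h2 : (univ.filter (fun i => f i ≠ 0)).card = 3 := by
    rw [card_filter]
    zify
    rw [← h]
    apply sum_congr rfl
    intro i _
    rcases h1 i with h | h | h <;> simp [h]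
  obtain ⟨a, b, c, hab, hac, hbc, hs⟩ := card_eq_three.1 h2
  have hm : ∀ i, f i ≠ 0 ↔ i = a ∨ i = b ∨ i = c := by
    intro i
    have : i ∈ univ.filter (fun i => f i ≠ 0) ↔ i ∈ ({a, b, c} : Finset ι) := by rw [hs]
    simpa using this
  have pm : ∀ i, f i ≠ 0 → (f i = 1 ∨ f i = -1) := fun i hi => (h1 i).resolve_left hi
  refine ⟨a, b, c, hab, hac, hbc, pm _ ((hm _).2 (by simp)), pm _ ((hm _).2 (by simp)), pm _ ((hm _).2 (by simp)),
    ?_, ?_, fun i => (hm i).1⟩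
  all_goals
    intro x
    rw [← sum_subset (subset_univ ({a, b, c} : Finset ι)), sum_insert, sum_insert, sum_singleton]
    · ring
    · simpa using hbc
    · simp [hab, hac]
    · intro i _ hi
      have : f i = 0 := by
        by_contra hne
        exact hi (by simpa using (hm i).1 hne)
      simp [this]

/-- arrangement of the three support elements according to sign -/
theorem norm3' (f n : ι → ℤ) (hn : ∀ i, 0 < n i) (h : ∑ i, f i * f i = 3) (h0 : ∑ i, f i * n i = 0) :
    ∃ (a b c : ι) (η : ℤ), a ≠ b ∧ a ≠ c ∧ b ≠ c ∧ (η = 1 ∨ η = -1) ∧ f a = η ∧ f b = -η ∧ f c = -η ∧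
    (∀ x : ι → ℚ, ∑ i, f i * x i = η * (x a - x b - x c)) ∧
    (∀ x : ι → ℤ, ∑ i, f i * x i = η * (x a - x b - x c)) ∧
    (∀ i, f i ≠ 0 → i = a ∨ i = b ∨ i = c) := by
  obtain ⟨a, b, c, hab, hac, hbc, ha, hb, hc, s1, s2, s3⟩ := norm3 f h
  have na := hn a
  have nb := hn b
  have nc := hn c
  rw [s2] at h0
  rcases ha with ha | ha <;> rcases hb with hb | hb <;> rcases hc with hc | hc <;> rw [ha, hb, hc] at h0 <;>
    simp only [ha, hb, hc] at s1 s2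
  any_goals omega
  on_goal 6 => refine ⟨c, a, b, 1, hac.symm, hbc.symm, hab, by simp, hc, by simp [ha], by simp [hb], ?_, ?_, ?_⟩
  on_goal 5 => refine ⟨b, a, c, 1, hab.symm, hbc, hac, by simp, hb, by simp [ha], by simp [hc], ?_, ?_, ?_⟩
  on_goal 4 => refine ⟨a, b, c, -1, hab, hac, hbc, by simp, ha, by simp [hb], by simp [hc], ?_, ?_, ?_⟩
  on_goal 3 => refine ⟨a, b, c, 1, hab, hac, hbc, by simp, ha, by simp [hb], by simp [hc], ?_, ?_, ?_⟩
  on_goal 2 => refine ⟨b, a, c, -1, hab.symm, hbc, hac, by simp, hb, by simp [ha], by simp [hc], ?_, ?_, ?_⟩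
  on_goal 1 => refine ⟨c, a, b, -1, hac.symm, hbc.symm, hab, by simp, hc, by simp [ha], by simp [hb], ?_, ?_, ?_⟩
  all_goals first
    | (intro x; rw [s1]; push_cast; ring)
    | (intro x; rw [s2]; ring)
    | (intro i hi; have := s3 i hi; tauto)

theorem ratio {n1 n2 : ℤ} (h1 : 0 < n1) (h2 : 0 < n2) {s1 s2 : ℤ}
    (h : ((s1 + s2 : ℤ) : ℚ) ^ 2 / ((n1 + n2 : ℤ) : ℚ) = (s1 : ℚ) ^ 2 / n1 + (s2 : ℚ) ^ 2 / n2) :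
    s1 * n2 = s2 * n1 := by
  have p1 : (0 : ℚ) < n1 := by exact_mod_cast h1
  have p2 : (0 : ℚ) < n2 := by exact_mod_cast h2
  have p3 : (0 : ℚ) < n1 + n2 := by positivity
  push_cast at h
  field_simp at h
  have : ((s1 : ℚ) * n2 - s2 * n1) ^ 2 = 0 := by linarith
  have := pow_eq_zero_iff (two_ne_zero) |>.1 this
  have : (s1 : ℚ) * n2 = s2 * n1 := by linarith
  exact_mod_cast this

/-- local analysis at the support of f2 -/
theorem loc {η pa pb pc ga gb gc nb nc : ℤ} (hη : η = 1 ∨ η = -1) (hpa : pa = 0 ∨ pa = 1 ∨ pa = -1)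
    (hpb : pb = 0 ∨ pb = 1 ∨ pb = -1) (hpc : pc = 0 ∨ pc = 1 ∨ pc = -1) (hp : η * (pa - pb - pc) = 1)
    (hg : η * (ga - gb - gc) = -3) (hg2 : ga * ga + gb * gb + gc * gc ≤ 8)
    (nb0 : 0 < nb) (nc0 : 0 < nc) (hv : (gb + 3 * pb) * nc = (gc + 3 * pc) * nb)
    (hno : ¬ (pa = pb ∧ pa = pc)) :
    pa = η ∧ pb = 0 ∧ pc = 0 ∧ 0 < η * gb ∧ 0 < η * gc ∧
      ((ga = 0 ∧ ga * ga + gb * gb + gc * gc = 5) ∨ (ga = -η ∧ gb = η ∧ gc = η)) := by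
  have b1 : gb ≤ 2 := by nlinarith [mul_self_nonneg ga, mul_self_nonneg gc]
  have b2 : -2 ≤ gb := by nlinarith [mul_self_nonneg ga, mul_self_nonneg gc]
  have c1 : gc ≤ 2 := by nlinarith [mul_self_nonneg ga, mul_self_nonneg gb]
  have c2 : -2 ≤ gc := by nlinarith [mul_self_nonneg ga, mul_self_nonneg gb]
  have e : ga = gb + gc - 3 * η := by rcases hη with rfl | rfl <;> omega
  have e' : pa = pb + pc + η := by rcases hη with rfl | rfl <;> omega
  subst e
  subst e'
  rcases hη with rfl | rfl <;> rcases hpb with rfl | rfl | rfl <;> rcases hpc with rfl | rfl | rfl <;>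
    interval_cases gb <;> interval_cases gc <;> omega

structure HalfData (n f1 fs f2 : ι → ℤ) (i0 : ι) : Prop where
  f11 : ∑ i, f1 i * f1 i = 3
  fss : ∑ i, fs i * fs i = 3
  f22 : ∑ i, f2 i * f2 i = 3
  f1s : ∑ i, f1 i * fs i = 0
  f12 : ∑ i, f1 i * f2 i = 0
  fs2 : ∑ i, fs i * f2 i = 0
  n1 : ∑ i, f1 i * n i = 0
  ns : ∑ i, fs i * n i = 0
  n2 : ∑ i, f2 i * n i = 0
  t1 : f1 i0 = 1
  ts : fs i0 = 0
  t2 : f2 i0 = 0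

structure MutData (n f1 fs f2 p1 ps p2 : ι → ℤ) : Prop where
  m1 : ∑ i, f1 i * p2 i = -1
  ms : ∑ i, fs i * p2 i = -1
  m2 : ∑ i, f2 i * p2 i = 1
  z2 : ∑ i, (f2 i : ℚ) * (((f1 i + fs i - f2 i + 3 * p2 i : ℤ) : ℚ) ^ 2 / n i) = 0
  z1 : ∑ i, ((f1 i : ℚ) + fs i) * (((f1 i + fs i - f2 i + 3 * p2 i : ℤ) : ℚ) ^ 2 / n i) = 0

section
variable {n f1 fs f2 p1 ps p2 : ι → ℤ} {i0 : ι}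
theorem HalfData.g_sq (F : HalfData n f1 fs f2 i0) :
    ∑ i, (f1 i + fs i - f2 i) * (f1 i + fs i - f2 i) = 9 := by
  have : ∀ i, (f1 i + fs i - f2 i) * (f1 i + fs i - f2 i) = f1 i * f1 i + fs i * fs i + f2 i * f2 i
    + 2 * (f1 i * fs i) - 2 * (f1 i * f2 i) - 2 * (fs i * f2 i) := fun i => by ring
  simp only [this, sum_add_distrib, sum_sub_distrib, ← mul_sum, F.f11, F.fss, F.f22, F.f1s, F.f12, F.fs2]
  norm_num
theorem HalfData.g_f2 (F : HalfData n f1 fs f2 i0) :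
    ∑ i, f2 i * (f1 i + fs i - f2 i) = -3 := by
  have : ∀ i, f2 i * (f1 i + fs i - f2 i) = f1 i * f2 i + fs i * f2 i - f2 i * f2 i := fun i => by ring
  simp only [this, sum_add_distrib, sum_sub_distrib, ← mul_sum, F.f11, F.fss, F.f22, F.f1s, F.f12, F.fs2]
  norm_num
theorem part_le (g : ι → ℤ) {N : ℤ} (h : ∑ i, g i * g i = N) (s : Finset ι) : ∑ i ∈ s, g i * g i ≤ N := by
  rw [← h]
  exact sum_le_sum_of_subset_of_nonneg (subset_univ s) (fun i _ _ => mul_self_nonneg _)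
theorem half1 (hn : ∀ i, 0 < n i) (F : HalfData n f1 fs f2 i0) (M : MutData n f1 fs f2 p1 ps p2)
    (hp : ∑ i, p2 i * p2 i = 3) (hpn : ∑ i, p2 i * n i = 0) : ∃ (a b c : ι) (η : ℤ),
    a ≠ b ∧ a ≠ c ∧ b ≠ c ∧ (η = 1 ∨ η = -1) ∧ f2 a = η ∧ f2 b = -η ∧ f2 c = -η ∧ n a = n b + n c ∧
    (∀ i, f2 i ≠ 0 → i = a ∨ i = b ∨ i = c) ∧
    p2 a = η ∧ p2 b = 0 ∧ p2 c = 0 ∧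
    ((f1 a + fs a - f2 a = 0 ∧ (f1 b + fs b - f2 b) * (f1 b + fs b - f2 b) +
        (f1 c + fs c - f2 c) * (f1 c + fs c - f2 c) = 5) ∨
      (f1 a + fs a - f2 a = -η ∧ f1 b + fs b - f2 b = η ∧ f1 c + fs c - f2 c = η ∧ n b = n c)) := by
  obtain ⟨a, b, c, η, hab, hac, hbc, hη, fa, fb, fc, s1, s2, s3⟩ := norm3' f2 n hn F.f22 F.n2
  have h1 := F.n2
  rw [s2] at h1
  have hna : n a = n b + n c := by rcases hη with rfl | rfl <;> omega
  have h2 := M.m2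
  rw [s2] at h2
  have h3 := F.g_f2
  rw [s2] at h3
  have h4 := M.z2
  rw [s1] at h4
  set g : ι → ℤ := fun i => f1 i + fs i - f2 i with hg
  have hgi : ∀ i, f1 i + fs i - f2 i = g i := fun i => rfl
  simp only [hgi] at *
  have hv : g a + 3 * p2 a = (g b + 3 * p2 b) + (g c + 3 * p2 c) := by
    rcases hη with rfl | rfl <;> omega
  have hr : (g b + 3 * p2 b) * n c = (g c + 3 * p2 c) * n b := by
    apply ratio (hn b) (hn c)
    rw [← hv, ← hna]
    rcases hη with rfl | rfl
    · push_cast at h4 ⊢; linarith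
    · push_cast at h4 ⊢; linarith
  have i0a : i0 ≠ a := by rintro rfl; rw [F.t2] at fa; omega
  have i0b : i0 ≠ b := by rintro rfl; rw [F.t2] at fb; omega
  have i0c : i0 ≠ c := by rintro rfl; rw [F.t2] at fc; omega
  have h5 := part_le g F.g_sq {i0, a, b, c}
  rw [sum_insert (by simp [i0a, i0b, i0c]), sum_insert (by simp [hab, hac]), sum_insert (by simp [hbc]),
    sum_singleton] at h5
  have hg0 : g i0 = 1 := by have := F.t1; have := F.ts; have := F.t2; simp only [g]; omega
  rw [hg0] at h5
  have hno : ¬ (p2 a = p2 b ∧ p2 a = p2 c) := by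
    rintro ⟨e1, e2⟩
    have ea : p2 a ≠ 0 := by
      intro h; rw [← e1, ← e2, h] at h2; simp at h2
    obtain ⟨a', b', c', _, _, _, ha', hb', hc', q1, q2, q3⟩ := norm3 p2 hp
    rw [q2] at hpn
    have na := hn a'
    have nb := hn b'
    have nc := hn c'
    have : p2 a' = p2 a ∧ p2 b' = p2 a ∧ p2 c' = p2 a := by
      have A := q3 a ea
      have B := q3 b (e1 ▸ ea)
      have C := q3 c (e2 ▸ ea)
      clear h4 h5 hr hv hg hgi hg0 M F s1 s2 s3 q1 q2 q3
      grind
    rw [this.1, this.2.1, this.2.2] at hpn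
    have : p2 a * (n a' + n b' + n c') = 0 := by linarith
    rcases mul_eq_zero.1 this with h | h
    · exact ea h
    · omega
  obtain ⟨k1, k2, k3, k4, k5, k6⟩ := loc hη (tern hp a) (tern hp b) (tern hp c) h2 h3 (by linarith) (hn b) (hn c) hr hno
  refine ⟨a, b, c, η, hab, hac, hbc, hη, fa, fb, fc, hna, s3, k1, k2, k3, ?_⟩
  rcases k6 with ⟨k6, k7⟩ | ⟨k6, k7, k8⟩
  · left; refine ⟨k6, ?_⟩; rw [k6] at k7; linarith
  · right; refine ⟨k6, k7, k8, ?_⟩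
    rw [k7, k8, k2, k3] at hr
    rcases hη with rfl | rfl <;> omega
theorem orth0 {x y : ι → ℤ} (h : ∀ i, x i * y i ≤ 0) (h0 : ∑ i, x i * y i = 0) (i : ι) : x i * y i = 0 :=
  (sum_eq_zero_iff_of_nonpos (fun i _ => h i)).1 h0 i (mem_univ i)

/-- support of `f1`: the trivial character, one linear-like `j`, one in the support of `p2` -/
theorem half2 {a e f : ι} {η p : ℤ} (x : ι → ℤ) (hx : ∑ i, x i * x i = 3) (hη : η = 1 ∨ η = -1)
    (hxv : ∑ i, x i * (f1 i + fs i - f2 i + 3 * p2 i) = 0)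
    (hxs : ∀ i, x i ≠ 0 → f2 i = 0 ∧ x i = f1 i + fs i - f2 i)
    (hp : ∀ i, p2 i ≠ 0 → f2 i = 0 → p2 i = -η ∧ f1 i + fs i - f2 i = η ∧ n i = p)
    (j0 : ι) (hj0 : x j0 ≠ 0) (hj0' : p2 j0 = 0) : ∃ j l, x j ≠ 0 ∧ p2 j = 0 ∧ x l = η ∧ p2 l = -η ∧ n l = p ∧
      j ≠ j0 ∧ (∀ y : ι → ℤ, ∑ i, x i * y i = x j0 * y j0 + x j * y j + η * y l) ∧
      (∀ y : ι → ℚ, ∑ i, x i * y i = x j0 * y j0 + x j * y j + η * y l) := by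
  obtain ⟨u, v, w, huv, huw, hvw, xu, xv, xw, s1, s2, s3⟩ := norm3 x hx
  have val : ∀ i, x i ≠ 0 → x i * (f1 i + fs i - f2 i + 3 * p2 i) = if p2 i = 0 then 1 else -2 := by
    intro i hi
    obtain ⟨h1, h2⟩ := hxs i hi
    rw [← h2]
    split_ifs with h
    · rw [h]
      rcases tern hx i with h | h | h
      · exact absurd h hi
      · rw [h]; rfl
      · rw [h]; rfl
    · obtain ⟨k1, k2, _⟩ := hp i h h1
      rw [h2, k1, k2]
      rcases hη with rfl | rfl <;> rfl
  have nu : x u ≠ 0 := by omega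
  have nv : x v ≠ 0 := by omega
  have nw : x w ≠ 0 := by omega
  suffices ∃ j l, j ≠ j0 ∧ x j ≠ 0 ∧ x l ≠ 0 ∧ p2 j = 0 ∧ p2 l ≠ 0 ∧
      (∀ y : ι → ℤ, ∑ i, x i * y i = x j0 * y j0 + x j * y j + x l * y l) ∧
      (∀ y : ι → ℚ, ∑ i, x i * y i = x j0 * y j0 + x j * y j + x l * y l) by
    obtain ⟨j, l, h1, h2, h3, h4, h5, h6, h7⟩ := this
    obtain ⟨h8, h9⟩ := hxs l h3
    obtain ⟨k1, k2, k3⟩ := hp l h5 h8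
    have : x l = η := by rw [h9, k2]
    rw [this] at h6 h7
    exact ⟨j, l, h2, h4, this, k1, k3, h1, h6, h7⟩
  suffices ∃ j l, j ≠ j0 ∧ l ≠ j0 ∧ x j ≠ 0 ∧ x l ≠ 0 ∧
      (∀ y : ι → ℤ, ∑ i, x i * y i = x j0 * y j0 + x j * y j + x l * y l) ∧
      (∀ y : ι → ℚ, ∑ i, x i * y i = x j0 * y j0 + x j * y j + x l * y l) by
    obtain ⟨j, l, h1, h1', h2, h3, h6, h7⟩ := this
    rw [h6, val _ hj0, val _ h2, val _ h3, if_pos hj0'] at hxv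
    by_cases hj : p2 j = 0
    · by_cases hl : p2 l = 0
      · rw [if_pos hj, if_pos hl] at hxv; omega
      · exact ⟨j, l, h1, h2, h3, hj, hl, h6, h7⟩
    · by_cases hl : p2 l = 0
      · exact ⟨l, j, h1', h3, h2, hl, hj, fun y => by rw [h6]; ring, fun y => by rw [h7]; ring⟩
      · rw [if_neg hj, if_neg hl] at hxv; omega
  rcases s3 j0 hj0 with rfl | rfl | rfl
  · exact ⟨v, w, huv.symm, huw.symm, nv, nw, s2, s1⟩
  · exact ⟨u, w, huv, hvw.symm, nu, nw, fun y => by rw [s2]; ring, fun y => by rw [s1]; ring⟩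
  · exact ⟨u, v, huw, hvw, nu, nv, fun y => by rw [s2]; ring, fun y => by rw [s1]; ring⟩
theorem sqb {x : ℤ} (h : x * x ≤ 3) : x ≤ 1 ∧ -1 ≤ x := by constructor <;> nlinarith
theorem solveP {η p : ℤ} {nj nj' gj gj' : ℤ} (hη : η = 1 ∨ η = -1) (hp : 0 < p) (h1 : 0 < nj) (h1' : 0 < nj')
    (hg : gj = 1 ∨ gj = -1) (hg' : gj' = 1 ∨ gj' = -1)
    (e1 : 1 + gj * nj + η * p = 0) (e2 : 1 + gj' * nj' + η * p = 0)
    (e3 : (1 : ℚ) + gj * (1 / nj) + η * (4 / p) + (gj' * (1 / nj') + 1 + η * (4 / p)) = 0) :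
    nj = 1 ∧ nj' = 1 ∧ gj = 1 ∧ gj' = 1 := by
  have P : (0 : ℚ) < p := by exact_mod_cast hp
  have Q : (0 : ℚ) < nj := by exact_mod_cast h1
  have Q' : (0 : ℚ) < nj' := by exact_mod_cast h1'
  rcases hη with rfl | rfl <;> rcases hg with rfl | rfl <;> rcases hg' with rfl | rfl <;> try omega
  · exfalso
    obtain rfl : nj = 1 + p := by omega
    obtain rfl : nj' = 1 + p := by omega
    push_cast at e3 Q
    field_simp at e3
    nlinarith
  · obtain ⟨p, rfl⟩ : ∃ q, p = q + 1 := ⟨p - 1, by ring⟩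
    obtain rfl : nj = p := by omega
    obtain rfl : nj = nj' := by omega
    push_cast at e3 P
    field_simp at e3
    have : ((nj : ℚ) - 1) ^ 2 = 0 := by nlinarith
    have := pow_eq_zero_iff (two_ne_zero) |>.1 this
    have : (nj : ℚ) = 1 := by linarith
    have : nj = 1 := by exact_mod_cast this
    simp [this]

set_option maxHeartbeats 1000000 in
theorem char_comb (hn : ∀ i, 0 < n i) (hn0 : n i0 = 1) (F : HalfData n f1 fs f2 i0) (Pd : HalfData n p1 ps p2 i0)
    (M : MutData n f1 fs f2 p1 ps p2) (M' : MutData n p1 ps p2 f1 fs f2)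
    (hg : ∀ i, f1 i + fs i - f2 i = p1 i + ps i - p2 i) (h11 : ∑ i, f1 i * p1 i = 1) :
    ∃ j j', (n j = 1 ∧ f1 j = 1 ∧ fs j = 0 ∧ f2 j = 0 ∧ p1 j = 0 ∧ ps j = 1 ∧ p2 j = 0) ∧
      (n j' = 1 ∧ f1 j' = 0 ∧ fs j' = 1 ∧ f2 j' = 0 ∧ p1 j' = 1 ∧ ps j' = 0 ∧ p2 j' = 0) := by
  obtain ⟨a, b, c, η, hab, hac, hbc, hη, fa, fb, fc, hna, s3, pa, pb, pc, alt⟩ := half1 hn F M Pd.f22 Pd.n2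
  obtain ⟨a', e, f, η', hae, haf, hef, hη', pa', pe, pf, hna', s3', fa', fe, ff, alt'⟩ := half1 hn Pd M' F.f22 F.n2
  obtain rfl : a = a' := by
    rcases s3' a (by omega) with h | rfl | rfl
    · exact h
    · omega
    · omega
  obtain rfl : η = η' := by omega
  have hbe : b ≠ e := by rintro rfl; omega
  have hbf : b ≠ f := by rintro rfl; omega
  have hce : c ≠ e := by rintro rfl; omega
  have hcf : c ≠ f := by rintro rfl; omega
  have hsq := part_le _ F.g_sq
  rcases alt with ⟨k1, k2⟩ | ⟨ga, gb, gc, hnbc⟩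
  · exfalso
    rcases alt' with ⟨k3, k4⟩ | ⟨k3, _, _, _⟩
    · have := hsq {b, c, e, f}
      rw [sum_insert (by simp [hbc, hbe, hbf]), sum_insert (by simp [hce, hcf]), sum_insert (by simp [hef]),
        sum_singleton, hg e, hg f] at this
      linarith
    · rw [← hg, k1] at k3; omega
  rcases alt' with ⟨k3, _⟩ | ⟨_, ge, gf, hnef⟩
  · exfalso; rw [← hg, ga] at k3; omega
  have hne : n e = n b := by omega
  have t1 := F.t1
  have ts := F.ts
  have t2 := F.t2
  have t1' := Pd.t1
  have ts' := Pd.ts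
  have t2' := Pd.t2
  have i0a : i0 ≠ a := by rintro rfl; omega
  have i0b : i0 ≠ b := by rintro rfl; omega
  have i0c : i0 ≠ c := by rintro rfl; omega
  have i0e : i0 ≠ e := by rintro rfl; omega
  have i0f : i0 ≠ f := by rintro rfl; omega
  have gbd : ∀ i, f2 i = 0 → p2 i = 0 → (f1 i + fs i - f2 i ≤ 1 ∧ -1 ≤ f1 i + fs i - f2 i) := by
    intro i h1 h2
    by_cases h0 : i = i0
    · subst h0; omega
    have ia : i ≠ a := by rintro rfl; omega
    have ib : i ≠ b := by rintro rfl; omega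
    have ic : i ≠ c := by rintro rfl; omega
    have ie : i ≠ e := by rintro rfl; omega
    have i_f : i ≠ f := by rintro rfl; omega
    have := hsq {i, i0, a, b, c, e, f}
    rw [sum_insert (by simp [h0, ia, ib, ic, ie, i_f]), sum_insert (by simp [i0a, i0b, i0c, i0e, i0f]),
      sum_insert (by simp [hab, hac, hae, haf]), sum_insert (by simp [hbc, hbe, hbf]),
      sum_insert (by simp [hce, hcf]), sum_insert (by simp [hef]),
      sum_singleton, hg e, hg f, ga, gb, gc, ge, gf, t1, ts, t2] at this
    have e1 : η * η = 1 := by rcases hη with rfl | rfl <;> rfl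
    have : (f1 i + fs i - f2 i) * (f1 i + fs i - f2 i) ≤ 3 := by linarith
    exact sqb this
  have hf2 : ∀ i, f2 i ≠ 0 → f1 i + fs i = 0 ∧ (p2 i = 0 → f2 i = -η ∧ p1 i + ps i - p2 i = η ∧ n i = n b) := by
    intro i hi
    have := hg i
    rcases s3 i hi with rfl | rfl | rfl
    · constructor <;> omega
    · constructor <;> omega
    · constructor <;> omega
  have hp2 : ∀ i, p2 i ≠ 0 → p1 i + ps i = 0 ∧ (f2 i = 0 → p2 i = -η ∧ f1 i + fs i - f2 i = η ∧ n i = n b) := by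
    intro i hi
    have := hg i
    rcases s3' i hi with rfl | rfl | rfl
    · constructor <;> omega
    · constructor <;> omega
    · constructor <;> omega
  have fbd : ∀ i, f1 i + fs i ≤ 1 ∧ -1 ≤ f1 i + fs i := by
    intro i
    by_cases h : f2 i = 0
    · by_cases h' : p2 i = 0
      · have := gbd i h h'; omega
      · have := (hp2 i h').2 h; omega
    · have := (hf2 i h).1; omega
  have pbd : ∀ i, p1 i + ps i ≤ 1 ∧ -1 ≤ p1 i + ps i := by
    intro i
    by_cases h : p2 i = 0
    · by_cases h' : f2 i = 0
      · have := gbd i h' h; have := hg i; omega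
      · have := (hf2 i h').2 h; omega
    · have := (hp2 i h).1; omega
  have npos : ∀ {x y : ℤ}, (x = 0 ∨ x = 1 ∨ x = -1) → (y = 0 ∨ y = 1 ∨ y = -1) → x + y ≤ 1 → -1 ≤ x + y → x * y ≤ 0 := by
    intro x y hx hy h1 h2
    rcases hx with rfl | rfl | rfl <;> rcases hy with rfl | rfl | rfl <;> omega
  have o1 := orth0 (fun i => npos (tern F.f11 i) (tern F.fss i) (fbd i).1 (fbd i).2) F.f1s
  have o2 := orth0 (fun i => npos (tern Pd.f11 i) (tern Pd.fss i) (pbd i).1 (pbd i).2) Pd.f1s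
  have hxs1 : ∀ i, f1 i ≠ 0 → f2 i = 0 ∧ f1 i = f1 i + fs i - f2 i := by
    intro i hi
    have h1 : fs i = 0 := by have := o1 i; simpa [hi] using this
    by_cases h : f2 i = 0
    · omega
    · have := (hf2 i h).1; omega
  have hxss : ∀ i, fs i ≠ 0 → f2 i = 0 ∧ fs i = f1 i + fs i - f2 i := by
    intro i hi
    have h1 : f1 i = 0 := by have := o1 i; simpa [hi] using this
    by_cases h : f2 i = 0
    · omega
    · have := (hf2 i h).1; omega
  have hxp1 : ∀ i, p1 i ≠ 0 → p2 i = 0 ∧ p1 i = p1 i + ps i - p2 i := by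
    intro i hi
    have h1 : ps i = 0 := by have := o2 i; simpa [hi] using this
    by_cases h : p2 i = 0
    · omega
    · have := (hp2 i h).1; omega
  have v1 : ∑ i, f1 i * (f1 i + fs i - f2 i + 3 * p2 i) = 0 := by
    have : ∀ i, f1 i * (f1 i + fs i - f2 i + 3 * p2 i) = f1 i * f1 i + f1 i * fs i - f1 i * f2 i + 3 * (f1 i * p2 i) :=
      fun i => by ring
    simp only [this, sum_add_distrib, sum_sub_distrib, ← mul_sum, F.f11, F.f1s, F.f12, M.m1]; norm_num
  have vs : ∑ i, fs i * (f1 i + fs i - f2 i + 3 * p2 i) = 0 := by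
    have : ∀ i, fs i * (f1 i + fs i - f2 i + 3 * p2 i) = fs i * fs i + f1 i * fs i - fs i * f2 i + 3 * (fs i * p2 i) :=
      fun i => by ring
    simp only [this, sum_add_distrib, sum_sub_distrib, ← mul_sum, F.fss, F.f1s, F.fs2, M.ms]; norm_num
  have v1' : ∑ i, p1 i * (p1 i + ps i - p2 i + 3 * f2 i) = 0 := by
    have : ∀ i, p1 i * (p1 i + ps i - p2 i + 3 * f2 i) = p1 i * p1 i + p1 i * ps i - p1 i * p2 i + 3 * (p1 i * f2 i) :=
      fun i => by ring
    simp only [this, sum_add_distrib, sum_sub_distrib, ← mul_sum, Pd.f11, Pd.f1s, Pd.f12, M'.m1]; norm_num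
  obtain ⟨j, l, fj, pj, fl, pl, nl, hj0, sm, smq⟩ := half2 (a := a) (e := e) (f := f) f1 F.f11 hη v1 hxs1
    (fun i h => (hp2 i h).2) i0 (by omega) t2'
  obtain ⟨j', l', pj', fj', pl', fl', nl', hj0', sm', smq'⟩ := half2 (a := a) (e := e) (f := f) p1 Pd.f11 hη v1' hxp1
    (fun i h => (hf2 i h).2) i0 (by omega) t2
  have hl' : f1 l' = 0 := by
    by_contra h
    have := (hxs1 l' h).1; omega
  have hl : p1 l = 0 := by
    by_contra h
    have := (hxp1 l h).1; omega
  have q1 : p1 j = 0 := by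
    have h := h11
    rw [sm, hl, t1, t1'] at h
    have : f1 j * p1 j = 0 := by linarith
    simpa [fj] using this
  have q1' : f1 j' = 0 := by
    have h := h11
    simp only [mul_comm (f1 _)] at h
    rw [sm', hl', t1, t1'] at h
    have : p1 j' * f1 j' = 0 := by linarith
    simpa [pj'] using this
  have p2j' := hxp1 j' pj'
  have fsj' : fs j' = p1 j' := by
    have h := hg j'
    rw [← p2j'.2, q1', fj'] at h
    clear * - h
    omega
  obtain ⟨q, l2, fq, pq, fl2, pl2, nl2, hq, sms, smsq⟩ := half2 (a := a) (e := e) (f := f) fs F.fss hη vs hxss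
    (fun i h => (hp2 i h).2) j' (by rw [fsj']; exact pj') p2j'.1
  have e1 := F.n1
  rw [sm, t1, hn0, nl] at e1
  have e2 := Pd.n1
  rw [sm', t1', hn0, nl'] at e2
  have e3 := F.ns
  rw [sms, nl2, fsj'] at e3
  have e4 : fs q * n q = 1 := by linarith
  have nq := hn q
  have fsq : fs q = 1 := by
    rcases tern F.fss q with h | h | h <;> rw [h] at e4 <;> clear * - h e4 nq <;> omega
  have nq1 : n q = 1 := by rw [fsq] at e4; clear * - e4; omega
  have z1 := M.z1
  simp only [add_mul, sum_add_distrib] at z1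
  rw [smq, smsq] at z1
  have tt1 : ∀ {x : ℤ}, (x = 0 ∨ x = 1 ∨ x = -1) → x ≠ 0 → (x : ℚ) ^ 2 = 1 := by
    intro x hx hx'
    rcases hx with rfl | rfl | rfl
    · omega
    · norm_num
    · norm_num
  have w0 : ((f1 i0 + fs i0 - f2 i0 + 3 * p2 i0 : ℤ) : ℚ) ^ 2 = 1 := by rw [t1, ts, t2, t2']; norm_num
  have wj : ((f1 j + fs j - f2 j + 3 * p2 j : ℤ) : ℚ) ^ 2 = 1 := by
    rw [← (hxs1 j fj).2, pj, mul_zero, add_zero, tt1 (tern F.f11 j) fj]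
  have fj'0 : fs j' ≠ 0 := by rw [fsj']; exact pj'
  have wj' : ((f1 j' + fs j' - f2 j' + 3 * p2 j' : ℤ) : ℚ) ^ 2 = 1 := by
    rw [← (hxss j' fj'0).2, p2j'.1, mul_zero, add_zero, tt1 (tern F.fss j') fj'0]
  have wq : ((f1 q + fs q - f2 q + 3 * p2 q : ℤ) : ℚ) ^ 2 = 1 := by
    rw [← (hxss q fq).2, pq, mul_zero, add_zero, tt1 (tern F.fss q) fq]
  have eta2 : (η : ℚ) ^ 2 = 1 := by rcases hη with rfl | rfl <;> norm_num
  have hl0 : f1 l ≠ 0 := by rw [fl]; clear * - hη; omega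
  have hl20 : fs l2 ≠ 0 := by rw [fl2]; clear * - hη; omega
  have wl : ((f1 l + fs l - f2 l + 3 * p2 l : ℤ) : ℚ) ^ 2 = 4 := by
    rw [← (hxs1 l hl0).2, pl, fl]; push_cast; linear_combination 4 * eta2
  have wl2 : ((f1 l2 + fs l2 - f2 l2 + 3 * p2 l2 : ℤ) : ℚ) ^ 2 = 4 := by
    rw [← (hxss l2 hl20).2, pl2, fl2]; push_cast; linear_combination 4 * eta2
  rw [w0, wj, wj', wq, wl, wl2, t1, hn0, nl, nl2, nq1, fsq] at z1
  obtain ⟨r1, r2, r3, r4⟩ := solveP (η := η) (p := n b) (nj := n j) (nj' := n j') (gj := f1 j) (gj' := fs j') hη (hn b) (hn j) (hn j')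
    ((tern F.f11 j).resolve_left fj) ((tern F.fss j').resolve_left fj'0) (by linarith) (by rw [fsj']; linarith)
    (by push_cast at z1; linarith)
  have q2 := hxs1 j fj
  have q2' := hxss j' fj'0
  have q3 := hg j
  have q4 : fs j = 0 := by have := o1 j; rwa [r3, one_mul] at this
  have q5 : ps j' = 0 := by have := o2 j'; rwa [← fsj', r4, one_mul] at this
  refine ⟨j, j', ⟨r1, r3, q4, q2.1, q1, ?_, pj⟩, ⟨r2, q1', r4, q2'.1, fsj' ▸ r4, q5, p2j'.1⟩⟩
  rw [r3, q4, q2.1, q1, pj] at q3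
  clear * - q3
  omega

end
end comb

section wedd
open Finset Matrix

/-- trace of an idempotent matrix -/
theorem trace_idem {n : ℕ} (M : Matrix (Fin n) (Fin n) ℂ) (h : M * M = M) : ∃ k : ℕ, M.trace = k := by
  have h1 : IsIdempotentElem (Matrix.toLin' M) := by
    unfold IsIdempotentElem
    rw [Module.End.mul_eq_comp, ← Matrix.toLin'_mul, h]
  have := (LinearMap.IsIdempotentElem.isProj_range _ h1).trace
  rw [Matrix.trace_toLin'_eq] at this
  exact ⟨_, this⟩
theorem scalar_of_comm {n : ℕ} (hn : 0 < n) (M : Matrix (Fin n) (Fin n) ℂ) (h : ∀ N, M * N = N * M) :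
    M = (M.trace / n) • (1 : Matrix (Fin n) (Fin n) ℂ) := by
  obtain ⟨c, hc⟩ := Matrix.mem_range_scalar_of_commute_single (M := M) (fun i j hij => (h _).symm)
  rw [← hc]
  have : (n : ℂ) ≠ 0 := by exact_mod_cast hn.ne'
  simp [Matrix.scalar_apply, Matrix.trace_diagonal, this, Matrix.smul_one_eq_diagonal]
theorem trace_mulLeft_matrix {m : ℕ} {d : Fin m → ℕ} (x : ∀ i, Matrix (Fin (d i)) (Fin (d i)) ℂ) :
    LinearMap.trace ℂ _ (LinearMap.mulLeft ℂ x) = ∑ i, (d i : ℂ) * (x i).trace := by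
  classical
  rw [LinearMap.trace_eq_matrix_trace ℂ (Pi.basis (fun i => Matrix.stdBasis ℂ (Fin (d i)) (Fin (d i))))]
  rw [Matrix.trace, Fintype.sum_sigma]
  apply sum_congr rfl
  intro i _
  rw [Fintype.sum_prod_type]
  have : ∀ r c, Matrix.diag (LinearMap.toMatrix (Pi.basis (fun i => Matrix.stdBasis ℂ (Fin (d i)) (Fin (d i))))
    (Pi.basis (fun i => Matrix.stdBasis ℂ (Fin (d i)) (Fin (d i)))) (LinearMap.mulLeft ℂ x)) ⟨i, (r, c)⟩ = x i r r := by
    intro r c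
    rw [Matrix.diag_apply, LinearMap.toMatrix_apply]
    rw [Pi.basis_repr, Pi.basis_apply]
    simp [Matrix.stdBasis_eq_single]
    change (x i * Matrix.single r c (1:ℂ) : Matrix _ _ ℂ) r c = _
    simp
  simp only [this]
  simp [Matrix.trace, mul_sum]
theorem trace_mulLeft_group {K : Type*} [Group K] [Fintype K] [DecidableEq K] (g : K) :
    LinearMap.trace ℂ _ (LinearMap.mulLeft ℂ (MonoidAlgebra.of ℂ K g)) = if g = 1 then (Fintype.card K : ℂ) else 0 := by
  classical
  rw [LinearMap.trace_eq_matrix_trace ℂ (MonoidAlgebra.basis K ℂ), Matrix.trace]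
  have : ∀ h, Matrix.diag (LinearMap.toMatrix (MonoidAlgebra.basis K ℂ) (MonoidAlgebra.basis K ℂ)
      (LinearMap.mulLeft ℂ (MonoidAlgebra.of ℂ K g))) h = if g = 1 then 1 else 0 := by
    intro h
    rw [Matrix.diag_apply, LinearMap.toMatrix_apply]
    simp [MonoidAlgebra.basis]
    rw [Finsupp.single_apply]; simp
  simp only [this]
  simp

/-- complete system of irreducible matrix representations -/
structure Irr (K : Type*) [Group K] [Fintype K] [DecidableEq K] where
  m : ℕ
  d : Fin m → ℕ
  pos : ∀ i, 0 < d i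
  π : ∀ i, K →* Matrix (Fin (d i)) (Fin (d i)) ℂ
  reg : ∀ g, ∑ i, (d i : ℂ) * (π i g).trace = if g = 1 then (Fintype.card K : ℂ) else 0
  avg : ∀ i a, ∑ h, π i (h * a * h⁻¹) = ((Fintype.card K : ℂ) * (π i a).trace / d i) • (1 : Matrix (Fin (d i)) (Fin (d i)) ℂ)
  i0 : Fin m
  d0 : d i0 = 1
  triv : ∀ g, (π i0 g).trace = 1
theorem exists_irr (K : Type*) [Group K] [Fintype K] [DecidableEq K] : Nonempty (Irr K) := by
  obtain ⟨m, d, hd, ⟨e⟩⟩ := IsSemisimpleRing.exists_algEquiv_pi_matrix_of_isAlgClosed ℂ (MonoidAlgebra ℂ K)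
  let ρ : ∀ i, MonoidAlgebra ℂ K →ₐ[ℂ] Matrix (Fin (d i)) (Fin (d i)) ℂ := fun i =>
    (Pi.evalAlgHom ℂ _ i).comp e.toAlgHom
  have hρ : ∀ i x, ρ i x = e x i := fun i x => rfl
  have hsurj : ∀ i N, ∃ x, ρ i x = N := by
    intro i N
    classical
    refine ⟨e.symm (Function.update 0 i N), ?_⟩
    rw [hρ]; simp
  let π : ∀ i, K →* Matrix (Fin (d i)) (Fin (d i)) ℂ := fun i =>
    (ρ i : MonoidAlgebra ℂ K →* _).comp (MonoidAlgebra.of ℂ K)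
  have hπ : ∀ i g, π i g = ρ i (MonoidAlgebra.of ℂ K g) := fun i g => rfl
  have hpos : ∀ i, 0 < d i := fun i => Nat.pos_of_ne_zero (hd i).out
  have cent : ∀ x : MonoidAlgebra ℂ K, (∀ g, x * MonoidAlgebra.of ℂ K g = MonoidAlgebra.of ℂ K g * x) →
      ∀ y, x * y = y * x := by
    intro x hx y
    induction y using MonoidAlgebra.induction_on with
    | of g => exact hx g
    | add a b ha hb => rw [mul_add, add_mul, ha, hb]
    | smul r a ha => rw [mul_smul_comm, smul_mul_assoc, ha]
  have cent' : ∀ x : MonoidAlgebra ℂ K, (∀ g, x * MonoidAlgebra.of ℂ K g = MonoidAlgebra.of ℂ K g * x) →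
      ∀ i, ρ i x = ((ρ i x).trace / d i) • (1 : Matrix (Fin (d i)) (Fin (d i)) ℂ) := by
    intro x hx i
    apply scalar_of_comm (hpos i)
    intro N
    obtain ⟨y, rfl⟩ := hsurj i N
    rw [← map_mul, ← map_mul, cent x hx]
  -- the trivial idempotent
  set s : MonoidAlgebra ℂ K := ∑ g, MonoidAlgebra.of ℂ K g with hs
  have s1 : ∀ g, s * MonoidAlgebra.of ℂ K g = s := by
    intro g
    rw [hs, sum_mul]
    simp only [← map_mul]
    exact Fintype.sum_equiv (Equiv.mulRight g) _ _ (fun x => rfl)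
  have s2 : ∀ g, MonoidAlgebra.of ℂ K g * s = s := by
    intro g
    rw [hs, mul_sum]
    simp only [← map_mul]
    exact Fintype.sum_equiv (Equiv.mulLeft g) _ _ (fun x => rfl)
  have s0 : s ≠ 0 := by
    intro h
    have h1 : (MonoidAlgebra.lift ℂ ℂ K (1 : K →* ℂ)) s = 0 := by rw [h, map_zero]
    rw [hs, map_sum] at h1
    simp at h1
  obtain ⟨i0, hi0⟩ : ∃ i, ρ i s ≠ 0 := by
    by_contra hcon
    push Not at hcon
    apply s0
    apply e.injective
    rw [map_zero]
    funext i
    exact hcon i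
  have hc := cent' s (fun g => by rw [s1, s2]) i0
  set c := (ρ i0 s).trace / d i0 with hcdef
  have hc0 : c ≠ 0 := by
    intro h; rw [h, zero_smul] at hc; exact hi0 hc
  have p1 : ∀ g, π i0 g = 1 := by
    intro g
    have := congrArg (ρ i0) (s2 g)
    rw [map_mul, hc, ← hπ, mul_smul_comm, mul_one] at this
    have h2 := congrArg (fun M => c⁻¹ • M) this
    simpa [smul_smul, hc0] using h2
  have d1 : d i0 = 1 := by
    have hall : ∀ x, ∃ c : ℂ, ρ i0 x = c • 1 := by
      intro x
      induction x using MonoidAlgebra.induction_on with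
      | of g => exact ⟨1, by rw [← hπ, p1, one_smul]⟩
      | add a b ha hb =>
        obtain ⟨u, hu⟩ := ha
        obtain ⟨v, hv⟩ := hb
        exact ⟨u + v, by rw [map_add, hu, hv, add_smul]⟩
      | smul r a ha =>
        obtain ⟨u, hu⟩ := ha
        exact ⟨r * u, by rw [map_smul, hu, smul_smul]⟩
    by_contra hne
    have h2 : 1 < d i0 := by have := hpos i0; omega
    obtain ⟨x, hx⟩ := hsurj i0 (Matrix.single ⟨0, by omega⟩ ⟨1, h2⟩ 1)
    obtain ⟨c', hc'⟩ := hall x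
    rw [hx] at hc'
    have := congrFun (congrFun hc' ⟨0, by omega⟩) ⟨1, h2⟩
    simp at this
  refine ⟨⟨m, d, hpos, π, ?_, ?_, i0, d1, ?_⟩⟩
  · intro g
    rw [← trace_mulLeft_group g]
    have h1 := trace_mulLeft_matrix (e (MonoidAlgebra.of ℂ K g))
    have h2 := LinearMap.trace_conj' (LinearMap.mulLeft ℂ (MonoidAlgebra.of ℂ K g)) e.toLinearEquiv
    rw [← h2]
    have h3 : e.toLinearEquiv.conj (LinearMap.mulLeft ℂ (MonoidAlgebra.of ℂ K g)) =
        LinearMap.mulLeft ℂ (e (MonoidAlgebra.of ℂ K g)) := by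
      apply LinearMap.ext
      intro x
      rw [LinearEquiv.conj_apply_apply]
      simp
    rw [h3, h1]
    rfl
  · intro i a
    set z : MonoidAlgebra ℂ K := ∑ h, MonoidAlgebra.of ℂ K (h * a * h⁻¹) with hz
    have hzc : ∀ g, z * MonoidAlgebra.of ℂ K g = MonoidAlgebra.of ℂ K g * z := by
      intro g
      rw [hz, sum_mul, mul_sum]
      simp only [← map_mul]
      apply Fintype.sum_equiv (Equiv.mulLeft g⁻¹)
      intro h
      simp [mul_assoc]
    have h1 := cent' z hzc i
    have h2 : ρ i z = ∑ h, π i (h * a * h⁻¹) := by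
      rw [hz, map_sum]; rfl
    rw [← h2, h1, h2]
    congr 2
    rw [Matrix.trace_sum]
    have : ∀ h, (π i (h * a * h⁻¹)).trace = (π i a).trace := by
      intro h
      rw [map_mul, Matrix.trace_mul_comm, ← map_mul]; simp
    simp only [this]
    simp
  · intro g
    rw [p1, Matrix.trace_one]; simp [d1]
namespace Irr
variable {K : Type*} [Group K] [Fintype K] [DecidableEq K] (I : Irr K)

def χ (i : Fin I.m) (g : K) : ℂ := (I.π i g).trace
theorem χ_conj (i : Fin I.m) (h a : K) : I.χ i (h * a * h⁻¹) = I.χ i a := by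
  unfold χ
  rw [map_mul, Matrix.trace_mul_comm, ← map_mul]; simp
theorem χ_one (i : Fin I.m) : I.χ i 1 = I.d i := by simp [χ]
theorem dC (i : Fin I.m) : (I.d i : ℂ) ≠ 0 := by exact_mod_cast (I.pos i).ne'
theorem avg2 (i : Fin I.m) (a b : K) : ∑ h, I.χ i (h * a * h⁻¹ * b) = (Fintype.card K : ℂ) * I.χ i a * I.χ i b / I.d i := by
  have h1 := congrArg (fun M => (M * I.π i b).trace) (I.avg i a)
  simp only [sum_mul, Matrix.trace_sum, ← map_mul, smul_mul_assoc, one_mul, Matrix.trace_smul, smul_eq_mul] at h1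
  unfold χ
  rw [h1]; ring
theorem cardC : (Fintype.card K : ℂ) ≠ 0 := by exact_mod_cast Fintype.card_ne_zero

theorem orth (a b : K) : ∑ i, I.χ i a * I.χ i b = ((univ.filter (fun h : K => h * a * h⁻¹ * b = 1)).card : ℂ) := by
  have h1 : ∑ h : K, ∑ i, (I.d i : ℂ) * I.χ i (h * a * h⁻¹ * b) =
      (Fintype.card K : ℂ) * ((univ.filter (fun h : K => h * a * h⁻¹ * b = 1)).card : ℂ) := by
    have : ∀ h : K, ∑ i, (I.d i : ℂ) * I.χ i (h * a * h⁻¹ * b) = if h * a * h⁻¹ * b = 1 then (Fintype.card K : ℂ) else 0 :=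
      fun h => I.reg _
    simp only [this]
    rw [← sum_filter, sum_const, nsmul_eq_mul, mul_comm]
  rw [sum_comm] at h1
  have h2 : ∀ i, ∑ h : K, (I.d i : ℂ) * I.χ i (h * a * h⁻¹ * b) = (Fintype.card K : ℂ) * (I.χ i a * I.χ i b) := by
    intro i
    rw [← mul_sum, I.avg2]
    have := I.dC i
    field_simp
  simp only [h2, ← mul_sum] at h1
  exact mul_left_cancel₀ cardC h1

/-- vanishing of class structure constants -/
theorem triple (a b e : K) (hno : ∀ h h' : K, h * a * h⁻¹ * (h' * b * h'⁻¹) * e ≠ 1) :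
    ∑ i, I.χ i a * I.χ i b * I.χ i e / I.d i = 0 := by
  have h1 : ∀ i, ∑ h : K, ∑ h' : K, I.χ i (h * a * h⁻¹ * (h' * b * h'⁻¹) * e) =
      (Fintype.card K : ℂ) ^ 2 * I.χ i a * I.χ i b * I.χ i e / I.d i ^ 2 := by
    intro i
    have h2 : ∀ h : K, ∑ h' : K, I.χ i (h * a * h⁻¹ * (h' * b * h'⁻¹) * e) =
        (Fintype.card K : ℂ) * I.χ i b / I.d i * I.χ i (h * a * h⁻¹ * e) := by
      intro h
      have : ∀ h', I.χ i (h * a * h⁻¹ * (h' * b * h'⁻¹) * e) = I.χ i (h' * b * h'⁻¹ * (e * (h * a * h⁻¹))) := by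
        intro h'
        unfold χ
        rw [mul_assoc, map_mul, Matrix.trace_mul_comm, ← map_mul]; simp [mul_assoc]
      simp only [this]
      rw [I.avg2]
      have : I.χ i (e * (h * a * h⁻¹)) = I.χ i (h * a * h⁻¹ * e) := by
        unfold χ
        rw [map_mul, Matrix.trace_mul_comm, ← map_mul]
      rw [this]; ring
    simp only [h2]
    rw [← mul_sum, I.avg2]
    ring
  have h3 : ∑ i, (I.d i : ℂ) * ∑ h : K, ∑ h' : K, I.χ i (h * a * h⁻¹ * (h' * b * h'⁻¹) * e) = 0 := by
    simp only [mul_sum]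
    rw [sum_comm]
    apply sum_eq_zero
    intro h _
    rw [sum_comm]
    apply sum_eq_zero
    intro h' _
    have := I.reg (h * a * h⁻¹ * (h' * b * h'⁻¹) * e)
    rw [if_neg (hno h h')] at this
    exact this
  simp only [h1] at h3
  have h4 : ∀ i, (I.d i : ℂ) * ((Fintype.card K : ℂ) ^ 2 * I.χ i a * I.χ i b * I.χ i e / I.d i ^ 2) =
      (Fintype.card K : ℂ) ^ 2 * (I.χ i a * I.χ i b * I.χ i e / I.d i) := by
    intro i
    have := I.dC i
    field_simp
  simp only [h4, ← mul_sum] at h3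
  exact (mul_eq_zero.1 h3).resolve_left (pow_ne_zero 2 cardC)
end Irr
end wedd

section A8
open Finset Matrix
theorem idem3 {R : Type*} [Ring R] [Algebra ℂ R] (c : R) (h : c * (c * c) = 1) :
    ((1 / 3 : ℂ) • (1 + c + c * c)) * ((1 / 3 : ℂ) • (1 + c + c * c)) = (1 / 3 : ℂ) • (1 + c + c * c) := by
  have e1 : c * (1 + c + c * c) = 1 + c + c * c := by rw [mul_add, mul_add, mul_one, h]; abel
  have e2 : (1 + c + c * c) * (1 + c + c * c) = (3 : ℂ) • (1 + c + c * c) := by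
    conv_lhs => rw [add_mul, add_mul, one_mul, mul_assoc c c, e1, e1]
    rw [show (3 : ℂ) = 1 + 1 + 1 by norm_num, add_smul, add_smul, one_smul]
  rw [smul_mul_smul_comm, e2, smul_smul]; norm_num
theorem idem2 {R : Type*} [Ring R] [Algebra ℂ R] (s : R) (h : s * s = 1) :
    ((1 / 2 : ℂ) • (1 + s)) * ((1 / 2 : ℂ) • (1 + s)) = (1 / 2 : ℂ) • (1 + s) := by
  have e2 : (1 + s) * (1 + s) = (2 : ℂ) • (1 + s) := by
    rw [add_mul, one_mul, mul_add, mul_one, h, show (2 : ℂ) = 1 + 1 by norm_num, add_smul, one_smul]; abel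
  rw [smul_mul_smul_comm, e2, smul_smul]; norm_num
theorem idem_mul {R : Type*} [Ring R] (a b : R) (ha : a * a = a) (hb : b * b = b) (h : a * b = b * a) :
    (a * b) * (a * b) = a * b := by
  calc (a * b) * (a * b) = a * (b * a) * b := by noncomm_ring
    _ = (a * a) * (b * b) := by rw [← h]; noncomm_ring
    _ = a * b := by rw [ha, hb]
theorem exists_omega : ∃ w : ℂ, w * w = -1 - w ∧ w * (w * w) = 1 := by
  obtain ⟨w, hw⟩ := IsAlgClosed.exists_root (Polynomial.X ^ 2 + Polynomial.X + 1 : Polynomial ℂ) (by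
    have : (Polynomial.X ^ 2 + Polynomial.X + 1 : Polynomial ℂ).degree = 2 := by compute_degree!
    rw [this]; norm_num)
  simp at hw
  have h1 : w * w = -1 - w := by linear_combination hw
  exact ⟨w, h1, by rw [h1]; linear_combination -h1⟩

/-- trace of `A x` is an integer -/
theorem int_tr {n : ℕ} (A x : Matrix (Fin n) (Fin n) ℂ) (hA : A * A = A) (hx : x * (x * x) = 1) (hc : A * x = x * A)
    (ht : (A * x).trace = (A * (x * x)).trace) : ∃ k : ℤ, (A * x).trace = k := by
  obtain ⟨w, hw, hw3⟩ := exists_omega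
  have key : ∀ c : Matrix (Fin n) (Fin n) ℂ, c * (c * c) = 1 → A * c = c * A →
      ∃ k : ℕ, (A * ((1 / 3 : ℂ) • (1 + c + c * c))).trace = k := by
    intro c h1 h2
    apply trace_idem
    apply idem_mul _ _ hA (idem3 c h1)
    have h3 : A * (c * c) = c * c * A := by rw [← mul_assoc, h2, mul_assoc, h2, mul_assoc]
    rw [mul_smul_comm, smul_mul_assoc, mul_add, mul_add, add_mul, add_mul, h2, h3, mul_one, one_mul]
  obtain ⟨k0, h0⟩ := key x hx hc
  obtain ⟨k1, h1⟩ := key (w • x) (by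
    rw [smul_mul_smul_comm, smul_mul_smul_comm, hw3, one_smul, hx]) (by rw [mul_smul_comm, smul_mul_assoc, hc])
  refine ⟨(k0 : ℤ) - k1, ?_⟩
  rw [mul_smul_comm, Matrix.trace_smul, mul_add, mul_add, Matrix.trace_add, Matrix.trace_add, smul_eq_mul] at h0 h1
  rw [smul_mul_smul_comm, mul_smul_comm, mul_smul_comm, Matrix.trace_smul, Matrix.trace_smul, smul_eq_mul, smul_eq_mul, ← ht, hw] at h1
  rw [← ht] at h0
  push_cast
  linear_combination h0 - h1

/-- configuration resembling `S3 × S3` -/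
structure Q8 {K : Type*} [Group K] (b1 b2 s1 s2 : K) : Prop where
  b1c : b1 * (b1 * b1) = 1
  b2c : b2 * (b2 * b2) = 1
  s1c : s1 * s1 = 1
  s2c : s2 * s2 = 1
  bb : b1 * b2 = b2 * b1
  s1b1 : s1 * b1 = b1⁻¹ * s1
  s1b2 : s1 * b2 = b2 * s1
  s2b1 : s2 * b1 = b1 * s2
  s2b2 : s2 * b2 = b2⁻¹ * s2
  s12 : s1 * s2 = s2 * s1
  n1 : b1 ≠ 1
  n2 : b2 ≠ 1
  ns1 : s1 ≠ 1
  ns2 : s2 ≠ 1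
  c1 : Nat.card (CC b1) = 18
  c2 : Nat.card (CC b2) = 18
  c12 : Nat.card (CC (b1 * b2)) = 9
  cs1 : Nat.card (CC (b2 * s1)) = 6
  cs2 : Nat.card (CC (b1 * s2)) = 6
  nc : ∀ h, h * b1 * h⁻¹ ≠ b2
  t11 : ∀ h h' : K, h * b1 * h⁻¹ * (h' * b1 * h'⁻¹) * b2 ≠ 1
  t1g : ∀ h h' : K, h * b1 * h⁻¹ * (h' * b1 * h'⁻¹) * (b1 * b2) ≠ 1
  t22 : ∀ h h' : K, h * b2 * h⁻¹ * (h' * b2 * h'⁻¹) * b1 ≠ 1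
  t2g : ∀ h h' : K, h * b2 * h⁻¹ * (h' * b2 * h'⁻¹) * (b1 * b2) ≠ 1
namespace Q8
variable {K : Type*} [Group K] {b1 b2 s1 s2 : K}
theorem symm (q : Q8 b1 b2 s1 s2) : Q8 b2 b1 s2 s1 where
  b1c := q.b2c
  b2c := q.b1c
  s1c := q.s2c
  s2c := q.s1c
  bb := q.bb.symm
  s1b1 := q.s2b2
  s1b2 := q.s2b1
  s2b1 := q.s1b2
  s2b2 := q.s1b1
  s12 := q.s12.symm
  n1 := q.n2
  n2 := q.n1
  ns1 := q.ns2
  ns2 := q.ns1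
  c1 := q.c2
  c2 := q.c1
  c12 := by rw [← q.bb]; exact q.c12
  cs1 := q.cs2
  cs2 := q.cs1
  nc h hh := q.nc h⁻¹ (by rw [← hh]; group)
  t11 := q.t22
  t1g := by rw [← q.bb]; exact q.t2g
  t22 := q.t11
  t2g := by rw [← q.bb]; exact q.t1g
variable [Fintype K] [DecidableEq K] (I : Irr K)
theorem orth0 (a b s : K) (hs : s * b * s⁻¹ = b⁻¹) (h : ∀ h, h * a * h⁻¹ ≠ b) : ∑ i, I.χ i a * I.χ i b = 0 := by
  rw [I.orth, Finset.card_eq_zero.2, Nat.cast_zero]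
  apply Finset.filter_eq_empty_iff.2
  intro x _ hx
  apply h (s⁻¹ * x)
  have h1 : x * a * x⁻¹ = b⁻¹ := eq_inv_of_mul_eq_one_left hx
  have h2 : s⁻¹ * x * a * (s⁻¹ * x)⁻¹ = s⁻¹ * (x * a * x⁻¹) * s := by group
  rw [h2, h1, ← hs]; group
theorem orth1 (a s : K) (hs : s * a * s⁻¹ = a⁻¹) : ∑ i, I.χ i a * I.χ i a = Nat.card (CC a) := by
  classical
  rw [I.orth]
  congr 1
  rw [Nat.card_eq_fintype_card, Fintype.card_subtype]
  symm
  apply Finset.card_bij (fun x _ => s * x)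
  · intro x hx
    rw [Finset.mem_filter] at hx ⊢
    refine ⟨Finset.mem_univ _, ?_⟩
    have hx2 := mem_CC'.1 hx.2
    have : s * x * a * (s * x)⁻¹ = s * (x * a * x⁻¹) * s⁻¹ := by group
    rw [this, hx2, hs]; group
  · intro x _ y _ h; exact mul_left_cancel h
  · intro y hy
    rw [Finset.mem_filter] at hy
    refine ⟨s⁻¹ * y, ?_, by group⟩
    rw [Finset.mem_filter]
    refine ⟨Finset.mem_univ _, ?_⟩
    apply mem_CC'.2
    have h1 : y * a * y⁻¹ = a⁻¹ := eq_inv_of_mul_eq_one_left hy.2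
    have h2 : s⁻¹ * y * a * (s⁻¹ * y)⁻¹ = s⁻¹ * (y * a * y⁻¹) * s := by group
    rw [h2, h1, ← hs]; group
theorem regs (a : K) (h : a ≠ 1) : ∑ i, I.χ i a * (I.d i : ℂ) = 0 := by
  have := I.reg a
  rw [if_neg h] at this
  rw [← this]
  exact Finset.sum_congr rfl (fun i _ => mul_comm _ _)

theorem χc {i : Fin I.m} {a b : K} (h : K) (e : h * a * h⁻¹ = b) : I.χ i b = I.χ i a := by
  rw [← e, I.χ_conj]
theorem p3 {x : K} (h : x * (x * x) = 1) : x ^ 3 = 1 := by rw [pow_three, h]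
theorem linear (j : Fin I.m) (hj : I.d j = 1) : ∃ l : K →* ℂ, ∀ g, l g = I.χ j g := by
  have key : ∀ M N : Matrix (Fin (I.d j)) (Fin (I.d j)) ℂ, (M * N).trace = M.trace * N.trace := by
    rw [hj]
    intro M N
    simp [Matrix.trace, Matrix.mul_apply]
  refine ⟨⟨⟨fun g => I.χ j g, ?_⟩, ?_⟩, fun g => rfl⟩
  · rw [I.χ_one, hj]; norm_num
  · intro x y
    simp only [Irr.χ, map_mul, key]

abbrev HF (b1 b2 s1 : K) (f1 fs f2 : Fin I.m → ℤ) : Prop := ∀ i,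
    (f1 i : ℂ) = (I.χ i b2 + 2 * I.χ i (b1 * b2) + 3 * I.χ i (b2 * s1)) / 6 ∧
    (fs i : ℂ) = (I.χ i b2 + 2 * I.χ i (b1 * b2) - 3 * I.χ i (b2 * s1)) / 6 ∧
    (f2 i : ℂ) = (I.χ i b2 - I.χ i (b1 * b2)) / 3
variable (q : Q8 b1 b2 s1 s2)
include q
theorem real1 : s1 * b1 * s1⁻¹ = b1⁻¹ := by rw [q.s1b1]; group
theorem real2 : s2 * b2 * s2⁻¹ = b2⁻¹ := by rw [q.s2b2]; group
theorem real2' : s1 * b2 * s1⁻¹ = b2 := by rw [q.s1b2]; group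
theorem real1' : s2 * b1 * s2⁻¹ = b1 := by rw [q.s2b1]; group
theorem real12 : (s1 * s2) * (b1 * b2) * (s1 * s2)⁻¹ = (b1 * b2)⁻¹ := by
  have : (s1 * s2) * (b1 * b2) * (s1 * s2)⁻¹ = (s1 * (s2 * b1 * s2⁻¹) * s1⁻¹) * (s1 * (s2 * b2 * s2⁻¹) * s1⁻¹) := by group
  rw [this, q.real1', q.real1, q.real2, show s1 * b2⁻¹ * s1⁻¹ = (s1 * b2 * s1⁻¹)⁻¹ by group, q.real2', q.bb, _root_.mul_inv_rev]
theorem reals1 : s2 * (b2 * s1) * s2⁻¹ = (b2 * s1)⁻¹ := by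
  have : s2 * (b2 * s1) * s2⁻¹ = (s2 * b2 * s2⁻¹) * (s2 * s1 * s2⁻¹) := by group
  rw [this, q.real2, ← q.s12, ← q.s1b2, _root_.mul_inv_rev, inv_eq_of_mul_eq_one_right q.s1c]; group
theorem inv1 : b1⁻¹ = b1 * b1 := inv_eq_of_mul_eq_one_right q.b1c
theorem inv2 : b2⁻¹ = b2 * b2 := inv_eq_of_mul_eq_one_right q.b2c

theorem cube : (b2 * s1) ^ 3 = s1 := by
  have h : Commute b2 s1 := q.s1b2.symm
  rw [h.mul_pow, pow_three, q.b2c, pow_three, q.s1c]; simp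
theorem fourth : (b2 * s1) ^ 4 = b2 := by
  have h : Commute b2 s1 := q.s1b2.symm
  rw [h.mul_pow, show b2 ^ 4 = b2 * (b2 * (b2 * b2)) by simp [pow_succ, mul_assoc], q.b2c, show s1 ^ 4 = (s1 * s1) * (s1 * s1) by simp [pow_succ, mul_assoc], q.s1c]; simp
theorem ncw {x : K} (hx : x ^ 3 = 1) (h : K) : h * x * h⁻¹ ≠ b2 * s1 := by
  intro hh
  apply q.ns1
  rw [← q.cube, ← hh, conj_pow, hx]; group
theorem nc' {x y : K} (hn : Nat.card (CC x) ≠ Nat.card (CC y)) (h : K) : h * x * h⁻¹ ≠ y := by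
  intro hh
  apply hn
  have : CC y = CJ h (CC x) := by
    ext g
    rw [mem_CJ, mem_CC, mem_CC, ← hh]
    constructor
    · intro h1
      calc h⁻¹ * g * h * x = h⁻¹ * (g * (h * x * h⁻¹)) * h := by group
        _ = h⁻¹ * ((h * x * h⁻¹) * g) * h := by rw [h1]
        _ = _ := by group
    · intro h1
      calc g * (h * x * h⁻¹) = h * (h⁻¹ * g * h * x) * h⁻¹ := by group
        _ = h * (x * (h⁻¹ * g * h)) * h⁻¹ := by rw [h1]
        _ = _ := by group
  rw [this, card_CJ]
theorem x1 (i) : I.χ i (b1 * (b1 * b2)) = I.χ i (b1 * b2) := by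
  apply χc I s1
  rw [show s1 * (b1 * b2) * s1⁻¹ = (s1 * b1 * s1⁻¹) * (s1 * b2 * s1⁻¹) by group, q.real1, q.real2', q.inv1, mul_assoc]
theorem x2 (i) : I.χ i (b2 * b2) = I.χ i b2 := by
  apply χc I s2
  rw [q.real2, q.inv2]
theorem x3 (i) : I.χ i (b1 * (b2 * b2)) = I.χ i (b1 * b2) := by
  apply χc I s2
  rw [show s2 * (b1 * b2) * s2⁻¹ = (s2 * b1 * s2⁻¹) * (s2 * b2 * s2⁻¹) by group, q.real1', q.real2, q.inv2]
theorem x4 (i) : I.χ i (b1 * (b1 * (b2 * b2))) = I.χ i (b1 * b2) := by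
  rw [← q.x3]
  apply χc I s1
  rw [show s1 * (b1 * (b2 * b2)) * s1⁻¹ = (s1 * b1 * s1⁻¹) * ((s1 * b2 * s1⁻¹) * (s1 * b2 * s1⁻¹)) by group, q.real1, q.real2', q.inv1, mul_assoc]
theorem sb : s1 * b1⁻¹ = b1 * s1 := by
  calc s1 * b1⁻¹ = (b1 * (b1⁻¹ * s1)) * b1⁻¹ := by group
    _ = _ := by rw [← q.s1b1]; group
theorem y1 (i) {x : K} (hx : x * b1 = b1 * x) :
    I.χ i (b1 * (b1 * (s1 * x))) = I.χ i (s1 * x) := by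
  apply χc I b1
  have h := q.sb
  have h2 := ((show Commute x b1 from hx).inv_right).eq
  rw [mul_assoc, mul_assoc, h2, ← mul_assoc s1, h]; simp only [mul_assoc]
theorem y2 (i) {x : K} (hx : x * b1 = b1 * x) :
    I.χ i (b1 * (s1 * x)) = I.χ i (s1 * x) := by
  rw [← q.y1 I i hx]
  symm
  apply χc I (b1 * b1)
  have h2 := ((show Commute x b1 from hx).inv_right).eq
  have h := q.sb
  calc b1 * b1 * (b1 * (s1 * x)) * (b1 * b1)⁻¹ = (b1 * (b1 * b1)) * s1 * (x * b1⁻¹) * b1⁻¹ := by group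
    _ = (s1 * b1⁻¹) * (x * b1⁻¹) := by
      conv_lhs => rw [q.b1c, h2]
      group
    _ = (b1 * (s1 * b1⁻¹)) * x := by rw [h2, h]; simp only [mul_assoc]; rw [← mul_assoc s1 b1⁻¹, h]; group
    _ = _ := by rw [h]; group
theorem int2 (i) : ∃ k : ℤ, (I.χ i b2 - I.χ i (b1 * b2)) / 3 = k := by
  obtain ⟨w, hw, hw3⟩ := exists_omega
  have e1 : ∀ y : K, (((1 / 3 : ℂ) • (1 + w • I.π i b1 + (w • I.π i b1) * (w • I.π i b1))) * I.π i y).trace =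
      (1 / 3) * (I.χ i y + w * I.χ i (b1 * y) + w * w * I.χ i (b1 * (b1 * y))) := by
    intro y
    simp only [smul_mul_assoc, add_mul, one_mul, Matrix.trace_smul, Matrix.trace_add, smul_eq_mul, mul_smul_comm,
      mul_assoc, ← map_mul, Irr.χ]
  obtain ⟨k, hk⟩ := int_tr ((1 / 3 : ℂ) • (1 + w • I.π i b1 + (w • I.π i b1) * (w • I.π i b1))) (I.π i b2)
    (idem3 _ (by rw [smul_mul_smul_comm, smul_mul_smul_comm, hw3, one_smul, ← map_mul, ← map_mul, q.b1c, map_one]))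
    (by rw [← map_mul, ← map_mul, q.b2c, map_one])
    (by
      have : I.π i b1 * I.π i b2 = I.π i b2 * I.π i b1 := by rw [← map_mul, q.bb, map_mul]
      have h2 : I.π i b1 * I.π i b1 * I.π i b2 = I.π i b2 * (I.π i b1 * I.π i b1) := by
        rw [mul_assoc, this, ← mul_assoc, this, mul_assoc]
      simp only [smul_mul_assoc, mul_smul_comm, add_mul, mul_add, one_mul, mul_one, this, h2])
    (by
      rw [← map_mul, e1, e1, q.x2, q.x1, q.x3, q.x4])
  refine ⟨k, ?_⟩
  rw [← hk, e1, q.x1, hw]; ring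
theorem int1 (i) (ε : ℂ) (hε : ε * ε = 1) :
    ∃ k : ℤ, (I.χ i b2 + 2 * I.χ i (b1 * b2) + 3 * ε * I.χ i (b2 * s1)) / 6 = k := by
  have e1 : ∀ y : K, (((1 / 3 : ℂ) • (1 + I.π i b1 + I.π i b1 * I.π i b1) * ((1 / 2 : ℂ) • (1 + ε • I.π i s1))) * I.π i y).trace =
      (1 / 6) * (I.χ i y + I.χ i (b1 * y) + I.χ i (b1 * (b1 * y)) + ε * (I.χ i (s1 * y) + I.χ i (b1 * (s1 * y)) + I.χ i (b1 * (b1 * (s1 * y))))) := by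
    intro y
    simp only [smul_mul_assoc, add_mul, one_mul, Matrix.trace_smul, Matrix.trace_add, smul_eq_mul, mul_smul_comm,
      mul_assoc, ← map_mul, Irr.χ, mul_add, mul_one, smul_add, add_mul]
    ring
  have z0 : I.χ i (s1 * (b2 * b2)) = I.χ i (s1 * b2) := by
    apply χc I s2
    rw [show s2 * (s1 * b2) * s2⁻¹ = (s2 * s1) * s2⁻¹ * (s2 * b2 * s2⁻¹) by group, ← q.s12, q.real2, q.inv2]; group
  have c2 : (b2 * b2) * b1 = b1 * (b2 * b2) := by rw [mul_assoc, ← q.bb, ← mul_assoc, ← q.bb, mul_assoc]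
  have bs : b1 * s1 = s1 * (b1 * b1) := by
    calc b1 * s1 = b1 * s1 * b1⁻¹ * b1 := by group
      _ = s1 * b1⁻¹ := by
        have := q.s1b1
        calc b1 * s1 * b1⁻¹ * b1 = (b1 * (b1⁻¹ * (b1 * s1))) := by group
          _ = b1 * (b1⁻¹ * s1) * (s1⁻¹ * b1 * s1) := by group
          _ = b1 * (s1 * b1) * (s1⁻¹ * b1 * s1) := by rw [← this]
          _ = b1 * ((s1 * b1) * (s1 * s1)⁻¹ * (s1 * b1) * s1) := by group
          _ = b1 * ((b1⁻¹ * s1) * (s1 * s1)⁻¹ * (b1⁻¹ * s1) * s1) := by rw [← this]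
          _ = s1 * (s1 * s1)⁻¹ * (b1⁻¹ * (s1 * s1)) := by group
          _ = _ := by rw [q.s1c]; group
      _ = _ := by rw [q.inv1]
  obtain ⟨k, hk⟩ := int_tr ((1 / 3 : ℂ) • (1 + I.π i b1 + I.π i b1 * I.π i b1) * ((1 / 2 : ℂ) • (1 + ε • I.π i s1))) (I.π i b2)
    (by
      apply idem_mul
      · exact idem3 _ (by rw [← map_mul, ← map_mul, q.b1c, map_one])
      · exact idem2 _ (by rw [smul_mul_smul_comm, ← map_mul, hε, q.s1c, map_one, one_smul])
      · have h1 : I.π i b1 * I.π i s1 = I.π i s1 * (I.π i b1 * I.π i b1) := by rw [← map_mul, ← map_mul, ← map_mul, bs]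
        have h2 : I.π i b1 * I.π i b1 * I.π i s1 = I.π i s1 * I.π i b1 := by
          simp only [← map_mul]
          congr 1
          rw [mul_assoc, bs, ← mul_assoc, bs, mul_assoc, mul_assoc, q.b1c, mul_one]
        rw [smul_mul_smul_comm, smul_mul_smul_comm, mul_comm (1 / 3 : ℂ)]
        congr 1
        simp only [smul_mul_assoc, mul_smul_comm, add_mul, mul_add, one_mul, mul_one, h1, h2, smul_add]
        abel)
    (by rw [← map_mul, ← map_mul, q.b2c, map_one])
    (by
      have h1 : I.π i b1 * I.π i b2 = I.π i b2 * I.π i b1 := by rw [← map_mul, q.bb, map_mul]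
      have h2 : I.π i s1 * I.π i b2 = I.π i b2 * I.π i s1 := by rw [← map_mul, q.s1b2, map_mul]
      have k1 : Commute (I.π i b2) (I.π i b1) := h1.symm
      have k2 : Commute (I.π i b2) (I.π i s1) := h2.symm
      have k3 : Commute (I.π i b2) ((1 / 3 : ℂ) • (1 + I.π i b1 + I.π i b1 * I.π i b1)) :=
        (((Commute.one_right _).add_right k1).add_right (k1.mul_right k1)).smul_right _
      have k4 : Commute (I.π i b2) ((1 / 2 : ℂ) • (1 + ε • I.π i s1)) :=
        ((Commute.one_right _).add_right (k2.smul_right _)).smul_right _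
      exact (k3.mul_right k4).symm)
    (by
      rw [← map_mul (I.π i) b2 b2, e1, e1, q.x2, q.x1, q.x3, q.x4, q.y1 I i c2, q.y2 I i c2, q.y1 I i q.bb.symm, q.y2 I i q.bb.symm, z0])
  refine ⟨k, ?_⟩
  rw [← hk, e1, q.x1, q.y1 I i q.bb.symm, q.y2 I i q.bb.symm, ← q.s1b2]; ring
theorem half_int : ∃ f1 fs f2 : Fin I.m → ℤ, HF I b1 b2 s1 f1 fs f2 := by
  choose f1 h1 using fun i => q.int1 I i 1 (by norm_num)
  choose fs hs using fun i => q.int1 I i (-1) (by norm_num)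
  choose f2 h2 using fun i => q.int2 I i
  refine ⟨f1, fs, f2, fun i => ⟨?_, ?_, (h2 i).symm⟩⟩
  · rw [← h1]; ring
  · rw [← hs]; ring
theorem p3' : (b1 * b2) ^ 3 = 1 := by
  have h : Commute b1 b2 := q.bb
  rw [h.mul_pow, p3 q.b1c, p3 q.b2c, one_mul]
theorem n12 : b1 * b2 ≠ 1 := by
  intro h
  have := q.c12
  have h2 : CC b1 = CC (1 : K) := by
    have h3 : b2 = b1⁻¹ := (inv_eq_of_mul_eq_one_right h).symm
    exact absurd (q.real1.trans h3.symm) (q.nc s1)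
  have h3 := q.c1
  rw [h2, ← h] at h3
  omega
theorem ns : b2 * s1 ≠ 1 := by
  intro h; apply q.ns1; rw [← q.cube, h, one_pow]

structure IP (_ : Q8 b1 b2 s1 s2) : Prop where
  vv : ∑ i, I.χ i b2 * I.χ i b2 = 18
  gg : ∑ i, I.χ i (b1 * b2) * I.χ i (b1 * b2) = 9
  ww : ∑ i, I.χ i (b2 * s1) * I.χ i (b2 * s1) = 6
  vg : ∑ i, I.χ i b2 * I.χ i (b1 * b2) = 0
  vw : ∑ i, I.χ i b2 * I.χ i (b2 * s1) = 0
  gw : ∑ i, I.χ i (b1 * b2) * I.χ i (b2 * s1) = 0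
  vn : ∑ i, I.χ i b2 * (I.d i : ℂ) = 0
  gn : ∑ i, I.χ i (b1 * b2) * (I.d i : ℂ) = 0
  wn : ∑ i, I.χ i (b2 * s1) * (I.d i : ℂ) = 0
  v12 : ∑ i, I.χ i b1 * I.χ i b2 = 0
  v1w : ∑ i, I.χ i b1 * I.χ i (b2 * s1) = 0
  ww' : ∑ i, I.χ i (b1 * s2) * I.χ i (b2 * s1) = 0
  t1 : ∑ i, I.χ i b1 * I.χ i b1 * I.χ i b2 / I.d i = 0
  t2 : ∑ i, I.χ i b1 * I.χ i b1 * I.χ i (b1 * b2) / I.d i = 0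
theorem ip : IP I q where
  vv := by rw [orth1 I b2 s2 q.real2, q.c2]; norm_num
  gg := by rw [orth1 I _ _ q.real12, q.c12]; norm_num
  ww := by rw [orth1 I _ _ q.reals1, q.cs1]; norm_num
  vg := orth0 I _ _ _ q.real12 (q.nc' (by rw [q.c2, q.c12]; norm_num))
  vw := orth0 I _ _ _ q.reals1 (q.ncw (p3 q.b2c))
  gw := orth0 I _ _ _ q.reals1 (q.ncw q.p3')
  vn := regs I _ q.n2
  gn := regs I _ q.n12
  wn := regs I _ q.ns
  v12 := orth0 I _ _ _ q.real2 q.nc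
  v1w := orth0 I _ _ _ q.reals1 (q.ncw (p3 q.b1c))
  ww' := orth0 I _ _ _ q.reals1 (fun h hh => q.nc h (by
    rw [← q.fourth, ← hh, conj_pow, q.symm.fourth]))
  t1 := I.triple _ _ _ q.t11
  t2 := I.triple _ _ _ q.t1g
variable {I}
theorem halfData {f1 fs f2 : Fin I.m → ℤ} (hf : HF I b1 b2 s1 f1 fs f2) : HalfData (fun i => (I.d i : ℤ)) f1 fs f2 I.i0 := by
  have p := q.ip I
  have cast : ∀ (f : Fin I.m → ℤ) (k : ℤ), ∑ i, (f i : ℂ) = k → ∑ i, f i = k := by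
    intro f k h; exact_mod_cast h
  have main : ∀ (f g : Fin I.m → ℤ) (k : ℤ) (A B C D E F : ℂ), (∀ i, (f i : ℂ) * g i =
      A * (I.χ i b2 * I.χ i b2) + B * (I.χ i (b1 * b2) * I.χ i (b1 * b2)) + C * (I.χ i (b2 * s1) * I.χ i (b2 * s1)) +
      D * (I.χ i b2 * I.χ i (b1 * b2)) + E * (I.χ i b2 * I.χ i (b2 * s1)) + F * (I.χ i (b1 * b2) * I.χ i (b2 * s1))) →
      A * 18 + B * 9 + C * 6 = k → ∑ i, f i * g i = k := by
    intro f g k A B C D E F h h'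
    apply cast
    push_cast
    rw [Finset.sum_congr rfl (fun i _ => h i)]
    simp only [Finset.sum_add_distrib, ← Finset.mul_sum]
    rw [p.vv, p.gg, p.ww, p.vg, p.vw, p.gw, ← h']; ring
  have main2 : ∀ (f : Fin I.m → ℤ) (A B C : ℂ), (∀ i, (f i : ℂ) =
      A * I.χ i b2 + B * I.χ i (b1 * b2) + C * I.χ i (b2 * s1)) → ∑ i, f i * (I.d i : ℤ) = 0 := by
    intro f A B C h
    apply cast
    push_cast
    simp only [h, add_mul, Finset.sum_add_distrib, mul_assoc, ← Finset.mul_sum]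
    rw [p.vn, p.gn, p.wn]; ring
  have tr : ∀ g, I.χ I.i0 g = 1 := I.triv
  have h0 := hf I.i0
  rw [tr, tr, tr] at h0
  exact
  { f11 := main _ _ _ (1 / 36) (4 / 36) (9 / 36) (4 / 36) (6 / 36) (12 / 36) (fun i => by rw [(hf i).1]; ring) (by norm_num)
    fss := main _ _ _ (1 / 36) (4 / 36) (9 / 36) (4 / 36) (-6 / 36) (-12 / 36) (fun i => by rw [(hf i).2.1]; ring) (by norm_num)
    f22 := main _ _ _ (1 / 9) (1 / 9) 0 (-2 / 9) 0 0 (fun i => by rw [(hf i).2.2]; ring) (by norm_num)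
    f1s := main _ _ _ (1 / 36) (4 / 36) (-9 / 36) (4 / 36) 0 0 (fun i => by rw [(hf i).1, (hf i).2.1]; ring) (by norm_num)
    f12 := main _ _ _ (1 / 18) (-2 / 18) 0 (1 / 18) (3 / 18) (-3 / 18) (fun i => by rw [(hf i).1, (hf i).2.2]; ring) (by norm_num)
    fs2 := main _ _ _ (1 / 18) (-2 / 18) 0 (1 / 18) (-3 / 18) (3 / 18) (fun i => by rw [(hf i).2.1, (hf i).2.2]; ring) (by norm_num)
    n1 := main2 _ (1 / 6) (2 / 6) (3 / 6) (fun i => by rw [(hf i).1]; ring)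
    ns := main2 _ (1 / 6) (2 / 6) (-3 / 6) (fun i => by rw [(hf i).2.1]; ring)
    n2 := main2 _ (1 / 3) (-1 / 3) 0 (fun i => by rw [(hf i).2.2]; ring)
    t1 := by have := h0.1; norm_num at this; exact_mod_cast this
    ts := by have := h0.2.1; norm_num at this; exact_mod_cast this
    t2 := by have := h0.2.2; norm_num at this; exact_mod_cast this }
theorem mutData {f1 fs f2 p1 ps p2 : Fin I.m → ℤ} (hf : HF I b1 b2 s1 f1 fs f2)
    (hp : ∀ i, (p2 i : ℂ) = (I.χ i b1 - I.χ i (b1 * b2)) / 3) :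
    MutData (fun i => (I.d i : ℤ)) f1 fs f2 p1 ps p2 := by
  have p := q.ip I
  have cast : ∀ (f : Fin I.m → ℤ) (k : ℤ), ∑ i, (f i : ℂ) = k → ∑ i, f i = k := by
    intro f k h; exact_mod_cast h
  have v1g : ∑ i, I.χ i b1 * I.χ i (b1 * b2) = 0 := by have := (q.symm.ip I).vg; rw [q.bb]; exact this
  have main : ∀ (f : Fin I.m → ℤ) (k : ℤ) (A B C : ℂ), (∀ i, (f i : ℂ) =
      A * I.χ i b2 + B * I.χ i (b1 * b2) + C * I.χ i (b2 * s1)) → - B * 3 = k → ∑ i, f i * p2 i = k := by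
    intro f k A B C h h'
    apply cast
    push_cast
    have : ∀ i, (f i : ℂ) * p2 i = A / 3 * (I.χ i b1 * I.χ i b2) + B / 3 * (I.χ i b1 * I.χ i (b1 * b2)) +
      C / 3 * (I.χ i b1 * I.χ i (b2 * s1)) - A / 3 * (I.χ i b2 * I.χ i (b1 * b2)) - B / 3 * (I.χ i (b1 * b2) * I.χ i (b1 * b2))
      - C / 3 * (I.χ i (b1 * b2) * I.χ i (b2 * s1)) := by
      intro i; rw [h, hp]; ring
    rw [Finset.sum_congr rfl (fun i _ => this i)]
    simp only [Finset.sum_add_distrib, Finset.sum_sub_distrib, ← Finset.mul_sum]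
    rw [p.v12, v1g, p.v1w, p.vg, p.gg, p.gw, ← h']; ring
  have e : ∀ i, ((f1 i + fs i - f2 i + 3 * p2 i : ℤ) : ℂ) = I.χ i b1 := by
    intro i
    push_cast
    rw [(hf i).1, (hf i).2.1, (hf i).2.2, hp]; ring
  have castQ : ∀ (f : Fin I.m → ℚ), ∑ i, (f i : ℂ) = 0 → ∑ i, f i = 0 := by
    intro f h; exact_mod_cast h
  have mainz : ∀ (f : Fin I.m → ℚ) (A B : ℂ), (∀ i, (f i : ℂ) =
      A * I.χ i b2 + B * I.χ i (b1 * b2)) →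
      ∑ i, f i * (((f1 i + fs i - f2 i + 3 * p2 i : ℤ) : ℚ) ^ 2 / ((I.d i : ℤ) : ℚ)) = 0 := by
    intro f A B h
    apply castQ
    have : ∀ i, ((f i * (((f1 i + fs i - f2 i + 3 * p2 i : ℤ) : ℚ) ^ 2 / ((I.d i : ℤ) : ℚ)) : ℚ) : ℂ) =
      A * (I.χ i b1 * I.χ i b1 * I.χ i b2 / I.d i) + B * (I.χ i b1 * I.χ i b1 * I.χ i (b1 * b2) / I.d i) := by
      intro i
      rw [Rat.cast_mul, Rat.cast_div, Rat.cast_pow, Rat.cast_intCast, e, h]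
      push_cast
      ring
    rw [Finset.sum_congr rfl (fun i _ => this i)]
    simp only [Finset.sum_add_distrib, ← Finset.mul_sum]
    rw [p.t1, p.t2]; ring
  exact
  { m1 := main _ _ (1 / 6) (2 / 6) (3 / 6) (fun i => by rw [(hf i).1]; ring) (by norm_num)
    ms := main _ _ (1 / 6) (2 / 6) (-3 / 6) (fun i => by rw [(hf i).2.1]; ring) (by norm_num)
    m2 := main _ _ (1 / 3) (-1 / 3) 0 (fun i => by rw [(hf i).2.2]; ring) (by norm_num)
    z2 := mainz (fun i => (f2 i : ℚ)) (1 / 3) (-1 / 3) (fun i => by rw [Rat.cast_intCast, (hf i).2.2]; ring)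
    z1 := mainz (fun i => (f1 i : ℚ) + fs i) (1 / 3) (2 / 3) (fun i => by
      rw [Rat.cast_add, Rat.cast_intCast, Rat.cast_intCast, (hf i).1, (hf i).2.1]; ring) }

/-- linear character from degree one -/
theorem A8 : ∃ l l' : K →* ℂ, l b1 = 1 ∧ l b2 = 1 ∧ l s1 = 1 ∧ l s2 = -1 ∧
    l' b1 = 1 ∧ l' b2 = 1 ∧ l' s1 = -1 ∧ l' s2 = 1 := by
  obtain ⟨I⟩ := exists_irr K
  obtain ⟨f1, fs, f2, hf⟩ := q.half_int I
  obtain ⟨p1, ps, p2, hp'⟩ := q.symm.half_int I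
  have hp := hp'
  unfold HF at hp; rw [← q.bb] at hp
  have p := q.ip I
  have p' := q.symm.ip I
  have M : MutData (fun i => (I.d i : ℤ)) f1 fs f2 p1 ps p2 := q.mutData hf (fun i => (hp i).2.2)
  have M' : MutData (fun i => (I.d i : ℤ)) p1 ps p2 f1 fs f2 := q.symm.mutData hp' (fun i => by rw [← q.bb]; exact (hf i).2.2)
  have h11 : ∑ i, f1 i * p1 i = 1 := by
    have : ((∑ i, f1 i * p1 i : ℤ) : ℂ) = 1 := by
      push_cast
      have e : ∀ i, (f1 i : ℂ) * p1 i = (1 / 36) * (I.χ i b1 * I.χ i b2) + (2 / 36) * (I.χ i b2 * I.χ i (b1 * b2)) +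
        (3 / 36) * (I.χ i b2 * I.χ i (b1 * s2)) + (2 / 36) * (I.χ i b1 * I.χ i (b2 * b1)) + (4 / 36) * (I.χ i (b1 * b2) * I.χ i (b1 * b2)) +
        (6 / 36) * (I.χ i (b2 * b1) * I.χ i (b1 * s2)) + (3 / 36) * (I.χ i b1 * I.χ i (b2 * s1)) + (6 / 36) * (I.χ i (b1 * b2) * I.χ i (b2 * s1))
        + (9 / 36) * (I.χ i (b1 * s2) * I.χ i (b2 * s1)) := by
        intro i
        rw [(hf i).1, (hp i).1, ← q.bb]; ring
      rw [Finset.sum_congr rfl (fun i _ => e i)]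
      simp only [Finset.sum_add_distrib, ← Finset.mul_sum]
      rw [p.v12, p.vg, p'.v1w, p'.vg, p.gg, p'.gw, p.v1w, p.gw, p.ww']; norm_num
    exact_mod_cast this
  obtain ⟨j, j', ⟨a1, a2, a3, a4, a5, a6, a7⟩, ⟨c1, c2, c3, c4, c5, c6, c7⟩⟩ :=
    char_comb (n := fun i => (I.d i : ℤ)) (i0 := I.i0) (fun i => by exact_mod_cast I.pos i) (by exact_mod_cast I.d0) (q.halfData hf)
      (q.symm.halfData hp') M M' (fun i => by
        have : ((f1 i + fs i - f2 i : ℤ) : ℂ) = ((p1 i + ps i - p2 i : ℤ) : ℂ) := by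
          push_cast
          rw [(hf i).1, (hf i).2.1, (hf i).2.2, (hp i).1, (hp i).2.1, (hp i).2.2]; ring
        exact_mod_cast this) h11
  obtain ⟨l, hl⟩ := linear (I := I) j (by exact_mod_cast a1)
  obtain ⟨l', hl'⟩ := linear (I := I) j' (by exact_mod_cast c1)
  have F := hf j
  have Q := hp j
  have F' := hf j'
  have Q' := hp j'
  rw [a2, a3, a4] at F
  rw [a5, a6, a7] at Q
  rw [c2, c3, c4] at F'
  rw [c5, c6, c7] at Q'
  have k : ∀ (v g w A B C : ℂ), A = (v + 2 * g + 3 * w) / 6 ∧ B = (v + 2 * g - 3 * w) / 6 ∧ C = (v - g) / 3 → v = A + B + 2 * C ∧ w = A - B := by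
    rintro v g w A B C ⟨h1, h2, h3⟩
    rw [h1, h2, h3]; constructor <;> ring
  obtain ⟨u1, u2⟩ := k _ _ _ _ _ _ F
  obtain ⟨u3, u4⟩ := k _ _ _ _ _ _ Q
  obtain ⟨u5, u6⟩ := k _ _ _ _ _ _ F'
  obtain ⟨u7, u8⟩ := k _ _ _ _ _ _ Q'
  rw [← hl] at u1 u2 u3 u4
  rw [← hl'] at u5 u6 u7 u8
  rw [map_mul] at u2 u4 u6 u8
  norm_num at u1 u3 u5 u7
  rw [u1] at u2
  rw [u3] at u4
  rw [u5] at u6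
  rw [u7] at u8
  norm_num at u2 u4 u6 u8
  exact ⟨l, l', u3, u1, u2, u4, u7, u5, u6, u8⟩
end Q8
end A8
theorem comm_of_conj {G : Type*} [Group G] {g x : G} (h : g * x * g⁻¹ = x) : g * x = x * g := by
  rw [mul_inv_eq_iff_eq_mul] at h; exact h
theorem conj_of_comm {G : Type*} [Group G] {g x : G} (h : g * x = x * g) : g * x * g⁻¹ = x := by
  rw [mul_inv_eq_iff_eq_mul]; exact h
namespace Setup
variable {G : Type*} [Group G] [Finite G] {S : Setup G}
theorem el_eq {p z b p' z' b' : T3} (h : S.α (el p z b) = S.α (el p' z' b')) : p = p' ∧ z = z' ∧ b = b' :=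
  el_inj (S.inj h)
theorem D_el : S.D = S.α (el 0 1 0) := rfl
theorem E_act {e : G} (he : e ∈ S.E) (p z b : T3) : e * S.α (el p z b) * e⁻¹ = S.α (el p z b) :=
  conj_of_comm (S.E_comm _ he _ (S.α_E.2 (el_mem _ _ _)))
theorem U_form {g : G} (h : g ∈ S.U) : g ∈ S.E ∨ ∃ e ∈ S.E, g = S.t * e := by
  obtain ⟨x, hx, rfl⟩ := S.mem_U.1 h
  rcases mem_Et x hx.1 hx.2 with h | h
  · exact Or.inl (S.α_E.2 h)
  · refine Or.inr ⟨S.α (tt * x), S.α_E.2 h, ?_⟩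
    rw [map_mul, ← mul_assoc]
    have : S.t * S.α tt = 1 := S.tt_sq
    rw [this, one_mul]

/-- normaliser elements centralising `D` and `d3` -/
theorem fix2 {n : G} (hn : Nz S.E n) (h4 : n * S.D * n⁻¹ = S.D) (h3 : n * S.α (el 0 0 1) * n⁻¹ = S.α (el 0 0 1)) :
    n ∈ S.E ∨ ∃ e ∈ S.E, n = S.t * e := by
  obtain ⟨x, hx, rfl⟩ := S.NE_X hn (comm_of_conj h4)
  have h := C_el_R 0 1 (by decide) x (S.α_comm.1 (comm_of_conj h3))
  exact U_form (S.α_U.2 h)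
theorem K4.pair (K : S.K4) {n : G} (hn : Nz S.E n) :
    (n * S.D * n⁻¹ = S.D ∧ ∃ q, n * S.α (el 0 0 1) * n⁻¹ = S.α (el q (q * q) 1)) ∨
    (∃ p, n * S.D * n⁻¹ = S.α (el p (p * p) 1) ∧ n * S.α (el 0 0 1) * n⁻¹ = S.D) ∨
    (∃ p q, n * S.D * n⁻¹ = S.α (el p (p * p) 1) ∧ n * S.α (el 0 0 1) * n⁻¹ = S.α (el q (q * q) 1)) := by
  have h0 := K.cls' hn 0
  rw [show S.α (el 0 (0 * 0) 1) = S.α (el 0 0 1) from rfl] at h0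
  rcases K.cls n hn with h | ⟨p, h⟩
  · left
    refine ⟨h, ?_⟩
    rcases h0 with h0 | h0
    · exfalso
      have := h.trans h0.symm
      have h2 := S.inj (mul_left_cancel (mul_right_cancel this))
      exact absurd h2 (by decide)
    · exact h0
  · rcases h0 with h0 | ⟨q, h0⟩
    · exact Or.inr (Or.inl ⟨p, h, h0⟩)
    · exact Or.inr (Or.inr ⟨p, q, h, h0⟩)
theorem K4.fix_b2 (K : S.K4) {n : G} (hn : Nz S.E n) (h : n * S.α (el 0 1 (-1)) * n⁻¹ = S.α (el 0 1 (-1))) :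
    n * S.D * n⁻¹ = S.D ∧ n * S.α (el 0 0 1) * n⁻¹ = S.α (el 0 0 1) := by
  have e : S.α (el 0 1 (-1)) = S.D * (S.α (el 0 0 1))⁻¹ := by
    rw [D_el, S.el_inv', S.el_add]; rfl
  rw [e, conj_mul', conj_inv'] at h
  rcases K.pair hn with ⟨h4, q, h3⟩ | ⟨p, h4, h3⟩ | ⟨p, q, h4, h3⟩
  · rw [h4] at h
    exact ⟨h4, inv_injective (mul_left_cancel h)⟩
  · rw [h4, h3, D_el, S.el_inv', S.el_inv', S.el_add, S.el_add] at h
    exact absurd (el_eq h).2.2 (by decide)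
  · rw [h4, h3, D_el, S.el_inv', S.el_inv', S.el_add, S.el_add] at h
    exact absurd (el_eq h).2.2 (by decide)

/-- the centraliser of `c` in the normaliser -/
theorem K4.Nc (K : S.K4) {r : G} (hr : S.RD r) {n : G} (hn : Nz S.E n) (h : n * S.α (el 0 1 1) * n⁻¹ = S.α (el 0 1 1)) :
    ∃ e ∈ S.E, n = e ∨ n = S.t * e ∨ n = r * e ∨ n = r * S.t * e := by
  have e : S.α (el 0 1 1) = S.D * S.α (el 0 0 1) := by
    rw [D_el, S.el_add]; rfl
  rw [e, conj_mul'] at h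
  rcases K.pair hn with ⟨h4, q, h3⟩ | ⟨p, h4, h3⟩ | ⟨p, q, h4, h3⟩
  · rw [h4] at h
    rcases fix2 hn h4 (mul_left_cancel h) with h | ⟨e, he, h⟩
    · exact ⟨n, h, Or.inl rfl⟩
    · exact ⟨e, he, Or.inr (Or.inl h)⟩
  · rw [h4, h3, D_el, S.el_add, S.el_add] at h
    have hp : p = 0 := by have := (el_eq h).1; simpa using this
    subst hp
    have k4 : (r * n) * S.D * (r * n)⁻¹ = S.D := by
      rw [conj_conj', h4, hr.act]; rfl
    have k3 : (r * n) * S.α (el 0 0 1) * (r * n)⁻¹ = S.α (el 0 0 1) := by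
      rw [conj_conj', h3, D_el, hr.act]
    have rr : ∀ x, r * (r * x) = x := fun x => by rw [← mul_assoc, hr.sq, one_mul]
    rcases fix2 (hr.nz.mul hn) k4 k3 with h | ⟨e, he, h⟩
    · exact ⟨_, h, Or.inr (Or.inr (Or.inl (rr n).symm))⟩
    · exact ⟨e, he, Or.inr (Or.inr (Or.inr (by rw [mul_assoc, ← h, rr])))⟩
  · rw [h4, h3, D_el, S.el_add, S.el_add] at h
    exact absurd (el_eq h).2.2 (by decide)
theorem K4.Nc_act (K : S.K4) {r : G} (hr : S.RD r) {n : G} (hn : Nz S.E n) (h : n * S.α (el 0 1 1) * n⁻¹ = S.α (el 0 1 1)) :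
    (n ∈ S.E ∧ ∀ p z b, n * S.α (el p z b) * n⁻¹ = S.α (el p z b)) ∨
    ((∃ e ∈ S.E, n = S.t * e) ∧ ∀ p z b, n * S.α (el p z b) * n⁻¹ = S.α (el (-p) z b)) ∨
    ((∃ e ∈ S.E, n = r * e) ∧ ∀ p z b, n * S.α (el p z b) * n⁻¹ = S.α (el p b z)) ∨
    ((∃ e ∈ S.E, n = r * S.t * e) ∧ ∀ p z b, n * S.α (el p z b) * n⁻¹ = S.α (el (-p) b z)) := by
  obtain ⟨e, he, rfl | rfl | rfl | rfl⟩ := K.Nc hr hn h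
  · exact Or.inl ⟨he, E_act he⟩
  · exact Or.inr (Or.inl ⟨⟨e, he, rfl⟩, fun p z b => by rw [conj_conj', E_act he, t_act]⟩)
  · exact Or.inr (Or.inr (Or.inl ⟨⟨e, he, rfl⟩, fun p z b => by rw [conj_conj', E_act he, hr.act]⟩))
  · exact Or.inr (Or.inr (Or.inr ⟨⟨e, he, rfl⟩, fun p z b => by rw [conj_conj', E_act he, conj_conj', t_act, hr.act]⟩))
theorem RD.ND_b2 {r : G} (hr : S.RD r) : S.ND (S.α (el 0 1 (-1))) := by
  apply S.ND_of_real (x := r)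
  rw [hr.act, S.el_inv']; rfl
theorem K4.ND_c (K : S.K4) : S.ND (S.α (el 0 1 1)) := by
  have key : ∀ n, Nz S.E n → ∀ z : T3, z ≠ 0 → n * S.α (el 0 1 1) * n⁻¹ ≠ S.α (el 0 z 0) := by
    intro n hn z hz h
    have h1 : n⁻¹ * S.α (el 0 z 0) * n⁻¹⁻¹ = S.α (el 0 1 1) := by rw [← h]; simp [mul_assoc]
    have h2 : ∃ w : T3, n⁻¹ * S.D * n⁻¹⁻¹ = S.α (el 0 w w) := by
      have : z = 1 ∨ z = -1 := (show ∀ z : T3, z ≠ 0 → z = 1 ∨ z = -1 by decide) z hz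
      rcases this with rfl | rfl
      · exact ⟨1, h1⟩
      · refine ⟨-1, ?_⟩
        have e : S.D = (S.α (el 0 (-1) 0))⁻¹ := by rw [S.el_inv']; rfl
        rw [e, conj_inv', h1, S.el_inv']; rfl
    obtain ⟨w, hw⟩ := h2
    rcases K.cls _ hn.inv with h3 | ⟨p, h3⟩
    · rw [h3, D_el] at hw
      have := el_eq hw
      rw [← this.2.1] at this
      exact absurd this.2.2 (by decide)
    · rw [h3] at hw
      obtain ⟨rfl, h5, h6⟩ := el_eq hw
      rw [← h5] at h6
      exact absurd h6 (by decide)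
  intro g
  constructor
  · intro h
    obtain ⟨n, hn, h2⟩ := S.fus (S.α_E.2 (el_mem 0 1 1)) (h := g) (by rw [h]; exact S.D_mem)
    exact key n hn 1 (by decide) (by rw [h2, h]; rfl)
  · intro h
    obtain ⟨n, hn, h2⟩ := S.fus (S.α_E.2 (el_mem 0 1 1)) (h := g) (by rw [h]; exact S.E.inv_mem S.D_mem)
    exact key n hn (-1) (by decide) (by rw [h2, h, D_el, S.el_inv']; rfl)
theorem α_ne {x : X0} (h : x ≠ 1) : S.α x ≠ 1 := by
  intro hh; exact h (S.inj (by rw [hh, map_one]))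
theorem K4.syl_c (K : S.K4) : IsSylowIn 3 S.E (CC (S.α (el 0 1 1))) :=
  S.sylE (S.α_E.2 (el_mem 0 1 1)) (α_ne (by decide)) K.ND_c
theorem K4.C_b2 (K : S.K4) {r : G} (hr : S.RD r) : CC (S.α (el 0 1 (-1))) ≤ S.U :=
  S.mini (by decide) hr.ND_b2 (fun n hn h => comm_of_conj (K.fix_b2 hn (conj_of_comm h)).1)
theorem b1_to_b2 : ∃ x y : X0, x.c = 0 ∧ y.c = 0 ∧ ∃ p z b, x * el 1 0 0 * x⁻¹ = el p z b ∧ y * el p b z * y⁻¹ = el 0 1 (-1) := by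
  have : ∃ j k : T3, ∃ p z b : T3, (mk0 0 j 0) * el 1 0 0 * (mk0 0 j 0)⁻¹ = el p z b ∧ mk0 0 k 0 * el p b z * (mk0 0 k 0)⁻¹ = el 0 1 (-1) := by decide +kernel
  obtain ⟨j, k, p, z, b, h⟩ := this
  exact ⟨_, _, rfl, rfl, p, z, b, h⟩
end Setup
theorem card_of_bij {G : Type*} [Group G] {K : Subgroup G} {ι : Type*} [Fintype ι] (f : ι → G)
    (hf : Function.Injective f) (C : Subgroup K) (h : ∀ k : K, k ∈ C ↔ ∃ i, f i = k) (hK : ∀ i, f i ∈ K) :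
    Nat.card C = Fintype.card ι := by
  rw [← Nat.card_eq_fintype_card]
  symm
  apply Nat.card_eq_of_bijective (fun i => (⟨⟨f i, hK i⟩, (h _).2 ⟨i, rfl⟩⟩ : C))
  constructor
  · intro i j hij
    apply hf
    simpa using hij
  · rintro ⟨k, hk⟩
    obtain ⟨i, hi⟩ := (h k).1 hk
    exact ⟨i, by ext; exact hi⟩
theorem T3.cases (z : T3) : z = 0 ∨ z = 1 ∨ z = -1 := (show ∀ z : T3, z = 0 ∨ z = 1 ∨ z = -1 by decide) z
namespace Setup
variable {G : Type*} [Group G] [Finite G] {S : Setup G}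

def c (S : Setup G) : G := S.α (el 0 1 1)
def f9 (S : Setup G) (p z : T3) : G := S.α (el p z (-z))
theorem f9_E (p z : T3) : S.f9 p z ∈ S.E := S.α_E.2 (el_mem _ _ _)
theorem c_E : S.c ∈ S.E := S.α_E.2 (el_mem _ _ _)
theorem f9_mul (p z p' z' : T3) : S.f9 p z * S.f9 p' z' = S.f9 (p + p') (z + z') := by
  unfold f9; rw [S.el_add]; congr 2; ring
theorem f9_inv (p z : T3) : (S.f9 p z)⁻¹ = S.f9 (-p) (-z) := by
  unfold f9; rw [S.el_inv']
theorem f9_inj {p z p' z' : T3} (h : S.f9 p z = S.f9 p' z') : p = p' ∧ z = z' := ⟨(el_eq h).1, (el_eq h).2.1⟩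
theorem f9_0 : S.f9 0 0 = 1 := by
  have h := S.f9_mul 0 0 0 0
  simpa using h
theorem mem_E_el {g : G} (h : g ∈ S.E) : ∃ p z b, g = S.α (el p z b) := by
  obtain ⟨x, hx, rfl⟩ := S.mem_E.1 h
  exact ⟨_, _, _, congrArg S.α (mem_E0_el hx)⟩
theorem el_c (p z b : T3) : ∃ k, S.α (el p z b) = S.α (el 0 k k) * S.f9 p (z - k) ∧ (k = 0 → b = -z) := by
  refine ⟨-(z+b), ?_, ?_⟩
  · unfold f9; rw [S.el_add]
    have : ∀ p z b : T3, el p z b = el (0 + p) (-(z+b) + (z - -(z+b))) (-(z+b) + -(z - -(z+b))) := by decide +kernel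
    rw [← this]
  · revert z b; decide
theorem c_pow (k : T3) : S.α (el 0 k k) = 1 ∨ S.α (el 0 k k) = S.c ∨ S.α (el 0 k k) = S.c⁻¹ := by
  rcases T3.cases k with rfl | rfl | rfl
  · left; rw [← S.α.map_one]; rfl
  · right; left; rfl
  · right; right; unfold c; rw [S.el_inv']; rfl

theorem E_split {e : G} (h : e ∈ S.E) : ∃ i, (i = 1 ∨ i = S.c ∨ i = S.c⁻¹) ∧ ∃ p z, e = i * S.f9 p z := by
  obtain ⟨p, z, b, rfl⟩ := mem_E_el h
  obtain ⟨k, hk, -⟩ := el_c (S := S) p z b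
  exact ⟨_, c_pow k, _, _, hk⟩
theorem nz_of_f9 {g : G} (hc : g * S.c = S.c * g) (h : ∀ p z, g * S.f9 p z * g⁻¹ ∈ S.E) : Nz S.E g := by
  apply Nz.of_finite
  intro e he
  obtain ⟨i, hi, p, z, rfl⟩ := E_split he
  rw [conj_mul']
  refine S.E.mul_mem ?_ (h p z)
  have h1 : g * S.c * g⁻¹ = S.c := conj_of_comm hc
  rcases hi with rfl | rfl | rfl
  · simp
  · rw [h1]; exact c_E
  · rw [conj_inv', h1]; exact S.E.inv_mem c_E
theorem t_c : S.t * S.c = S.c * S.t := comm_of_conj (by unfold c; rw [t_act]; rfl)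
theorem RD.r_c {r : G} (hr : S.RD r) : r * S.c = S.c * r := comm_of_conj (by unfold c; rw [hr.act])
theorem RD.ne {r : G} (hr : S.RD r) : r ∉ S.E := by
  intro h
  have := E_act h 0 1 0
  rw [hr.act] at this
  exact absurd (el_eq this).2.1 (by decide)
theorem t_nE : S.t ∉ S.E := by
  intro h
  have := E_act h 1 0 0
  rw [t_act] at this
  exact absurd (el_eq this).1 (by decide)

section
variable (K : S.K4) {r : G} (hr : S.RD r)
include K hr
theorem K4.C_b1 {g : G} (hg : g * S.f9 1 0 = S.f9 1 0 * g) : Nz S.E g := by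
  obtain ⟨x, y, hx, hy, p, z, b, h1, h2⟩ := b1_to_b2
  set n := S.α y * (r * S.α x) with hn
  have nE : Nz S.E n := (S.X_NE hy).mul (hr.nz.mul (S.X_NE hx))
  have e : n * S.f9 1 0 * n⁻¹ = S.α (el 0 1 (-1)) := by
    rw [hn, conj_conj', conj_conj', f9, neg_zero, S.α_conj, h1, hr.act, S.α_conj, h2]
  have h3 : n * g * n⁻¹ ∈ CC (S.α (el 0 1 (-1))) := by
    rw [← e, mem_CC]
    have := congrArg (fun u => n * u * n⁻¹) hg
    simpa only [conj_mul'] using this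
  have h4 := S.U_nz (K.C_b2 hr h3)
  have h5 := (nE.inv.mul h4).mul nE
  have e2 : n⁻¹ * (n * g * n⁻¹) * n = g := by simp [mul_assoc]
  rwa [e2] at h5
theorem K4.C_f9 {g : G} (hc : g * S.c = S.c * g) {p z : T3} (h0 : ¬ (p = 0 ∧ z = 0))
    (hg : g * S.f9 p z = S.f9 p z * g) : Nz S.E g := by
  by_cases hp : p = 0
  · subst hp
    have : g * S.f9 0 1 = S.f9 0 1 * g := by
      rcases T3.cases z with rfl | rfl | rfl
      · simp at h0
      · exact hg
      · have h := S.f9_inv 0 1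
        rw [neg_zero] at h
        rw [← h] at hg
        exact (Commute.inv_right_iff.1 (show Commute g _ from hg)).eq
    exact S.U_nz (K.C_b2 hr this)
  by_cases hz : z = 0
  · subst hz
    have : g * S.f9 1 0 = S.f9 1 0 * g := by
      rcases T3.cases p with rfl | rfl | rfl
      · simp at h0
      · exact hg
      · have h := S.f9_inv 1 0
        rw [neg_zero] at h
        rw [← h] at hg
        exact (Commute.inv_right_iff.1 (show Commute g _ from hg)).eq
    exact K.C_b1 hr this
  have hE : S.E ≤ CC S.c ⊓ CC (S.f9 p z) := le_inf (S.E_le_CC c_E) (S.E_le_CC (f9_E _ _))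
  have := S.NC (K.syl_c.mono inf_le_left hE) (by
    rintro n ⟨n1, n2⟩ hn
    have h3 := conj_of_comm n2
    unfold f9 at h3
    have h4 : ∀ z : T3, z ≠ 0 → -z ≠ z := by decide
    rcases K.Nc_act hr hn (conj_of_comm n1) with h | ⟨-, h⟩ | ⟨-, h⟩ | ⟨-, h⟩
    · exact h.1
    · rw [h] at h3; exact absurd (el_eq h3).1 (h4 p hp)
    · rw [h] at h3; exact absurd (el_eq h3).2.1 (h4 z hz)
    · rw [h] at h3; exact absurd (el_eq h3).1 (h4 p hp))
  exact Nz.of_mem (this ⟨hc, hg⟩)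
theorem K4.L_fus {g : G} (hc : g * S.c = S.c * g) {p z : T3} (h : g * S.f9 p z * g⁻¹ ∈ S.E) :
    ∃ p' z', (p' = p ∨ p' = -p) ∧ (z' = z ∨ z' = -z) ∧ g * S.f9 p z * g⁻¹ = S.f9 p' z' := by
  obtain ⟨n, n1, n2, n3⟩ := K.syl_c.fusion S.E_comm (f9_E p z) hc h
  rw [← n3]
  rcases K.Nc_act hr n2 (conj_of_comm n1) with ⟨-, h⟩ | ⟨-, h⟩ | ⟨-, h⟩ | ⟨-, h⟩
  · exact ⟨p, z, Or.inl rfl, Or.inl rfl, by unfold f9; rw [h]⟩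
  · exact ⟨-p, z, Or.inr rfl, Or.inl rfl, by unfold f9; rw [h]⟩
  · exact ⟨p, -z, Or.inl rfl, Or.inr rfl, by unfold f9; rw [h]; simp⟩
  · exact ⟨-p, -z, Or.inr rfl, Or.inr rfl, by unfold f9; rw [h]; simp⟩
theorem K4.notri {p1 z1 p z : T3} (h0 : (p1 = 0 ∧ p ≠ 0) ∨ (z1 = 0 ∧ z ≠ 0)) {g g' : G}
    (hg : g * S.c = S.c * g) (hg' : g' * S.c = S.c * g')
    (h : g * S.f9 p1 z1 * g⁻¹ * (g' * S.f9 p1 z1 * g'⁻¹) * S.f9 p z = 1) : False := by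
  set f := S.f9 p1 z1 with hf
  have fE : f ∈ S.E := f9_E _ _
  have hfL : f ∈ CC S.c := S.E_comm _ fE _ c_E
  have c3 : ∀ g, (g * f * g⁻¹) ^ 3 = 1 := fun g => by rw [conj_pow, S.E_cube fE]; simp
  have hL : ∀ g, g ∈ CC S.c → g * f * g⁻¹ ∈ CC S.c := fun g hg =>
    Subgroup.mul_mem _ (Subgroup.mul_mem _ hg hfL) (Subgroup.inv_mem _ hg)
  obtain ⟨r1, h1, r2, h2, h3, h4, h5, -⟩ := tri (x := g * f * g⁻¹) (y := (g' * f * g'⁻¹)⁻¹) (a := (S.f9 p z)⁻¹)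
    K.syl_c S.E_comm (hL g hg) (Subgroup.inv_mem _ (hL g' hg')) (c3 g)
    (by rw [inv_pow, c3, inv_one]) (S.E.inv_mem (f9_E p z)) (S.E_cube (S.E.inv_mem (f9_E p z)))
    (by
      rw [mul_assoc, mul_eq_one_iff_eq_inv, mul_inv_rev] at h
      exact h)
    (by
      intro k hk hk2 ⟨j, hj⟩
      have : Nz S.E k := K.C_f9 hr hk (p := p) (z := z) (by
        rintro ⟨rfl, rfl⟩; simp at h0) (Commute.inv_right_iff.1 (show Commute k _ from hk2)).eq
      exact K.syl_c.mem_of_nz hk this hj)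
  obtain ⟨u, hu, hu2⟩ := h4
  obtain ⟨v, hv, hv2⟩ := h5
  have hu3 : (u * g) * f * (u * g)⁻¹ = r1 := by rw [conj_conj']; exact hu2.symm
  have hv3 : (v * g') * f * (v * g')⁻¹ = r2⁻¹ := by
    rw [conj_conj', hv2]
    simp [mul_assoc]
  obtain ⟨p', z', hp', hz', e1⟩ := K.L_fus hr (g := u * g) (Subgroup.mul_mem (CC S.c) hu hg) (by rw [hu3]; exact h1)
  obtain ⟨p'', z'', hp'', hz'', e2⟩ := K.L_fus hr (g := v * g') (Subgroup.mul_mem (CC S.c) hv hg')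
    (by rw [hv3]; exact S.E.inv_mem h2)
  rw [← hf, hu3] at e1
  rw [← hf, hv3, inv_eq_iff_eq_inv] at e2
  rw [e1, e2, f9_inv, f9_inv, f9_mul] at h3
  obtain ⟨h6, h7⟩ := f9_inj h3
  clear * - h0 h6 h7 hp' hp'' hz' hz''
  rcases h0 with ⟨rfl, hp⟩ | ⟨rfl, hz⟩
  · rcases hp' with rfl | rfl <;> rcases hp'' with rfl | rfl <;> revert hp h6 <;> revert p <;> decide
  · rcases hz' with rfl | rfl <;> rcases hz'' with rfl | rfl <;> revert hz h7 <;> revert z <;> decide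

end
end Setup
theorem one_of_sq_cube {G : Type*} [Group G] {g : G} (h2 : g * g = 1) (h3 : g ^ 3 = 1) : g = 1 := by
  have : g ^ 3 = g * g * g := by rw [pow_succ, sq]
  rw [this, h2, one_mul] at h3; exact h3
namespace Setup
variable {G : Type*} [Group G] [Finite G] {S : Setup G}

structure KK (S : Setup G) (r : G) (K : Subgroup G) : Prop where
  le : ∀ g ∈ K, g * S.c = S.c * g
  f9 : ∀ p z, S.f9 p z ∈ K
  t : S.t ∈ K
  r : r ∈ K
  E : ∀ e ∈ S.E, e ∈ K → ∃ p z, e = S.f9 p z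
  nz : ∀ g, g * S.c = S.c * g → ∀ k ∈ K, g * k * g⁻¹ ∈ K
theorem K4.exists_KK (K : S.K4) {r : G} (hr : S.RD r) : ∃ M, S.KK r M := by
  have hS : IsSylowIn 3 S.E (CC S.c) := K.syl_c
  obtain ⟨m, hm, hm3⟩ := hS.card
  obtain ⟨φ, h1, h2⟩ := transfer_hom hS S.E_comm hm
  have hcc := h2 S.c c_E (fun n hn _ => conj_of_comm hn)
  have hc1 : S.c ≠ 1 := α_ne (by decide)
  have hc : φ ⟨S.c, hS.1 c_E⟩ ≠ 1 := by
    rw [hcc]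
    intro h
    have h3 : orderOf S.c = 3 := orderOf_eq_prime (S.E_cube c_E) hc1
    exact hm3 (h3 ▸ orderOf_dvd_of_pow_eq_one h)
  have sq : ∀ x : CC S.c, x * x = 1 → φ x = 1 := fun x hx =>
    one_of_sq_cube (by rw [← map_mul, hx, map_one]) (S.E_cube (h1 x))
  have fL : ∀ p z, S.f9 p z ∈ CC S.c := fun p z => hS.1 (f9_E p z)
  have hf : ∀ p z, φ ⟨S.f9 p z, fL p z⟩ = 1 := by
    intro p z
    have hg : r * S.t ∈ CC S.c := Subgroup.mul_mem _ hr.r_c t_c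
    have e : (⟨r * S.t, hg⟩ : CC S.c) * ⟨S.f9 p z, fL p z⟩ = ⟨S.f9 p z, fL p z⟩⁻¹ * ⟨r * S.t, hg⟩ := by
      ext
      show r * S.t * S.f9 p z = (S.f9 p z)⁻¹ * (r * S.t)
      rw [← mul_inv_eq_iff_eq_mul, conj_conj', f9_inv]
      unfold f9
      rw [t_act, hr.act]; simp
    have := congrArg φ e
    rw [map_mul, map_mul, map_inv] at this
    rw [S.E_comm _ (S.E.inv_mem (h1 _)) _ (h1 _)] at this
    have h4 := mul_left_cancel this
    apply one_of_sq_cube _ (S.E_cube (h1 _))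
    nth_rewrite 1 [h4]
    simp
  refine ⟨φ.ker.map (CC S.c).subtype, ?_⟩
  have mem : ∀ g, g ∈ φ.ker.map (CC S.c).subtype ↔ ∃ h : g ∈ CC S.c, φ ⟨g, h⟩ = 1 := by
    intro g
    rw [Subgroup.mem_map]
    constructor
    · rintro ⟨x, hx, rfl⟩; exact ⟨x.2, hx⟩
    · rintro ⟨h, hx⟩; exact ⟨_, hx, rfl⟩
  refine ⟨?_, ?_, ?_, ?_, ?_, ?_⟩
  · intro g hg; exact ((mem g).1 hg).1
  · intro p z; exact (mem _).2 ⟨fL p z, hf p z⟩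
  · exact (mem _).2 ⟨t_c, sq _ (Subtype.ext S.tt_sq)⟩
  · exact (mem _).2 ⟨hr.r_c, sq _ (Subtype.ext hr.sq)⟩
  · intro e he hk
    obtain ⟨i, hi, p, z, rfl⟩ := E_split he
    have hi2 : i ∈ φ.ker.map (CC S.c).subtype := by
      have := Subgroup.mul_mem _ hk (Subgroup.inv_mem _ ((mem _).2 ⟨fL p z, hf p z⟩))
      simpa using this
    have nc : S.c ∉ φ.ker.map (CC S.c).subtype := by
      rw [mem]; rintro ⟨_, h⟩; exact hc h
    rcases hi with rfl | rfl | rfl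
    · exact ⟨p, z, by simp⟩
    · exact absurd hi2 nc
    · exact absurd ((Subgroup.inv_mem_iff _).1 hi2) nc
  · intro g hg k hk
    obtain ⟨h3, h4⟩ := (mem k).1 hk
    have hg' : g ∈ CC S.c := hg
    refine (mem _).2 ⟨Subgroup.mul_mem _ (Subgroup.mul_mem _ hg' h3) (Subgroup.inv_mem _ hg'), ?_⟩
    have e : (⟨g * k * g⁻¹, Subgroup.mul_mem _ (Subgroup.mul_mem _ hg' h3) (Subgroup.inv_mem _ hg')⟩ : CC S.c)
      = ⟨g, hg'⟩ * ⟨k, h3⟩ * ⟨g, hg'⟩⁻¹ := rfl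
    rw [e, map_mul, map_mul, h4, mul_one, ← map_mul, mul_inv_cancel, map_one]
theorem f9_t (p z : T3) : S.t * S.f9 p z * S.t⁻¹ = S.f9 (-p) z := by unfold f9; rw [t_act]
theorem f9_f9 (p z p' z' : T3) : S.f9 p z * S.f9 p' z' * (S.f9 p z)⁻¹ = S.f9 p' z' := E_act (f9_E _ _) _ _ _
theorem RD.f9_r {r : G} (hr : S.RD r) (p z : T3) : r * S.f9 p z * r⁻¹ = S.f9 p (-z) := by
  unfold f9; rw [hr.act]; simp

section
variable (K : S.K4) {r : G} (hr : S.RD r) {M : Subgroup G} (hM : S.KK r M)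
include K hr hM

/-- elements of `M` normalising `E` -/
theorem K4.M_form {g : G} (hg : g ∈ M) (hn : Nz S.E g) :
    ∃ p z, g = S.f9 p z ∨ g = S.t * S.f9 p z ∨ g = r * S.f9 p z ∨ g = r * S.t * S.f9 p z := by
  obtain ⟨e, he, h⟩ := K.Nc hr hn (conj_of_comm (hM.le g hg))
  have hi : ∀ u ∈ M, g = u * e → ∃ p z, e = S.f9 p z := by
    intro u hu h
    apply hM.E e he
    have : e = u⁻¹ * g := by rw [h]; simp
    rw [this]; exact M.mul_mem (M.inv_mem hu) hg
  rcases h with h | h | h | h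
  · obtain ⟨p, z, hh⟩ := hi 1 M.one_mem (by simpa using h)
    exact ⟨p, z, Or.inl (h.trans hh)⟩
  · obtain ⟨p, z, hh⟩ := hi _ hM.t h
    exact ⟨p, z, Or.inr (Or.inl (hh ▸ h))⟩
  · obtain ⟨p, z, hh⟩ := hi _ hM.r h
    exact ⟨p, z, Or.inr (Or.inr (Or.inl (hh ▸ h)))⟩
  · obtain ⟨p, z, hh⟩ := hi _ (M.mul_mem hM.r hM.t) h
    exact ⟨p, z, Or.inr (Or.inr (Or.inr (hh ▸ h)))⟩
theorem inj18 {s : G} (hs : s ∉ S.E) : Function.Injective (fun i : Bool × T3 × T3 => (if i.1 then s else 1) * S.f9 i.2.1 i.2.2) := by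
  rintro ⟨i, p, z⟩ ⟨i', p', z'⟩ h
  have hs1 : ∀ p z p' z', s * S.f9 p z = S.f9 p' z' → False := by
    intro p z p' z' h
    apply hs
    have : s = S.f9 p' z' * (S.f9 p z)⁻¹ := by rw [← h]; simp
    rw [this]; exact S.E.mul_mem (f9_E _ _) (S.E.inv_mem (f9_E _ _))
  rcases i <;> rcases i' <;> simp at h
  · obtain ⟨rfl, rfl⟩ := f9_inj h; rfl
  · exact (hs1 _ _ _ _ h.symm).elim
  · exact (hs1 _ _ _ _ h).elim
  · obtain ⟨rfl, rfl⟩ := f9_inj h; rfl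
theorem K4.M_b1 (g : M) : g * ⟨S.f9 1 0, hM.f9 1 0⟩ = ⟨S.f9 1 0, hM.f9 1 0⟩ * g ↔ ∃ p z, (g : G) = S.f9 p z ∨ (g : G) = r * S.f9 p z := by
  rw [Subtype.ext_iff]
  show (g : G) * S.f9 1 0 = S.f9 1 0 * g ↔ _
  constructor
  · intro h
    obtain ⟨p, z, h1⟩ := K.M_form hr hM g.2 (K.C_b1 hr h)
    have h2 := conj_of_comm h
    refine ⟨p, z, ?_⟩
    rcases h1 with h1 | h1 | h1 | h1
    · exact Or.inl h1
    · rw [h1, conj_conj', f9_f9, f9_t] at h2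
      exact absurd (f9_inj h2).1 (by decide)
    · exact Or.inr h1
    · rw [h1, conj_conj', f9_f9, conj_conj', f9_t, hr.f9_r] at h2
      exact absurd (f9_inj h2).1 (by decide)
  · rintro ⟨p, z, h | h⟩
    · rw [h]; exact S.E_comm _ (f9_E _ _) _ (f9_E _ _)
    · apply comm_of_conj
      rw [h, conj_conj', f9_f9, hr.f9_r, neg_zero]
theorem K4.M_b2 (g : M) : g * ⟨S.f9 0 1, hM.f9 0 1⟩ = ⟨S.f9 0 1, hM.f9 0 1⟩ * g ↔ ∃ p z, (g : G) = S.f9 p z ∨ (g : G) = S.t * S.f9 p z := by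
  rw [Subtype.ext_iff]
  show (g : G) * S.f9 0 1 = S.f9 0 1 * g ↔ _
  constructor
  · intro h
    obtain ⟨p, z, h1⟩ := K.M_form hr hM g.2 (K.C_f9 hr (hM.le g g.2) (by decide) h)
    have h2 := conj_of_comm h
    refine ⟨p, z, ?_⟩
    rcases h1 with h1 | h1 | h1 | h1
    · exact Or.inl h1
    · exact Or.inr h1
    · rw [h1, conj_conj', f9_f9, hr.f9_r] at h2
      exact absurd (f9_inj h2).2 (by decide)
    · rw [h1, conj_conj', f9_f9, conj_conj', f9_t, hr.f9_r] at h2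
      exact absurd (f9_inj h2).2 (by decide)
  · rintro ⟨p, z, h | h⟩
    · rw [h]; exact S.E_comm _ (f9_E _ _) _ (f9_E _ _)
    · apply comm_of_conj
      rw [h, conj_conj', f9_f9, f9_t, neg_zero]
theorem K4.M_12 (g : M) : g * (⟨S.f9 1 0, hM.f9 1 0⟩ * ⟨S.f9 0 1, hM.f9 0 1⟩) = (⟨S.f9 1 0, hM.f9 1 0⟩ * ⟨S.f9 0 1, hM.f9 0 1⟩) * g ↔ ∃ p z, (g : G) = S.f9 p z := by
  rw [Subtype.ext_iff]
  show (g : G) * (S.f9 1 0 * S.f9 0 1) = (S.f9 1 0 * S.f9 0 1) * g ↔ _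
  rw [f9_mul]
  constructor
  · intro h
    obtain ⟨p, z, h1⟩ := K.M_form hr hM g.2 (K.C_f9 hr (hM.le g g.2) (by decide) h)
    have h2 := conj_of_comm h
    refine ⟨p, z, ?_⟩
    rcases h1 with h1 | h1 | h1 | h1
    · exact h1
    · rw [h1, conj_conj', f9_f9, f9_t] at h2
      exact absurd (f9_inj h2).1 (by decide)
    · rw [h1, conj_conj', f9_f9, hr.f9_r] at h2
      exact absurd (f9_inj h2).2 (by decide)
    · rw [h1, conj_conj', f9_f9, conj_conj', f9_t, hr.f9_r] at h2
      exact absurd (f9_inj h2).2 (by decide)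
  · rintro ⟨p, z, h⟩
    rw [h]; exact S.E_comm _ (f9_E _ _) _ (f9_E _ _)
theorem if_mem {A : Subgroup G} {s : G} (hs : s ∈ A) (i : Bool) : (if i then s else 1) ∈ A := by
  cases i
  · exact A.one_mem
  · exact hs
theorem K4.Q8 : Q8 (⟨S.f9 1 0, hM.f9 1 0⟩ : M) ⟨S.f9 0 1, hM.f9 0 1⟩ ⟨S.t, hM.t⟩ ⟨r, hM.r⟩ := by
  set b1 : M := ⟨S.f9 1 0, hM.f9 1 0⟩ with hb1
  set b2 : M := ⟨S.f9 0 1, hM.f9 0 1⟩ with hb2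
  set s1 : M := ⟨S.t, hM.t⟩ with hs1
  set s2 : M := ⟨r, hM.r⟩ with hs2
  have cE : ∀ e ∈ S.E, e * (e * e) = 1 := fun e he => by rw [← mul_assoc, ← sq, ← pow_succ, S.E_cube he]
  have b1c : b1 * (b1 * b1) = 1 := Subtype.ext (cE _ (f9_E _ _))
  have b2c : b2 * (b2 * b2) = 1 := Subtype.ext (cE _ (f9_E _ _))
  have s1c : s1 * s1 = 1 := Subtype.ext S.tt_sq
  have s2c : s2 * s2 = 1 := Subtype.ext hr.sq
  have s1b2 : s1 * b2 = b2 * s1 := Subtype.ext (comm_of_conj (by simpa using f9_t (S := S) 0 1))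
  have s2b1 : s2 * b1 = b1 * s2 := Subtype.ext (comm_of_conj (by simpa using hr.f9_r 1 0))
  have mE : ∀ p z, ∃ x : M, (x : G) = S.f9 p z := fun p z => ⟨⟨_, hM.f9 p z⟩, rfl⟩
  have ne1 : ∀ p z : T3, ¬ (p = 0 ∧ z = 0) → S.f9 p z ≠ 1 := by
    intro p z h h1
    rw [← f9_0] at h1
    exact h (f9_inj h1)
  have hex : ∀ (s g : G), (∃ p z, g = S.f9 p z ∨ g = s * S.f9 p z) ↔
      ∃ i : Bool × T3 × T3, (if i.1 then s else 1) * S.f9 i.2.1 i.2.2 = g := by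
    intro s g
    constructor
    · rintro ⟨p, z, h | h⟩
      · exact ⟨(false, p, z), by simp [h]⟩
      · exact ⟨(true, p, z), by simp [h]⟩
    · rintro ⟨⟨i, p, z⟩, h⟩
      rcases i
      · exact ⟨p, z, Or.inl (by simpa using h.symm)⟩
      · exact ⟨p, z, Or.inr (by simpa using h.symm)⟩
  have six : ∀ {a s : M} (x : M), x ∈ CC (a * s) → a * (a * a) = 1 → s * s = 1 → s * a = a * s → x * a = a * x ∧ x * s = s * x := by
    intro a s x hx ha hs has
    have h1 : Commute x (a * s) := hx
    have e3 : (a * s) ^ 3 = s := by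
      rw [(show Commute a s from has.symm).mul_pow, show a ^ 3 = 1 by rw [pow_succ, sq, mul_assoc, ha], one_mul, pow_succ, sq, hs, one_mul]
    have h3 : Commute x s := e3 ▸ h1.pow_right 3
    have h4 : Commute x (a * s * s) := h1.mul_right h3
    rw [mul_assoc, hs, mul_one] at h4
    exact ⟨h4, h3⟩
  refine ⟨b1c, b2c, s1c, s2c, Subtype.ext (S.E_comm _ (f9_E _ _) _ (f9_E _ _)), ?_, s1b2, s2b1, ?_, Subtype.ext hr.comm.symm, ?_, ?_, ?_, ?_, ?_, ?_, ?_, ?_, ?_, ?_, ?_, ?_, ?_, ?_⟩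
  · apply Subtype.ext
    show S.t * S.f9 1 0 = (S.f9 1 0)⁻¹ * S.t
    rw [← mul_inv_eq_iff_eq_mul, f9_t, f9_inv, neg_zero]
  · apply Subtype.ext
    show r * S.f9 0 1 = (S.f9 0 1)⁻¹ * r
    rw [← mul_inv_eq_iff_eq_mul, hr.f9_r, f9_inv, neg_zero]
  · intro h; exact ne1 1 0 (by decide) (congrArg Subtype.val h)
  · intro h; exact ne1 0 1 (by decide) (congrArg Subtype.val h)
  · intro h; exact S.t_ne (congrArg Subtype.val h)
  · intro h
    have : r = 1 := congrArg Subtype.val h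
    exact hr.ne (this ▸ S.E.one_mem)
  · rw [card_of_bij _ (inj18 K hr hM hr.ne) (CC b1) (fun k => by rw [mem_CC, hb1, K.M_b1 hr hM, hex])
      (fun i => M.mul_mem (if_mem K hr hM hM.r _) (hM.f9 _ _))]
    simp [T3.fcard]
  · rw [card_of_bij _ (inj18 K hr hM t_nE) (CC b2) (fun k => by rw [mem_CC, hb2, K.M_b2 hr hM, hex])
      (fun i => M.mul_mem (if_mem K hr hM hM.t _) (hM.f9 _ _))]
    simp [T3.fcard]
  · rw [card_of_bij (fun i : T3 × T3 => S.f9 i.1 i.2) (fun i j h => Prod.ext (f9_inj h).1 (f9_inj h).2)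
      (CC (b1 * b2)) (fun k => by
        rw [mem_CC, hb1, hb2, K.M_12 hr hM]
        exact ⟨fun ⟨p, z, h⟩ => ⟨(p, z), h.symm⟩, fun ⟨i, h⟩ => ⟨_, _, h.symm⟩⟩) (fun i => hM.f9 _ _)]
    simp [T3.fcard]
  · rw [card_of_bij (fun i : Bool × T3 => (if i.1 then S.t else 1) * S.f9 0 i.2) ?_ (CC (b2 * s1)) (fun k => ?_)
      (fun i => M.mul_mem (if_mem K hr hM hM.t _) (hM.f9 _ _))]
    · simp [T3.fcard]
    · intro i j h
      have := @inj18 _ _ _ _ K _ hr _ hM _ t_nE (i.1, 0, i.2) (j.1, 0, j.2) h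
      simp at this
      exact Prod.ext this.1 this.2
    · rw [mem_CC]
      constructor
      · intro h
        obtain ⟨h1, h2⟩ := six k h b2c s1c s1b2
        rw [hb2, K.M_b2 hr hM, hex] at h1
        obtain ⟨⟨i, p, z⟩, hk⟩ := h1
        have h3 : (k : G) * S.t = S.t * k := congrArg Subtype.val h2
        have h4 : p = 0 := by
          simp only at hk
          have h5 : S.t * S.f9 p z * S.t⁻¹ = S.f9 p z := by
            have e : S.f9 p z = (if i = true then S.t else 1)⁻¹ * k := by rw [← hk, inv_mul_cancel_left]
            apply conj_of_comm
            rw [e]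
            have c1 : Commute S.t (if i = true then S.t else 1) := by split <;> simp
            exact (c1.inv_right.mul_right h3.symm).eq
          rw [f9_t] at h5
          have := (f9_inj h5).1
          exact (show ∀ p : T3, -p = p → p = 0 by decide) p this
        subst h4
        exact ⟨(i, z), hk⟩
      · rintro ⟨⟨i, z⟩, h⟩
        have h1 : k * b2 = b2 * k := by
          rw [hb2, K.M_b2 hr hM, hex]; exact ⟨(i, 0, z), h⟩
        have h2 : k * s1 = s1 * k := by
          apply Subtype.ext
          show (k : G) * S.t = S.t * k
          rw [← h]
          have c1 : Commute (if i = true then S.t else 1) S.t := by split <;> simp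
          have c2 : Commute S.t (S.f9 0 z) := comm_of_conj (by rw [f9_t, neg_zero])
          exact (c1.mul_left c2.symm).eq
        exact ((show Commute k b2 from h1).mul_right (show Commute k s1 from h2)).eq
  · rw [card_of_bij (fun i : Bool × T3 => (if i.1 then r else 1) * S.f9 i.2 0) ?_ (CC (b1 * s2)) (fun k => ?_)
      (fun i => M.mul_mem (if_mem K hr hM hM.r _) (hM.f9 _ _))]
    · simp [T3.fcard]
    · intro i j h
      have := @inj18 _ _ _ _ K _ hr _ hM _ hr.ne (i.1, i.2, 0) (j.1, j.2, 0) h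
      simp at this
      exact Prod.ext this.1 this.2
    · rw [mem_CC]
      constructor
      · intro h
        obtain ⟨h1, h2⟩ := six k h b1c s2c s2b1
        rw [hb1, K.M_b1 hr hM, hex] at h1
        obtain ⟨⟨i, p, z⟩, hk⟩ := h1
        have h3 : (k : G) * r = r * k := congrArg Subtype.val h2
        have h4 : z = 0 := by
          simp only at hk
          have h5 : r * S.f9 p z * r⁻¹ = S.f9 p z := by
            have e : S.f9 p z = (if i = true then r else 1)⁻¹ * k := by rw [← hk, inv_mul_cancel_left]
            apply conj_of_comm
            rw [e]
            have c1 : Commute r (if i = true then r else 1) := by split <;> simp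
            exact (c1.inv_right.mul_right h3.symm).eq
          rw [hr.f9_r] at h5
          have := (f9_inj h5).2
          exact (show ∀ p : T3, -p = p → p = 0 by decide) z this
        subst h4
        exact ⟨(i, p), hk⟩
      · rintro ⟨⟨i, p⟩, h⟩
        have h1 : k * b1 = b1 * k := by
          rw [hb1, K.M_b1 hr hM, hex]; exact ⟨(i, p, 0), h⟩
        have h2 : k * s2 = s2 * k := by
          apply Subtype.ext
          show (k : G) * r = r * k
          rw [← h]
          have c1 : Commute (if i = true then r else 1) r := by split <;> simp
          have c2 : Commute r (S.f9 p 0) := comm_of_conj (by rw [hr.f9_r, neg_zero])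
          exact (c1.mul_left c2.symm).eq
        exact ((show Commute k b1 from h1).mul_right (show Commute k s2 from h2)).eq
  · intro h hh
    have hh2 : (h : G) * S.f9 1 0 * (h : G)⁻¹ = S.f9 0 1 := congrArg Subtype.val hh
    obtain ⟨p, z, hp, -, h3⟩ := K.L_fus hr (hM.le _ h.2) (p := 1) (z := 0) (by rw [hh2]; exact f9_E _ _)
    rw [hh2] at h3
    rw [← (f9_inj h3).1] at hp
    exact absurd hp (by decide)
  · intro h h' hh
    exact K.notri hr (p1 := 1) (z1 := 0) (p := 0) (z := 1) (by decide) (hM.le _ h.2) (hM.le _ h'.2) (congrArg Subtype.val hh)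
  · intro h h' hh
    refine K.notri hr (p1 := 1) (z1 := 0) (p := 1) (z := 1) (by decide) (hM.le _ h.2) (hM.le _ h'.2) ?_
    have := congrArg Subtype.val hh
    rw [show S.f9 1 1 = S.f9 1 0 * S.f9 0 1 by rw [f9_mul]; rfl]
    exact this
  · intro h h' hh
    exact K.notri hr (p1 := 0) (z1 := 1) (p := 1) (z := 0) (by decide) (hM.le _ h.2) (hM.le _ h'.2) (congrArg Subtype.val hh)
  · intro h h' hh
    refine K.notri hr (p1 := 0) (z1 := 1) (p := 1) (z := 1) (by decide) (hM.le _ h.2) (hM.le _ h'.2) ?_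
    have := congrArg Subtype.val hh
    rw [show S.f9 1 1 = S.f9 1 0 * S.f9 0 1 by rw [f9_mul]; rfl]
    exact this
end

theorem K4.C_c (K : S.K4) {r : G} (hr : S.RD r) {g : G} (hg : g * S.c = S.c * g) : Nz S.E g := by
  classical
  obtain ⟨M, hM⟩ := K.exists_KK hr
  haveI : Fintype M := Fintype.ofFinite M
  obtain ⟨l, l', h1, h2, h3, h4, h1', h2', h3', h4'⟩ := (K.Q8 hr hM).A8
  set M0 : Subgroup G := (l.ker ⊓ l'.ker).map M.subtype with hM0
  have mem : ∀ x, x ∈ M0 ↔ ∃ h : x ∈ M, l ⟨x, h⟩ = 1 ∧ l' ⟨x, h⟩ = 1 := by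
    intro x
    rw [hM0, Subgroup.mem_map]
    constructor
    · rintro ⟨y, hy, rfl⟩; exact ⟨y.2, hy⟩
    · rintro ⟨h, hx⟩; exact ⟨_, hx, rfl⟩
  have fgen : ∀ p z, (⟨S.f9 p z, hM.f9 p z⟩ : M) ∈ l.ker ⊓ l'.ker := by
    have a1 : (⟨S.f9 1 0, hM.f9 1 0⟩ : M) ∈ l.ker ⊓ l'.ker := ⟨h1, h1'⟩
    have a2 : (⟨S.f9 0 1, hM.f9 0 1⟩ : M) ∈ l.ker ⊓ l'.ker := ⟨h2, h2'⟩
    have add : ∀ p z p' z', (⟨S.f9 p z, hM.f9 p z⟩ : M) ∈ l.ker ⊓ l'.ker → (⟨S.f9 p' z', hM.f9 p' z'⟩ : M) ∈ l.ker ⊓ l'.ker →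
        (⟨S.f9 (p + p') (z + z'), hM.f9 _ _⟩ : M) ∈ l.ker ⊓ l'.ker := by
      intro p z p' z' ha hb
      have := Subgroup.mul_mem _ ha hb
      have e : (⟨S.f9 p z, hM.f9 p z⟩ : M) * ⟨S.f9 p' z', hM.f9 p' z'⟩ = ⟨S.f9 (p + p') (z + z'), hM.f9 _ _⟩ :=
        Subtype.ext (f9_mul _ _ _ _)
      rwa [e] at this
    have b1 : ∀ p, (⟨S.f9 p 0, hM.f9 p 0⟩ : M) ∈ l.ker ⊓ l'.ker := by
      intro p
      rcases T3.cases p with rfl | rfl | rfl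
      · exact add _ _ _ _ a1 (add _ _ _ _ a1 a1)
      · exact a1
      · exact add _ _ _ _ a1 a1
    have b2 : ∀ z, (⟨S.f9 0 z, hM.f9 0 z⟩ : M) ∈ l.ker ⊓ l'.ker := by
      intro p
      rcases T3.cases p with rfl | rfl | rfl
      · exact add _ _ _ _ a2 (add _ _ _ _ a2 a2)
      · exact a2
      · exact add _ _ _ _ a2 a2
    intro p z
    have := add _ _ _ _ (b1 p) (b2 z)
    simpa only [add_zero, zero_add] using this
  have fM0 : ∀ p z, S.f9 p z ∈ M0 := fun p z => (mem _).2 ⟨hM.f9 p z, fgen p z⟩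
  have M0M : M0 ≤ M := fun x hx => ((mem x).1 hx).1
  have self : ∀ x ∈ M0, Nz S.E x → x ∈ S.E := by
    intro x hx hn
    obtain ⟨hx1, hx2, hx3⟩ := (mem x).1 hx
    obtain ⟨p, z, h⟩ := K.M_form hr hM hx1 hn
    have k1 : l ⟨S.f9 p z, hM.f9 p z⟩ = 1 := (fgen p z).1
    have k2 : l' ⟨S.f9 p z, hM.f9 p z⟩ = 1 := (fgen p z).2
    rcases h with rfl | rfl | rfl | rfl
    · exact f9_E _ _
    · exfalso
      have e : (⟨S.t * S.f9 p z, hx1⟩ : M) = ⟨S.t, hM.t⟩ * ⟨S.f9 p z, hM.f9 p z⟩ := rfl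
      rw [e, map_mul, k2, h3'] at hx3
      norm_num at hx3
    · exfalso
      have e : (⟨r * S.f9 p z, hx1⟩ : M) = ⟨r, hM.r⟩ * ⟨S.f9 p z, hM.f9 p z⟩ := rfl
      rw [e, map_mul, k1, h4] at hx2
      norm_num at hx2
    · exfalso
      have e : (⟨r * S.t * S.f9 p z, hx1⟩ : M) = ⟨r, hM.r⟩ * ⟨S.t, hM.t⟩ * ⟨S.f9 p z, hM.f9 p z⟩ := rfl
      rw [e, map_mul, map_mul, k1, h3, h4] at hx2
      norm_num at hx2
  have nzE : ∀ x ∈ M, Nz (S.E ⊓ M0) x → Nz S.E x := fun x hx hn =>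
    nz_of_f9 (hM.le x hx) (fun p z => (hn.conj ⟨f9_E p z, fM0 p z⟩).1)
  have sy : IsSylowIn 3 (S.E ⊓ M0) M0 := isSylowIn_of_nz (S.pgE.to_le inf_le_left) inf_le_right
    (fun x hx hn _ => ⟨self x hx (nzE x (M0M hx) hn), hx⟩)
  obtain ⟨Y, hY, hY3, hYn, hYA, -, -⟩ := burnside sy (fun x hx hn a ha =>
    S.E_comm _ (self x hx (nzE x (M0M hx) hn)) _ ha.1)
  have hYb : Y = ⊥ := by
    apply S.sig Y hY3
    intro x hx
    obtain ⟨i, hi, p, z, h⟩ := E_split (S.α_E.2 hx)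
    rw [h]
    refine Nz.mul ?_ (hYn _ (fM0 p z))
    have nc : Nz Y S.c := by
      apply Nz.of_finite
      intro a ha
      rw [conj_of_comm (hM.le a (M0M (hY ha))).symm]; exact ha
    rcases hi with rfl | rfl | rfl
    · exact Nz.of_mem Y.one_mem
    · exact nc
    · exact nc.inv
  have hM0E : ∀ x ∈ M0, x ∈ S.E := by
    intro x hx
    obtain ⟨y, hy, a, ha, rfl⟩ := hYA x hx
    rw [hYb, Subgroup.mem_bot] at hy
    rw [hy, one_mul]; exact ha.1
  have MN : ∀ x ∈ M, Nz S.E x := by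
    intro x hx
    apply nz_of_f9 (hM.le x hx)
    intro p z
    apply hM0E
    have : (⟨x, hx⟩ : M) * ⟨S.f9 p z, hM.f9 p z⟩ * ⟨x, hx⟩⁻¹ ∈ l.ker ⊓ l'.ker :=
      Subgroup.Normal.conj_mem inferInstance _ (fgen p z) _
    exact (mem _).2 ⟨M.mul_mem (M.mul_mem hx (hM.f9 p z)) (M.inv_mem hx), this⟩
  apply nz_of_f9 hg
  intro p z
  have hk := hM.nz g hg _ (hM.f9 p z)
  refine K.syl_c.mem_of_nz (hM.le _ hk) (MN _ hk) (k := 1) ?_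
  rw [conj_pow, pow_one, S.E_cube (f9_E _ _)]; simp
end Setup
namespace X0
/-- the quaternion subgroup of the complement `SL₂(3)` -/
def Q0 : Subgroup X0 where
  carrier := {x | x.p = 0 ∧ x.q = 0 ∧ x.z = 0 ∧ lam x.a x.b x.c x.e = 0}
  mul_mem' := by
    rintro x y ⟨h1, h2, h3, h4⟩ ⟨k1, k2, k3, k4⟩
    refine ⟨?_, ?_, ?_, ?_⟩
    · simp [mul_def, h1, h2, h3, k1, k2, k3]
    · simp [mul_def, h1, h2, h3, k1, k2, k3]
    · simp [mul_def, h1, h2, h3, k1, k2, k3]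
    · have := lam_mul _ _ _ _ _ _ _ _ x.h y.h
      simp only [mul_def]
      rw [this, h4, k4]; rfl
  one_mem' := by decide
  inv_mem' := by
    rintro x ⟨h1, h2, h3, h4⟩
    have h : ∀ x : X0, x.p = 0 ∧ x.q = 0 ∧ x.z = 0 ∧ lam x.a x.b x.c x.e = 0 →
      (x⁻¹).p = 0 ∧ (x⁻¹).q = 0 ∧ (x⁻¹).z = 0 ∧ lam (x⁻¹).a (x⁻¹).b (x⁻¹).c (x⁻¹).e = 0 := by decide +kernel
    exact h x ⟨h1, h2, h3, h4⟩

instance : DecidablePred (· ∈ Q0) := fun x =>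
  inferInstanceAs (Decidable (x.p = 0 ∧ x.q = 0 ∧ x.z = 0 ∧ lam x.a x.b x.c x.e = 0))
theorem C_tt_Q : ∀ x : X0, x * tt = tt * x → x * x * (x * x) * (x * x * (x * x)) * (x * x * (x * x)) = 1 ∧
    (x * x * (x * x) = 1 → x ∈ Q0) := by decide +kernel
theorem Q0_tt : ∀ x : X0, x ∈ Q0 → x * tt = tt * x ∧ x * x * (x * x) = 1 := by decide +kernel
end X0
namespace Setup
variable {G : Type*} [Group G] [Finite G] {S : Setup G}
theorem K4.DtoR (K : S.K4) {g : G} (h : g * S.D * g⁻¹ ∈ S.R) :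
    g * S.D * g⁻¹ = S.D ∨ g * S.D * g⁻¹ = S.α (el 0 0 1) := by
  obtain ⟨n, hn, h1⟩ := S.fus S.D_mem (S.R_le_E h)
  rw [← h1] at h ⊢
  rcases K.cls n hn with h2 | ⟨p, h2⟩
  · exact Or.inl h2
  · right
    rw [h2] at h ⊢
    have : p = 0 := (S.α_R.1 h).2
    rw [this]; rfl
theorem RD.act_D {r : G} (hr : S.RD r) : r * S.D * r⁻¹ = S.α (el 0 0 1) := hr.act 0 1 0
theorem K4.NT (K : S.K4) {r : G} (hr : S.RD r) {g : G} (hn : Nz S.R g) :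
    (g * S.D * g⁻¹ = S.D ∧ g * S.α (el 0 0 1) * g⁻¹ = S.α (el 0 0 1)) ∨
    (g * S.D * g⁻¹ = S.α (el 0 0 1) ∧ g * S.α (el 0 0 1) * g⁻¹ = S.D) := by
  have h1 := K.DtoR (hn.conj (S.α_R.2 (el_R0 1 0)))
  have h2 := K.DtoR (g := g * r) (by
    rw [conj_conj', hr.act_D]; exact hn.conj (S.α_R.2 (el_R0 0 1)))
  rw [conj_conj', hr.act_D] at h2
  have hne : S.D ≠ S.α (el 0 0 1) := fun h => by
    have := S.inj h; revert this; decide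
  have inj : g * S.D * g⁻¹ ≠ g * S.α (el 0 0 1) * g⁻¹ := fun h => hne (by simpa using h)
  rcases h1 with h1 | h1 <;> rcases h2 with h2 | h2
  · exact absurd (h1.trans h2.symm) inj
  · exact Or.inl ⟨h1, h2⟩
  · exact Or.inr ⟨h1, h2⟩
  · exact absurd (h1.trans h2.symm) inj
theorem c_eq : S.c = S.D * S.α (el 0 0 1) := by
  rw [c, D_el, el_add]; rfl
theorem K4.NT_c (K : S.K4) {r : G} (hr : S.RD r) {g : G} (hn : Nz S.R g) : g * S.c = S.c * g := by
  rw [← mul_inv_eq_iff_eq_mul, c_eq, conj_mul']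
  rcases K.NT hr hn with ⟨h1, h2⟩ | ⟨h1, h2⟩ <;> rw [h1, h2]
  exact S.E_comm _ (S.α_E.2 (el_mem _ _ _)) _ S.D_mem
theorem K4.sylR (K : S.K4) {r : G} (hr : S.RD r) : IsSylowIn 3 S.R (CC S.t) := by
  apply S.sylR
  rintro g hg hn ⟨k, hk⟩
  rcases K.NT hr hn with ⟨h1, h2⟩ | ⟨h1, h2⟩
  · exact mul_inv_eq_iff_eq_mul.1 h1
  · exfalso
    -- g swaps, g^2 fixes, and an odd power of g is 1
    have h3 : g ^ 2 * S.D * (g ^ 2)⁻¹ = S.D := by rw [sq, conj_conj', h1, h2]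
    have h4 : g ^ 2 ∈ CC S.D := mul_inv_eq_iff_eq_mul.1 h3
    have ho : Odd (3 ^ k) := Odd.pow (by decide)
    obtain ⟨m, hm⟩ := ho
    have h5 : g * (g ^ 2) ^ m = 1 := by rw [← pow_mul, ← pow_succ', ← hm, hk]
    have h6 : g ∈ CC S.D := by
      rw [mul_eq_one_iff_eq_inv] at h5
      rw [h5]; exact (CC S.D).inv_mem ((CC S.D).pow_mem h4 m)
    rw [mul_inv_eq_iff_eq_mul.2 (mem_CC.1 h6)] at h1
    have := S.inj (h1 : S.α dd = _); revert this; decide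
variable (S) in
def QQ : Subgroup G := Q0.map S.α
variable (S) in
theorem mem_QQ {g : G} : g ∈ S.QQ ↔ ∃ x ∈ Q0, S.α x = g := Iff.rfl
theorem α_QQ {x : X0} : S.α x ∈ S.QQ ↔ x ∈ Q0 :=
  ⟨fun ⟨y, hy, h⟩ => S.inj h ▸ hy, fun h => ⟨x, h, rfl⟩⟩
theorem QQ_T : S.QQ ≤ CC S.t := by
  rintro _ ⟨x, hx, rfl⟩; exact S.α_comm.2 (Q0_tt x hx).1
theorem t_QQ : S.t ∈ S.QQ := α_QQ.2 (by decide)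
theorem cube_mem {Y : Subgroup G} (hY : ¬ 3 ∣ Nat.card Y) {y : G} (hy : y ∈ Y) (h : y ^ 3 = 1) : y = 1 := by
  have h1 : orderOf y ∣ 3 := orderOf_dvd_of_pow_eq_one h
  have h2 : orderOf y ∣ Nat.card Y := Subgroup.orderOf_dvd_natCard Y hy
  rcases (Nat.dvd_prime Nat.prime_three).1 h1 with h3 | h3
  · exact orderOf_eq_one_iff.1 h3
  · exact absurd (h3 ▸ h2) hY

/-- 3'-elements of `C(t) ∩ C(D)` -/
theorem CtD_QQ {Y : Subgroup G} (hY : ¬ 3 ∣ Nat.card Y) {y : G} (hy : y ∈ Y) (ht : y ∈ CC S.t) (hD : y ∈ CC S.D) :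
    y ∈ S.QQ := by
  obtain ⟨x, rfl⟩ := S.cent y hD
  obtain ⟨h1, h2⟩ := C_tt_Q x (S.α_comm.1 ht)
  refine α_QQ.2 (h2 (S.inj ?_))
  rw [map_one]
  apply cube_mem hY
  · rw [map_mul, map_mul]; exact Y.mul_mem (Y.mul_mem hy hy) (Y.mul_mem hy hy)
  · rw [pow_succ, pow_two, ← map_mul, ← map_mul, h1, map_one]
theorem Y_inf_E {Y : Subgroup G} (hY : ¬ 3 ∣ Nat.card Y) {y : G} (hy : y ∈ Y) (hE : y ∈ S.E) : y = 1 :=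
  cube_mem hY hy (S.E_cube hE)

/-- `R`-invariant `3'`-subgroups of `T` -/
theorem K4.T1 (K : S.K4) {r : G} (hr : S.RD r) {Y W : Subgroup G} (hY : ¬ 3 ∣ Nat.card Y) (hYT : Y ≤ CC S.t)
    (hR : ∀ a ∈ S.R, Nz Y a) (ht : S.t ∈ W) (h1 : ∀ y ∈ Y, y ∈ S.QQ → y ∈ W)
    (h2 : ∀ y ∈ Y, r * y * r⁻¹ ∈ S.QQ → y ∈ W) : Y ≤ W := by
  have hT : ∀ z b, S.α (el 0 z b) ∈ S.R := fun z b => (S.α_R.2 (el_R0 z b))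
  have cube : ∀ z b, S.α (el 0 z b) ^ 3 = 1 := fun z b => S.E_cube (S.α_E.2 (el_mem _ _ _))
  have key : ∀ y ∈ Y, Nz S.E y → y ∈ W := by
    intro y hy hn
    have fx : ∀ z b, y * S.α (el 0 z b) * y⁻¹ = S.α (el 0 z b) := by
      intro z b
      have e1 : y * S.α (el 0 z b) * y⁻¹ * (S.α (el 0 z b))⁻¹ ∈ S.E :=
        S.E.mul_mem (hn.conj (S.α_E.2 (el_mem _ _ _))) (S.E.inv_mem (S.α_E.2 (el_mem _ _ _)))
      have e2 : y * S.α (el 0 z b) * y⁻¹ * (S.α (el 0 z b))⁻¹ ∈ Y := by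
        have := Y.mul_mem hy ((hR _ (hT z b)).conj (Y.inv_mem hy))
        simpa [mul_assoc] using this
      exact mul_inv_eq_one.1 (Y_inf_E hY e2 e1)
    rcases fix2 hn (fx 1 0) (fx 0 1) with h | ⟨e, he, rfl⟩
    · rw [Y_inf_E hY hy h]; exact W.one_mem
    · have hc : e * S.t = S.t * e := by
        have := hYT hy
        rw [mem_CC] at this
        rw [mul_assoc] at this
        exact mul_left_cancel this
      have h3 : S.t * e * (S.t * e) = e * e := by
        rw [mul_assoc, ← mul_assoc e, hc, mul_assoc, ← mul_assoc S.t, S.tt_sq, one_mul]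
      have h4 : e * e = 1 := Y_inf_E hY (h3 ▸ Y.mul_mem hy hy) (S.E.mul_mem he he)
      have h5 := S.E_cube he
      rw [pow_succ, pow_two, h4, one_mul] at h5
      rw [h5, mul_one]; exact ht
  have cm : ∀ {f y : G}, f * y * f⁻¹ = y → y * f = f * y := fun h => (mul_inv_eq_iff_eq_mul.1 h).symm
  refine generation hY (σ := S.α (el 0 1 0)) (τ := S.α (el 0 0 1)) ?_ (cube _ _) (cube _ _)
      (hR _ (hT _ _)) (hR _ (hT _ _)) ?_ ?_ ?_ ?_
  · rw [S.α_comm]; decide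
  · intro y hy h
    exact h1 y hy (CtD_QQ hY hy (hYT hy) (cm h))
  · intro y hy h
    apply h2 y hy
    have hY' : ¬ 3 ∣ Nat.card (CJ r Y) := by rw [card_CJ]; exact hY
    refine CtD_QQ hY' (conj_mem_CJ hy) ?_ ?_
    · show _ * _ = _ * _
      rw [← mul_inv_eq_iff_eq_mul]
      have e : r * S.t * r⁻¹ = S.t := mul_inv_eq_iff_eq_mul.2 hr.comm
      have e2 : r * y * r⁻¹ * S.t * (r * y * r⁻¹)⁻¹ = r * (y * (r⁻¹ * S.t * r) * y⁻¹) * r⁻¹ := by simp [mul_assoc]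
      have e3 : r⁻¹ * S.t * r = S.t := by
        rw [mul_assoc, ← hr.comm]; simp
      rw [e2, e3, mul_inv_eq_iff_eq_mul.2 (hYT hy), e]
    · show _ * _ = _ * _
      have e3 : S.D = r * S.α (el 0 0 1) * r⁻¹ := (hr.act 0 0 1).symm
      rw [e3, ← conj_mul', ← conj_mul', cm h]
  · rw [el_add]
    intro y hy h
    exact key y hy (K.C_c hr (cm h))
  · rw [el_add, el_add]
    intro y hy h
    have h6 := K.C_b2 hr (cm h : y ∈ CC (S.α (el 0 1 (-1))))

    exact key _ hy (S.U_nz h6)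
end Setup
namespace X0
abbrev vv : X0 := d3 * ww * d3⁻¹
theorem C_Q0 : ∀ x : X0, x * ww = ww * x → x * vv = vv * x →
    (x = 1 ∨ x = dd ∨ x = dd⁻¹) ∨ x * x * x = tt := by decide +kernel
theorem Q0_inv : ∀ x : X0, x ∈ Q0 → x * x = 1 → x = 1 ∨ x = tt := by decide +kernel
theorem Q0_four : ∀ x : X0, x ∈ Q0 → x = 1 ∨ x = tt ∨ x * x = tt ∧ ∃ i : T3, el 0 0 i * x * (el 0 0 i)⁻¹ = ww ∨
   el 0 0 i * x * (el 0 0 i)⁻¹ = ww⁻¹ := by decide +kernel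
theorem Q0_gen : ∀ x : X0, x ∈ Q0 → ∃ i j : Fin 4, x = ww ^ (i:ℕ) * vv ^ (j:ℕ) := by decide +kernel
theorem Q0_norm : ∀ x : X0, x ∈ Q0 → ∀ i, el 0 0 i * x * (el 0 0 i)⁻¹ ∈ Q0 := by decide +kernel
theorem Q0_cen : ∀ x : X0, x ∈ Q0 → x * ww = ww * x → x * vv = vv * x → x = 1 ∨ x = tt := by decide +kernel
theorem Q0_dd : ∀ x : X0, x ∈ Q0 → dd * x = x * dd := by decide +kernel
def SL (x : X0) : Prop := x.p = 0 ∧ x.q = 0 ∧ x.z = 0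
instance : DecidablePred SL := fun x => inferInstanceAs (Decidable (x.p = 0 ∧ x.q = 0 ∧ x.z = 0))
theorem SL_Q : ∀ x : X0, SL x → ∃ i : Fin 3, ∃ y : T3, el 0 0 y = d3 ^ (i:ℕ) ∧ x * (d3 ^ (i:ℕ))⁻¹ ∈ Q0 := by decide +kernel
theorem R_Q0 : ∀ z b : T3, ∀ x ∈ Q0, el 0 z b * x * (el 0 z b)⁻¹ ∈ Q0 := by decide +kernel
end X0
namespace Setup
variable {G : Type*} [Group G] [Finite G] {S : Setup G}
theorem D_ord : ∀ g ∈ Subgroup.zpowers S.D, g = 1 ∨ g = S.D ∨ g = S.D⁻¹ := by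
  intro g hg
  have h3 : S.D ^ 3 = 1 := S.E_cube S.D_mem
  obtain ⟨n, rfl⟩ := Subgroup.mem_zpowers_iff.1 hg
  have h : S.D ^ n = S.D ^ (n % 3) := by
    conv_lhs => rw [← Int.emod_add_mul_ediv n 3, zpow_add, zpow_mul]
    have : S.D ^ (3:ℤ) = 1 := by exact_mod_cast h3
    rw [this, one_zpow, mul_one]
  rw [h]
  have : n % 3 = 0 ∨ n % 3 = 1 ∨ n % 3 = 2 := by omega
  rcases this with h | h | h <;> rw [h]
  · left; exact zpow_zero _
  · right; left; exact zpow_one _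
  · right; right
    rw [eq_inv_iff_mul_eq_one]
    have : S.D ^ (2:ℤ) = S.D ^ 2 := by exact_mod_cast rfl
    rw [this, ← pow_succ]; exact h3
theorem D_ne : S.D ≠ 1 := fun h => by
  have := S.inj (h.trans (map_one S.α).symm : S.α dd = _); revert this; decide
theorem conj_D {g : G} (h : g * S.D * g⁻¹ ∈ Subgroup.zpowers S.D) : g * S.D = S.D * g := by
  rcases D_ord _ h with h | h | h
  · exact absurd (conj_eq_one_iff.1 h) D_ne
  · exact mul_inv_eq_iff_eq_mul.1 h
  · exact absurd h (S.nonreal g)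

noncomputable def HQ (S : Setup G) : Subgroup G := Subgroup.centralizer (S.QQ : Set G)
theorem mem_HQ {g : G} : g ∈ S.HQ ↔ ∀ x ∈ Q0, g * S.α x = S.α x * g := by
  rw [HQ, Subgroup.mem_centralizer_iff]
  constructor
  · intro h x hx; exact (h _ (α_QQ.2 hx)).symm
  · rintro h _ ⟨x, hx, rfl⟩; exact (h x hx).symm
theorem HQ_X {x : X0} (h : S.α x ∈ S.HQ) : S.α x ∈ Subgroup.zpowers S.D ∨ x * x * x = tt := by
  rcases C_Q0 x (S.α_comm.1 (mem_HQ.1 h ww (by decide))) (S.α_comm.1 (mem_HQ.1 h vv (by decide))) with h | h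
  · left
    rcases h with rfl | rfl | rfl
    · rw [map_one]; exact one_mem _
    · exact Subgroup.mem_zpowers _
    · rw [map_inv]; exact inv_mem (Subgroup.mem_zpowers S.D)
  · exact Or.inr h
theorem t_cube {x : X0} (h2 : x * x * x = tt) {k : ℕ} (hk : S.α x ^ 3 ^ k = 1) : False := by
  apply S.t_3 (k := k)
  rw [t, ← h2, map_mul, map_mul, ← pow_two, ← pow_succ, ← pow_mul, mul_comm, pow_mul, hk, one_pow]
theorem HQ_nz {n : G} (hn : Nz S.QQ n) : Nz S.HQ n := by
  apply Nz.of_finite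
  intro g hg
  rw [HQ, Subgroup.mem_centralizer_iff] at hg ⊢
  intro q hq
  have := hg (n⁻¹ * q * n) (by have := hn.inv.conj hq; simpa using this)
  calc q * (n * g * n⁻¹) = n * ((n⁻¹ * q * n) * g) * n⁻¹ := by simp [mul_assoc]
    _ = _ := by rw [this]; simp [mul_assoc]
theorem R_QQ {a : G} (ha : a ∈ S.R) : Nz S.QQ a := by
  obtain ⟨x, hx, rfl⟩ := S.mem_R.1 ha
  rw [mem_R0_el hx]
  apply Nz.of_finite
  rintro _ ⟨y, hy, rfl⟩
  rw [S.α_conj, α_QQ]; exact R_Q0 _ _ y hy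
theorem RD.ne_t {r : G} (hr : S.RD r) : r ≠ S.t := by
  rintro h
  have h1 := hr.act_D
  rw [h, S.D_el, t_act] at h1
  have := S.inj h1; revert this; decide
theorem QQ_inv {g : G} (hg : g ∈ S.QQ) (h : g * g = 1) : g = 1 ∨ g = S.t := by
  obtain ⟨x, hx, rfl⟩ := hg
  rcases Q0_inv x hx (S.inj (by rw [map_mul, h, map_one])) with rfl | rfl
  · left; exact map_one _
  · right; rfl
theorem K4.HQ_burn (K : S.K4) {r : G} (hr : S.RD r) : IsSylowIn 3 (Subgroup.zpowers S.D) S.HQ ∧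
    ∃ Y : Subgroup G, Y ≤ S.HQ ∧ (∀ h ∈ S.HQ, ∃ y ∈ Y, ∃ a ∈ Subgroup.zpowers S.D, h = y * a) ∧
      (∀ n, Nz S.QQ n → Nz Y n) ∧ Y ≤ CJ r S.QQ := by
  have hcD : ∀ g, g ∈ CC S.D → ∀ a ∈ Subgroup.zpowers S.D, g * a = a * g := by
    intro g hg a ha
    obtain ⟨n, rfl⟩ := Subgroup.mem_zpowers_iff.1 ha
    exact (Commute.zpow_right (show Commute g S.D from hg) n)
  have hDH : Subgroup.zpowers S.D ≤ S.HQ := by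
    rw [Subgroup.zpowers_le, mem_HQ]
    intro x hx; exact S.α_comm.2 (Q0_dd x hx)
  have hDp : IsPGroup 3 (Subgroup.zpowers S.D) := pgroup_zpowers (k := 1) (by rw [pow_one]; exact S.E_cube S.D_mem)
  have hS : IsSylowIn 3 (Subgroup.zpowers S.D) S.HQ := by
    apply isSylowIn_of_nz hDp hDH
    rintro g hg hn ⟨k, hk⟩
    obtain ⟨x, rfl⟩ := S.cent g (conj_D (hn.conj (Subgroup.mem_zpowers _)))
    rcases HQ_X hg with h | h
    · exact h
    · exact (t_cube h hk).elim
  obtain ⟨Y, hYH, hY3, hYn, hYR, -, hYo⟩ := burnside hS (by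
    intro g hg hn a ha
    exact hcD g (conj_D (hn.conj (Subgroup.mem_zpowers _))) a ha)
  have hYT : Y ≤ CC S.t := fun y hy => mem_HQ.1 (hYH hy) tt (by decide)
  have hYnz : ∀ n, Nz S.QQ n → Nz Y n := by
    intro n hn
    apply Nz.of_finite
    intro y hy
    refine hYo _ ((HQ_nz hn).conj (hYH hy)) ?_
    rw [show orderOf (n * y * n⁻¹) = orderOf y from orderOf_injective (MulAut.conj n).toMonoidHom (MulAut.conj n).injective y]
    intro h
    exact hY3 (h.trans (Subgroup.orderOf_dvd_natCard Y hy))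
  have hYQ : Y ≤ CJ r S.QQ := by
    have ht : S.t ∈ CJ r S.QQ := by
      rw [mem_CJ, mul_assoc, ← hr.comm, inv_mul_cancel_left]; exact t_QQ
    refine K.T1 hr hY3 hYT (fun a ha => hYnz a (R_QQ ha)) ht ?_ ?_
    · rintro _ hy ⟨x, hx, rfl⟩
      have h := mem_HQ.1 (hYH hy)
      rcases Q0_cen x hx (S.α_comm.1 (h ww (by decide))) (S.α_comm.1 (h vv (by decide))) with rfl | rfl
      · rw [map_one]; exact one_mem _
      · exact ht
    · intro y hy h
      rw [mem_CJ]; rwa [hr.inv] at h ⊢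
  exact ⟨hS, Y, hYH, hYR, hYnz, hYQ⟩
theorem K4.QQ_comm (K : S.K4) {r : G} (hr : S.RD r) : ∀ x ∈ Q0, r * S.α x * r⁻¹ ∈ S.HQ := by
  obtain ⟨hS, Y, hYH, hYR, hYnz, hYQ⟩ := K.HQ_burn hr
  have hDH := hS.1
  by_cases hc : ∃ y ∈ Y, y ≠ 1 ∧ y ≠ S.t
  · obtain ⟨y, hy, hy1, hyt⟩ := hc
    have hcj : ∀ q i, r * S.α q * r⁻¹ ∈ Y → r * S.α (el 0 0 i * q * (el 0 0 i)⁻¹) * r⁻¹ ∈ Y := by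
      intro q i h
      have := (hYnz _ (R_QQ (S.α_R.2 (el_R0 i 0)))).conj h
      rw [← hr.act 0 0 i] at this
      rw [map_mul, map_mul, map_inv]
      simpa [mul_assoc] using this
    obtain ⟨q, hq, hqy⟩ := mem_CJ.1 (hYQ hy)
    have hqy' : r * S.α q * r⁻¹ = y := by rw [hqy]; simp [mul_assoc]
    rcases Q0_four q hq with rfl | rfl | ⟨-, i, h⟩
    · exact absurd (by rw [← hqy']; simp) hy1
    · exact absurd (by rw [← hqy']; exact mul_inv_eq_iff_eq_mul.2 hr.comm) hyt
    · have h0 := hcj q i (hqy' ▸ hy)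
      have hw : r * S.α ww * r⁻¹ ∈ Y := by
        rcases h with h | h
        · rwa [h] at h0
        · rw [h] at h0
          have := Y.inv_mem h0
          rwa [map_inv, conj_inv', inv_inv] at this
      have hv : r * S.α vv * r⁻¹ ∈ Y := hcj ww 1 hw
      intro x hx
      obtain ⟨i, j, rfl⟩ := Q0_gen x hx
      apply hYH
      rw [map_mul, map_pow, map_pow, conj_mul', ← conj_pow, ← conj_pow]
      exact Y.mul_mem (Y.pow_mem hw _) (Y.pow_mem hv _)
  · exfalso
    push Not at hc
    have hN : ∀ n, Nz S.QQ n → n * S.D = S.D * n := by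
      intro n hn
      apply conj_D
      have h1 : n * S.D * n⁻¹ ∈ S.HQ := (HQ_nz hn).conj (hDH (Subgroup.mem_zpowers _))
      have h3 : (n * S.D * n⁻¹) ^ 3 = 1 := by rw [conj_pow, S.E_cube S.D_mem]; simp
      obtain ⟨y, hy, a, ha, h⟩ := hYR _ h1
      by_cases hy1 : y = 1
      · rw [h, hy1, one_mul]; exact ha
      · exfalso
        rw [hc y hy hy1] at h
        have hta : Commute S.t a := by
          have := hDH ha
          exact (mem_HQ.1 this tt (by decide)).symm
        have ha3 : a ^ 3 = 1 := S.E_cube (show a ∈ S.E from (Subgroup.zpowers_le.2 S.D_mem) ha)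
        rw [h, hta.mul_pow, ha3, mul_one, pow_succ, pow_two, S.tt_sq, one_mul] at h3
        exact S.t_ne h3
    have : Fact (Nat.Prime 2) := ⟨Nat.prime_two⟩
    have h2p : IsPGroup 2 S.QQ := by
      apply pgroup_of
      rintro _ ⟨x, hx, rfl⟩
      refine ⟨2, ?_⟩
      have := congrArg S.α (Q0_tt x hx).2
      rw [map_one, map_mul, map_mul] at this
      rw [show (2:ℕ)^2 = 2+2 from rfl, pow_add, pow_two]; exact this
    have hSy : IsSylowIn 2 S.QQ ⊤ := by
      apply isSylowIn_of_nz h2p le_top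
      rintro g - hn ⟨k, hk⟩
      obtain ⟨x, rfl⟩ := S.cent g (hN g hn)
      have ht : S.α x * S.t * (S.α x)⁻¹ = S.t := by
        rcases QQ_inv (hn.conj t_QQ) (by rw [conj_mul, S.tt_sq]; simp) with h | h
        · exact absurd (conj_eq_one_iff.1 h) S.t_ne
        · exact h
      obtain ⟨h1, h2⟩ := C_tt_Q x (S.α_comm.1 (mul_inv_eq_iff_eq_mul.1 ht))
      refine α_QQ.2 (h2 (S.inj ?_))
      rw [map_one]
      have h3 : (S.α (x * x * (x * x))) ^ 3 = 1 := by
        rw [pow_succ, pow_two, ← map_mul, ← map_mul, h1, map_one]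
      have h4 : (S.α (x * x * (x * x))) ^ 2 ^ k = 1 := by
        have : S.α (x * x * (x * x)) = S.α x ^ 4 := by rw [map_mul, map_mul, pow_succ, pow_succ, pow_two]; simp [mul_assoc]
        rw [this, ← pow_mul, mul_comm, pow_mul, hk, one_pow]
      have h5 := Nat.dvd_gcd (orderOf_dvd_of_pow_eq_one h3) (orderOf_dvd_of_pow_eq_one h4)
      rw [Nat.Coprime.gcd_eq_one (Nat.Coprime.pow_right _ (by norm_num))] at h5
      exact orderOf_eq_one_iff.1 (Nat.dvd_one.1 h5)
    obtain ⟨g, -, hg⟩ := hSy.conj (pgroup_two (p := 2) hr.comm (by rw [pow_two, hr.sq]) (by rw [pow_two, S.tt_sq])) le_top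
    have e1 : g * r * g⁻¹ = S.t := by
      rcases QQ_inv (hg r (Subgroup.mem_sup_left (Subgroup.mem_zpowers r))) (by rw [conj_mul, hr.sq]; simp) with h | h
      · rw [conj_eq_one_iff] at h
        exact absurd (by rw [h]; exact S.E.one_mem) hr.ne
      · exact h
    have e2 : g * S.t * g⁻¹ = S.t := by
      rcases QQ_inv (hg S.t (Subgroup.mem_sup_right (Subgroup.mem_zpowers _))) (by rw [conj_mul, S.tt_sq]; simp) with h | h
      · exact absurd (conj_eq_one_iff.1 h) S.t_ne
      · exact h
    have := e1.trans e2.symm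
    exact hr.ne_t (by simpa using this)

/-- the two copies of `SL₂(3)` commute -/
theorem K4.SL_comm (K : S.K4) {r : G} (hr : S.RD r) {x y : X0} (hx : SL x) (hy : SL y) :
    S.α x * (r * S.α y * r⁻¹) = (r * S.α y * r⁻¹) * S.α x := by
  obtain ⟨i, u, hu, hi⟩ := SL_Q x hx
  obtain ⟨j, v, hv, hj⟩ := SL_Q y hy
  set q := x * (d3 ^ (i:ℕ))⁻¹ with hq
  set q' := y * (d3 ^ (j:ℕ))⁻¹ with hq'
  have ex : x = q * el 0 0 u := by rw [hu, hq]; simp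
  have ey : y = q' * el 0 0 v := by rw [hv, hq']; simp
  have c1 : Commute (S.α q) (r * S.α q' * r⁻¹) := (mem_HQ.1 (K.QQ_comm hr q' hj) q hi).symm
  have com : ∀ w ∈ Q0, ∀ z, Commute (S.α w) (S.α (el 0 z 0)) := by
    intro w hw z
    refine S.α_comm.2 ?_
    revert z
    exact (show ∀ w : X0, w ∈ Q0 → ∀ z, w * el 0 z 0 = el 0 z 0 * w by decide +kernel) w hw
  have c2 : Commute (S.α q) (r * S.α (el 0 0 v) * r⁻¹) := by rw [hr.act]; exact com _ hi _
  have c3 : Commute (S.α (el 0 0 u)) (r * S.α q' * r⁻¹) := by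
    have : S.α (el 0 0 u) = r * S.α (el 0 u 0) * r⁻¹ := (hr.act 0 u 0).symm
    rw [this]
    show _ * _ = _ * _
    rw [← conj_mul', ← conj_mul', (com _ hj u).eq]
  have c4 : Commute (S.α (el 0 0 u)) (r * S.α (el 0 0 v) * r⁻¹) := by
    rw [hr.act]; exact S.E_comm _ (S.α_E.2 (el_mem _ _ _)) _ (S.α_E.2 (el_mem _ _ _))
  clear_value q q'
  rw [ex, ey, map_mul, map_mul, conj_mul']
  exact ((c1.mul_right c2).mul_left (c3.mul_right c4))
end Setup
namespace X0
theorem ww_inv : ww⁻¹ = tt * ww := by decide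
theorem Q0_SL {x : X0} (h : x ∈ Q0) : SL x := ⟨h.1, h.2.1, h.2.2.1⟩
theorem Q0_mod : ∀ x : X0, x ∈ Q0 → ∀ y : X0, y ∈ Q0 → x * y * x⁻¹ = y ∨ x * y * x⁻¹ = tt * y := by decide +kernel
theorem Q0_sq : ∀ x : X0, x ∈ Q0 → (x = 1 ∨ x = tt) ∨ x * x = tt := by decide +kernel
theorem Q0_ttm : ∀ x : X0, x ∈ Q0 → tt * x ∈ Q0 ∧ (tt * x) * (tt * x) = x * x := by decide +kernel
theorem C_tt_form : ∀ x : X0, x * tt = tt * x → ∃ z b, x * (el 0 z b)⁻¹ ∈ Q0 := by decide +kernel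
def equivQ0 : Q0 ≃ {v : T3 × T3 × T3 × T3 // v.1 * v.2.2.2 - v.2.1 * v.2.2.1 = 1 ∧ lam v.1 v.2.1 v.2.2.1 v.2.2.2 = 0} where
  toFun x := ⟨(x.1.a, x.1.b, x.1.c, x.1.e), x.1.h, x.2.2.2.2⟩
  invFun v := ⟨⟨0, 0, 0, v.1.1, v.1.2.1, v.1.2.2.1, v.1.2.2.2, v.2.1⟩, rfl, rfl, rfl, v.2.2⟩
  left_inv := by
    rintro ⟨x, h1, h2, h3, h4⟩
    apply Subtype.ext
    apply X0.ext <;> simp_all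
  right_inv := by rintro ⟨⟨a, b, c, e⟩, h⟩; rfl
theorem card_Q0 : Nat.card Q0 = 8 := by
  rw [Nat.card_congr equivQ0, Nat.card_eq_fintype_card]
  decide +kernel
end X0
namespace Setup
variable {G : Type*} [Group G] [Finite G] {S : Setup G}

structure KR (S : Setup G) (r : G) : Prop where
  K : S.K4
  hr : S.RD r

def be (S : Setup G) (r : G) : X0 →* G := (MulAut.conj r).toMonoidHom.comp S.α
theorem be_apply (r : G) (x : X0) : S.be r x = r * S.α x * r⁻¹ := rfl

def Z0 (S : Setup G) (r : G) : Subgroup G := S.QQ ⊔ Q0.map (S.be r)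
variable {r : G} (k : S.KR r)
include k
theorem KR.r_be (x : X0) : r * S.be r x * r⁻¹ = S.α x := by
  rw [be_apply, k.hr.inv, ← mul_assoc, ← mul_assoc, k.hr.sq, one_mul, mul_assoc, k.hr.sq, mul_one]
theorem KR.com {x y : X0} (hx : SL x) (hy : SL y) : Commute (S.α x) (S.be r y) := k.K.SL_comm k.hr hx hy
theorem KR.be_tt : S.be r tt = S.t := mul_inv_eq_iff_eq_mul.2 k.hr.comm
theorem KR.mem_Z0 {g : G} : g ∈ S.Z0 r ↔ ∃ x ∈ Q0, ∃ y ∈ Q0, g = S.α x * S.be r y := by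
  have h := MonoidHom.noncommCoprod_range (S.α.comp Q0.subtype) ((S.be r).comp Q0.subtype)
    (fun m n => k.com (Q0_SL m.2) (Q0_SL n.2))
  have e : S.Z0 r = (S.α.comp Q0.subtype).range ⊔ ((S.be r).comp Q0.subtype).range := by
    rw [Z0, QQ, MonoidHom.range_comp, MonoidHom.range_comp, Subgroup.range_subtype]
  rw [e, ← h, MonoidHom.mem_range]
  constructor
  · rintro ⟨⟨x, y⟩, rfl⟩; exact ⟨x, x.2, y, y.2, rfl⟩
  · rintro ⟨x, hx, y, hy, rfl⟩; exact ⟨(⟨x, hx⟩, ⟨y, hy⟩), rfl⟩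

omit k in
theorem α_Z0 {x : X0} (h : x ∈ Q0) : S.α x ∈ S.Z0 r := Subgroup.mem_sup_left (α_QQ.2 h)
omit k in
theorem be_Z0 {x : X0} (h : x ∈ Q0) : S.be r x ∈ S.Z0 r := Subgroup.mem_sup_right ⟨x, h, rfl⟩
omit k in
theorem t_Z0 : S.t ∈ S.Z0 r := α_Z0 (by decide)
theorem KR.Z0_T : S.Z0 r ≤ CC S.t := by
  intro g hg
  obtain ⟨x, hx, y, hy, rfl⟩ := k.mem_Z0.1 hg
  refine Subgroup.mul_mem _ (QQ_T (α_QQ.2 hx)) ?_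
  have h : S.α y * S.t = S.t * S.α y := QQ_T (α_QQ.2 hy)
  show _ * _ = _ * _
  rw [← k.be_tt, be_apply, be_apply, ← conj_mul', ← conj_mul']
  rw [show S.α y * S.α tt = S.α tt * S.α y from h]
theorem KR.cap {x y : X0} (hx : x ∈ Q0) (hy : y ∈ Q0) (h : S.α x = S.be r y) : x = 1 ∨ x = tt := by
  have h1 : S.α x ∈ S.HQ := h ▸ k.K.QQ_comm k.hr y hy
  rw [mem_HQ] at h1
  exact Q0_cen x hx (S.α_comm.1 (h1 ww (by decide))) (S.α_comm.1 (h1 vv (by decide)))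
theorem KR.be_inj : Function.Injective (S.be r) := by
  intro x y h
  rw [be_apply, be_apply] at h
  exact S.inj (by simpa using h)

theorem KR.Z0_mod {m n : G} (hm : m ∈ S.Z0 r) (hn : n ∈ S.Z0 r) : m * n * m⁻¹ = n ∨ m * n * m⁻¹ = S.t * n := by
  obtain ⟨x, hx, y, hy, rfl⟩ := k.mem_Z0.1 hm
  obtain ⟨x', hx', y', hy', rfl⟩ := k.mem_Z0.1 hn
  have c1 := k.com (Q0_SL hx) (Q0_SL hy)
  have c2 := k.com (Q0_SL hx) (Q0_SL hy')
  have c3 := k.com (Q0_SL hx') (Q0_SL hy)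
  have c3' : S.be r y * S.α x' * (S.be r y)⁻¹ = S.α x' := mul_inv_eq_iff_eq_mul.2 c3.eq.symm
  have ct := k.com (x := x') (y := tt) (Q0_SL hx') (by decide)
  rw [k.be_tt] at ct
  have e : S.α x * S.be r y * (S.α x' * S.be r y') * (S.α x * S.be r y)⁻¹ =
      S.α (x * x' * x⁻¹) * S.be r (y * y' * y⁻¹) := by
    rw [conj_conj', conj_mul' (S.be r y), c3', conj_mul']
    have h := k.com (x := x) (y := y * y' * y⁻¹) (Q0_SL hx) (Q0_SL (Q0.mul_mem (Q0.mul_mem hy hy') (Q0.inv_mem hy)))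
    have h' : S.α x * (S.be r y * S.be r y' * (S.be r y)⁻¹) * (S.α x)⁻¹ = S.be r y * S.be r y' * (S.be r y)⁻¹ := by
      rw [mul_inv_eq_iff_eq_mul, ← map_mul, ← map_inv, ← map_mul]; exact h.eq
    rw [h']
    simp only [map_mul, map_inv]
  rw [e]
  have e1 : S.α (tt * x') = S.t * S.α x' := map_mul _ _ _
  have e2 : S.be r (tt * y') = S.t * S.be r y' := by rw [map_mul, k.be_tt]
  rcases Q0_mod x hx x' hx' with h1 | h1 <;> rcases Q0_mod y hy y' hy' with h2 | h2 <;> rw [h1, h2]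
  · left; rfl
  · right; rw [e2, ← mul_assoc, ct.eq, mul_assoc]
  · right; rw [e1, mul_assoc]
  · left; rw [e1, e2, ← mul_assoc, mul_assoc S.t, ct.eq, ← mul_assoc, S.tt_sq, one_mul]
theorem KR.r_Z0 : Nz (S.Z0 r) r := by
  apply Nz.of_finite
  intro a ha
  obtain ⟨x, hx, y, hy, rfl⟩ := k.mem_Z0.1 ha
  rw [conj_mul', k.r_be]
  exact Subgroup.mul_mem _ (be_Z0 hx) (α_Z0 hy)
theorem KR.sq {x y : X0} (hx : x ∈ Q0) (hy : y ∈ Q0) :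
    S.α x * S.be r y * (S.α x * S.be r y) = S.α (x * x) * S.be r (y * y) := by
  have h := k.com (Q0_SL hx) (Q0_SL hy)
  rw [map_mul, map_mul, mul_assoc, ← mul_assoc (S.be r y), ← h.eq]; simp [mul_assoc]
theorem KR.r_nZ0 : r ∉ S.Z0 r := by
  intro h
  obtain ⟨x, hx, y, hy, h⟩ := k.mem_Z0.1 h
  have h1 : r * S.α ww * r⁻¹ = S.α (x * ww * x⁻¹) := by
    rw [h, conj_conj', mul_inv_eq_iff_eq_mul.2 (k.com (x := ww) (by decide) (Q0_SL hy)).eq.symm, S.α_conj]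
  have h2 := k.cap (x := x * ww * x⁻¹) (y := ww) (Q0.mul_mem (Q0.mul_mem hx (by decide)) (Q0.inv_mem hx)) (by decide) h1.symm
  rcases h2 with h2 | h2
  · rw [conj_eq_one_iff] at h2; revert h2; decide
  · rw [mul_inv_eq_iff_eq_mul, ← (Q0_tt x hx).1] at h2
    have := mul_left_cancel h2
    revert this; decide

/-- elements of `Z0` squaring to `t` -/
theorem KR.sq_t {m : G} (hm : m ∈ S.Z0 r) (h : m * m = S.t) : m ∈ S.QQ ∨ r * m * r⁻¹ ∈ S.QQ := by
  obtain ⟨x, hx, y, hy, rfl⟩ := k.mem_Z0.1 hm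
  rw [k.sq hx hy] at h
  have ht : S.be r tt = S.α tt := k.be_tt
  rcases Q0_sq x hx with h1 | h1
  · right
    rw [conj_mul', k.r_be]
    refine S.QQ.mul_mem ?_ (α_QQ.2 hy)
    rcases h1 with rfl | rfl
    · simp
    · have : r * S.α tt * r⁻¹ = S.t := k.be_tt
      rw [this]; exact t_QQ
  · rcases Q0_sq y hy with h2 | h2
    · left
      refine S.QQ.mul_mem (α_QQ.2 hx) ?_
      rcases h2 with rfl | rfl
      · rw [map_one]; exact S.QQ.one_mem
      · rw [k.be_tt]; exact t_QQ
    · rw [h1, h2, ht] at h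
      exact absurd (mul_eq_left.1 h) S.t_ne

/-- elements of `Z0` commuting with `r` mod `t` are involutory -/
theorem KR.r_mod {m : G} (hm : m ∈ S.Z0 r) (h : r * m * r⁻¹ = m ∨ r * m * r⁻¹ = S.t * m) : m * m = 1 := by
  obtain ⟨x, hx, y, hy, rfl⟩ := k.mem_Z0.1 hm
  rw [conj_mul', k.r_be] at h
  have hb : r * S.α x * r⁻¹ = S.be r x := rfl
  rw [hb, ← (k.com (Q0_SL hy) (Q0_SL hx)).eq] at h
  have key : ∀ x' ∈ Q0, S.α y * S.be r x = S.α x' * S.be r y → y = x' ∨ y = tt * x' := by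
    intro x' hx' h
    have h1 : S.α (x'⁻¹ * y) = S.be r (y * x⁻¹) := by
      rw [map_mul, map_mul, map_inv, map_inv, eq_mul_inv_iff_mul_eq, mul_assoc, h, inv_mul_cancel_left]
    rcases k.cap (Q0.mul_mem (Q0.inv_mem hx') hy) (Q0.mul_mem hy (Q0.inv_mem hx)) h1 with h2 | h2
    · left; exact (inv_mul_eq_one.1 h2).symm
    · right
      rw [inv_mul_eq_iff_eq_mul] at h2
      rw [h2]; exact (Q0_tt x' hx').1
  have fin : y * y = x * x := by
    rcases h with h | h
    · rcases key x hx h with rfl | rfl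
      · rfl
      · exact (Q0_ttm x hx).2
    · rcases key (tt * x) (Q0_ttm x hx).1 (by rw [h, map_mul]; simp [mul_assoc, t]) with rfl | rfl
      · exact (Q0_ttm x hx).2
      · rw [(Q0_ttm _ (Q0_ttm x hx).1).2]; exact (Q0_ttm x hx).2
  rw [k.sq hx hy, fin]
  have hone : ∀ x ∈ Q0, x * x = 1 ∨ x * x = tt := by decide +kernel
  rcases hone x hx with h | h <;> rw [h]
  · simp
  · rw [k.be_tt]; exact S.tt_sq

def KR.SS : Subgroup G where
  carrier := {g | g ∈ S.Z0 r ∨ r * g ∈ S.Z0 r}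
  mul_mem' := by
    have key : ∀ g, r * g * r⁻¹ ∈ S.Z0 r ↔ g ∈ S.Z0 r := k.r_Z0
    rintro a b (ha | ha) (hb | hb)
    · left; exact Subgroup.mul_mem _ ha hb
    · right
      have := Subgroup.mul_mem _ ((key a).2 ha) hb
      simpa [mul_assoc] using this
    · right; rw [← mul_assoc]; exact Subgroup.mul_mem _ ha hb
    · left
      have := Subgroup.mul_mem _ ((key _).2 ha) hb
      rw [show r * (r * a) * r⁻¹ * (r * b) = (r * r) * (a * b) by simp [mul_assoc], k.hr.sq, one_mul] at this
      exact this
  one_mem' := Or.inl (Subgroup.one_mem _)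
  inv_mem' := by
    have key : ∀ g, r * g * r⁻¹ ∈ S.Z0 r ↔ g ∈ S.Z0 r := k.r_Z0
    rintro a (ha | ha)
    · left; exact Subgroup.inv_mem _ ha
    · right
      have := (key _).2 (Subgroup.inv_mem _ ha)
      rw [mul_inv_rev, k.hr.inv, mul_assoc, mul_assoc, k.hr.sq, mul_one] at this
      exact this
theorem KR.mem_SS {g : G} : g ∈ k.SS ↔ g ∈ S.Z0 r ∨ r * g ∈ S.Z0 r := Iff.rfl
theorem KR.Z0_SS : S.Z0 r ≤ k.SS := fun _ h => Or.inl h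
theorem KR.r_SS : r ∈ k.SS := Or.inr (by rw [k.hr.sq]; exact Subgroup.one_mem _)
theorem KR.SS_T : k.SS ≤ CC S.t := by
  rintro g (h | h)
  · exact k.Z0_T h
  · have hr : r ∈ CC S.t := k.hr.comm
    exact (Subgroup.mul_mem_cancel_left _ hr).1 (k.Z0_T h)
theorem KR.SS_mul {a b : G} (ha : a ∈ k.SS) (hb : b ∈ k.SS) (ha' : a ∉ S.Z0 r) (hb' : b ∉ S.Z0 r) : a * b ∈ S.Z0 r := by
  have ha := ha.resolve_left ha'
  have hb := hb.resolve_left hb'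
  have := Subgroup.mul_mem _ ((k.r_Z0 _).2 ha) hb
  rw [show r * (r * a) * r⁻¹ * (r * b) = (r * r) * (a * b) by simp [mul_assoc], k.hr.sq, one_mul] at this
  exact this
theorem KR.Z0_four {m : G} (hm : m ∈ S.Z0 r) : m ^ 4 = 1 := by
  obtain ⟨x, hx, y, hy, rfl⟩ := k.mem_Z0.1 hm
  rw [show 4 = 2 * 2 from rfl, pow_mul, pow_two, pow_two, k.sq hx hy, k.sq (Q0.mul_mem hx hx) (Q0.mul_mem hy hy),
    (Q0_tt x hx).2, (Q0_tt y hy).2]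
  simp
theorem KR.SS_2 : IsPGroup 2 k.SS := by
  apply pgroup_of
  intro g hg
  refine ⟨3, ?_⟩
  rw [show 2 ^ 3 = 2 * 4 from rfl, pow_mul]
  apply k.Z0_four
  rw [pow_two]
  by_cases h : g ∈ S.Z0 r
  · exact Subgroup.mul_mem _ h h
  · exact k.SS_mul hg hg h h
theorem KR.SS_Z0 {g : G} (hg : g * S.t = S.t * g) (hn : Nz k.SS g) : Nz (S.Z0 r) g := by
  apply Nz.of_finite
  intro z hz
  by_contra hs
  have hsS : g * z * g⁻¹ ∈ k.SS := hn.conj (k.Z0_SS hz)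
  have hq : ∃ q ∈ Q0, q * q = tt ∧ g * S.α q * g⁻¹ ∈ S.Z0 r := by
    by_cases h1 : g * S.α ww * g⁻¹ ∈ S.Z0 r
    · exact ⟨ww, by decide, by decide, h1⟩
    by_cases h2 : g * S.α vv * g⁻¹ ∈ S.Z0 r
    · exact ⟨vv, by decide, by decide, h2⟩
    refine ⟨ww * vv, by decide, by decide, ?_⟩
    rw [map_mul, conj_mul']
    exact k.SS_mul (hn.conj (k.Z0_SS (α_Z0 (by decide)))) (hn.conj (k.Z0_SS (α_Z0 (by decide)))) h1 h2
  obtain ⟨q, hq, hqq, hm⟩ := hq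
  have hmm : (g * S.α q * g⁻¹) * (g * S.α q * g⁻¹) = S.t := by
    rw [← conj_mul', ← map_mul, hqq]; exact conj_of_comm hg
  have h1 := k.Z0_mod hz (α_Z0 (S := S) (r := r) hq)
  have ht := S.tt_sq
  have hrt := k.hr.comm
  have h2 : (g * z * g⁻¹) * (g * S.α q * g⁻¹) * (g * z * g⁻¹)⁻¹ = g * S.α q * g⁻¹ ∨
      (g * z * g⁻¹) * (g * S.α q * g⁻¹) * (g * z * g⁻¹)⁻¹ = S.t * (g * S.α q * g⁻¹) := by
    rw [← conj_inv', ← conj_mul', ← conj_mul']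
    rcases h1 with h | h <;> rw [h]
    · exact Or.inl rfl
    · right; rw [conj_mul', conj_of_comm hg]
  have hsr := (k.mem_SS.1 hsS).resolve_left hs
  have h3 := k.Z0_mod hsr hm
  generalize g * S.α q * g⁻¹ = m at *
  generalize g * z * g⁻¹ = s at *
  rw [conj_conj'] at h3
  refine S.t_ne (hmm ▸ k.r_mod hm ?_)
  have htt : ∀ x, S.t * (S.t * x) = x := fun x => by rw [← mul_assoc, ht, one_mul]
  rcases h2 with h | h <;> rw [h] at h3
  · exact h3
  · rw [conj_mul', conj_of_comm hrt] at h3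
    rcases h3 with h | h
    · right; rw [← h, htt, h]
    · left; exact mul_left_cancel h
theorem KR.N_QQ {n : G} (hn : n * S.t = S.t * n) (h : Nz S.QQ n) : ∃ s ∈ S.Z0 r, ∃ a ∈ S.R, n = s * a := by
  obtain ⟨hS, Y, hY, hYa, -, hYr⟩ := k.K.HQ_burn k.hr
  have hD : S.D ∈ S.HQ := hS.1 (Subgroup.mem_zpowers _)
  obtain ⟨h', hh, h1⟩ := hS.conj_elt (k := 1) ((HQ_nz h).conj hD) (by
    rw [pow_one, conj_pow, S.E_cube S.D_mem]; simp)
  rw [← conj_conj'] at h1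
  obtain ⟨x, hx⟩ := S.cent _ (S.conj_D h1)
  have hht : h' * S.t = S.t * h' := S.mem_HQ.1 hh tt (by decide)
  have hxt : x * tt = tt * x := S.α_comm.1 (by
    rw [hx]; exact (CC S.t).mul_mem hht hn)
  obtain ⟨z, b, hxq⟩ := C_tt_form x hxt
  obtain ⟨y, hy, a, ha, e⟩ := hYa _ (Subgroup.inv_mem _ hh)
  have haR : a ∈ S.R := (Subgroup.zpowers_le.2 (S.α_R.2 (el_R0 1 0))) ha
  obtain ⟨x', hx', e'⟩ := S.mem_QQ.1 (mem_CJ.1 (hYr hy))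
  have hy' : y = S.be r x' := by rw [be_apply, e']; simp [mul_assoc]
  have hac : a * S.α (x * (el 0 z b)⁻¹) = S.α (x * (el 0 z b)⁻¹) * a := mem_HQ.1 (hS.1 ha) _ hxq
  refine ⟨y * S.α (x * (el 0 z b)⁻¹), Subgroup.mul_mem _ (hy' ▸ be_Z0 hx') (α_Z0 hxq), a * S.α (el 0 z b),
    Subgroup.mul_mem _ haR (S.α_R.2 (el_R0 _ _)), ?_⟩
  calc n = h'⁻¹ * S.α x := by rw [hx]; simp
    _ = y * (a * S.α (x * (el 0 z b)⁻¹)) * S.α (el 0 z b) := by rw [e]; simp [mul_assoc]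
    _ = _ := by rw [hac]; simp only [mul_assoc]
theorem KR.gQQ {g : G} (hg : g * S.t = S.t * g) (hn : Nz (S.Z0 r) g) : Nz S.QQ g ∨ Nz S.QQ (r * g) := by
  have hgen : ∀ h : G, h * S.α ww * h⁻¹ ∈ S.QQ → h * S.α vv * h⁻¹ ∈ S.QQ → Nz S.QQ h := by
    intro h h1 h2
    apply Nz.of_finite
    rintro _ ⟨x, hx, rfl⟩
    obtain ⟨i, j, rfl⟩ := Q0_gen x hx
    show h * S.α _ * h⁻¹ ∈ _
    rw [map_mul, map_pow, map_pow, conj_mul', ← conj_pow, ← conj_pow]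
    exact Subgroup.mul_mem _ (Subgroup.pow_mem _ h1 _) (Subgroup.pow_mem _ h2 _)
  have hs : ∀ q ∈ Q0, q * q = tt → g * S.α q * g⁻¹ ∈ S.QQ ∨ (r * g) * S.α q * (r * g)⁻¹ ∈ S.QQ := by
    intro q hq hqq
    rw [conj_conj']
    apply k.sq_t (hn.conj (α_Z0 hq))
    rw [← conj_mul', ← map_mul, hqq]; exact conj_of_comm hg
  have hmix : ∀ p ∈ Q0, ∀ q ∈ Q0, p * q ≠ q * p → g * S.α p * g⁻¹ ∈ S.QQ → (r * g) * S.α q * (r * g)⁻¹ ∈ S.QQ → False := by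
    rintro p hp q hq hne ⟨x, hx, h1⟩ ⟨y, hy, h2⟩
    apply hne
    rw [conj_conj'] at h2
    have h1 : S.α x = g * S.α p * g⁻¹ := h1
    have h3 : S.be r y = g * S.α q * g⁻¹ := by
      have h2 : S.α y = r * (g * S.α q * g⁻¹) * r⁻¹ := h2
      rw [be_apply, h2, ← conj_conj', k.hr.sq]; simp
    have h4 := (k.com (Q0_SL hx) (Q0_SL hy)).eq
    rw [h1, h3, ← conj_mul', ← conj_mul'] at h4
    exact S.α_comm.1 (mul_left_cancel (mul_right_cancel h4))
  rcases hs ww (by decide) (by decide) with h1 | h1 <;> rcases hs vv (by decide) (by decide) with h2 | h2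
  · exact Or.inl (hgen _ h1 h2)
  · exact (hmix _ (by decide) _ (by decide) (by decide) h1 h2).elim
  · exact (hmix _ (by decide) _ (by decide) (by decide) h2 h1).elim
  · exact Or.inr (hgen _ h1 h2)
theorem KR.sylSS : IsSylowIn 2 k.SS (CC S.t) := by
  refine isSylowIn_of_nz k.SS_2 k.SS_T ?_
  rintro g hg hn ⟨j, hj⟩
  have hg : g * S.t = S.t * g := hg
  have hZ := k.SS_Z0 hg hn
  have : ∃ s ∈ k.SS, ∃ a ∈ S.R, g = s * a := by
    rcases k.gQQ hg hZ with h | h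
    · obtain ⟨s, hs, a, ha, e⟩ := k.N_QQ hg h
      exact ⟨s, k.Z0_SS hs, a, ha, e⟩
    · obtain ⟨s, hs, a, ha, e⟩ := k.N_QQ ((CC S.t).mul_mem k.hr.comm hg) h
      refine ⟨r⁻¹ * s, Subgroup.mul_mem _ (Subgroup.inv_mem _ k.r_SS) (k.Z0_SS hs), a, ha, ?_⟩
      rw [mul_assoc, ← e]; simp
  obtain ⟨s, hs, a, ha, rfl⟩ := this
  have hna : Nz k.SS a := by
    have := (Nz.of_mem (Subgroup.inv_mem _ hs)).mul hn
    simpa [← mul_assoc] using this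
  have hpow : ∀ n : ℕ, (s * a) ^ n * (a ^ n)⁻¹ ∈ k.SS := by
    intro n
    induction n with
    | zero => simp [Subgroup.one_mem]
    | succ n ih =>
      have h1 := Subgroup.mul_mem _ hs (hna.conj ih)
      rw [pow_succ', pow_succ' a]
      simpa [mul_assoc] using h1
  have h1 := hpow (2 ^ j)
  rw [hj, one_mul] at h1
  obtain ⟨l, hl⟩ := pgroup_mem k.SS_2 (Subgroup.inv_mem _ h1)
  rw [inv_inv, ← pow_mul, ← pow_add] at hl
  have h3 := S.E_cube (S.R_le_E ha)
  have : a = 1 := pow_inj3 (m := 2 ^ (j + l)) h3 (one_pow 3) (fun h => by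
    have := Nat.prime_three.dvd_of_dvd_pow h; omega) (by rw [hl, one_pow])
  rw [this, mul_one]; exact hs
theorem KR.card_Z0 : Nat.card (S.Z0 r) = 32 := by
  have hc : ∀ m n : Q0, Commute ((S.α.comp Q0.subtype) m) (((S.be r).comp Q0.subtype) n) :=
    fun m n => k.com (Q0_SL m.2) (Q0_SL n.2)
  let f := MonoidHom.noncommCoprod _ _ hc
  have hf : ∀ m n, f (m, n) = S.α m * S.be r n := fun m n => rfl
  have hr : f.range = S.Z0 r := by
    ext g
    rw [k.mem_Z0, MonoidHom.mem_range]
    constructor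
    · rintro ⟨⟨x, y⟩, rfl⟩; exact ⟨x, x.2, y, y.2, rfl⟩
    · rintro ⟨x, hx, y, hy, rfl⟩; exact ⟨(⟨x, hx⟩, ⟨y, hy⟩), rfl⟩
  have ht : tt ∈ Q0 := by decide
  have hk : Nat.card f.ker = 2 := by
    rw [Nat.card_eq_two_iff]
    refine ⟨1, ⟨(⟨tt, ht⟩, ⟨tt, ht⟩), ?_⟩, ?_, ?_⟩
    · rw [MonoidHom.mem_ker, hf]; show S.t * S.be r tt = 1; rw [k.be_tt, S.tt_sq]
    · intro h
      have := congrArg (fun x : f.ker => (x.1.1 : X0)) h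
      exact absurd (show (1 : X0) = tt from this) (by decide)
    · rw [Set.eq_univ_iff_forall]
      rintro ⟨⟨⟨x, hx⟩, ⟨y, hy⟩⟩, h⟩
      rw [MonoidHom.mem_ker, hf] at h
      have h : S.α x * S.be r y = 1 := h
      have h1 : S.α x = S.be r y⁻¹ := by rw [map_inv]; exact eq_inv_of_mul_eq_one_left h
      simp only [Set.mem_insert_iff, Set.mem_singleton_iff, Subtype.ext_iff, Prod.ext_iff]
      rcases k.cap hx (Q0.inv_mem hy) h1 with rfl | rfl
      · left
        rw [map_one, one_mul, ← map_one (S.be r)] at h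
        exact ⟨rfl, k.be_inj h⟩
      · right
        refine ⟨rfl, k.be_inj ?_⟩
        show _ = S.be r tt
        rw [k.be_tt, ← mul_right_inj S.t, S.tt_sq]; exact h
  have h1 := f.ker.card_mul_index
  rw [Subgroup.index_ker, hr, hk, Nat.card_prod, card_Q0] at h1
  omega
theorem KR.card_SS : Nat.card k.SS = 64 := by
  have h1 : ((S.Z0 r).subgroupOf k.SS).index = 2 := by
    rw [Subgroup.index_eq_two_iff]
    refine ⟨⟨r, k.r_SS⟩, fun b => ?_⟩
    simp only [Subgroup.mem_subgroupOf, Subgroup.coe_mul]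
    by_cases h : (b : G) ∈ S.Z0 r
    · exact Or.inr ⟨h, fun h2 => k.r_nZ0 ((Subgroup.mul_mem_cancel_left _ h).1 h2)⟩
    · exact Or.inl ⟨k.SS_mul b.2 k.r_SS h k.r_nZ0, h⟩
  have h2 := ((S.Z0 r).subgroupOf k.SS).card_mul_index
  rw [h1, Nat.card_congr (Subgroup.subgroupOfEquivOfLe k.Z0_SS).toEquiv, k.card_Z0] at h2
  omega
theorem KR.conj_r {g : G} (hg : g * S.t = S.t * g) (h : g * r * g⁻¹ = 1 ∨ g * r * g⁻¹ = S.t) : False := by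
  apply k.r_nZ0
  rcases h with h | h
  · rw [conj_eq_one_iff.1 h]; exact Subgroup.one_mem _
  · rw [mul_inv_eq_iff_eq_mul, ← hg] at h
    rw [mul_left_cancel h]; exact t_Z0
theorem KR.Z_SS {s : G} (hs : s ∈ k.SS) (h : ∀ m ∈ k.SS, s * m = m * s) : s = 1 ∨ s = S.t := by
  have ha : ∀ x ∈ Q0, s * S.α x = S.α x * s := fun x hx => h _ (k.Z0_SS (α_Z0 hx))
  have hb : ∀ x ∈ Q0, s * S.be r x = S.be r x * s := fun x hx => h _ (k.Z0_SS (be_Z0 hx))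
  have hZ : s ∈ S.Z0 r := by
    by_contra hs'
    have h1 := k.Z0_mod ((k.mem_SS.1 hs).resolve_left hs') (α_Z0 (r := r) (S := S) (show ww ∈ Q0 by decide))
    rw [conj_conj', conj_of_comm (ha ww (by decide))] at h1
    have h2 := k.r_mod (α_Z0 (by decide)) h1
    rw [← map_mul] at h2
    exact S.t_ne h2
  obtain ⟨x, hx, y, hy, rfl⟩ := k.mem_Z0.1 hZ
  have hx1 : ∀ q ∈ Q0, x * q = q * x := by
    intro q hq
    have h1 := ha q hq
    rw [mul_assoc, ← (k.com (Q0_SL hq) (Q0_SL hy)).eq, ← mul_assoc, ← mul_assoc] at h1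
    exact S.α_comm.1 (mul_right_cancel h1)
  have hy1 : ∀ q ∈ Q0, y * q = q * y := by
    intro q hq
    have h1 := hb q hq
    rw [← mul_assoc, ← (k.com (Q0_SL hx) (Q0_SL hq)).eq, mul_assoc, mul_assoc] at h1
    have h2 := mul_left_cancel h1
    rw [← map_mul, ← map_mul] at h2
    exact k.be_inj h2
  have hx2 := Q0_cen x hx (hx1 _ (by decide)) (hx1 _ (by decide))
  have hy2 := Q0_cen y hy (hy1 _ (by decide)) (hy1 _ (by decide))
  have ht : S.α tt * S.α tt = 1 := S.tt_sq
  rcases hx2 with rfl | rfl <;> rcases hy2 with rfl | rfl <;> simp [k.be_tt, t, ht]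
theorem KR.Hrc {g : G} (ht : g * S.t = S.t * g) (hr : g * r = r * g) (hc : g * S.c = S.c * g) :
    ∃ τ z, (τ = 1 ∨ τ = S.t ∨ τ = r ∨ τ = r * S.t) ∧ g = τ * S.α (el 0 z z) := by
  have hrt := k.hr.comm
  obtain ⟨e, he, h⟩ := k.K.Nc k.hr (k.K.C_c k.hr hc) (conj_of_comm hc)
  have : ∃ τ : G, (τ = 1 ∨ τ = S.t ∨ τ = r ∨ τ = r * S.t) ∧ g = τ * e := by
    rcases h with h | h | h | h
    · exact ⟨1, by simp, by simpa using h⟩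
    · exact ⟨_, by simp, h⟩
    · exact ⟨_, by simp, h⟩
    · exact ⟨_, by simp, h⟩
  obtain ⟨τ, hτ, rfl⟩ := this
  have hτt : τ ∈ CC S.t := by
    have h1 : S.t ∈ CC S.t := rfl
    rcases hτ with rfl | rfl | rfl | rfl
    · exact Subgroup.one_mem _
    · exact h1
    · exact hrt
    · exact Subgroup.mul_mem _ hrt h1
  have hτr : τ ∈ CC r := by
    have h1 : r ∈ CC r := rfl
    have h2 : S.t ∈ CC r := hrt.symm
    rcases hτ with rfl | rfl | rfl | rfl
    · exact Subgroup.one_mem _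
    · exact h2
    · exact h1
    · exact Subgroup.mul_mem _ h1 h2
  have het : e * S.t = S.t * e := (Subgroup.mul_mem_cancel_left _ hτt).1 ht
  have her : e * r = r * e := (Subgroup.mul_mem_cancel_left _ hτr).1 hr
  obtain ⟨x, hx, rfl⟩ := S.mem_E.1 he
  have hx' := mem_E0_el hx
  rw [(C_tt _ (S.α_comm.1 het)).1] at hx'
  rw [hx'] at her ⊢
  rw [k.hr.act'] at her
  have h1 := el_inj (S.inj (mul_right_cancel her))
  refine ⟨τ, x.z, hτ, ?_⟩
  rw [h1.2.1]
theorem KR.c_conj {g : G} (hg : g * S.t = S.t * g) (h : g * S.c * g⁻¹ ∈ Subgroup.zpowers S.c) : g * S.c = S.c * g := by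
  have hcR : S.c ∈ S.R := S.α_R.2 (el_R0 1 1)
  obtain ⟨n, -, hn, e⟩ := (k.K.sylR k.hr).fusion S.R_comm hcR hg ((Subgroup.zpowers_le.2 hcR) h)
  apply comm_of_conj
  rw [← e]
  exact conj_of_comm (k.K.NT_c k.hr hn)
theorem KR.tau {τ : G} (hτ : τ = 1 ∨ τ = S.t ∨ τ = r ∨ τ = r * S.t) : τ ∈ CC S.t ⊓ CC r ⊓ CC S.c ∧ τ ^ 2 = 1 := by
  have ht : S.t ∈ CC S.t ⊓ CC r ⊓ CC S.c := ⟨⟨rfl, k.hr.comm.symm⟩, S.t_c⟩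
  have hr : r ∈ CC S.t ⊓ CC r ⊓ CC S.c := ⟨⟨k.hr.comm, rfl⟩, k.hr.r_c⟩
  have h1 : S.t ^ 2 = 1 := by rw [pow_two, S.tt_sq]
  have h2 : r ^ 2 = 1 := by rw [pow_two, k.hr.sq]
  rcases hτ with rfl | rfl | rfl | rfl
  · exact ⟨Subgroup.one_mem _, one_pow 2⟩
  · exact ⟨ht, h1⟩
  · exact ⟨hr, h2⟩
  · refine ⟨Subgroup.mul_mem _ hr ht, ?_⟩
    rw [(show Commute r S.t from k.hr.comm).mul_pow, h1, h2, one_mul]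
theorem KR.Hr_bound {B : Subgroup G} (hB : IsPGroup 2 B) (hBH : B ≤ CC S.t ⊓ CC r) (h32 : 32 ≤ Nat.card B) : False := by
  have htH : S.t ∈ CC S.t ⊓ CC r := (k.tau (τ := S.t) (by simp)).1.1
  have hrH : r ∈ CC S.t ⊓ CC r := (k.tau (τ := r) (by simp)).1.1
  have hcH : S.c ∈ CC S.t ⊓ CC r := ⟨S.t_c.symm, k.hr.r_c.symm⟩
  have hc3 : S.c ^ 3 = 1 := S.E_cube S.c_E
  have hcp : IsPGroup 3 (Subgroup.zpowers S.c) := pgroup_zpowers (k := 1) hc3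
  have hez : ∀ z, S.α (el 0 z z) ∈ Subgroup.zpowers S.c := by
    intro z
    rcases S.c_pow z with h | h | h <;> rw [h]
    · exact Subgroup.one_mem _
    · exact Subgroup.mem_zpowers _
    · exact Subgroup.inv_mem _ (Subgroup.mem_zpowers _)
  have hnc : ∀ g ∈ CC S.t ⊓ CC r, Nz (Subgroup.zpowers S.c) g → g * S.c = S.c * g :=
    fun g hg hn => k.c_conj hg.1 (hn.conj (Subgroup.mem_zpowers _))
  have hsyl : IsSylowIn 3 (Subgroup.zpowers S.c) (CC S.t ⊓ CC r) := by
    refine isSylowIn_of_nz hcp (Subgroup.zpowers_le.2 hcH) ?_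
    rintro g hg hn ⟨j, hj⟩
    obtain ⟨τ, z, hτ, rfl⟩ := k.Hrc hg.1 hg.2 (hnc g hg hn)
    obtain ⟨hτH, hτ2⟩ := k.tau hτ
    have hcom : Commute τ (S.α (el 0 z z)) := by
      obtain ⟨i, hi⟩ := Subgroup.mem_zpowers_iff.1 (hez z)
      rw [← hi]; exact Commute.zpow_right (show Commute τ S.c from hτH.2) i
    have h3 : (τ * S.α (el 0 z z)) ^ 3 = τ := by
      rw [hcom.mul_pow, S.E_cube (S.α_E.2 (el_mem _ _ _)), mul_one, pow_succ, hτ2, one_mul]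
    have h4 : τ ^ 3 ^ j = 1 := by rw [← h3, ← pow_mul, mul_comm, pow_mul, hj, one_pow]
    have : τ = 1 := by
      have h5 : Nat.Coprime 2 (3 ^ j) := Nat.Coprime.pow_right _ (by norm_num)
      have h6 := pow_gcd_eq_one.2 ⟨hτ2, h4⟩
      rwa [Nat.Coprime.gcd_eq_one h5, pow_one] at h6
    rw [this, one_mul]; exact hez z
  obtain ⟨Y, hYH, hY3, hYn, -, hYc, hYm⟩ := burnside hsyl (fun g hg hn a ha => by
    obtain ⟨i, rfl⟩ := Subgroup.mem_zpowers_iff.1 ha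
    exact (Commute.zpow_right (show Commute g S.c from hnc g hg hn) i))
  obtain ⟨V, hVY, hVn⟩ := exists_inv_sylow (q := 2) hcp hY3 (fun a ha => hYn a ((Subgroup.zpowers_le.2 hcH) ha))
  have hV : IsSylowIn 2 V (CC S.t ⊓ CC r) := by
    obtain ⟨m, hm, hm2⟩ := hVY.card
    refine isSylowIn_of_card (m := m * Nat.card (Subgroup.zpowers S.c)) hVY.2.1 (hVY.1.trans hYH) ?_ ?_
    · rw [hYc, hm, mul_assoc]
    · rw [Nat.prime_two.dvd_mul]
      rintro (h | h)
      · exact hm2 h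
      · obtain ⟨i, hi⟩ := hcp.exists_card_eq
        rw [hi] at h
        have := Nat.prime_two.dvd_of_dvd_pow h; omega
  have hcen : ∀ x, (∀ g ∈ CC S.t ⊓ CC r, x * g = g * x) → x ∈ CC S.t ⊓ CC r → x ^ 2 = 1 → x ∈ V := by
    intro x hx hxH hx2
    exact hV.mem_of_nz (k := 1) hxH (Nz.of_finite fun a ha => by rw [conj_of_comm (hx a (hV.1 ha))]; exact ha) hx2
  have htV : S.t ∈ V := hcen _ (fun g hg => hg.1.symm) htH (k.tau (by simp)).2
  have hrV : r ∈ V := hcen _ (fun g hg => hg.2.symm) hrH (k.tau (by simp)).2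
  have h4 : Nat.card (V ⊓ CC S.c : Subgroup G) = 4 := by
    have hset : ((V ⊓ CC S.c : Subgroup G) : Set G) = {1, S.t, r, r * S.t} := by
      ext g
      simp only [Set.mem_insert_iff, Set.mem_singleton_iff, SetLike.mem_coe]
      constructor
      · rintro ⟨hgV, hgc⟩
        obtain ⟨τ, z, hτ, rfl⟩ := k.Hrc (hV.1 hgV).1 (hV.1 hgV).2 hgc
        have hτV : τ ∈ V := by
          rcases hτ with rfl | rfl | rfl | rfl
          exacts [V.one_mem, htV, hrV, V.mul_mem hrV htV]
        obtain ⟨l, hl⟩ := pgroup_mem hV.2.1 ((Subgroup.mul_mem_cancel_left _ hτV).1 hgV)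
        rw [pow_inj3 (m := 2 ^ l) (S.E_cube (S.α_E.2 (el_mem 0 z z))) (one_pow 3) (fun h => by
          have := Nat.prime_three.dvd_of_dvd_pow h; omega) (by rw [hl, one_pow]), mul_one]
        exact hτ
      · intro hg
        refine ⟨?_, (k.tau hg).1.2⟩
        rcases hg with rfl | rfl | rfl | rfl
        exacts [V.one_mem, htV, hrV, V.mul_mem hrV htV]
    have h1 := S.t_ne
    have h2 : r ≠ 1 := fun h => k.r_nZ0 (h ▸ Subgroup.one_mem _)
    have h3 := k.hr.ne_t
    have h5 : r * S.t ≠ 1 := fun h => h3 (by rw [eq_inv_of_mul_eq_one_left h]; exact inv_eq_of_mul_eq_one_left S.tt_sq)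
    rw [← SetLike.coe_sort_coe, Nat.card_coe_set_eq, hset, Set.ncard_insert_of_notMem (by simp [h1.symm, h2.symm, h5.symm]),
      Set.ncard_insert_of_notMem (by simp [h3.symm, h2]), Set.ncard_insert_of_notMem (by simp [h1]), Set.ncard_singleton]
  have hmod := card_fixed (p := 3) (k := 1) (hVn _ (Subgroup.mem_zpowers _)) hc3
  rw [h4] at hmod
  have hge : 32 ≤ Nat.card V := by
    obtain ⟨g, -, hg⟩ := hV.conj hB hBH
    refine h32.trans ?_
    rw [← card_CJ g B]
    exact Subgroup.card_le_of_le (by rintro _ ⟨a, ha, rfl⟩; exact hg a ha)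
  obtain ⟨g, hgT, hg⟩ := k.sylSS.conj hV.2.1 (hV.1.trans inf_le_left)
  have hle : CJ g V ≤ k.SS := by rintro _ ⟨a, ha, rfl⟩; exact hg a ha
  have hcd : Nat.card (CJ g V) = 64 := by
    have h1 := Subgroup.card_le_of_le hle
    rw [k.card_SS, card_CJ] at h1
    rw [card_CJ]
    obtain ⟨i, hi⟩ := hV.2.1.exists_card_eq
    rw [hi] at h1 hge hmod ⊢
    have h2 : i < 7 := (Nat.pow_lt_pow_iff_right (a := 2) (by norm_num)).1 (by omega)
    clear * - h1 hge hmod h2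
    interval_cases i <;> first | rfl | omega | (exact absurd hmod (by decide))
  have heq : CJ g V = k.SS := Subgroup.eq_of_le_of_card_ge hle (by rw [hcd, k.card_SS])
  refine k.conj_r hgT (k.Z_SS (hg _ hrV) ?_)
  intro m hm
  rw [← heq, mem_CJ] at hm
  have h5 : g⁻¹ * m * g * r = r * (g⁻¹ * m * g) := (hV.1 hm).2
  have h6 := congrArg (fun x => g * x * g⁻¹) h5
  simpa [mul_assoc] using h6.symm
theorem KR.be_el (i j : T3) : S.be r (el 0 i j) = S.α (el 0 j i) := k.hr.act 0 i j

/-- involutions of `Z0` other than `t` are conjugate, up to `t`, to `α w * β w` -/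
theorem KR.inv_Z0 {z : G} (hz : z ∈ S.Z0 r) (h1 : z * z = 1) (h2 : z ≠ 1) (h3 : z ≠ S.t) :
    ∃ e ∈ S.R, e * z * e⁻¹ = S.α ww * S.be r ww ∨ e * z * e⁻¹ = S.t * (S.α ww * S.be r ww) := by
  obtain ⟨x, hx, y, hy, rfl⟩ := k.mem_Z0.1 hz
  rw [k.sq hx hy] at h1
  have hb := k.be_tt
  have ht : S.α tt * S.α tt = 1 := S.tt_sq
  have ha : S.α tt = S.t := rfl
  have hxy : x * x = 1 ∨ y * y = 1 → False := by
    intro h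
    have h4 : x * x = 1 ∧ y * y = 1 := by
      rcases h with h | h <;> rw [h] at h1
      · rw [map_one, one_mul, ← map_one (S.be r)] at h1; exact ⟨h, k.be_inj h1⟩
      · rw [map_one, mul_one, ← map_one S.α] at h1; exact ⟨S.inj h1, h⟩
    rcases Q0_inv x hx h4.1 with rfl | rfl <;> rcases Q0_inv y hy h4.2 with rfl | rfl <;>
      simp [hb, t, ht] at h2 h3
  rcases Q0_four x hx with rfl | rfl | ⟨-, i, hi⟩
  · exact (hxy (by simp)).elim
  · exact (hxy (Or.inl (by decide))).elim
  rcases Q0_four y hy with rfl | rfl | ⟨-, j, hj⟩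
  · exact (hxy (by simp)).elim
  · exact (hxy (Or.inr (by decide))).elim
  have hsl : ∀ i, SL (el 0 0 i) := fun i => ⟨rfl, rfl, rfl⟩
  refine ⟨S.α (el 0 0 i) * S.be r (el 0 0 j), ?_, ?_⟩
  · rw [k.be_el]; exact Subgroup.mul_mem _ (S.α_R.2 (el_R0 _ _)) (S.α_R.2 (el_R0 _ _))
  have e : S.α (el 0 0 i) * S.be r (el 0 0 j) * (S.α x * S.be r y) * (S.α (el 0 0 i) * S.be r (el 0 0 j))⁻¹ =
      S.α (el 0 0 i * x * (el 0 0 i)⁻¹) * S.be r (el 0 0 j * y * (el 0 0 j)⁻¹) := by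
    have c2 : S.α (el 0 0 i) * S.be r (el 0 0 j * y * (el 0 0 j)⁻¹) = _ :=
      (k.com (hsl i) (Q0_SL (Q0_norm y hy j))).eq
    rw [conj_conj', conj_mul' _ (S.α x), conj_of_comm (k.com (Q0_SL hx) (hsl j)).eq.symm, ← map_inv (S.be r), ← map_mul, ← map_mul,
      conj_mul', conj_of_comm c2, S.α_conj]
  rw [e]
  have hc := (k.com (Q0_SL (show ww ∈ Q0 by decide)) (Q0_SL (show tt ∈ Q0 by decide))).eq
  rcases hi with hi | hi <;> rcases hj with hj | hj <;> rw [hi, hj] <;> simp only [ww_inv, map_mul, hb, ha] at hc ⊢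
  · simp
  · right; rw [← mul_assoc, hc, mul_assoc]
  · right; rw [mul_assoc]
  · left; rw [mul_assoc, ← mul_assoc _ S.t, hc, mul_assoc, ← mul_assoc, S.tt_sq, one_mul]
theorem KR.r_not {g : G} (hg : g * S.t = S.t * g) (hz : g * r * g⁻¹ ∈ S.Z0 r) : False := by
  obtain ⟨e, he, h⟩ := k.inv_Z0 hz (by rw [← conj_mul', k.hr.sq]; simp) (fun h => k.conj_r hg (Or.inl h))
    (fun h => k.conj_r hg (Or.inr h))
  rw [← conj_conj'] at h
  have heg : e * g ∈ CC S.t := (CC S.t).mul_mem ((k.K.sylR k.hr).1 he) hg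
  generalize e * g = u at h heg
  have ht : S.t ∈ S.Z0 r := t_Z0
  have hww : ww ∈ Q0 := by decide
  have hx0 : S.α ww * S.be r ww ∈ S.Z0 r := Subgroup.mul_mem _ (α_Z0 hww) (be_Z0 hww)
  have hu : u * r * u⁻¹ ∈ S.Z0 r := by
    rcases h with h | h <;> rw [h]
    · exact hx0
    · exact Subgroup.mul_mem _ ht hx0
  have hr0 : r * (S.α ww * S.be r ww) * r⁻¹ = S.α ww * S.be r ww := by
    rw [conj_mul', k.r_be, ← be_apply, (k.com (Q0_SL hww) (Q0_SL hww)).eq]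
  have hr1 : r * (u * r * u⁻¹) * r⁻¹ = u * r * u⁻¹ := by
    rcases h with h | h <;> rw [h]
    · exact hr0
    · rw [conj_mul', hr0, conj_of_comm k.hr.comm]
  have hcls : cls k.SS (u * r * u⁻¹) ⊆ {u * r * u⁻¹, S.t * (u * r * u⁻¹)} := by
    rintro _ ⟨s, hs, rfl⟩
    rcases k.mem_SS.1 hs with hs | hs
    · exact k.Z0_mod hs hu
    · have h1 := k.Z0_mod ((k.r_Z0 _).2 hs) hu
      rw [show r * (r * s) * r⁻¹ = (r * r) * (s * r⁻¹) by simp [mul_assoc], k.hr.sq, one_mul, k.hr.inv, conj_conj',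
        hr1] at h1
      exact h1
  have h2 := (Set.ncard_le_ncard hcls).trans ((Set.ncard_insert_le _ _).trans (by rw [Set.ncard_singleton]))
  have h3 := card_cls k.SS (u * r * u⁻¹)
  rw [k.card_SS] at h3
  have h4 : 32 ≤ Nat.card (k.SS ⊓ CC (u * r * u⁻¹) : Subgroup G) := by
    clear * - h2 h3
    nlinarith
  refine k.Hr_bound (B := CJ u⁻¹ (k.SS ⊓ CC (u * r * u⁻¹))) ?_ ?_ (by rw [card_CJ]; exact h4)
  · exact IsPGroup_CJ (k.SS_2.to_le inf_le_left) _
  · rintro _ ⟨a, ⟨ha, hb⟩, rfl⟩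
    show u⁻¹ * a * u⁻¹⁻¹ ∈ _
    refine ⟨Subgroup.mul_mem _ (Subgroup.mul_mem _ (Subgroup.inv_mem _ heg) (k.SS_T ha)) (Subgroup.inv_mem _ (Subgroup.inv_mem _ heg)), ?_⟩
    have hb : a * (u * r * u⁻¹) = u * r * u⁻¹ * a := hb
    have := congrArg (fun x => u⁻¹ * x * u) hb
    show u⁻¹ * a * u⁻¹⁻¹ * r = r * (u⁻¹ * a * u⁻¹⁻¹)
    simpa [mul_assoc] using this
theorem KR.card_R : Nat.card S.R ≤ 9 := by
  have : Function.Surjective (fun v : T3 × T3 => (⟨S.α (el 0 v.1 v.2), S.α_R.2 (el_R0 _ _)⟩ : S.R)) := by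
    rintro ⟨g, hg⟩
    obtain ⟨x, hx, rfl⟩ := S.mem_R.1 hg
    exact ⟨(x.z, x.b), by rw [Subtype.mk.injEq, ← mem_R0_el hx]⟩
  have h := Nat.card_le_card_of_surjective _ this
  rwa [Nat.card_prod, T3.card] at h
theorem KR.card_T : Nat.card (CC S.t) ≤ 576 ∧ ∀ M : Subgroup G, CC S.D ≤ M → r ∈ M → CC S.t ≤ M := by
  obtain ⟨m, hm, hm2⟩ := k.sylSS.card
  rw [k.card_SS] at hm
  obtain ⟨T2, hT2, hrT, hc, hn, hsq⟩ := thompson k.Z0_T (Nat.not_even_iff_odd.1 fun h => hm2 h.two_dvd)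
    (by rw [hm, k.card_Z0]; ring) k.hr.comm k.hr.sq (fun g hg hz => k.r_not hg hz)
  have hRT := (k.K.sylR k.hr).1
  have ht2 : S.t ∈ T2 := by
    have : S.t = S.α ww * S.α ww := by rw [← map_mul]; rfl
    rw [this]; exact hsq _ (S.QQ_T (α_QQ.2 (by decide)))
  have hR2 : S.R ≤ T2 := by
    intro a ha
    have h1 := hsq _ (hRT (S.R.mul_mem ha ha))
    have h3 := S.E_cube (S.R_le_E ha)
    rwa [show a * a * (a * a) = a ^ 3 * a by simp [pow_succ, mul_assoc], h3, one_mul] at h1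
  have hsyl := (k.K.sylR k.hr).mono hT2 hR2
  have hcR : ∀ g : G, g * S.D * g⁻¹ = S.D → g * S.α (el 0 0 1) * g⁻¹ = S.α (el 0 0 1) → ∀ a ∈ S.R, g * a = a * g := by
    intro g h1 h2 a ha
    obtain ⟨x, hx, rfl⟩ := S.mem_R.1 ha
    obtain ⟨i, j, h⟩ := (show ∀ z b : T3, ∃ i j : Fin 3, el 0 z b = el 0 1 0 ^ (i:ℕ) * el 0 0 1 ^ (j:ℕ) by decide +kernel) x.z x.b
    rw [mem_R0_el hx, h, map_mul, map_pow, map_pow]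
    exact (Commute.pow_right (comm_of_conj h1 : Commute g (S.α (el 0 1 0))) _).mul_right
      (Commute.pow_right (comm_of_conj h2 : Commute g (S.α (el 0 0 1))) _)
  obtain ⟨Y, hYT, hY3, hYn, hYa, hYc, -⟩ := burnside hsyl (fun g hg hn => by
    rcases k.K.NT k.hr hn with ⟨h1, h2⟩ | ⟨h1, h2⟩
    · exact hcR g h1 h2
    · exfalso
      apply hrT
      have hr0 : r * S.α (el 0 0 1) * r⁻¹ = S.D := k.hr.act 0 0 1
      have h3 : r * g * S.D * (r * g)⁻¹ = S.D := by rw [conj_conj', h1, hr0]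
      have h4 : r * g * S.α (el 0 0 1) * (r * g)⁻¹ = S.α (el 0 0 1) := by rw [conj_conj', h2, k.hr.act_D]
      have h5 : r * g ∈ CC S.t := (CC S.t).mul_mem k.hr.comm (hT2 hg)
      obtain ⟨x, hx⟩ := S.cent _ (comm_of_conj h3)
      rw [← hx] at h4 h5
      rw [S.α_conj] at h4
      rw [← Subgroup.mul_mem_cancel_right _ hg, ← hx]
      rcases R0_norm x (S.α_comm.1 h5) (by rw [show d3 = el 0 0 1 from rfl, S.inj h4]; exact el_R0 0 1) with h | ⟨-, h⟩
      · exact hR2 (S.α_R.2 h)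
      · rw [← Subgroup.mul_mem_cancel_left _ ht2]
        have := hR2 (S.α_R.2 h)
        rwa [map_mul] at this)
  have hYZ : Y ≤ S.Z0 r := by
    refine k.K.T1 k.hr hY3 (hYT.trans hT2) (fun a ha => hYn a (hR2 ha)) t_Z0 ?_ ?_
    · exact fun y _ hy => Subgroup.mem_sup_left hy
    · rintro y - ⟨x, hx, h⟩
      have : y = S.be r x := by
        have h : S.α x = r * y * r⁻¹ := h
        rw [be_apply, h, ← conj_conj', k.hr.sq]; simp
      rw [this]; exact be_Z0 hx
  have h1 := Subgroup.card_le_of_le hYZ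
  rw [k.card_Z0] at h1
  constructor
  · rw [hc, hYc]
    nlinarith [Nat.mul_le_mul h1 k.card_R]
  intro M hXM hrM
  have hαM : ∀ x, S.α x ∈ M := fun x => hXM (S.X_mem x)
  have hT2M : T2 ≤ M := by
    intro g hg
    obtain ⟨y, hy, a, ha, rfl⟩ := hYa g hg
    obtain ⟨x, -, rfl⟩ := S.mem_R.1 ha
    obtain ⟨x1, -, x2, -, rfl⟩ := k.mem_Z0.1 (hYZ hy)
    exact M.mul_mem (M.mul_mem (hαM _) (M.mul_mem (M.mul_mem hrM (hαM _)) (M.inv_mem hrM))) (hαM _)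
  have hcard := Subgroup.card_le_of_le (show M ⊓ CC S.t ≤ CC S.t from inf_le_right)
  have hlt : T2 < M ⊓ CC S.t := lt_of_le_of_ne (le_inf hT2M hT2) (fun h => hrT (h ▸ ⟨hrM, k.hr.comm⟩))
  obtain ⟨q, hq⟩ := Subgroup.card_dvd_of_le hlt.le
  have hq1 : q ≠ 1 := fun h => hlt.ne (Subgroup.eq_of_le_of_card_ge hlt.le (by rw [hq, h, mul_one]))
  have hq0 : q ≠ 0 := fun h => Nat.card_pos.ne' (hq.trans (by rw [h, mul_zero]))
  have h2q : 2 ≤ q := by omega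
  exact inf_eq_right.1 (Subgroup.eq_of_le_of_card_ge inf_le_right (by rw [hc, hq]; nlinarith))
end Setup

/-- the relations satisfied by `X0` and the extra involution `r` -/
structure BN {Γ : Type*} [Group Γ] (a : X0 →* Γ) (r : Γ) : Prop where
  rr : r * r = 1
  rt : r * a tt = a tt * r
  re : ∀ p z b, r * a (el p z b) = a (el p b z) * r
  br : r * a t2 * r = a t2 * r * a t2
  rw : a ww * r * a ww * r = r * a ww * r * a ww
namespace BN

abbrev Y (k : T3) : X0 := mk0 0 k 0
theorem dec0 : ∀ x : X0, x.c = 0 → ∃ ε : X0, (ε = 1 ∨ ε = tt) ∧ x = Y x.q * el x.p (x.z + x.p * x.q) (x.a * x.b) * ε := by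
  intro x hc
  have : ∀ x : X0, x.c = 0 → (x = Y x.q * el x.p (x.z + x.p * x.q) (x.a * x.b) ∨ x = Y x.q * el x.p (x.z + x.p * x.q) (x.a * x.b) * tt) := by decide +kernel
  rcases this x hc with h | h
  · exact ⟨1, Or.inl rfl, by rw [mul_one]; exact h⟩
  · exact ⟨tt, Or.inr rfl, h⟩
theorem dec1 : ∀ x : X0, x.c ≠ 0 → ∃ j u, u.c = 0 ∧ x = el 0 0 j * ww * u := by
  intro x hc
  have : ∀ x : X0, x.c ≠ 0 → ((el 0 0 (x.a * x.c) * ww)⁻¹ * x).c = 0 := by decide +kernel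
  exact ⟨x.a * x.c, _, this x hc, by group⟩
theorem c_mul (x y : X0) (hx : x.c = 0) : (x * y).c = 0 ↔ y.c = 0 := by
  have h := x.h
  rw [hx, mul_zero, sub_zero] at h
  show x.c * y.a + x.e * y.c = 0 ↔ _
  rw [hx, zero_mul, zero_add]
  constructor
  · intro h1
    have : x.a * (x.e * y.c) = 0 := by rw [h1, mul_zero]
    rwa [← mul_assoc, h, one_mul] at this
  · intro h1; rw [h1, mul_zero]
variable {Γ : Type*} [Group Γ] {a : X0 →* Γ} {r : Γ} (B : BN a r)
include B

/-- moving an element of `B` past `r` -/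
theorem mv {u : X0} (hu : u.c = 0) : ∃ v, v.c = 0 ∧ a u * r = a (Y u.q) * r * a v := by
  obtain ⟨ε, hε, h⟩ := dec0 u hu
  have e1 := B.re u.p (u.a * u.b) (u.z + u.p * u.q)
  have e2 : r * a ε = a ε * r := by
    rcases hε with rfl | rfl
    · simp
    · exact B.rt
  refine ⟨el u.p (u.a * u.b) (u.z + u.p * u.q) * ε, ?_, ?_⟩
  · rw [c_mul _ _ rfl]; rcases hε with rfl | rfl <;> rfl
  · conv_lhs => rw [h]
    simp only [map_mul]
    rw [mul_assoc (a (Y u.q)) r, ← mul_assoc r, e1, mul_assoc _ r, e2]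
    simp only [mul_assoc]
theorem Yr {k : T3} (hk : k ≠ 0) : ∃ u v, r * a (Y k) * r = a u * r * a v := by
  cases k with
  | o => exact absurd rfl hk
  | i =>
    refine ⟨t2, t2 * tt, ?_⟩
    have : (Y T3.i) = t2 * tt := by decide +kernel
    rw [this]
    rw [map_mul, ← mul_assoc r, mul_assoc _ (a tt) r, ← B.rt, ← mul_assoc, B.br]
    simp only [mul_assoc]
  | j =>
    refine ⟨tt * t2, t2, ?_⟩
    have : (Y T3.j) = tt * t2 := by decide +kernel
    rw [this]
    rw [map_mul, ← mul_assoc r, B.rt, mul_assoc (a tt), mul_assoc (a tt), B.br]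
    simp only [mul_assoc]
theorem W {u v : X0} (hu : u.c ≠ 0) (hv : v.c ≠ 0) :
    ∃ u0 x0, u0.c = 0 ∧ a u * r * a v * r = a u0 * r * a ww * r * a x0 := by
  obtain ⟨j, u1, hu1, rfl⟩ := dec1 u hu
  obtain ⟨s, hs, e1⟩ := B.mv hu1
  have hsv : (s * v).c ≠ 0 := fun h => hv ((c_mul _ _ hs).1 h)
  obtain ⟨j', v1, hv1, e2⟩ := dec1 _ hsv
  obtain ⟨s', hs', e3⟩ := B.mv hv1
  have e4 : ww * Y v1.q = el v1.q 0 0 * ww := (show ∀ q, ww * Y q = el q 0 0 * ww by decide +kernel) _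
  have e5 : ww * el v1.q 0 0 = Y (-v1.q) * ww := (show ∀ q, ww * el q 0 0 = Y (-q) * ww by decide +kernel) _
  refine ⟨el 0 0 j * (ww * Y u1.q * el 0 j' 0 * ww⁻¹) * Y (-v1.q), ww * s', ?_, ?_⟩
  · exact (show ∀ j q k l, (el 0 0 j * (ww * Y q * el 0 k 0 * ww⁻¹) * Y l).c = 0 by decide +kernel) _ _ _ _
  · have h1 : a (el 0 0 j * ww * u1) * r * a v * r = a (el 0 0 j * ww) * (a u1 * r) * a v * r := by
      simp only [map_mul, mul_assoc]
    have h2 : a s * a v = a (el 0 0 j' * ww) * a v1 := by rw [← map_mul, e2, map_mul]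
    have h3 : r * a (el 0 0 j') = a (el 0 j' 0) * r := B.re 0 0 j'
    have h4 : r * a (el v1.q 0 0) = a (el v1.q 0 0) * r := B.re _ _ _
    have h5 : a ww * a (Y v1.q) = a (el v1.q 0 0) * a ww := by rw [← map_mul, e4, map_mul]
    have h6 : a ww * a (el v1.q 0 0) = a (Y (-v1.q)) * a ww := by rw [← map_mul, e5, map_mul]
    calc _ = a (el 0 0 j * ww) * (a (Y u1.q) * r * a s) * a v * r := by rw [h1, e1]
      _ = a (el 0 0 j * ww) * a (Y u1.q) * r * (a s * a v) * r := by simp only [mul_assoc]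
      _ = a (el 0 0 j * ww) * a (Y u1.q) * (r * a (el 0 0 j')) * a ww * (a v1 * r) := by
          rw [h2]; simp only [map_mul, mul_assoc]
      _ = a (el 0 0 j * ww) * a (Y u1.q) * a (el 0 j' 0) * r * (a ww * a (Y v1.q)) * r * a s' := by
          rw [h3, e3]; simp only [mul_assoc]
      _ = a (el 0 0 j * ww) * a (Y u1.q) * a (el 0 j' 0) * (r * a (el v1.q 0 0)) * a ww * r * a s' := by
          rw [h5]; simp only [mul_assoc]
      _ = a (el 0 0 j * ww) * a (Y u1.q) * a (el 0 j' 0) * a ww⁻¹ * (a ww * a (el v1.q 0 0)) * r * a ww * r * a s' := by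
          rw [h4, map_inv]; simp only [mul_assoc, inv_mul_cancel_left]
      _ = a (el 0 0 j * ww) * a (Y u1.q) * a (el 0 j' 0) * a ww⁻¹ * a (Y (-v1.q)) * (a ww * r * a ww * r) * a s' := by
          rw [h6]; simp only [mul_assoc]
      _ = _ := by rw [B.rw]; simp only [map_mul, mul_assoc]

theorem col {u v : X0} (hv : v.c = 0) : (∃ x, a u * r * a v * r = a x) ∨
    ∃ x y, a u * r * a v * r = a x * r * a y := by
  obtain ⟨s, hs, e⟩ := B.mv hv
  have e' : a u * r * a v * r = a u * (r * a (Y v.q) * r) * a s := by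
    rw [mul_assoc _ (a v), e]; simp only [mul_assoc]
  rw [e']
  by_cases hq : v.q = 0
  · left
    refine ⟨u * s, ?_⟩
    have : a (Y v.q) = 1 := by rw [hq]; exact map_one a
    rw [this, mul_one, B.rr, mul_one, map_mul]
  · right
    obtain ⟨x, y, h⟩ := B.Yr hq
    exact ⟨u * x, y * s, by rw [h]; simp only [map_mul, mul_assoc]⟩

def NF (a : X0 →* Γ) (r g : Γ) : Prop := (∃ x, g = a x) ∨ (∃ x y, g = a x * r * a y) ∨
  ∃ u v x, u.c = 0 ∧ v.c ≠ 0 ∧ g = a u * r * a v * r * a x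
theorem nf (u v x : X0) : NF a r (a u * r * a v * r * a x) := by
  by_cases hv : v.c = 0
  · rcases B.col (u := u) hv with ⟨s, h⟩ | ⟨s, s', h⟩
    · exact Or.inl ⟨s * x, by rw [h, map_mul]⟩
    · exact Or.inr (Or.inl ⟨s, s' * x, by rw [h, map_mul, mul_assoc]⟩)
  by_cases hu : u.c = 0
  · exact Or.inr (Or.inr ⟨u, v, x, hu, hv, rfl⟩)
  · obtain ⟨u0, x0, h0, h⟩ := B.W hu hv
    exact Or.inr (Or.inr ⟨u0, ww, x0 * x, h0, by decide, by rw [h, map_mul, mul_assoc]⟩)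
theorem nfX (x : X0) {g : Γ} (hg : NF a r g) : NF a r (a x * g) := by
  rcases hg with ⟨y, rfl⟩ | ⟨y, z, rfl⟩ | ⟨u, v, y, -, -, rfl⟩
  · exact Or.inl ⟨x * y, (map_mul _ _ _).symm⟩
  · exact Or.inr (Or.inl ⟨x * y, z, by simp only [map_mul, mul_assoc]⟩)
  · have := B.nf (x * u) v y
    simpa only [map_mul, mul_assoc] using this
theorem nfr {g : Γ} (hg : NF a r g) : NF a r (r * g) := by
  rcases hg with ⟨y, rfl⟩ | ⟨y, z, rfl⟩ | ⟨u, v, y, hu, hv, rfl⟩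
  · exact Or.inr (Or.inl ⟨1, y, by simp⟩)
  · have := B.nf 1 y z
    simpa only [map_one, one_mul, mul_assoc] using this
  · rcases B.col (u := 1) hu with ⟨s, h⟩ | ⟨s, s', h⟩
    · rw [map_one, one_mul] at h
      refine Or.inr (Or.inl ⟨s * v, y, ?_⟩)
      rw [map_mul, ← h]; simp only [mul_assoc]
    · rw [map_one, one_mul] at h
      have := B.nf s (s' * v) y
      rw [map_mul, ← mul_assoc, ← h] at this
      simpa only [mul_assoc] using this
theorem nf_all (hgen : ∀ M : Subgroup Γ, (∀ x, a x ∈ M) → r ∈ M → M = ⊤) (g : Γ) : NF a r g := by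
  let M : Subgroup Γ :=
    { carrier := {m | (∀ g, NF a r g → NF a r (m * g)) ∧ ∀ g, NF a r g → NF a r (m⁻¹ * g)}
      mul_mem' := by
        rintro x y ⟨h1, h2⟩ ⟨h3, h4⟩
        refine ⟨fun g hg => ?_, fun g hg => ?_⟩
        · rw [mul_assoc]; exact h1 _ (h3 _ hg)
        · rw [mul_inv_rev, mul_assoc]; exact h4 _ (h2 _ hg)
      one_mem' := by simp
      inv_mem' := by
        rintro x ⟨h1, h2⟩
        exact ⟨h2, by simpa using h1⟩ }
  have hM := hgen M (fun x => ⟨fun g => B.nfX x, fun g => by rw [← map_inv]; exact B.nfX x⁻¹⟩)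
    ⟨fun g => B.nfr, fun g => by rw [inv_eq_of_mul_eq_one_left B.rr]; exact B.nfr⟩
  have hg : g ∈ M := hM ▸ Subgroup.mem_top g
  simpa using hg.1 1 (Or.inl ⟨1, by simp⟩)
theorem bound (hgen : ∀ M : Subgroup Γ, (∀ x, a x ∈ M) → r ∈ M → M = ⊤) : Finite Γ ∧ Nat.card Γ ≤ 25920 := by
  have hf : Function.Surjective (fun w : (Unit ⊕ T3 ⊕ (T3 × T3) ⊕ (T3 × T3 × T3)) × X0 =>
      (match w.1 with
        | .inl _ => 1
        | .inr (.inl k) => a (Y k) * r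
        | .inr (.inr (.inl jk)) => a (el 0 0 jk.1 * ww * Y jk.2) * r
        | .inr (.inr (.inr kjk)) => a (Y kjk.1) * r * (a (el 0 0 kjk.2.1 * ww * Y kjk.2.2) * r)) * a w.2) := by
    intro g
    have hC : ∀ v : X0, v.c ≠ 0 → ∃ j k s, a v * r = a (el 0 0 j * ww * Y k) * r * a s := by
      intro v hv
      obtain ⟨j, u, hu, rfl⟩ := dec1 v hv
      obtain ⟨s, hs, e⟩ := B.mv hu
      exact ⟨j, u.q, s, by rw [map_mul, mul_assoc, e, map_mul _ _ (Y _)]; simp only [mul_assoc]⟩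
    rcases B.nf_all hgen g with ⟨y, rfl⟩ | ⟨y, z, rfl⟩ | ⟨u, v, y, hu, hv, rfl⟩
    · exact ⟨(.inl (), y), one_mul _⟩
    · by_cases hy : y.c = 0
      · obtain ⟨s, hs, e⟩ := B.mv hy
        exact ⟨(.inr (.inl y.q), s * z), by simp only [e, map_mul, mul_assoc]⟩
      · obtain ⟨j, k, s, e⟩ := hC y hy
        exact ⟨(.inr (.inr (.inl (j, k))), s * z), by simp only [e, map_mul, mul_assoc]⟩
    · obtain ⟨s, hs, e⟩ := B.mv hu
      obtain ⟨j, k, s', e'⟩ := hC (s * v) (fun h => hv ((c_mul _ _ hs).1 h))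
      refine ⟨(.inr (.inr (.inr (u.q, j, k))), s' * y), ?_⟩
      show a (Y u.q) * r * (a (el 0 0 j * ww * Y k) * r) * a (s' * y) = _
      calc _ = a (Y u.q) * r * (a (el 0 0 j * ww * Y k) * r * a s') * a y := by
            rw [map_mul a s' y]; simp only [mul_assoc]
        _ = (a (Y u.q) * r * a s) * a v * r * a y := by
            rw [← e', map_mul a s v]; simp only [mul_assoc]
        _ = _ := by rw [e]
  have hfin : Finite Γ := Finite.of_surjective _ hf
  refine ⟨hfin, (Nat.card_le_card_of_surjective _ hf).trans ?_⟩
  simp [Nat.card_prod, Nat.card_sum, T3.card, card_X0]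
end BN

/-- comparison of the two fields of order three -/
def th : T3 →+* ZMod 3 where
  toFun x := match x with
    | .o => 0
    | .i => 1
    | .j => 2
  map_one' := rfl
  map_zero' := rfl
  map_mul' := by decide
  map_add' := by decide
theorem th_inj : ∀ {x y : T3}, th x = th y → x = y := by decide
theorem th_surj : ∀ v : ZMod 3, ∃ x, th x = v := by decide
namespace Sp
open Matrix

abbrev M4 := Matrix (Fin 2 ⊕ Fin 2) (Fin 2 ⊕ Fin 2) (ZMod 3)

/-- the matrix of an element of `X0` -/
def Mx (x : X0) : M4 := Matrix.fromBlocks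
  !![1, th x.p * th x.c - th x.q * th x.a; 0, th x.a]
  !![th x.z, th x.p * th x.e - th x.q * th x.b; th x.p, th x.b]
  !![0, 0; 0, th x.c] !![1, 0; th x.q, th x.e]
theorem th_h (x : X0) : th x.a * th x.e - th x.b * th x.c = 1 := by
  have := congrArg th x.h
  simpa using this
theorem Mx_mem (x : X0) : Mx x ∈ Matrix.symplecticGroup (Fin 2) (ZMod 3) := by
  have h := th_h x
  rw [SymplecticGroup.mem_iff]
  unfold Mx Matrix.J
  simp only [Matrix.fromBlocks_transpose, Matrix.fromBlocks_multiply]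
  congr 1 <;> ext i j <;> fin_cases i <;> fin_cases j <;> simp [Matrix.mul_apply, Fin.sum_univ_two, Matrix.vecMul, dotProduct] <;>
    first | ring1 | linear_combination h | linear_combination -h | linear_combination th x.p * h | linear_combination th x.q * h | linear_combination -th x.p * h | linear_combination -th x.q * h
theorem Mx_mul (x y : X0) : Mx (x * y) = Mx x * Mx y := by
  have h := th_h x
  unfold Mx
  simp only [Matrix.fromBlocks_multiply]
  congr 1 <;> ext i j <;> fin_cases i <;> fin_cases j <;> simp [Matrix.mul_apply, Fin.sum_univ_two, mul_def] <;>
    first | ring1 | linear_combination (th y.p * th y.c - th y.q * th y.a) * h | linear_combination (th y.p * th y.e - th y.q * th y.b) * h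

def al : X0 →* Sp4F3 where
  toFun x := ⟨Mx x, Mx_mem x⟩
  map_one' := Subtype.ext (by
    show Mx 1 = 1
    decide +kernel)
  map_mul' x y := Subtype.ext (Mx_mul x y)

def rM : M4 := Matrix.fromBlocks !![0, 1; 1, 0] 0 0 !![0, 1; 1, 0]

def rr : Sp4F3 := ⟨rM, by rw [SymplecticGroup.mem_iff]; decide +kernel⟩

def ng : Sp4F3 := ⟨-1, by rw [SymplecticGroup.mem_iff]; decide +kernel⟩
theorem al_inj : Function.Injective al := by
  intro x y h
  have h' : Mx x = Mx y := congrArg Subtype.val h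
  have e := fun i j => congrFun (congrFun h' i) j
  have e1 := e (.inr 0) (.inr 0)
  refine X0.ext (th_inj ?_) (th_inj ?_) (th_inj ?_) (th_inj ?_) (th_inj ?_) (th_inj ?_) (th_inj ?_)
  · exact e (.inl 1) (.inr 0)
  · exact e (.inr 1) (.inr 0)
  · exact e (.inl 0) (.inr 0)
  · exact e (.inl 1) (.inl 1)
  · exact e (.inl 1) (.inr 1)
  · exact e (.inr 1) (.inl 1)
  · exact e (.inr 1) (.inr 1)

/-- the stabilizer of the first basis vector -/
theorem stab (g : Sp4F3) (h : ∀ i, (g : M4) i (.inl 0) = if i = .inl 0 then 1 else 0) : ∃ x, al x = g := by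
  have hg := (SymplecticGroup.mem_iff').1 g.2
  set A := (g : M4) with hA
  have e : ∀ i j, (∑ l, (∑ k, A k i * Matrix.J (Fin 2) (ZMod 3) k l) * A l j) = Matrix.J (Fin 2) (ZMod 3) i j := by
    intro i j
    have := congrFun (congrFun hg i) j
    simpa only [Matrix.mul_apply, Matrix.transpose_apply] using this
  have h1 := h (.inl 0)
  have h2 := h (.inl 1)
  have h3 := h (.inr 0)
  have h4 := h (.inr 1)
  have e1 := e (.inl 0) (.inl 1)
  have e2 := e (.inl 0) (.inr 0)
  have e3 := e (.inl 0) (.inr 1)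
  have e4 := e (.inr 0) (.inl 1)
  have e5 := e (.inr 0) (.inr 1)
  have e6 := e (.inl 1) (.inr 1)
  simp [Fintype.sum_sum_type, Fin.sum_univ_two, Matrix.J] at h1 h2 h3 h4 e1 e2 e3 e4 e5 e6
  simp [h1, h2, h3, h4] at e1 e2 e3
  simp [e1, e2, e3] at e4 e5 e6
  obtain ⟨z, hz⟩ := th_surj (A (.inl 0) (.inr 0))
  obtain ⟨p, hp⟩ := th_surj (A (.inl 1) (.inr 0))
  obtain ⟨q, hq⟩ := th_surj (A (.inr 1) (.inr 0))
  obtain ⟨a, ha⟩ := th_surj (A (.inl 1) (.inl 1))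
  obtain ⟨b, hb⟩ := th_surj (A (.inl 1) (.inr 1))
  obtain ⟨c, hc⟩ := th_surj (A (.inr 1) (.inl 1))
  obtain ⟨e', he⟩ := th_surj (A (.inr 1) (.inr 1))
  have hh : a * e' - b * c = 1 := by
    apply th_inj
    simp only [map_sub, map_mul, map_one, ha, he, hb, hc]
    linear_combination -e6
  refine ⟨⟨p, q, z, a, b, c, e', hh⟩, Subtype.ext ?_⟩
  show Mx _ = A
  ext i j
  rcases i with i | i <;> rcases j with j | j <;> fin_cases i <;> fin_cases j <;>
    simp [Mx, h1, h2, h3, h4, e1, e2, e3, ha, hb, hc, he, hp, hq, hz]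
  · linear_combination -e4
  · linear_combination -e5
theorem ng_c (g : Sp4F3) : g * ng = ng * g := Subtype.ext (by
  show (g : M4) * -1 = -1 * (g : M4)
  simp)
theorem ng_ng : ng * ng = 1 := Subtype.ext (by
  show (-1 : M4) * -1 = 1
  simp)

/-- the centralizer of the transvection -/
theorem CD (g : Sp4F3) (h : g * al dd = al dd * g) : ∃ x, g = al x ∨ g = ng * al x := by
  have h' : (g : M4) * Mx dd = Mx dd * (g : M4) := congrArg Subtype.val h
  have e : ∀ i, (g : M4) i (.inl 0) = if i = .inl 0 then (g : M4) (.inr 0) (.inr 0) else 0 := by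
    intro i
    have := congrFun (congrFun h' i) (.inr 0)
    rcases i with i | i <;> fin_cases i <;>
      simp [Matrix.mul_apply, Fintype.sum_sum_type, Fin.sum_univ_two, Mx] at this ⊢
    · linear_combination this
    all_goals exact this
  have hs : (g : M4) (.inr 0) (.inr 0) = 0 ∨ (g : M4) (.inr 0) (.inr 0) = 1 ∨ (g : M4) (.inr 0) (.inr 0) = -1 :=
    (show ∀ s : ZMod 3, s = 0 ∨ s = 1 ∨ s = -1 by decide) _
  rcases hs with hs | hs | hs
  · exfalso
    have hg := congrFun (congrFun ((SymplecticGroup.mem_iff').1 g.2) (.inl 0)) (.inr 0)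
    simp [Matrix.mul_apply, Fintype.sum_sum_type, Fin.sum_univ_two, Matrix.J, e, hs] at hg
  · obtain ⟨x, hx⟩ := stab g (fun i => by rw [e, hs])
    exact ⟨x, Or.inl hx.symm⟩
  · obtain ⟨x, hx⟩ := stab (ng * g) (fun i => by
      show ((-1 : M4) * (g : M4)) i (.inl 0) = _
      rw [neg_mul, one_mul, Matrix.neg_apply, e, hs]
      split_ifs <;> simp)
    exact ⟨x, Or.inr (by rw [hx, ← mul_assoc, ng_ng, one_mul])⟩
theorem r_r : rr * rr = 1 := Subtype.ext (by show rM * rM = 1; decide +kernel)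
theorem r_t : rr * al tt = ng * (al tt * rr) :=
  Subtype.ext (by show rM * Mx tt = -1 * (Mx tt * rM); decide +kernel)
theorem r_e (p z b : T3) : rr * al (el p z b) = al (el p b z) * rr :=
  Subtype.ext ((show ∀ p z b : T3, rM * Mx (el p z b) = Mx (el p b z) * rM by decide +kernel) p z b)
theorem r_b : rr * al t2 * rr = ng * (al t2 * rr * al t2) :=
  Subtype.ext (by show rM * Mx t2 * rM = -1 * (Mx t2 * rM * Mx t2); decide +kernel)
theorem r_w : al ww * rr * al ww * rr = rr * al ww * rr * al ww :=
  Subtype.ext (by show Mx ww * rM * Mx ww * rM = rM * Mx ww * rM * Mx ww; decide +kernel)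
theorem center_iff (g : Sp4F3) : g ∈ Subgroup.center Sp4F3 ↔ g = 1 ∨ g = ng := by
  constructor
  · intro h
    have hc := Subgroup.mem_center_iff.1 h
    have key : ∀ x, al x ∈ Subgroup.center Sp4F3 → x = 1 := by
      intro x hx
      have hx := Subgroup.mem_center_iff.1 hx
      have h1 : ∀ y, x * y = y * x := fun y => al_inj (by rw [map_mul, map_mul]; exact (hx _).symm)
      have h2 : x = 1 ∨ x = dd ∨ x = dd * dd :=
        (show ∀ x : X0, x * b1 = b1 * x → x * ww = ww * x → x = 1 ∨ x = dd ∨ x = dd * dd by decide +kernel)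
          x (h1 _) (h1 _)
      rcases h2 with h2 | h2 | h2
      · exact h2
      · exfalso
        have := congrArg Subtype.val (hx rr)
        rw [h2] at this
        exact absurd this (show ¬ rM * Mx dd = Mx dd * rM by decide +kernel)
      · exfalso
        have := congrArg Subtype.val (hx rr)
        rw [h2] at this
        exact absurd this (show ¬ rM * Mx (dd * dd) = Mx (dd * dd) * rM by decide +kernel)
    obtain ⟨x, hx | hx⟩ := CD g (hc _).symm
    · left
      rw [hx, key x (hx ▸ h), map_one]
    · right
      have h3 : ng ∈ Subgroup.center Sp4F3 := Subgroup.mem_center_iff.2 ng_c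
      have h4 : al x = ng * g := by rw [hx, ← mul_assoc, ng_ng, one_mul]
      rw [hx, key x (h4 ▸ mul_mem h3 h), map_one, mul_one]
  · rintro (rfl | rfl)
    · exact one_mem _
    · exact Subgroup.mem_center_iff.2 ng_c

abbrev vec (v1 v2 v3 v4 : T3) : Fin 2 ⊕ Fin 2 → T3 := Sum.elim ![v1, v2] ![v3, v4]
theorem vec_eta (v : Fin 2 ⊕ Fin 2 → T3) : v = vec (v (.inl 0)) (v (.inl 1)) (v (.inr 0)) (v (.inr 1)) := by
  funext i
  rcases i with i | i <;> fin_cases i <;> rfl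

def Hit (M : Subgroup Sp4F3) (v : Fin 2 ⊕ Fin 2 → T3) : Prop :=
  ∃ g ∈ M, ∀ i, (g : M4) i (.inl 0) = th (v i)
theorem Hit.neg {M : Subgroup Sp4F3} (hn : ng ∈ M) {v w : Fin 2 ⊕ Fin 2 → T3} (h : Hit M v) (hw : w = -v) : Hit M w := by
  obtain ⟨g, hg, h⟩ := h
  refine ⟨ng * g, mul_mem hn hg, fun i => ?_⟩
  show ((-1 : M4) * (g : M4)) i (.inl 0) = _
  rw [neg_mul, one_mul, Matrix.neg_apply, h, hw, Pi.neg_apply, map_neg]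

/-- transitivity on non-zero vectors -/
theorem trans (M : Subgroup Sp4F3) (hn : ng ∈ M) (ha : ∀ x, al x ∈ M) (hr : rr ∈ M)
    (v : Fin 2 ⊕ Fin 2 → T3) (hv : v ≠ 0) : Hit M v := by
  have c1 : ∀ v1 v2 v4, Hit M (vec v1 v2 1 v4) := by
    intro v1 v2 v4
    refine Hit.neg hn (v := -vec v1 v2 1 v4) ⟨al (mk0 v2 v4 v1) * (rr * al ww * rr),
      mul_mem (ha _) (mul_mem (mul_mem hr (ha _)) hr), ?_⟩ (neg_neg _).symm
    exact (show ∀ v1 v2 v4, ∀ i, (Mx (mk0 v2 v4 v1) * (rM * Mx ww * rM)) i (.inl 0) = th (-(vec v1 v2 1 v4 i))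
      by decide +kernel) v1 v2 v4
  have c2 : ∀ v1 v4, Hit M (vec v1 1 0 v4) := by
    intro v1 v4
    refine ⟨al ⟨0, -v1, 0, 1, 0, v4, 1, by simp⟩ * rr, mul_mem (ha _) hr, ?_⟩
    exact (show ∀ v1 v4, ∀ i, (Mx ⟨0, -v1, 0, 1, 0, v4, 1, by simp⟩ * rM) i (.inl 0) = th (vec v1 1 0 v4 i)
      by decide +kernel) v1 v4
  have c3 : ∀ v1, Hit M (vec v1 0 0 1) := by
    intro v1
    refine ⟨al ⟨v1, 0, 0, 0, -1, 1, 0, by decide⟩ * rr, mul_mem (ha _) hr, ?_⟩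
    exact (show ∀ v1, ∀ i, (Mx ⟨v1, 0, 0, 0, -1, 1, 0, by decide⟩ * rM) i (.inl 0) = th (vec v1 0 0 1 i)
      by decide +kernel) v1
  have c4 : Hit M (vec 1 0 0 0) := ⟨1, one_mem _, by
    show ∀ i, (1 : M4) i (.inl 0) = th (vec 1 0 0 0 i)
    decide +kernel⟩
  have nv : ∀ v1 v2 v3 v4, vec v1 v2 v3 v4 = -vec (-v1) (-v2) (-v3) (-v4) := by decide +kernel
  rw [vec_eta v] at hv ⊢
  generalize v (.inl 0) = v1 at *
  generalize v (.inl 1) = v2 at *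
  generalize v (.inr 0) = v3 at *
  generalize v (.inr 1) = v4 at *
  cases v3
  · cases v2
    · cases v4
      · cases v1
        · exact absurd (by decide) hv
        · exact c4
        · exact c4.neg hn (nv _ _ _ _)
      · exact c3 _
      · exact (c3 _).neg hn (nv _ _ _ _)
    · exact c2 _ _
    · exact (c2 _ _).neg hn (nv _ _ _ _)
  · exact c1 _ _ _
  · exact (c1 _ _ _).neg hn (nv _ _ _ _)
theorem fst_ne (g : Sp4F3) : ∃ v : Fin 2 ⊕ Fin 2 → T3, v ≠ 0 ∧ ∀ i, (g : M4) i (.inl 0) = th (v i) := by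
  choose v hv using fun i => th_surj ((g : M4) i (.inl 0))
  refine ⟨v, fun h0 => ?_, fun i => (hv i).symm⟩
  have hg := congrFun (congrFun ((SymplecticGroup.mem_iff').1 g.2) (.inl 0)) (.inr 0)
  simp [Matrix.mul_apply, Fintype.sum_sum_type, Fin.sum_univ_two, Matrix.J, ← hv, h0] at hg
theorem gen (M : Subgroup Sp4F3) (hn : ng ∈ M) (ha : ∀ x, al x ∈ M) (hr : rr ∈ M) : M = ⊤ := by
  rw [eq_top_iff]
  rintro g -
  obtain ⟨v, hv, h⟩ := fst_ne g
  obtain ⟨m, hm, h'⟩ := trans M hn ha hr v hv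
  obtain ⟨x, hx⟩ := stab (m⁻¹ * g) (by
    intro i
    have e : (((m⁻¹ * m : Sp4F3)) : M4) i (.inl 0) = (((m⁻¹ * g : Sp4F3)) : M4) i (.inl 0) := by
      show ((m⁻¹ : Sp4F3) * (m : M4)) i (.inl 0) = ((m⁻¹ : Sp4F3) * (g : M4)) i (.inl 0)
      rw [Matrix.mul_apply, Matrix.mul_apply]
      exact Finset.sum_congr rfl (fun k _ => by rw [h, h'])
    rw [← e, inv_mul_cancel]
    exact Matrix.one_apply)
  have : g = m * al x := by rw [hx]; group
  rw [this]
  exact mul_mem hm (ha x)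
theorem card_ge : 80 * 648 ≤ Nat.card Sp4F3 := by
  choose n hn hn' using fun v : {v : Fin 2 ⊕ Fin 2 → T3 // v ≠ 0} =>
    trans ⊤ (Subgroup.mem_top _) (fun _ => Subgroup.mem_top _) (Subgroup.mem_top _) v.1 v.2
  have hc : Nat.card ({v : Fin 2 ⊕ Fin 2 → T3 // v ≠ 0} × X0) = 80 * 648 := by
    rw [Nat.card_prod, card_X0, Nat.card_eq_fintype_card, Fintype.card_subtype_compl]
    simp
  rw [← hc]
  refine Nat.card_le_card_of_injective (fun w => n w.1 * al w.2) ?_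
  rintro ⟨v, x⟩ ⟨v', x'⟩ h
  have c : ∀ v x i, ((n v * al x : Sp4F3) : M4) i (.inl 0) = th (v.1 i) := by
    intro v x i
    show ((n v : M4) * Mx x) i (.inl 0) = _
    rw [← hn' v i]
    simp [Matrix.mul_apply, Fintype.sum_sum_type, Fin.sum_univ_two, Mx]
  have h : n v * al x = n v' * al x' := h
  have hv : v = v' := Subtype.ext (funext fun i => th_inj (by rw [← c v x i, ← c v' x' i, h]))
  subst hv
  rw [al_inj (mul_left_cancel h)]
open Matrix

def qm : Sp4F3 →* PSp4F3 := QuotientGroup.mk' (Subgroup.center Sp4F3)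
def ap : X0 →* PSp4F3 := qm.comp al
def rp : PSp4F3 := qm rr
theorem qm_surj (g : PSp4F3) : ∃ h, qm h = g := QuotientGroup.mk'_surjective _ g
theorem qm_eq {g h : Sp4F3} : qm g = qm h ↔ h = g ∨ h = ng * g := by
  have : qm g = qm h ↔ g⁻¹ * h ∈ Subgroup.center Sp4F3 := QuotientGroup.eq
  rw [this, center_iff, inv_mul_eq_one, inv_mul_eq_iff_eq_mul, ng_c, eq_comm (a := g)]
theorem qm_ng (g : Sp4F3) : qm (ng * g) = qm g := (qm_eq.2 (Or.inr rfl)).symm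
theorem al_ng (x : X0) : al x ≠ ng := by
  intro h
  have := congrFun (congrFun (congrArg Subtype.val h) (.inl 0)) (.inl 0)
  exact absurd (show (1 : ZMod 3) = -1 from this) (by decide)
theorem ap_inj : Function.Injective ap := by
  intro x y h
  rcases qm_eq.1 h with h | h
  · exact (al_inj h).symm
  · exfalso
    apply al_ng (y * x⁻¹)
    rw [map_mul, h, map_inv, mul_inv_cancel_right]
theorem BNp : BN ap rp where
  rr := by show qm rr * qm rr = 1; rw [← map_mul, r_r, map_one]
  rt := by show qm rr * qm (al tt) = qm (al tt) * qm rr; rw [← map_mul, r_t, qm_ng, map_mul]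
  re p z b := by
    show qm rr * qm (al _) = qm (al _) * qm rr
    rw [← map_mul, r_e, map_mul]
  br := by
    show qm rr * qm (al t2) * qm rr = qm (al t2) * qm rr * qm (al t2)
    rw [← map_mul, ← map_mul, r_b, qm_ng, map_mul, map_mul]
  rw := by
    show qm (al ww) * qm rr * qm (al ww) * qm rr = qm rr * qm (al ww) * qm rr * qm (al ww)
    rw [← map_mul, ← map_mul, ← map_mul, r_w, map_mul, map_mul, map_mul]
theorem genp (M : Subgroup PSp4F3) (ha : ∀ x, ap x ∈ M) (hr : rp ∈ M) : M = ⊤ := by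
  have := gen (M.comap qm) (by
    rw [Subgroup.mem_comap, ← mul_one ng, qm_ng, map_one]; exact one_mem _) ha hr
  rw [eq_top_iff]
  rintro g -
  obtain ⟨h, rfl⟩ := qm_surj g
  have hh : h ∈ M.comap qm := this ▸ Subgroup.mem_top h
  exact hh
theorem card_center : Nat.card (Subgroup.center Sp4F3) ≤ 2 := by
  have : ((Subgroup.center Sp4F3 : Subgroup Sp4F3) : Set Sp4F3) = {1, ng} := by
    ext g; exact center_iff g
  calc Nat.card (Subgroup.center Sp4F3) = ((Subgroup.center Sp4F3 : Subgroup Sp4F3) : Set Sp4F3).ncard := rfl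
    _ ≤ 2 := by rw [this]; exact (Set.ncard_insert_le _ _).trans (by simp)
theorem cardp : Nat.card PSp4F3 = 25920 := by
  have h1 := (BNp.bound genp).2
  have h2 := card_ge
  have h3 := Subgroup.card_eq_card_quotient_mul_card_subgroup (Subgroup.center Sp4F3)
  have h4 := card_center
  have h5 : Nat.card Sp4F3 ≤ Nat.card PSp4F3 * 2 := h3 ▸ Nat.mul_le_mul_left _ h4
  clear * - h1 h2 h5
  omega
theorem centp (g : PSp4F3) (h : g * ap dd = ap dd * g) : ∃ x, ap x = g := by
  obtain ⟨g, rfl⟩ := qm_surj g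
  have h : qm g * qm (al dd) = qm (al dd) * qm g := h
  rw [← map_mul, ← map_mul] at h
  rcases qm_eq.1 h with h | h
  · obtain ⟨x, rfl | rfl⟩ := CD g h.symm
    · exact ⟨x, rfl⟩
    · exact ⟨x, (qm_ng _).symm⟩
  · exfalso
    have h1 : g * al dd * g⁻¹ = ng * al dd := by
      have : al dd * g = ng * (g * al dd) := h
      have h3 : g * al dd = ng * (al dd * g) := by rw [this, ← mul_assoc ng, ng_ng, one_mul]
      rw [h3]; group
    have h2 : (g * al dd * g⁻¹) ^ 3 = 1 := by
      rw [conj_pow, ← map_pow, show dd ^ 3 = 1 by decide +kernel]; simp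
    have h3 : (ng * al dd) ^ 3 = ng := by
      rw [(show Commute ng (al dd) from (ng_c _).symm).mul_pow, ← map_pow, show dd ^ 3 = 1 by decide +kernel,
        map_one, mul_one, pow_succ, pow_two, ng_ng, one_mul]
    rw [h1, h3] at h2
    exact al_ng 1 (by rw [map_one, h2])

def mM : M4 := Matrix.fromBlocks !![0, 1; 1, 1] !![2, 2; 0, 1] !![2, 1; 0, 2] !![0, 1; 2, 1]
def mm : Sp4F3 := ⟨mM, by rw [SymplecticGroup.mem_iff]; decide +kernel⟩

/-- the fusion of two involutions -/
theorem word : ∃ m : PSp4F3, m * (ap ww * (rp * ap ww * rp)) = ap tt * rp * m := by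
  refine ⟨qm mm, ?_⟩
  have : mm * (al ww * (rr * al ww * rr)) = al tt * rr * mm := Subtype.ext (by
    show mM * (Mx ww * (rM * Mx ww * rM)) = Mx tt * rM * mM
    decide +kernel)
  show qm mm * (qm (al ww) * (qm rr * qm (al ww) * qm rr)) = qm (al tt) * qm rr * qm mm
  simp only [← map_mul]
  rw [this]

instance finp : Finite PSp4F3 := (BNp.bound genp).1

theorem central {z : PSp4F3} (hz : IsThreeCentral z) :
    ∃ b : X0 →* PSp4F3, Function.Injective b ∧ ∀ g, g * z = z * g ↔ ∃ x, b x = g := by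
  obtain ⟨ho, T, hzT, hT⟩ := hz
  have f3 : Fact (Nat.Prime 3) := ⟨Nat.prime_three⟩
  have hS : IsSylowIn 3 (T : Subgroup PSp4F3) ⊤ := ⟨le_top, T.2, fun R _ h1 h2 => T.3 h1 h2⟩
  have hP : IsPGroup 3 (P0.map ap) := by
    refine IsPGroup.of_card (n := 4) ?_
    rw [Nat.card_congr (P0.equivMapOfInjective ap ap_inj).symm.toEquiv, card_P0]; norm_num
  obtain ⟨g, -, hg⟩ := hS.conj hP le_top
  have hc : ∀ x ∈ P0, (g⁻¹ * z * g) * ap x = ap x * (g⁻¹ * z * g) := by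
    intro x hx
    have := hT _ (hg _ ⟨x, hx, rfl⟩)
    calc _ = g⁻¹ * (z * (g * ap x * g⁻¹)) * g := by group
      _ = g⁻¹ * (g * ap x * g⁻¹ * z) * g := by rw [this]
      _ = _ := by group
  obtain ⟨x, hx⟩ := centp _ (hc dd ⟨rfl, rfl, rfl⟩)
  have hx' : ∀ y ∈ P0, x * y = y * x := fun y hy => ap_inj (by
    rw [map_mul, map_mul, hx, hc y hy])
  have hxE := centr_E x (hx' _ ⟨rfl, rfl, rfl⟩) (hx' _ ⟨rfl, rfl, rfl⟩)
  have h3 := centr_P x (E0_le hxE) (hx' _ ⟨rfl, rfl, rfl⟩) (hx' _ ⟨rfl, rfl, rfl⟩) (hx' _ ⟨rfl, rfl, rfl⟩)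
  have hzx : z = g * ap x * g⁻¹ := by rw [hx]; group
  have hx1 : x ≠ 1 := by
    rintro rfl
    rw [map_one, mul_one, mul_inv_cancel] at hzx
    rw [hzx, orderOf_one] at ho
    exact absurd ho (by norm_num)
  have hcomm : ∀ h, h * ap x = ap x * h ↔ ∃ y, ap y = h := by
    intro h
    constructor
    · intro hh
      apply centp
      rcases h3 with h3 | h3 | h3
      · exact absurd h3 hx1
      · rw [← h3]; exact hh
      · have e : ap dd = ap x * ap x := by
          rw [h3, ← map_mul]; congr 1
        rw [e, ← mul_assoc, hh, mul_assoc, hh, mul_assoc]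
    · rintro ⟨y, rfl⟩
      rw [← map_mul, ← map_mul]
      congr 1
      rcases h3 with h3 | h3 | h3
      · exact absurd h3 hx1
      · rw [h3]; exact centr_dd y
      · rw [h3, ← mul_assoc, centr_dd, mul_assoc, centr_dd]
  refine ⟨(MulAut.conj g).toMonoidHom.comp ap, (MulAut.conj g).injective.comp ap_inj, fun h => ?_⟩
  have e1 : h * z = z * h ↔ (g⁻¹ * h * g) * ap x = ap x * (g⁻¹ * h * g) := by
    rw [hzx]
    constructor
    · intro e
      calc _ = g⁻¹ * (h * (g * ap x * g⁻¹)) * g := by group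
        _ = _ := by rw [e]; group
    · intro e
      calc _ = g * ((g⁻¹ * h * g) * ap x) * g⁻¹ := by group
        _ = _ := by rw [e]; group
  rw [e1, hcomm]
  constructor
  · rintro ⟨y, hy⟩
    refine ⟨y, ?_⟩
    show g * ap y * g⁻¹ = h
    rw [hy]; group
  · rintro ⟨y, rfl⟩
    refine ⟨y, ?_⟩
    show ap y = g⁻¹ * (g * ap y * g⁻¹) * g
    group
end Sp
theorem F13 : 11 ≤ (insert dd ((Finset.univ : Finset (T3 × T3)).image fun w =>
    (el 0 0 w.1 * ww * BN.Y w.2) * d3 * (el 0 0 w.1 * ww * BN.Y w.2)⁻¹) ∪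
    (Finset.univ : Finset T3).image fun i => BN.Y i * d3 * (BN.Y i)⁻¹).card := by decide +kernel

/-- comparing two groups satisfying the relations -/
theorem BN.lift {G : Type*} [Group G] [Finite G] {a : X0 →* G} {r : G} (B : BN a r) :
    ∃ f : PSp4F3 →* G, (∀ x, f (Sp.ap x) = a x) ∧ f Sp.rp = r := by
  let Γ : Subgroup (G × PSp4F3) := Subgroup.closure (Set.range (a.prod Sp.ap) ∪ {(r, Sp.rp)})
  have ha : ∀ x, (a.prod Sp.ap) x ∈ Γ := fun x => Subgroup.subset_closure (Or.inl ⟨x, rfl⟩)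
  have hr : (r, Sp.rp) ∈ Γ := Subgroup.subset_closure (Or.inr rfl)
  let a' : X0 →* Γ := (a.prod Sp.ap).codRestrict Γ ha
  let r' : Γ := ⟨(r, Sp.rp), hr⟩
  have B' : BN a' r' :=
    { rr := Subtype.ext (Prod.ext B.rr Sp.BNp.rr)
      rt := Subtype.ext (Prod.ext B.rt Sp.BNp.rt)
      re := fun p z b => Subtype.ext (Prod.ext (B.re p z b) (Sp.BNp.re p z b))
      br := Subtype.ext (Prod.ext B.br Sp.BNp.br)
      rw := Subtype.ext (Prod.ext B.rw Sp.BNp.rw) }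
  have hb := B'.bound (by
    intro M h1 h2
    rw [eq_top_iff]
    rintro ⟨g, hg⟩ -
    have : Γ ≤ M.map Γ.subtype := by
      rw [Subgroup.closure_le]
      rintro _ (⟨x, rfl⟩ | h)
      · exact ⟨a' x, h1 x, rfl⟩
      · rw [h]; exact ⟨r', h2, rfl⟩
    obtain ⟨m, hm, e⟩ := this hg
    have : m = ⟨g, hg⟩ := Subtype.ext e
    exact this ▸ hm)
  let π : Γ →* PSp4F3 := (MonoidHom.snd G PSp4F3).comp Γ.subtype
  have hs : Function.Surjective π := by
    rw [← MonoidHom.range_eq_top]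
    exact Sp.genp _ (fun x => ⟨a' x, rfl⟩) ⟨r', rfl⟩
  have hfin := hb.1
  have hbij : Function.Bijective π := by
    refine (Nat.bijective_iff_surjective_and_card π).2 ⟨hs, le_antisymm ?_ (Nat.card_le_card_of_surjective π hs)⟩
    rw [Sp.cardp]; exact hb.2
  let e : Γ ≃* PSp4F3 := MulEquiv.ofBijective π hbij
  refine ⟨(MonoidHom.fst G PSp4F3).comp (Γ.subtype.comp e.symm.toMonoidHom), ?_, ?_⟩
  · intro x
    have : e.symm (Sp.ap x) = a' x := e.symm_apply_eq.2 rfl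
    show ((e.symm (Sp.ap x) : Γ) : G × PSp4F3).1 = a x
    rw [this]; rfl
  · have : e.symm Sp.rp = r' := e.symm_apply_eq.2 rfl
    show ((e.symm Sp.rp : Γ) : G × PSp4F3).1 = r
    rw [this]
namespace Setup
variable {G : Type*} [Group G] [Finite G] {S : Setup G}
variable {r : G} (k : S.KR r)
include k
theorem KR.BN : BN S.α r where
  rr := k.hr.sq
  rt := k.hr.comm
  re := k.hr.act'
  br := by
    have h := k.hr.braid
    have h2 : S.α t2 * S.α t2 = 1 := by rw [← map_mul, show t2 * t2 = 1 by decide +kernel, map_one]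
    have h1 := k.hr.sq
    have h3 : r * S.α t2 * r * (S.α t2 * r * S.α t2) = 1 := by
      rw [pow_succ, pow_two] at h; simpa only [mul_assoc] using h
    have h4 : (S.α t2 * r * S.α t2) * (S.α t2 * r * S.α t2) = 1 := by
      calc _ = S.α t2 * r * (S.α t2 * S.α t2) * r * S.α t2 := by simp only [mul_assoc]
        _ = S.α t2 * (r * r) * S.α t2 := by rw [h2, mul_one, mul_assoc _ r r]
        _ = 1 := by rw [h1, mul_one, h2]
    exact mul_right_cancel (h3.trans h4.symm)
  rw := by
    have := k.K.SL_comm k.hr (x := ww) (y := ww) ⟨rfl, rfl, rfl⟩ ⟨rfl, rfl, rfl⟩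
    rw [k.hr.inv] at this
    simpa only [mul_assoc] using this

/-- the subgroup generated by `X` and `r` is `PSp₄(3)` -/
theorem KR.emb : ∃ f : PSp4F3 →* G, Function.Injective f ∧ (∀ x, f (Sp.ap x) = S.α x) ∧ f Sp.rp = r := by
  obtain ⟨f, h1, h2⟩ := k.BN.lift
  refine ⟨f, ?_, h1, h2⟩
  rw [← MonoidHom.ker_eq_bot_iff]
  have hn : Nz f.ker (Sp.ap dd) := by
    intro a
    constructor
    · intro h
      have := f.normal_ker.conj_mem _ h (Sp.ap dd)⁻¹
      simpa [mul_assoc] using this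
    · intro h; exact f.normal_ker.conj_mem _ h _
  have h3 : Nat.card f.ker ≡ 1 [MOD 3] := by
    have := card_fixed (p := 3) hn (k := 1) (by rw [pow_one, ← map_pow, show dd ^ 3 = 1 by decide +kernel, map_one])
    have hb : (f.ker ⊓ CC (Sp.ap dd) : Subgroup PSp4F3) = ⊥ := by
      rw [eq_bot_iff]
      rintro g ⟨hg, hc⟩
      obtain ⟨x, rfl⟩ := Sp.centp g (mem_CC.1 hc)
      have hg : f (Sp.ap x) = 1 := hg
      rw [h1] at hg
      have : x = 1 := S.inj (by rw [hg, map_one])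
      rw [this, map_one]; exact one_mem _
    rw [hb, Subgroup.card_bot] at this
    exact this
  have hX : CC S.D ≤ f.range := by
    intro g hg
    obtain ⟨x, rfl⟩ := S.cent g (mem_CC.1 hg)
    exact ⟨Sp.ap x, h1 x⟩
  have hc := card_cls f.range S.D
  rw [inf_eq_right.2 hX, S.cardX] at hc
  have hk : Nat.card f.range * Nat.card f.ker = 25920 := by
    rw [← Sp.cardp, Subgroup.card_eq_card_quotient_mul_card_subgroup f.ker,
      Nat.card_congr (QuotientGroup.quotientKerEquivRange f).toEquiv]
  have h11 : 11 ≤ (cls f.range S.D).ncard := by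
    refine F13.trans ?_
    rw [← Set.ncard_coe_finset, ← Set.ncard_image_of_injective _ S.inj]
    refine Set.ncard_le_ncard ?_ (Set.toFinite _)
    have key : ∀ u : X0, S.α (u * d3 * u⁻¹) ∈ cls f.range S.D := by
      intro u
      refine ⟨S.α u * r, mul_mem ⟨Sp.ap u, h1 u⟩ ⟨Sp.rp, h2⟩, ?_⟩
      have := k.hr.act_D
      rw [conj_conj', this, map_mul, map_mul, map_inv]
    rintro _ ⟨x, hx, rfl⟩
    simp only [Finset.coe_union, Finset.coe_insert, Finset.coe_image, Finset.coe_univ, Set.image_univ] at hx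
    rcases hx with (rfl | ⟨w, rfl⟩) | ⟨w, rfl⟩
    · exact self_mem_cls _ _
    · exact key _
    · exact key _
  have h40 : (cls f.range S.D).ncard * Nat.card f.ker = 40 := by
    rw [← hc] at hk
    have : 648 * ((cls f.range S.D).ncard * Nat.card f.ker) = 648 * 40 := by rw [← mul_assoc, mul_comm 648]; exact hk
    exact Nat.eq_of_mul_eq_mul_left (by norm_num) this
  have : Nat.card f.ker = 1 := by
    generalize Nat.card f.ker = m at *
    generalize (cls f.range S.D).ncard = n at *
    clear * - h3 h11 h40
    have hm : m < 4 := by nlinarith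
    unfold Nat.ModEq at h3
    omega
  exact Subgroup.card_eq_one.1 this
end Setup
namespace X0
theorem A_conj : ∀ p z : T3, p ≠ 0 → ∃ y : X0, y * el p z 0 * y⁻¹ = el 1 0 0 := by
  have : ∀ p z : T3, p ≠ 0 → (∃ q : T3, mk0 0 q 0 * el p z 0 * (mk0 0 q 0)⁻¹ = el 1 0 0) ∨
      ∃ q : T3, (tt * mk0 0 q 0) * el p z 0 * (tt * mk0 0 q 0)⁻¹ = el 1 0 0 := by decide +kernel
  intro p z hp
  rcases this p z hp with ⟨q, h⟩ | ⟨q, h⟩ <;> exact ⟨_, h⟩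
theorem d_conj : ∀ p : T3, ∃ y : X0, y * el 0 0 1 * y⁻¹ = el p (p * p) 1 := by
  have : ∀ p : T3, ∃ q : T3, mk0 0 q 0 * el 0 0 1 * (mk0 0 q 0)⁻¹ = el p (p * p) 1 := by decide +kernel
  intro p
  obtain ⟨q, h⟩ := this p
  exact ⟨_, h⟩
theorem vv_conj : vv * ww * vv⁻¹ = tt * ww := by decide +kernel
theorem Q0_wv : ww ∈ Q0 ∧ vv ∈ Q0 := by decide +kernel
end X0
namespace Setup
variable {G : Type*} [Group G] [Finite G] {S : Setup G}
theorem CC_el_neg (p z b : T3) : CC (S.α (el (-p) (-z) (-b))) = CC (S.α (el p z b)) := by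
  ext g
  rw [← el_inv', mem_CC, mem_CC]
  exact Commute.inv_right_iff (a := g) (b := S.α (el p z b))
variable {r : G} (k : S.KR r)
include k

section
variable {M : Subgroup G} (hX : CC S.D ≤ M) (hrM : r ∈ M)
include hX hrM
theorem KR.C_M {x : X0} (h1 : x ≠ 1) (h : x * x = 1 ∨ x * x * x = 1) : CC (S.α x) ≤ M := by
  have hXM : ∀ x, S.α x ∈ M := fun x => hX (S.X_mem x)
  have hb2 : CC (S.α (el 0 1 (-1))) ≤ M := by
    intro g hg
    obtain ⟨x, -, rfl⟩ := S.mem_U.1 (k.K.C_b2 k.hr hg)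
    exact hXM x
  have hc : CC (S.α (el 0 1 1)) ≤ M := by
    intro g hg
    have h1 : g * S.α (el 0 1 1) * g⁻¹ = S.α (el 0 1 1) := mul_inv_eq_iff_eq_mul.2 hg
    obtain ⟨e, he, h2⟩ := k.K.Nc k.hr (k.K.C_c k.hr hg) h1
    obtain ⟨y, -, rfl⟩ := S.mem_E.1 he
    have ht : S.t ∈ M := hXM tt
    rcases h2 with rfl | rfl | rfl | rfl
    · exact hXM y
    · exact mul_mem ht (hXM y)
    · exact mul_mem hrM (hXM y)
    · exact mul_mem (mul_mem hrM ht) (hXM y)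
  have hd : CC (S.α (el 0 0 1)) ≤ M := by
    refine C_conj hrM ?_
    rw [k.hr.act]; exact hX
  rcases h with h | h
  · exact S.C_inv (k.card_T.2 M hX hrM) hX h h1
  · refine S.C_el hX ?_ ?_ h h1
    · intro p z hp
      obtain ⟨y, hy⟩ := A_conj p z hp
      refine C_conj (hXM y) ?_
      rw [S.α_conj, hy]
      obtain ⟨u, v, -, -, p', z', b', e1, e2⟩ := b1_to_b2
      refine C_conj (hXM u) ?_
      rw [S.α_conj, e1]
      refine C_conj hrM ?_
      rw [k.hr.act]
      refine C_conj (hXM v) ?_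
      rw [S.α_conj, e2]
      exact hb2
    · intro z b hb
      have := (show ∀ z b : T3, b ≠ 0 → ((z = 0 ∧ b = 1) ∨ (z = -0 ∧ b = -1)) ∨ ((z = 1 ∧ b = 1) ∨ (z = -1 ∧ b = -1)) ∨
        ((z = 1 ∧ b = -1) ∨ (z = -1 ∧ b = -(-1))) by decide) z b hb
      have h0 : ∀ z b : T3, S.α (el 0 (-z) (-b)) = S.α (el (-0) (-z) (-b)) := fun z b => rfl
      rcases this with (⟨rfl, rfl⟩ | ⟨rfl, rfl⟩) | (⟨rfl, rfl⟩ | ⟨rfl, rfl⟩) | (⟨rfl, rfl⟩ | ⟨rfl, rfl⟩)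
      · exact hd
      · rw [h0, CC_el_neg]; exact hd
      · exact hc
      · rw [h0, CC_el_neg]; exact hc
      · exact hb2
      · rw [h0, CC_el_neg]; exact hb2
theorem KR.D_M {u : G} (h : u * S.D * u⁻¹ ∈ M) : u * S.D * u⁻¹ ∈ cls M S.D := by
  have hXM : ∀ x, S.α x ∈ M := fun x => hX (S.X_mem x)
  have hP : IsSylowIn 3 S.P M := S.sylP.mono le_top (S.P_le_X.trans hX)
  have h3 : ∀ v : G, (v * S.D * v⁻¹) ^ 3 = 1 := by
    intro v; rw [conj_pow, S.E_cube S.D_mem]; simp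
  obtain ⟨m, hm, h1⟩ := hP.conj_elt h (k := 1) (by rw [pow_one]; exact h3 u)
  obtain ⟨x, -, hx⟩ := S.mem_P.1 h1
  have hx3 : x * x * x = 1 := by
    apply S.inj
    rw [map_one, map_mul, map_mul, hx, ← pow_two, ← pow_succ, ← conj_conj', h3]
  have key : ∃ y : X0, y * x * y⁻¹ ∈ E0 := by
    rcases conj_into_E x hx3 with h | ⟨j, h⟩
    · exact ⟨1, by simpa using h⟩
    · exact ⟨_, h⟩
  obtain ⟨y, hy⟩ := key
  have e1 : (S.α y * m * u) * S.D * (S.α y * m * u)⁻¹ = S.α (y * x * y⁻¹) := by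
    rw [conj_conj', conj_conj', ← hx, S.α_conj]
  obtain ⟨n, hn, e2⟩ := S.fus (h := S.α y * m * u) S.D_mem (by rw [e1]; exact S.α_E.2 hy)
  have e3 : u * S.D * u⁻¹ = (S.α y * m)⁻¹ * (n * S.D * n⁻¹) * ((S.α y * m)⁻¹)⁻¹ := by
    rw [e2, conj_conj' (S.α y * m) u]; simp [mul_assoc]
  rw [e3]
  refine cls_conj (M.inv_mem (mul_mem (hXM y) hm)) ?_
  rcases k.K.cls n hn with h | ⟨p, h⟩
  · rw [h]; exact self_mem_cls _ _
  · obtain ⟨v, hv⟩ := d_conj p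
    rw [h, ← hv, ← S.α_conj, ← k.hr.act_D]
    exact cls_conj (hXM v) ⟨r, hrM, rfl⟩
end
theorem KR.v_ne {g : G} (h : g * S.t * g⁻¹ = S.t * r) : False := by
  have hcv : S.t * r * S.c = S.c * (S.t * r) := by
    rw [mul_assoc, k.hr.r_c, ← mul_assoc, S.t_c, mul_assoc]
  have hc3 : S.c ^ 3 = 1 := S.E_cube (S.α_E.2 (el_mem _ _ _))
  have h1 : g⁻¹ * S.c * g ∈ CC S.t := by
    rw [mem_CC]
    have : S.t = g⁻¹ * (S.t * r) * g := by rw [← h]; simp [mul_assoc]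
    calc g⁻¹ * S.c * g * S.t = g⁻¹ * (S.c * (S.t * r)) * g := by rw [← h]; simp [mul_assoc]
      _ = g⁻¹ * (S.t * r * S.c) * g := by rw [hcv]
      _ = _ := by rw [← h]; simp [mul_assoc]
  obtain ⟨y, hy, h2⟩ := (k.K.sylR k.hr).conj_elt h1 (k := 1) (by
    have := conj_pow (i := 3) (a := g⁻¹) (b := S.c)
    rw [inv_inv] at this
    rw [pow_one, this, hc3]; simp)
  have hg' : (g * y⁻¹) * S.t * (g * y⁻¹)⁻¹ = S.t * r := by
    rw [conj_conj', inv_inv]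
    have : y⁻¹ * S.t * y = S.t := by rw [mul_assoc, ← mem_CC.1 hy]; simp
    rw [this, h]
  have h3 : (g * y⁻¹)⁻¹ * S.c * (g * y⁻¹) ∈ S.R := by
    convert h2 using 1; simp [mul_assoc]
  generalize g * y⁻¹ = w at *
  have hwR : ∀ e ∈ S.R, (w * e * w⁻¹) * S.c = S.c * (w * e * w⁻¹) := by
    intro e he
    have := S.R_comm _ he _ h3
    calc _ = w * (e * (w⁻¹ * S.c * w)) * w⁻¹ := by simp [mul_assoc]
      _ = _ := by rw [this]; simp [mul_assoc]
  have hDR : S.D ∈ S.R := S.α_R.2 (el_R0 1 0)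
  have hxc := hwR _ hDR
  have hxE : w * S.D * w⁻¹ ∈ S.E := k.K.syl_c.mem_of_nz (k := 1) (mem_CC.2 hxc) (k.K.C_c k.hr hxc)
    (by rw [pow_one, conj_pow, S.E_cube S.D_mem]; simp)
  have htD : S.t * S.D * S.t⁻¹ = S.D := by
    rw [mul_inv_eq_iff_eq_mul]; exact (S.X_mem tt)
  have hxv : (S.t * r) * (w * S.D * w⁻¹) * (S.t * r)⁻¹ = w * S.D * w⁻¹ := by
    rw [← hg']
    calc _ = w * (S.t * S.D * S.t⁻¹) * w⁻¹ := by simp [mul_assoc]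
      _ = _ := by rw [htD]
  obtain ⟨p, z, b, hx⟩ := mem_E_el hxE
  rw [hx, conj_conj', k.hr.act, t_act] at hxv
  obtain ⟨e1, e2, -⟩ := el_eq hxv
  have hp : p = 0 := (show ∀ p : T3, -p = p → p = 0 by decide) p e1
  subst hp e2
  have hw : S.D = w⁻¹ * (w * S.D * w⁻¹) * (w⁻¹)⁻¹ := by simp [mul_assoc]
  rcases c_pow (S := S) b with h | h | h <;> rw [h] at hx
  · rw [hx] at hw; exact S.D_ne (by rw [hw]; simp)
  · rw [hx] at hw; exact (k.K.ND_c w⁻¹).1 hw.symm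
  · rw [hx] at hw
    refine (k.K.ND_c w⁻¹).2 ?_
    rw [hw]; simp [mul_assoc, c]
theorem KR.r_t {M : Subgroup G} (hX : CC S.D ≤ M) (hrM : r ∈ M) : r ∈ cls M S.t := by
  have hXM : ∀ x, S.α x ∈ M := fun x => hX (S.X_mem x)
  have br := k.BN.br
  have h2 : S.α t2 * S.α t2 = 1 := by rw [← map_mul, show t2 * t2 = 1 by decide +kernel, map_one]
  have e1 : S.α t2 = (S.α yy)⁻¹ * S.t * ((S.α yy)⁻¹)⁻¹ := by
    rw [map_mul, map_mul, map_inv, inv_inv]; rfl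
  have h3 : S.α t2 ∈ cls M S.t := by rw [e1]; exact ⟨_, M.inv_mem (hXM yy), rfl⟩
  have h4 : r = (r * S.α t2)⁻¹ * S.α t2 * ((r * S.α t2)⁻¹)⁻¹ := by
    rw [inv_inv, mul_assoc, eq_inv_mul_iff_mul_eq, br, mul_assoc]
  rw [h4]
  exact cls_conj (M.inv_mem (mul_mem hrM (hXM _))) h3
theorem KR.t_M {M : Subgroup G} (hX : CC S.D ≤ M) (hrM : r ∈ M) (hM : Nat.card M = 25920)
    (hw : ∃ m, m * (S.α ww * (r * S.α ww * r)) = S.t * r * m) {g : G} (h : g * S.t * g⁻¹ ∈ M) :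
    g * S.t * g⁻¹ ∈ cls M S.t := by
  have hXM : ∀ x, S.α x ∈ M := fun x => hX (S.X_mem x)
  have hS : IsSylowIn 2 k.SS M := isSylowIn_of_card k.SS_2 (k.SS_T.trans (k.card_T.2 M hX hrM)) (m := 405)
    (by rw [hM, k.card_SS]) (by norm_num)
  have hsq : ∀ v : G, (v * S.t * v⁻¹) * (v * S.t * v⁻¹) = 1 := by
    intro v; rw [conj_mul, S.tt_sq]; simp
  obtain ⟨m, hm, h1⟩ := hS.conj_elt h (k := 1) (by rw [pow_one, pow_two]; exact hsq g)
  rw [← conj_conj'] at h1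
  have e0 : g * S.t * g⁻¹ = m⁻¹ * ((m * g) * S.t * (m * g)⁻¹) * (m⁻¹)⁻¹ := by simp [mul_assoc]
  rw [e0]
  refine cls_conj (M.inv_mem hm) ?_
  generalize m * g = v at *
  clear e0 h
  rcases h1 with h1 | h1
  · by_cases h2 : v * S.t * v⁻¹ = S.t
    · rw [h2]; exact self_mem_cls _ _
    exfalso
    obtain ⟨m, hw⟩ := hw
    have hw' : m * (S.α ww * S.be r ww) * m⁻¹ = S.t * r := by
      rw [be_apply, k.hr.inv, mul_inv_eq_iff_eq_mul]; exact hw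
    obtain ⟨e, -, h3⟩ := k.inv_Z0 h1 (hsq v) (by rw [Ne, conj_eq_one_iff]; exact S.t_ne) h2
    rcases h3 with h3 | h3
    · rw [← conj_conj'] at h3
      rw [← h3, ← conj_conj'] at hw'
      exact k.v_ne hw'
    · have h4 : S.α vv * (S.α ww * S.be r ww) * (S.α vv)⁻¹ = S.t * (S.α ww * S.be r ww) := by
        have hc := (k.com (Q0_SL Q0_wv.2) (Q0_SL Q0_wv.1)).eq
        rw [conj_mul', S.α_conj, vv_conj, hc, mul_inv_cancel_right, map_mul, mul_assoc]; rfl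
      rw [← h4, ← conj_conj', mul_inv_eq_iff_eq_mul, ← eq_inv_mul_iff_mul_eq, ← mul_assoc] at h3
      have h5 : S.α ww * S.be r ww = ((S.α vv)⁻¹ * (e * v)) * S.t * ((S.α vv)⁻¹ * (e * v))⁻¹ := by
        rw [conj_conj', h3]; simp [mul_assoc]
      rw [h5, ← conj_conj'] at hw'
      exact k.v_ne hw'
  · obtain ⟨x, hx, y, hy, h2⟩ := k.mem_Z0.1 h1
    have h3 : v * S.t * v⁻¹ = r * S.α x * S.be r y := by
      rw [mul_assoc r, ← h2, ← mul_assoc, k.hr.sq, one_mul]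
    have hrb : ∀ x, S.be r x * r = r * S.α x := fun x => by rw [be_apply]; simp [mul_assoc]
    have hra : ∀ x, S.α x * r = r * S.be r x := fun x => by rw [← k.r_be]; simp [mul_assoc]
    have h4 : S.α (y * x) = S.be r ((x * y)⁻¹) := by
      have := hsq v
      rw [h3, ← hrb x] at this
      have e : S.be r x * r * S.be r y * (S.be r x * r * S.be r y) = S.α (y * x) * S.be r (x * y) := by
        have c1 := (k.com (Q0_SL (Q0.mul_mem hy hx)) (Q0_SL hx)).eq
        rw [map_mul (S.be r) x y, ← mul_assoc (S.α (y * x)), c1, map_mul]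
        have e2 : r * S.be r y = S.α y * r := (hra y).symm
        have e3 : S.be r x * r = r * S.α x := hrb x
        calc _ = S.be r x * (r * S.be r y) * (S.be r x * r) * S.be r y := by simp only [mul_assoc]
          _ = S.be r x * S.α y * (r * r) * S.α x * S.be r y := by rw [e2, e3]; simp only [mul_assoc]
          _ = _ := by rw [k.hr.sq, mul_one]; simp only [mul_assoc]
      rw [e] at this
      rw [map_inv]; exact eq_inv_of_mul_eq_one_left this
    have hmain : r * S.α x * S.be r x⁻¹ = (S.α x)⁻¹ * r * ((S.α x)⁻¹)⁻¹ := by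
      have c1 := (k.com (Q0_SL (Q0.inv_mem hx)) (Q0_SL hx)).eq
      rw [inv_inv, mul_assoc _ r, ← hrb x, ← map_inv, ← mul_assoc _ (S.be r x), c1, mul_assoc _ _ r, hra, ← mul_assoc, hrb]
    rcases k.cap (Q0.mul_mem hy hx) (Q0.inv_mem (Q0.mul_mem hx hy)) h4 with h5 | h5
    · have hy' : y = x⁻¹ := eq_inv_of_mul_eq_one_left h5
      rw [h3, hy', hmain]
      exact cls_conj (M.inv_mem (hXM x)) (k.r_t hX hrM)
    · exfalso
      have hy' : y = tt * x⁻¹ := eq_mul_inv_of_mul_eq h5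
      have c1 : r * S.α x * S.t = S.t * (r * S.α x) := by
        have : S.α x * S.t = S.t * S.α x := S.α_comm.2 (Q0_tt x hx).1
        rw [mul_assoc, this, ← mul_assoc, k.hr.comm, mul_assoc]
      have c2 : S.t * (S.α x)⁻¹ = (S.α x)⁻¹ * S.t := by
        have : Commute S.t (S.α x) := (S.α_comm.2 (Q0_tt x hx).1).symm
        exact this.inv_right.eq
      have h6 : v * S.t * v⁻¹ = (S.α x)⁻¹ * (S.t * r) * S.α x := by
        rw [h3, hy', map_mul, k.be_tt, ← mul_assoc, c1, mul_assoc, hmain, inv_inv, ← mul_assoc, ← mul_assoc, c2]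
        simp only [mul_assoc]
      apply k.v_ne (g := S.α x * v)
      rw [conj_conj', h6]; simp [mul_assoc]
theorem KR.final : Nonempty (G ≃* PSp4F3) := by
  obtain ⟨f, hf, h1, h2⟩ := k.emb
  have hfin := Sp.finp
  have hX : CC S.D ≤ f.range := by
    intro g hg
    obtain ⟨x, rfl⟩ := S.cent g (mem_CC.1 hg)
    exact ⟨Sp.ap x, h1 x⟩
  have hrM : r ∈ f.range := ⟨_, h2⟩
  have hM : Nat.card f.range = 25920 := by
    rw [← Sp.cardp]; exact (Nat.card_congr (MonoidHom.ofInjective hf).toEquiv).symm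
  have hw : ∃ m, m * (S.α ww * (r * S.α ww * r)) = S.t * r * m := by
    obtain ⟨m, hm⟩ := Sp.word
    refine ⟨f m, ?_⟩
    have := congrArg f hm
    simp only [map_mul, h1, h2] at this
    exact this
  have hT := k.card_T.2 _ hX hrM
  have hT576 := k.card_T.1
  generalize hMd : f.range = M at *
  have hct := card_cls ⊤ S.t
  have hcd := card_cls ⊤ S.D
  have hct' := card_cls M S.t
  have hcd' := card_cls M S.D
  rw [top_inf_eq] at hct
  rw [top_inf_eq, S.cardX] at hcd
  rw [inf_eq_right.2 hT, hM] at hct'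
  rw [inf_eq_right.2 hX, hM, S.cardX] at hcd'
  have hsub : ∀ x : G, cls M x ⊆ cls ⊤ x := fun x y hy => cls_mono le_top hy
  have hle : (cls ⊤ S.t \ cls M S.t).ncard ≤ (cls ⊤ S.D \ cls M S.D).ncard := by
    have hin : ∀ u, u ∈ cls ⊤ S.t \ cls M S.t → u * S.D * u⁻¹ ∈ cls ⊤ S.D \ cls M S.D := by
      rintro u ⟨⟨g, -, hug⟩, hu⟩
      refine ⟨⟨u, Subgroup.mem_top u, rfl⟩, ?_⟩
      rintro ⟨m, hm, e⟩
      apply hu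
      have : m⁻¹ * u ∈ CC S.D := by
        rw [mem_CC']
        rw [conj_conj', e]; simp [mul_assoc]
      have huM : u ∈ M := by
        have := mul_mem hm (hX this)
        rwa [mul_inv_cancel_left] at this
      rw [hug] at huM ⊢
      exact k.t_M hX hrM hM hw huM
    apply Set.ncard_le_ncard_of_injOn (fun u => u * S.D * u⁻¹) hin
    rintro u hu0 v ⟨⟨g', -, hvg⟩, hv⟩ h
    have hD0 := hin u hu0
    obtain ⟨⟨g, -, hug⟩, hu⟩ := hu0
    by_contra hne
    obtain ⟨x, hx1, hx2, h5⟩ := S.inv_pair hug hvg h hne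
    exact hD0.2 (k.D_M hX hrM (k.C_M hX hrM hx1 hx2 h5))
  have hd1 := Set.ncard_sdiff_add_ncard_of_subset (hsub S.t)
  have hd2 := Set.ncard_sdiff_add_ncard_of_subset (hsub S.D)
  have hG : Nat.card (⊤ : Subgroup G) = 25920 := by
    generalize (cls ⊤ S.t).ncard = A at *
    generalize (cls M S.t).ncard = B at *
    generalize (cls ⊤ S.D).ncard = N at *
    generalize (cls M S.D).ncard = N' at *
    generalize (cls ⊤ S.t \ cls M S.t).ncard = A' at *
    generalize (cls ⊤ S.D \ cls M S.D).ncard = N'' at *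
    generalize Nat.card (CC S.t) = τ at *
    generalize Nat.card (⊤ : Subgroup G) = Γ at *
    clear * - hd1 hd2 hle hct hct' hcd hcd' hT576
    have hN' : N' = 40 := by omega
    subst hN'
    have : A' * τ = N'' * 648 := by
      have e1 : (A' + B) * τ = (N'' + 40) * 648 := by rw [hd1, hd2, hct, hcd]
      rw [add_mul, add_mul, hct'] at e1
      omega
    have h2 : A' * τ ≤ N'' * 576 := Nat.mul_le_mul hle hT576
    omega
  have : Function.Bijective f := by
    refine (Nat.bijective_iff_injective_and_card f).2 ⟨hf, ?_⟩
    rw [Sp.cardp, ← hG, Subgroup.card_top]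
  exact ⟨(MulEquiv.ofBijective f this).symm⟩
end Setup
theorem X0.center_form : ∀ x : X0, x * b1 = b1 * x → x * ww = ww * x → x ≠ 1 → x = dd ∨ x = dd⁻¹ := by
  decide +kernel
theorem stmt4_setup {H : Type*} [Group H] [Finite H] (d : H) (hd : orderOf d = 3)
    (α : X0 →* H) (hα : Function.Injective α) (hr : ∀ g, g ∈ CC d ↔ ∃ x, α x = g)
    (P : Subgroup H) (hP : IsSylowIn 3 P (CC d))
    (E : Subgroup H) (hEP : E ≤ P) (hEcard : Nat.card E = 27)
    (hEab : ∀ a ∈ E, ∀ b ∈ E, a * b = b * a)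
    (hsig : ∀ Y : Subgroup H, (Nat.card Y).Coprime 3 →
      (∀ e ∈ E, ∀ y ∈ Y, e⁻¹ * y * e ∈ Y) → Y = ⊥)
    (hnc : ¬ ∃ h : H, h⁻¹ * d * h = d⁻¹) : ∃ S : Setup H, CC S.D = CC d := by
  have f3 : Fact (Nat.Prime 3) := ⟨Nat.prime_three⟩
  have hdd : α dd = d ∨ α dd = d⁻¹ := by
    obtain ⟨x, hx⟩ := (hr d).1 (mem_CC.2 rfl)
    have hc : ∀ y, x * y = y * x := by
      intro y
      apply hα
      rw [map_mul, map_mul, hx]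
      exact (mem_CC.1 ((hr (α y)).2 ⟨y, rfl⟩)).symm
    have hx1 : x ≠ 1 := by
      rintro rfl
      rw [map_one] at hx
      rw [← hx, orderOf_one] at hd
      norm_num at hd
    rcases center_form x (hc _) (hc _) hx1 with rfl | rfl
    · exact Or.inl hx
    · right; rw [← hx, map_inv, inv_inv]
  have hCC : CC (α dd) = CC d := by
    rcases hdd with h | h <;> rw [h]
    ext g
    rw [mem_CC, mem_CC]
    exact Commute.inv_right_iff (a := g) (b := d)
  have hcard : Nat.card (CC d) = 648 := by
    have : CC d = α.range := by ext g; exact hr g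
    rw [this, ← card_X0]
    exact (Nat.card_congr (MonoidHom.ofInjective hα).toEquiv).symm
  have hP81 : Nat.card (P0.map α) = 81 := by
    rw [← card_P0]; exact (Nat.card_congr (Subgroup.equivMapOfInjective _ _ hα).toEquiv).symm
  have hP0 : IsSylowIn 3 (P0.map α) (CC d) := by
    refine isSylowIn_of_card (IsPGroup.of_card (n := 4) (by rw [hP81]; norm_num)) ?_ (m := 8) (by rw [hcard, hP81])
      (by norm_num)
    rintro _ ⟨x, -, rfl⟩
    exact (hr _).2 ⟨x, rfl⟩
  obtain ⟨g, -, hg⟩ := hP0.conj hP.2.1 hP.1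
  have hE : CJ g E = E0.map α := by
    refine X0.unique27_map hα ?_ (by rw [card_CJ, hEcard]) (Setup.CJ_ab hEab g)
    intro x hx
    have := hg _ (hEP (mem_CJ.1 hx))
    simpa [mul_assoc] using this
  refine ⟨⟨α, hα, fun y hy => (hr y).1 (hCC ▸ mem_CC.2 hy), ?_, ?_⟩, hCC⟩
  · intro y hy
    rcases hdd with h | h <;> rw [h] at hy
    · exact hnc ⟨y⁻¹, by rw [inv_inv]; exact hy⟩
    · refine hnc ⟨y⁻¹, ?_⟩
      rw [inv_inv]
      rw [← conj_inv] at hy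
      have := inv_injective hy
      exact this
  · intro Y hY hn
    have h1 : CJ g⁻¹ Y = ⊥ := by
      apply hsig
      · rw [card_CJ]
        exact ((Nat.Prime.coprime_iff_not_dvd Nat.prime_three).2 hY).symm
      · intro e he y hy
        rw [mem_CJ, inv_inv] at hy ⊢
        have h2 : g * e⁻¹ * g⁻¹ ∈ E0.map α := hE ▸ conj_mem_CJ (E.inv_mem he)
        obtain ⟨x, hx, hxe⟩ := h2
        have h3 := (hn x hx).conj hy
        have hxe' : α x = g * e⁻¹ * g⁻¹ := hxe
        rw [hxe'] at h3
        simpa [mul_assoc] using h3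
    rw [← Subgroup.card_eq_one, ← card_CJ g⁻¹ Y, h1, Subgroup.card_bot]
theorem stmt4    {H : Type*} [Group H] [Fintype H] (d : H) (hd : orderOf d = 3)
    (hX : ∃ z : PSp4F3, z ≠ 1 ∧ IsThreeCentral z ∧
      Nonempty ((Subgroup.centralizer {d} : Subgroup H) ≃*
        (Subgroup.centralizer {z} : Subgroup PSp4F3)))
    (P : Subgroup H) (hP : IsSylowIn 3 P (Subgroup.centralizer {d}))
    (E : Subgroup H) (hEP : E ≤ P) (hEcard : Nat.card E = 27)
    (hEab : ∀ a ∈ E, ∀ b ∈ E, a * b = b * a) (hEexp : ∀ a ∈ E, a ^ 3 = 1)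
    (hsig : ∀ Y : Subgroup H, (Nat.card Y).Coprime 3 →
      (∀ e ∈ E, ∀ y ∈ Y, e⁻¹ * y * e ∈ Y) → Y = ⊥)
    (hnc : ¬ ∃ h : H, h⁻¹ * d * h = d⁻¹) :
    Subgroup.centralizer {d} = (⊤ : Subgroup H) ∨ Nonempty (H ≃* PSp4F3) := by
  obtain ⟨z, -, hz, ⟨φ⟩⟩ := hX
  obtain ⟨b, hb, hbz⟩ := Sp.central hz
  have hbm : ∀ x, b x ∈ (Subgroup.centralizer {z} : Subgroup PSp4F3) := by
    intro x
    rw [← CC_eq]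
    exact mem_CC.2 ((hbz _).2 ⟨x, rfl⟩)
  let b' : X0 →* (Subgroup.centralizer {z} : Subgroup PSp4F3) := b.codRestrict _ hbm
  let α : X0 →* H := (Subgroup.centralizer {d} : Subgroup H).subtype.comp (φ.symm.toMonoidHom.comp b')
  have hα : Function.Injective α := by
    intro x y h
    have h1 : φ.symm (b' x) = φ.symm (b' y) := Subtype.ext h
    have h2 : b' x = b' y := φ.symm.injective h1
    exact hb (congrArg Subtype.val h2)
  have hr : ∀ g, g ∈ CC d ↔ ∃ x, α x = g := by
    intro g
    rw [CC_eq]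
    constructor
    · intro hg
      have h1 : ((φ ⟨g, hg⟩ : (Subgroup.centralizer {z} : Subgroup PSp4F3)) : PSp4F3) ∈ CC z :=
        (CC_eq z).ge (φ ⟨g, hg⟩).2
      obtain ⟨x, hx⟩ := (hbz _).1 (mem_CC.1 h1)
      refine ⟨x, ?_⟩
      have h2 : b' x = φ ⟨g, hg⟩ := Subtype.ext hx
      show ((φ.symm (b' x) : (Subgroup.centralizer {d} : Subgroup H)) : H) = g
      rw [h2, φ.symm_apply_apply]
    · rintro ⟨x, rfl⟩
      exact (φ.symm (b' x)).2
  rw [← CC_eq] at hP ⊢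
  obtain ⟨S, hS⟩ := stmt4_setup d hd α hα hr P hP E hEP hEcard hEab hsig hnc
  rcases S.dichotomy with h | ⟨S', K, hD⟩
  · left
    rw [← hS]; exact S.k1_finish h
  · right
    obtain ⟨r, hr⟩ := K.exists_r
    exact (Setup.KR.mk K hr).final
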